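/- Let K be a congruence function field over 𝔽₂ with genus g_K = 4 and class number h_K = 1, and let k = 𝔽₂(T) be its unique rational subfield with [K : k] = 5. Then Aut_{𝔽₂}(K) = Aut_k(K) = Gal(K/k), which is cyclic of order 5. -/

import Mathlib

set_option synthInstance.maxHeartbeats 1000000
set_option maxHeartbeats 1000000

open scoped Classical

noncomputable section

namespace CFF

variable (F : Type*) [Field F]

/-- `K` is a (congruence) function field in one variable over `F`: a finitely
generated field extension of transcendence degree one. -/
def IsFunctionField (K : Type*) [Field K] [Algebra F K] : Prop :=
  ∃ x : K, Transcendental F x ∧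
    FiniteDimensional (IntermediateField.adjoin F {x}) K

/-- The exact field of constants of `K` is `F`: every element of `K` algebraic
over `F` already lies in `F`. -/
def HasExactConstants (K : Type*) [Field K] [Algebra F K] : Prop :=
  ∀ a : K, IsAlgebraic F a → a ∈ (algebraMap F K).range

variable (K : Type*) [Field K] [Algebra F K]

/-- A place of the function field `K/F`: a proper valuation subring of `K`
containing the constants. -/
def IsPlace (O : ValuationSubring K) : Prop :=
  O ≠ ⊤ ∧ ∀ c : F, algebraMap F K c ∈ O

/-- The type of places (prime divisors) of `K/F`. -/
def Place := {O : ValuationSubring K // IsPlace F K O}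

variable {K}

/-- `𝔪`-adic order of an element of a valuation subring. -/
def ordAux (O : ValuationSubring K) (x : O) : ℕ :=
  sSup {n : ℕ | x ∈ IsLocalRing.maximalIdeal O ^ n}

/-- The order (normalized valuation) of `f ∈ K` at a valuation subring `O`. -/
def ordAt (O : ValuationSubring K) (f : K) : ℤ :=
  if h : f ∈ O then (ordAux O ⟨f, h⟩ : ℤ)
  else -(ordAux O ⟨f⁻¹, (O.mem_or_inv_mem f).resolve_left h⟩ : ℤ)

/-- The constants embed into (the valuation ring of) any place. -/
def constHom (p : Place F K) : F →+* p.1 :=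
  (algebraMap F K).codRestrict p.1.toSubring fun c => p.2.2 c

/-- The map from the constants to the residue field of a place. -/
def residueHom (p : Place F K) : F →+* IsLocalRing.ResidueField p.1 :=
  (IsLocalRing.residue (p.1 : ValuationSubring K)).comp (constHom F p)

/-- The degree of a place: the dimension of its residue field over the
constants. -/
def placeDegree (p : Place F K) : ℕ :=
  letI := (residueHom F p).toAlgebra
  Module.finrank F (IsLocalRing.ResidueField p.1)

variable (K)

/-- The group of divisors of `K/F`. -/
abbrev Divisor := Place F K →₀ ℤ

/-- The degree homomorphism on divisors. -/
def degHom : Divisor F K →+ ℤ :=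
  Finsupp.liftAddHom fun p => AddMonoidHom.mulRight (placeDegree F p : ℤ)

variable {K}

/-- The Riemann-Roch space `L(D)` of a divisor `D` (the span coincides with the
set of `f` with `div f ≥ -D`, which is an `F`-subspace). -/
def RRspace (D : Divisor F K) : Submodule F K :=
  Submodule.span F {f : K | ∀ p : Place F K, 0 ≤ D p + ordAt p.1 f}

/-- `ℓ(D)`, the dimension of the Riemann-Roch space of `D`. -/
def ell (D : Divisor F K) : ℕ := Module.finrank F (RRspace F D)

variable (K)

/-- The genus of `K/F`, via Riemann's theorem: `g = max_D (deg D + 1 - ℓ(D))`. -/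
def genus : ℕ :=
  sSup {g : ℕ | ∃ D : Divisor F K, (g : ℤ) = degHom F K D + 1 - ell F D}

/-- The subgroup of divisors of degree zero. -/
def zeroDivisors : AddSubgroup (Divisor F K) := (degHom F K).ker

/-- The subgroup of principal divisors. -/
def principalDivisors : AddSubgroup (Divisor F K) :=
  AddSubgroup.closure
    {D : Divisor F K | ∃ f : K, f ≠ 0 ∧ ∀ p : Place F K, D p = ordAt p.1 f}

/-- The group of divisor classes of degree zero of `K/F`. -/
def ClassGroup0 :=
  zeroDivisors F K ⧸ (principalDivisors F K).addSubgroupOf (zeroDivisors F K)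

instance : AddGroup (ClassGroup0 F K) := by
  unfold ClassGroup0; infer_instance

/-- The class number of `K/F`: the order of the group of divisor classes of
degree zero. -/
def classNumber : ℕ := Nat.card (ClassGroup0 F K)

section Extension

variable {k L : Type*} [Field k] [Field L] [Algebra F k] [Algebra F L] [Algebra k L]

/-- A place `P` of `L` lies over the place `p` of `k`. -/
def LiesOver (P : Place F L) (p : Place F k) : Prop :=
  P.1.comap (algebraMap k L) = p.1

variable (L)

/-- `p` is inert in `L/k`: there is a unique place of `L` above `p`, and its
degree is `[L:k] · deg p` (i.e. the residue degree is `[L:k]`, so `e = 1`). -/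
def IsInert (p : Place F k) : Prop :=
  ∃ P : Place F L, LiesOver F P p ∧
    placeDegree F P = Module.finrank k L * placeDegree F p ∧
    ∀ P' : Place F L, LiesOver F P' p → P' = P

/-- `p` splits completely in `L/k`: there are `[L:k]` places above `p`, each of
the same degree as `p`. -/
def SplitsCompletely (p : Place F k) : Prop :=
  Nat.card {P : Place F L // LiesOver F P p} = Module.finrank k L ∧
    ∀ P : Place F L, LiesOver F P p → placeDegree F P = placeDegree F p

/-- `p` is totally ramified in `L/k`: there is a unique place above `p`, of the
same degree (so `f = 1` and `e = [L:k]`). -/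
def IsTotallyRamified (p : Place F k) : Prop :=
  ∃ P : Place F L, LiesOver F P p ∧ placeDegree F P = placeDegree F p ∧
    ∀ P' : Place F L, LiesOver F P' p → P' = P

/-- `p` is unramified in `L/k`: at every place above `p` the orders of elements
of `k` are preserved (`e = 1`). -/
def IsUnramifiedAt (p : Place F k) : Prop :=
  ∀ P : Place F L, LiesOver F P p →
    ∀ x : k, ordAt P.1 (algebraMap k L x) = ordAt p.1 x

end Extension

section Rational

/-- The valuation ring of the finite place of `𝔽₂(T)` corresponding to an
irreducible polynomial `P`: it contains all polynomials and `P` lies in its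
maximal ideal. -/
def IsFinitePlaceOf (O : ValuationSubring (RatFunc (ZMod 2)))
    (P : Polynomial (ZMod 2)) : Prop :=
  (∀ g : Polynomial (ZMod 2), algebraMap (Polynomial (ZMod 2)) (RatFunc (ZMod 2)) g ∈ O) ∧
    (algebraMap (Polynomial (ZMod 2)) (RatFunc (ZMod 2)) P)⁻¹ ∉ O

/-- The infinite place `𝔭_∞` of `𝔽₂(T)`: the place where `T` has a pole. -/
def IsInfinitePlace (O : ValuationSubring (RatFunc (ZMod 2))) : Prop :=
  RatFunc.X ∉ O

end Rational

end CFF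

namespace CFF

local notation "F₂" => ZMod 2

section Dedekind

variable {B K : Type*} [CommRing B] [IsDedekindDomain B] [Field K] [Algebra B K] [IsFractionRing B K]

/-- The prime of a ring of integral elements below a valuation ring. -/
def centerIdeal (O : ValuationSubring K) (hB : ∀ b : B, algebraMap B K b ∈ O) : Ideal B :=
  (IsLocalRing.maximalIdeal O).comap ((algebraMap B K).codRestrict O.toSubring hB)

instance centerIdeal_isPrime (O : ValuationSubring K) (hB : ∀ b : B, algebraMap B K b ∈ O) :
    (centerIdeal O hB).IsPrime := by
  unfold centerIdeal; exact Ideal.IsPrime.comap _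

lemma mem_centerIdeal (O : ValuationSubring K) (hB : ∀ b : B, algebraMap B K b ∈ O) (b : B) :
    b ∈ centerIdeal O hB ↔ algebraMap B K b = 0 ∨ (algebraMap B K b)⁻¹ ∉ O := by
  rw [← ValuationSubring.mem_nonunits_iff_or, ValuationSubring.mem_nonunits_iff_exists_mem_maximalIdeal]
  constructor
  · intro h; exact ⟨hB b, h⟩
  · rintro ⟨h, h'⟩; exact h'

lemma dedekind_place (O : ValuationSubring K) (hO : O ≠ ⊤) (hB : ∀ b : B, algebraMap B K b ∈ O) :
    IsDiscreteValuationRing O ∧ centerIdeal O hB ≠ ⊥ ∧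
    ∀ f ∈ O, ∃ b c : B, c ∉ centerIdeal O hB ∧ f = algebraMap B K b / algebraMap B K c := by
  set q := centerIdeal O hB with hq
  have hq0 : q ≠ ⊥ := by
    intro h
    apply hO
    rw [eq_top_iff]
    intro f _
    obtain ⟨b, c, hc, rfl⟩ := IsFractionRing.div_surjective (A := B) f
    have hc0 : c ≠ 0 := nonZeroDivisors.ne_zero hc
    have : c ∉ q := by rw [h]; simpa using hc0
    rw [hq, mem_centerIdeal] at this
    push Not at this
    rw [div_eq_mul_inv]
    exact O.mul_mem _ _ (hB b) this.2
  have hle : q.primeCompl ≤ nonZeroDivisors B := Ideal.primeCompl_le_nonZeroDivisors q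
  let W : Subalgebra B K := Localization.subalgebra.ofField K q.primeCompl hle
  haveI : IsLocalization.AtPrime W q := Localization.subalgebra.isLocalization_ofField K q.primeCompl hle
  haveI hW : IsDiscreteValuationRing W :=
    IsLocalization.AtPrime.isDiscreteValuationRing_of_dedekind_domain B hq0 W
  haveI : IsFractionRing W K := Localization.subalgebra.isFractionRing_ofField K q.primeCompl hle
  have hfrac : ∀ f ∈ W, ∃ b c : B, c ∉ q ∧ f = algebraMap B K b / algebraMap B K c := by
    intro f hf
    obtain ⟨⟨b, c⟩, hbc⟩ := IsLocalization.surj q.primeCompl (⟨f, hf⟩ : W)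
    refine ⟨b, c, c.2, ?_⟩
    have h2 := congrArg (Subtype.val) hbc
    have hc0 : algebraMap B K c ≠ 0 := by
      rw [Ne, IsFractionRing.to_map_eq_zero_iff]
      exact nonZeroDivisors.ne_zero (hle c.2)
    rw [eq_div_iff hc0]
    exact h2
  let V : ValuationSubring K := ValuationSubring.ofSubring W.toSubring (by
    intro x
    rcases ValuationRing.isInteger_or_isInteger W x with ⟨y, hy⟩ | ⟨y, hy⟩
    · left; rw [← hy]; exact y.2
    · right; rw [← hy]; exact y.2)
  have hVO : V ≤ O := by
    intro f hf
    obtain ⟨b, c, hc, rfl⟩ := hfrac f hf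
    rw [hq, mem_centerIdeal] at hc
    push Not at hc
    rw [div_eq_mul_inv]
    exact O.mul_mem _ _ (hB b) hc.2
  haveI hV : IsDiscreteValuationRing V := hW
  have hVO' : V = O := ValuationSubring.eq_of_le_of_ne_top V hVO hO
  refine ⟨hVO' ▸ hV, hq0, ?_⟩
  intro f hf
  rw [← hVO'] at hf
  exact hfrac f hf

end Dedekind

section Chart

variable {K : Type} [Field K] [Algebra (ZMod 2) K]

/-- `t` is a separating element of `K` over the constants. -/
structure IsSep (t : K) : Prop where
  tr : Transcendental F₂ t
  fin : FiniteDimensional (IntermediateField.adjoin F₂ {t}) K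
  sep : Algebra.IsSeparable (IntermediateField.adjoin F₂ {t}) K

lemma IsSep.inv {t : K} (h : IsSep t) : IsSep t⁻¹ := by
  have h0 : IntermediateField.adjoin F₂ {t⁻¹} = IntermediateField.adjoin F₂ {t} := by
    apply le_antisymm
    · rw [IntermediateField.adjoin_simple_le_iff]
      exact inv_mem (IntermediateField.mem_adjoin_simple_self F₂ t)
    · rw [IntermediateField.adjoin_simple_le_iff]
      have := inv_mem (IntermediateField.mem_adjoin_simple_self F₂ t⁻¹)
      rwa [inv_inv] at this
  refine ⟨?_, ?_, ?_⟩
  · intro h'; exact h.tr (by simpa using h'.inv)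
  · rw [h0]; exact h.fin
  · rw [h0]; exact h.sep

instance polynomial_hasFiniteQuotients : Ring.HasFiniteQuotients (Polynomial F₂) where
  finiteQuotient {I} hI := by
    obtain ⟨f, hf⟩ := (inferInstance : I.IsPrincipal).principal
    have hf' : I = Ideal.span {f} := hf
    have hf0 : f ≠ 0 := by rintro rfl; simp at hf'; exact hI hf'
    subst hf'
    have : Module.Finite F₂ (AdjoinRoot f) := by
      exact (AdjoinRoot.powerBasis hf0).finite
    have : Finite (AdjoinRoot f) := Module.finite_of_finite F₂
    exact this

lemma hasFiniteQuotients_of_equiv {A B : Type*} [CommRing A] [CommRing B] (e : A ≃+* B)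
    [Ring.HasFiniteQuotients A] : Ring.HasFiniteQuotients B where
  finiteQuotient {I} hI := by
    have h1 : I.comap (e : A →+* B) ≠ ⊥ := by
      intro h
      apply hI
      rw [eq_bot_iff]
      intro x hx
      have : e.symm x ∈ I.comap (e : A →+* B) := by
        rw [Ideal.mem_comap]; change e (e.symm x) ∈ I; rwa [e.apply_symm_apply]
      rw [h] at this
      simpa using this
    have := Ring.HasFiniteQuotients.finiteQuotient h1
    exact Finite.of_surjective (Ideal.quotientMap I (e : A →+* B) le_rfl)
      (Ideal.quotientMap_surjective e.surjective)

open scoped IntermediateField.algebraAdjoinAdjoin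

/-- Every valuation ring avoiding the poles of `s` is discrete with finite residue field, and
a nonzero element of `K` is a unit at almost all of them. -/
lemma chart {s : K} (h : IsSep s) :
    (∀ O : ValuationSubring K, O ≠ ⊤ → s ∈ O →
      IsDiscreteValuationRing O ∧ Finite (IsLocalRing.ResidueField O)) ∧
    ∀ f : K, f ≠ 0 →
      {O : ValuationSubring K | O ≠ ⊤ ∧ s ∈ O ∧ (f ∉ O ∨ f⁻¹ ∉ O)}.Finite := by
  let A := Algebra.adjoin F₂ {s}
  let k := IntermediateField.adjoin F₂ {s}
  have := h.fin
  have := h.sep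
  let e : Polynomial F₂ ≃ₐ[F₂] A := Polynomial.algEquivOfTranscendental F₂ s h.tr
  have hPID : IsPrincipalIdealRing A := IsPrincipalIdealRing.of_surjective e.toRingEquiv.toRingHom e.surjective
  have hFQ : Ring.HasFiniteQuotients A := hasFiniteQuotients_of_equiv e.toRingEquiv
  have : IsFractionRing A k := inferInstance
  let B := integralClosure A K
  have : IsScalarTower A k K := inferInstance
  have hB : IsDedekindDomain B := integralClosure.isDedekindDomain A k K
  have hBK : IsFractionRing B K := integralClosure.isFractionRing_of_finite_extension k K
  have hfin : Module.Finite A B := IsIntegralClosure.finite A k K B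
  have hFQB : Ring.HasFiniteQuotients B := Ring.HasFiniteQuotients.of_module_finite A B
  have hBO : ∀ O : ValuationSubring K, s ∈ O → ∀ b : B, algebraMap B K b ∈ O := by
    intro O hs b
    have hAO : ∀ a : A, (a : K) ∈ O := by
      intro a
      have : (a : K) ∈ Algebra.adjoin F₂ {s} := a.2
      refine Algebra.adjoin_induction (p := fun x _ => x ∈ O) ?_ ?_ ?_ ?_ this
      · rintro x rfl; exact hs
      · intro r
        fin_cases r
        · change algebraMap F₂ K 0 ∈ O; rw [map_zero]; exact O.zero_mem
        · change algebraMap F₂ K 1 ∈ O; rw [map_one]; exact O.one_mem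
      · intro x y _ _ hx hy; exact O.add_mem _ _ hx hy
      · intro x y _ _ hx hy; exact O.mul_mem _ _ hx hy
    obtain ⟨p, hp, hpb⟩ := b.2
    have : IsIntegral O (b : K) := by
      let j : A →+* O := (algebraMap A K).codRestrict O.toSubring hAO
      refine ⟨p.map j, hp.map j, ?_⟩
      rw [Polynomial.eval₂_map]
      exact hpb
    obtain ⟨y, hy⟩ := (IsIntegrallyClosed.isIntegral_iff (R := O) (K := K)).1 this
    change (b : K) ∈ O
    rw [← hy]; exact y.2
  constructor
  · intro O hO hs
    obtain ⟨h1, h2, h3⟩ := dedekind_place O hO (hBO O hs)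
    refine ⟨h1, ?_⟩
    set q := centerIdeal O (hBO O hs) with hq
    have := Ring.HasFiniteQuotients.finiteQuotient h2
    have hqmax : q.IsMaximal := Ring.HasFiniteQuotients.maximalOfPrime h2
    let φ : B →+* IsLocalRing.ResidueField O :=
      (IsLocalRing.residue O).comp ((algebraMap B K).codRestrict O.toSubring (hBO O hs))
    have hφ : ∀ b, φ b = 0 ↔ b ∈ q := by
      intro b
      change IsLocalRing.residue O _ = 0 ↔ _
      rw [IsLocalRing.residue_eq_zero_iff]; rfl
    have hsurj : Function.Surjective φ := by
      intro z
      obtain ⟨f, rfl⟩ := IsLocalRing.residue_surjective z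
      obtain ⟨b, c, hc, hf⟩ := h3 f f.2
      have hc' : Ideal.Quotient.mk q c ≠ 0 := by rwa [Ne, Ideal.Quotient.eq_zero_iff_mem]
      let := Ideal.Quotient.field q
      obtain ⟨d, hd⟩ := Ideal.Quotient.mk_surjective ((Ideal.Quotient.mk q c)⁻¹)
      have hcd : φ (c * d) = 1 := by
        have : c * d - 1 ∈ q := by
          rw [← Ideal.Quotient.eq_zero_iff_mem, map_sub, map_mul, hd, mul_inv_cancel₀ hc', map_one, sub_self]
        rw [← hφ, map_sub, map_one, sub_eq_zero] at this
        exact this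
      refine ⟨b * d, ?_⟩
      have hc0 : algebraMap B K c ≠ 0 := by
        rw [Ne, IsFractionRing.to_map_eq_zero_iff]; rintro rfl; exact hc q.zero_mem
      have h5 : φ b = IsLocalRing.residue O f * φ c := by
        change IsLocalRing.residue O _ = _ * IsLocalRing.residue O _
        rw [← map_mul]
        congr 1
        apply Subtype.ext
        change algebraMap B K b = f * algebraMap B K c
        rw [hf]; field_simp
      rw [map_mul, h5, mul_assoc, ← map_mul, hcd, mul_one]
    have hker : ∀ a : B, a ∈ q → φ a = 0 := fun a ha => (hφ a).2 ha
    refine Finite.of_surjective (Ideal.Quotient.lift q φ hker) ?_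
    exact Ideal.Quotient.lift_surjective_of_surjective q hker hsurj
  · intro f hf
    obtain ⟨b, c, hc, rfl⟩ := IsFractionRing.div_surjective (A := B) f
    have hc0 : c ≠ 0 := nonZeroDivisors.ne_zero hc
    have hb0 : b ≠ 0 := by rintro rfl; simp at hf
    have hfinI := (Ring.HasFiniteQuotients.finite_setOfPred_mem b hb0).union
      (Ring.HasFiniteQuotients.finite_setOfPred_mem c hc0)
    let c' : ValuationSubring K → Ideal B := fun O =>
      if hs : s ∈ O then centerIdeal O (hBO O hs) else ⊥
    refine Set.Finite.of_finite_image (f := c') (hfinI.subset ?_) ?_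
    · rintro _ ⟨O, ⟨hO, hs, hfO⟩, rfl⟩
      simp only [c', dif_pos hs]
      change b ∈ centerIdeal O (hBO O hs) ∨ c ∈ centerIdeal O (hBO O hs)
      rw [mem_centerIdeal, mem_centerIdeal]
      by_contra hcon
      push Not at hcon
      rcases hfO with h' | h' <;> apply h'
      · rw [div_eq_mul_inv]; exact O.mul_mem _ _ (hBO O hs b) hcon.2.2
      · rw [inv_div, div_eq_mul_inv]; exact O.mul_mem _ _ (hBO O hs c) hcon.1.2
    · rintro O ⟨hO, hs, -⟩ O' ⟨hO', hs', -⟩ hOO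
      simp only [c', dif_pos hs, dif_pos hs'] at hOO
      have key : ∀ (O O' : ValuationSubring K) (hO : O ≠ ⊤) (hs : s ∈ O) (hs' : s ∈ O')
          (_ : centerIdeal O (hBO O hs) = centerIdeal O' (hBO O' hs')), O ≤ O' := by
        intro O O' hO hs hs' heq f hf
        obtain ⟨b, c, hc, rfl⟩ := (dedekind_place O hO (hBO O hs)).2.2 f hf
        rw [heq, mem_centerIdeal] at hc
        push Not at hc
        rw [div_eq_mul_inv]
        exact O'.mul_mem _ _ (hBO O' hs' b) hc.2
      exact le_antisymm (key O O' hO hs hs' hOO) (key O' O hO' hs' hs hOO.symm)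

end Chart

/-- A function field over `𝔽₂` of genus four and class number one with a separating element. -/
class GenusFour (K : Type) [Field K] [Algebra (ZMod 2) K] : Prop where
  sep : ∃ t : K, IsSep t
  const : HasExactConstants F₂ K
  gen : genus F₂ K = 4
  cls : classNumber F₂ K = 1

section Order

variable {K : Type} [Field K]

lemma mem_maximalIdeal_pow_iff {O : ValuationSubring K} [IsDiscreteValuationRing O] {ϖ : O}
    (hϖ : Irreducible ϖ) (u : Oˣ) (n j : ℕ) :
    ((u : O) * ϖ ^ n) ∈ IsLocalRing.maximalIdeal O ^ j ↔ j ≤ n := by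
  rw [hϖ.maximalIdeal_eq, Ideal.span_singleton_pow, Ideal.mem_span_singleton,
    Units.dvd_mul_left, pow_dvd_pow_iff hϖ.ne_zero hϖ.not_isUnit]

lemma ordAux_eq {O : ValuationSubring K} [IsDiscreteValuationRing O] {ϖ : O}
    (hϖ : Irreducible ϖ) (u : Oˣ) (n : ℕ) : ordAux O ((u : O) * ϖ ^ n) = n := by
  unfold ordAux
  have : {j : ℕ | ((u : O) * ϖ ^ n) ∈ IsLocalRing.maximalIdeal O ^ j} = Set.Iic n := by
    ext j; exact mem_maximalIdeal_pow_iff hϖ u n j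
  rw [this]; exact csSup_Iic

lemma ordAt_eq {O : ValuationSubring K} [IsDiscreteValuationRing O] {ϖ : O}
    (hϖ : Irreducible ϖ) (u : Oˣ) (n : ℤ) : ordAt O (((u : O) : K) * (ϖ : K) ^ n) = n := by
  have hϖ0 : (ϖ : K) ≠ 0 := by
    intro h; exact hϖ.ne_zero (Subtype.ext h)
  have hu0 : ((u : O) : K) ≠ 0 := by
    intro h; exact u.ne_zero (Subtype.ext h)
  have hpos : ∀ m : ℕ, ∀ v : Oˣ, (((v : O) : K) * (ϖ : K) ^ m) ∈ O :=
    fun m v => O.mul_mem _ _ (v : O).2 (pow_mem ϖ.2 m)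
  have hinv : (((u : O) : K))⁻¹ = ((u⁻¹ : Oˣ) : O) := by
    have : (u : O) * ((u⁻¹ : Oˣ) : O) = 1 := u.mul_inv
    have h2 := congrArg Subtype.val this
    exact inv_eq_of_mul_eq_one_right h2
  rcases le_or_gt 0 n with hn | hn
  · lift n to ℕ using hn
    rw [zpow_natCast]
    unfold ordAt
    rw [dif_pos (hpos n u)]
    have := ordAux_eq hϖ u n
    exact_mod_cast this
  · obtain ⟨m, hm⟩ : ∃ m : ℕ, n = -(m : ℤ) := ⟨n.natAbs, by omega⟩
    subst hm
    have hm0 : 0 < m := by omega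
    have hinv2 : (((u : O) : K) * (ϖ : K) ^ (-(m : ℤ)))⁻¹ = (((u⁻¹ : Oˣ) : O) : K) * (ϖ : K) ^ m := by
      rw [mul_inv, hinv, zpow_neg, inv_inv, zpow_natCast]
    have hnot : (((u : O) : K) * (ϖ : K) ^ (-(m : ℤ))) ∉ O := by
      intro hmem
      have h1 := hpos m u⁻¹
      rw [← hinv2] at h1
      have : (⟨_, h1⟩ : O) * ⟨_, hmem⟩ = 1 := by
        apply Subtype.ext
        exact inv_mul_cancel₀ (mul_ne_zero hu0 (zpow_ne_zero _ hϖ0))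
      have hunit : IsUnit (⟨_, h1⟩ : O) := IsUnit.of_mul_eq_one _ this
      have heq : (⟨_, h1⟩ : O) = ((u⁻¹ : Oˣ) : O) * ϖ ^ m := Subtype.ext hinv2
      rw [heq, IsUnit.mul_iff] at hunit
      exact hϖ.not_isUnit ((isUnit_pow_iff hm0.ne').1 hunit.2)
    unfold ordAt
    rw [dif_neg hnot]
    have : (⟨_, (O.mem_or_inv_mem (((u : O) : K) * (ϖ : K) ^ (-(m : ℤ)))).resolve_left hnot⟩ : O)
        = ((u⁻¹ : Oˣ) : O) * ϖ ^ m := Subtype.ext hinv2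
    rw [this, ordAux_eq hϖ]

lemma exists_unit_zpow {O : ValuationSubring K} [IsDiscreteValuationRing O] {ϖ : O}
    (hϖ : Irreducible ϖ) {f : K} (hf : f ≠ 0) :
    ∃ u : Oˣ, f = ((u : O) : K) * (ϖ : K) ^ (ordAt O f) := by
  suffices h : ∃ (u : Oˣ) (n : ℤ), f = ((u : O) : K) * (ϖ : K) ^ n by
    obtain ⟨u, n, h⟩ := h
    refine ⟨u, ?_⟩
    have : ordAt O f = n := by rw [h, ordAt_eq hϖ]
    rw [this]; exact h
  have hϖ0 : (ϖ : K) ≠ 0 := by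
    intro h; exact hϖ.ne_zero (Subtype.ext h)
  rcases O.mem_or_inv_mem f with h | h
  · have h0 : (⟨f, h⟩ : O) ≠ 0 := fun h' => hf (congrArg Subtype.val h')
    obtain ⟨n, u, hu⟩ := IsDiscreteValuationRing.eq_unit_mul_pow_irreducible h0 hϖ
    exact ⟨u, n, by rw [zpow_natCast]; exact congrArg Subtype.val hu⟩
  · have h0 : (⟨f⁻¹, h⟩ : O) ≠ 0 := fun h' => inv_ne_zero hf (congrArg Subtype.val h')
    obtain ⟨n, u, hu⟩ := IsDiscreteValuationRing.eq_unit_mul_pow_irreducible h0 hϖ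
    refine ⟨u⁻¹, -n, ?_⟩
    have h2 : f⁻¹ = ((u : O) : K) * (ϖ : K) ^ n := congrArg Subtype.val hu
    have h3 : (u : O) * ((u⁻¹ : Oˣ) : O) = 1 := u.mul_inv
    have h4 : ((u : O) : K) * (((u⁻¹ : Oˣ) : O) : K) = 1 := congrArg Subtype.val h3
    rw [zpow_neg, zpow_natCast]
    rw [← inv_inv f, h2, mul_inv]
    congr 1
    exact inv_eq_of_mul_eq_one_right h4

variable {O : ValuationSubring K} [IsDiscreteValuationRing O]

lemma ordAt_mul {f g : K} (hf : f ≠ 0) (hg : g ≠ 0) :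
    ordAt O (f * g) = ordAt O f + ordAt O g := by
  obtain ⟨ϖ, hϖ⟩ := IsDiscreteValuationRing.exists_irreducible O
  have hϖ0 : (ϖ : K) ≠ 0 := by
    intro h; exact hϖ.ne_zero (Subtype.ext h)
  obtain ⟨u, hu⟩ := exists_unit_zpow hϖ hf
  obtain ⟨v, hv⟩ := exists_unit_zpow hϖ hg
  have : f * g = (((u * v : Oˣ) : O) : K) * (ϖ : K) ^ (ordAt O f + ordAt O g) := by
    conv_lhs => rw [hu, hv]
    rw [zpow_add₀ hϖ0, Units.val_mul]
    push_cast
    ring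
  rw [this, ordAt_eq hϖ]

lemma ordAt_one : ordAt O (1 : K) = 0 := by
  have := ordAt_mul (O := O) (one_ne_zero (α := K)) one_ne_zero
  rw [mul_one] at this; omega

lemma ordAt_inv {f : K} (hf : f ≠ 0) : ordAt O f⁻¹ = - ordAt O f := by
  have := ordAt_mul (O := O) hf (inv_ne_zero hf)
  rw [mul_inv_cancel₀ hf, ordAt_one] at this; omega

lemma ordAt_div {f g : K} (hf : f ≠ 0) (hg : g ≠ 0) :
    ordAt O (f / g) = ordAt O f - ordAt O g := by
  rw [div_eq_mul_inv, ordAt_mul hf (inv_ne_zero hg), ordAt_inv hg]; ring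

lemma ordAt_pow {f : K} (hf : f ≠ 0) (n : ℕ) : ordAt O (f ^ n) = n * ordAt O f := by
  induction n with
  | zero => simp [ordAt_one]
  | succ n ih => rw [pow_succ, ordAt_mul (pow_ne_zero n hf) hf, ih]; push_cast; ring

lemma mem_iff_ordAt {f : K} (hf : f ≠ 0) : f ∈ O ↔ 0 ≤ ordAt O f := by
  obtain ⟨ϖ, hϖ⟩ := IsDiscreteValuationRing.exists_irreducible O
  constructor
  · intro h; unfold ordAt; rw [dif_pos h]; positivity
  · intro h
    obtain ⟨u, hu⟩ := exists_unit_zpow hϖ hf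
    rw [hu]
    lift ordAt O f to ℕ using h with n
    rw [zpow_natCast]
    exact O.mul_mem _ _ (u : O).2 (pow_mem ϖ.2 n)

lemma exists_ordAt_eq_one : ∃ π : K, π ≠ 0 ∧ ordAt O π = 1 := by
  obtain ⟨ϖ, hϖ⟩ := IsDiscreteValuationRing.exists_irreducible O
  refine ⟨ϖ, fun h => hϖ.ne_zero (Subtype.ext h), ?_⟩
  have := ordAt_eq hϖ 1 1
  simpa using this

lemma exists_ordAt_eq (n : ℤ) : ∃ π : K, π ≠ 0 ∧ ordAt O π = n := by
  obtain ⟨ϖ, hϖ⟩ := IsDiscreteValuationRing.exists_irreducible O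
  refine ⟨(ϖ : K) ^ n, zpow_ne_zero _ fun h => hϖ.ne_zero (Subtype.ext h), ?_⟩
  have := ordAt_eq hϖ 1 n
  simpa using this

lemma ordAt_add {f g : K} {n : ℤ} (hf : f = 0 ∨ n ≤ ordAt O f) (hg : g = 0 ∨ n ≤ ordAt O g) :
    f + g = 0 ∨ n ≤ ordAt O (f + g) := by
  obtain ⟨π, hπ, hn⟩ := exists_ordAt_eq (O := O) n
  have key : ∀ f : K, (f = 0 ∨ n ≤ ordAt O f) ↔ f / π ∈ O := by
    intro f
    by_cases hf : f = 0
    · simp [hf, O.zero_mem]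
    · rw [mem_iff_ordAt (div_ne_zero hf hπ), ordAt_div hf hπ, hn]
      simp only [hf, false_or]; omega
  rw [key] at *
  rw [add_div]; exact O.add_mem _ _ hf hg

end Order

section Places

variable {K : Type} [Field K] [Algebra (ZMod 2) K]

lemma algebraMap_mem (O : ValuationSubring K) (c : ZMod 2) : algebraMap (ZMod 2) K c ∈ O := by
  fin_cases c
  · change algebraMap F₂ K 0 ∈ O; rw [map_zero]; exact O.zero_mem
  · change algebraMap F₂ K 1 ∈ O; rw [map_one]; exact O.one_mem

/-- The place given by a nontrivial valuation ring. -/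
def mkPlace (O : ValuationSubring K) (hO : O ≠ ⊤) : Place F₂ K := ⟨O, hO, algebraMap_mem O⟩

instance residueAlgebra (P : Place F₂ K) : Algebra F₂ (IsLocalRing.ResidueField P.1) :=
  (residueHom F₂ P).toAlgebra

lemma placeDegree_eq (P : Place F₂ K) :
    placeDegree F₂ P = Module.finrank F₂ (IsLocalRing.ResidueField P.1) := rfl

variable [GenusFour K]

lemma place_facts (P : Place F₂ K) :
    IsDiscreteValuationRing P.1 ∧ Finite (IsLocalRing.ResidueField P.1) := by
  obtain ⟨t, ht⟩ := GenusFour.sep (K := K)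
  rcases P.1.mem_or_inv_mem t with h | h
  · exact (chart ht).1 P.1 P.2.1 h
  · exact (chart ht.inv).1 P.1 P.2.1 h

instance (P : Place F₂ K) : IsDiscreteValuationRing P.1 := (place_facts P).1
instance (P : Place F₂ K) : Finite (IsLocalRing.ResidueField P.1) := (place_facts P).2
instance (P : Place F₂ K) : Module.Finite F₂ (IsLocalRing.ResidueField P.1) :=
  Module.Finite.of_finite

lemma placeDegree_pos (P : Place F₂ K) : 0 < placeDegree F₂ P := by
  rw [placeDegree_eq]; exact Module.finrank_pos

lemma card_residue (P : Place F₂ K) :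
    Nat.card (IsLocalRing.ResidueField P.1) = 2 ^ placeDegree F₂ P := by
  rw [placeDegree_eq, Module.natCard_eq_pow_finrank (K := F₂)]; simp

lemma finite_ord_ne_zero {f : K} (hf : f ≠ 0) : {P : Place F₂ K | ordAt P.1 f ≠ 0}.Finite := by
  obtain ⟨t, ht⟩ := GenusFour.sep (K := K)
  have h := ((chart ht).2 f hf).union ((chart ht.inv).2 f hf)
  refine Set.Finite.of_finite_image (f := Subtype.val) (h.subset ?_) Subtype.val_injective.injOn
  rintro _ ⟨P, hP, rfl⟩
  have h1 : f ∉ P.1 ∨ f⁻¹ ∉ P.1 := by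
    by_contra hcon
    push Not at hcon
    obtain ⟨h2, h3⟩ := hcon
    rw [mem_iff_ordAt hf] at h2
    rw [mem_iff_ordAt (inv_ne_zero hf), ordAt_inv hf] at h3
    exact hP (by omega)
  rcases P.1.mem_or_inv_mem t with h | h
  · exact Or.inl ⟨P.2.1, h, h1⟩
  · exact Or.inr ⟨P.2.1, h, h1⟩

/-- The principal divisor of `f`. -/
def div (f : K) : Divisor F₂ K :=
  if hf : f = 0 then 0 else
    Finsupp.ofSupportFinite (fun P => ordAt P.1 f) (finite_ord_ne_zero hf)

lemma div_apply {f : K} (hf : f ≠ 0) (P : Place F₂ K) : div f P = ordAt P.1 f := by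
  unfold div; rw [dif_neg hf]; rfl

lemma div_mul {f g : K} (hf : f ≠ 0) (hg : g ≠ 0) : div (f * g) = div f + div g := by
  ext P
  rw [Finsupp.add_apply, div_apply hf, div_apply hg, div_apply (mul_ne_zero hf hg), ordAt_mul hf hg]

lemma div_inv {f : K} (hf : f ≠ 0) : div f⁻¹ = - div f := by
  ext P
  rw [Finsupp.neg_apply, div_apply hf, div_apply (inv_ne_zero hf), ordAt_inv hf]

/-- Elements of order at least `n` at `P`. -/
def lev (P : Place F₂ K) (n : ℤ) : Submodule F₂ K where
  carrier := {f | f = 0 ∨ n ≤ ordAt P.1 f}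
  add_mem' := ordAt_add
  zero_mem' := Or.inl rfl
  smul_mem' := by
    intro c f hf
    fin_cases c
    · change (0 : F₂) • f = 0 ∨ _; left; exact zero_smul _ _
    · change (1 : F₂) • f = 0 ∨ n ≤ ordAt P.1 ((1 : F₂) • f)
      rw [one_smul]; exact hf

lemma mem_lev {P : Place F₂ K} {n : ℤ} {f : K} : f ∈ lev P n ↔ f = 0 ∨ n ≤ ordAt P.1 f := Iff.rfl

lemma mem_lev_iff {P : Place F₂ K} {n : ℤ} {f : K} (hf : f ≠ 0) : f ∈ lev P n ↔ n ≤ ordAt P.1 f := by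
  rw [mem_lev]; simp [hf]

lemma lev_mono (P : Place F₂ K) {m n : ℤ} (h : m ≤ n) : lev P n ≤ lev P m := by
  intro f hf
  rcases hf with hf | hf
  · exact Or.inl hf
  · exact Or.inr (h.trans hf)

lemma mem_lev_zero {P : Place F₂ K} {f : K} : f ∈ lev P 0 ↔ f ∈ P.1 := by
  by_cases hf : f = 0
  · simp [hf, P.1.zero_mem]
  · rw [mem_lev_iff hf, mem_iff_ordAt hf]

lemma mul_mem_lev {P : Place F₂ K} {m n : ℤ} {f g : K} (hf : f ∈ lev P m) (hg : g ∈ lev P n) :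
    f * g ∈ lev P (m + n) := by
  by_cases hf0 : f = 0
  · rw [hf0, zero_mul]; exact Submodule.zero_mem _
  by_cases hg0 : g = 0
  · rw [hg0, mul_zero]; exact Submodule.zero_mem _
  rw [mem_lev_iff hf0] at hf
  rw [mem_lev_iff hg0] at hg
  rw [mem_lev_iff (mul_ne_zero hf0 hg0), ordAt_mul hf0 hg0]; omega

lemma mem_maximalIdeal_iff {P : Place F₂ K} (f : P.1) :
    f ∈ IsLocalRing.maximalIdeal P.1 ↔ (f : K) ∈ lev P 1 := by
  by_cases hf : (f : K) = 0
  · have : f = 0 := Subtype.ext hf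
    simp [this]
  · rw [mem_lev_iff hf, IsLocalRing.mem_maximalIdeal, mem_nonunits_iff]
    have h0 := (mem_iff_ordAt hf).1 f.2
    constructor
    · intro h
      by_contra hlt
      apply h
      have h1 : (f : K)⁻¹ ∈ P.1 := by
        rw [mem_iff_ordAt (inv_ne_zero hf), ordAt_inv hf]; omega
      exact IsUnit.of_mul_eq_one ⟨_, h1⟩ (Subtype.ext (mul_inv_cancel₀ hf))
    · intro h hu
      obtain ⟨v, hv⟩ := hu
      have h3 : (v : P.1) * ((v⁻¹ : (P.1)ˣ) : P.1) = 1 := v.mul_inv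
      have h4 : (f : K) * (((v⁻¹ : (P.1)ˣ) : P.1) : K) = 1 := by
        rw [← hv]; exact congrArg Subtype.val h3
      have h5 : (((v⁻¹ : (P.1)ˣ) : P.1) : K) = (f : K)⁻¹ := by
        field_simp; rw [mul_comm]; exact h4
      have h6 : (f : K)⁻¹ ∈ P.1 := by rw [← h5]; exact ((v⁻¹ : (P.1)ˣ) : P.1).2
      rw [mem_iff_ordAt (inv_ne_zero hf), ordAt_inv hf] at h6
      omega

lemma exists_red (P : Place F₂ K) (n : ℤ) :
    ∃ r : lev P n →ₗ[F₂] IsLocalRing.ResidueField P.1, Function.Surjective r ∧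
      ∀ x, r x = 0 ↔ (x : K) ∈ lev P (n + 1) := by
  obtain ⟨π, hπ, hn⟩ := exists_ordAt_eq (O := P.1) n
  have hd : ∀ x : lev P n, (x : K) / π ∈ P.1 := by
    intro x
    rw [← mem_lev_zero, div_eq_mul_inv]
    have : π⁻¹ ∈ lev P (-n) := by
      rw [mem_lev_iff (inv_ne_zero hπ), ordAt_inv hπ]; omega
    have := mul_mem_lev x.2 this
    rwa [add_neg_cancel] at this
  let r : lev P n →+ IsLocalRing.ResidueField P.1 :=
    { toFun := fun x => IsLocalRing.residue P.1 ⟨(x : K) / π, hd x⟩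
      map_zero' := by
        rw [IsLocalRing.residue_eq_zero_iff, mem_maximalIdeal_iff]
        simp
      map_add' := by
        intro x y
        rw [← map_add]; congr 1; apply Subtype.ext
        change ((x : K) + y) / π = (x : K) / π + (y : K) / π
        rw [add_div] }
  refine ⟨r.toZModLinearMap 2, ?_, ?_⟩
  · intro z
    obtain ⟨f, rfl⟩ := IsLocalRing.residue_surjective z
    have hf : (f : K) * π ∈ lev P n := by
      have h1 : (f : K) ∈ lev P 0 := mem_lev_zero.2 f.2
      have h2 : π ∈ lev P n := by rw [mem_lev_iff hπ]; omega
      have := mul_mem_lev h1 h2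
      rwa [zero_add] at this
    refine ⟨⟨_, hf⟩, ?_⟩
    change IsLocalRing.residue P.1 _ = _
    congr 1; apply Subtype.ext
    change (f : K) * π / π = f
    field_simp
  · intro x
    change IsLocalRing.residue P.1 _ = 0 ↔ _
    rw [IsLocalRing.residue_eq_zero_iff, mem_maximalIdeal_iff]
    change (x : K) / π ∈ lev P 1 ↔ _
    by_cases hx : (x : K) = 0
    · simp [hx]
    · rw [mem_lev_iff hx, mem_lev_iff (div_ne_zero hx hπ), ordAt_div hx hπ]; omega

lemma mem_RR {D : Divisor F₂ K} {f : K} : f ∈ RRspace F₂ D ↔ ∀ P, f ∈ lev P (-D P) := by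
  constructor
  · intro h
    have h2 : RRspace F₂ D ≤ ⨅ P, lev P (-D P) := by
      unfold RRspace
      rw [Submodule.span_le]
      intro f hf
      simp only [SetLike.mem_coe, Submodule.mem_iInf]
      intro P
      right
      have := hf P
      omega
    have := h2 h
    simpa [Submodule.mem_iInf] using this
  · intro h
    by_cases hf : f = 0
    · rw [hf]; exact Submodule.zero_mem _
    · apply Submodule.subset_span
      intro P
      have := (mem_lev_iff hf).1 (h P)
      omega

lemma mem_RR_iff {D : Divisor F₂ K} {f : K} (hf : f ≠ 0) :
    f ∈ RRspace F₂ D ↔ 0 ≤ div f + D := by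
  rw [mem_RR]
  constructor
  · intro h P
    have := (mem_lev_iff hf).1 (h P)
    rw [Finsupp.add_apply, div_apply hf, Finsupp.zero_apply]; omega
  · intro h P
    have := h P
    rw [Finsupp.add_apply, div_apply hf, Finsupp.zero_apply] at this
    rw [mem_lev_iff hf]; omega

lemma RR_mono {D D' : Divisor F₂ K} (h : D ≤ D') : RRspace F₂ D ≤ RRspace F₂ D' := by
  intro f hf
  rw [mem_RR] at *
  intro P
  exact lev_mono P (neg_le_neg (h P)) (hf P)

lemma mul_mem_RR {D D' : Divisor F₂ K} {f g : K} (hf : f ∈ RRspace F₂ D) (hg : g ∈ RRspace F₂ D') :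
    f * g ∈ RRspace F₂ (D + D') := by
  rw [mem_RR] at *
  intro P
  have := mul_mem_lev (hf P) (hg P)
  rw [Finsupp.add_apply, neg_add]; exact this

omit [GenusFour K] in
lemma degHom_single (P : Place F₂ K) (n : ℤ) :
    degHom F₂ K (Finsupp.single P n) = n * placeDegree F₂ P := by
  simp [degHom]

lemma mem_RR_sub {D : Divisor F₂ K} {P : Place F₂ K} {f : K} (hf : f ∈ RRspace F₂ D)
    (hP : f ∈ lev P (-D P + 1)) : f ∈ RRspace F₂ (D - Finsupp.single P 1) := by
  rw [mem_RR] at *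
  intro Q
  by_cases h : P = Q
  · subst h
    simpa [sub_eq_add_neg, add_comm] using hP
  · simpa [Finsupp.single_apply, h] using hf Q

lemma lev_of_mem_RR_sub {D : Divisor F₂ K} {P : Place F₂ K} {f : K}
    (hf : f ∈ RRspace F₂ (D - Finsupp.single P 1)) : f ∈ lev P (-D P + 1) := by
  rw [mem_RR] at hf
  have := hf P
  simpa [sub_eq_add_neg, add_comm] using this

lemma RR_step (D : Divisor F₂ K) (P : Place F₂ K)
    [FiniteDimensional F₂ (RRspace F₂ (D - Finsupp.single P 1))] :
    FiniteDimensional F₂ (RRspace F₂ D) ∧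
    ell F₂ D ≤ ell F₂ (D - Finsupp.single P 1) + placeDegree F₂ P ∧
    (ell F₂ (D - Finsupp.single P 1) + placeDegree F₂ P ≤ ell F₂ D → ∀ f ∈ lev P (-D P),
      ∃ l ∈ RRspace F₂ D, f - l ∈ lev P (-D P + 1)) := by
  obtain ⟨r, hr, hk⟩ := exists_red P (-D P)
  have hle : RRspace F₂ D ≤ lev P (-D P) := fun f hf => mem_RR.1 hf P
  let φ := r ∘ₗ Submodule.inclusion hle
  have hsub : RRspace F₂ (D - Finsupp.single P 1) ≤ RRspace F₂ D :=
    RR_mono (by simp)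
  let j := Submodule.inclusion hsub
  have hex : LinearMap.ker φ = LinearMap.range j := by
    ext x
    rw [LinearMap.mem_ker, LinearMap.mem_range]
    change r _ = 0 ↔ _
    rw [hk]
    constructor
    · intro h
      exact ⟨⟨x, mem_RR_sub x.2 h⟩, rfl⟩
    · rintro ⟨y, rfl⟩
      exact lev_of_mem_RR_sub y.2
  have hj : Function.Injective j := Submodule.inclusion_injective hsub
  have hker : FiniteDimensional F₂ (LinearMap.ker φ) := by
    rw [hex]; infer_instance
  have hfd : FiniteDimensional F₂ (RRspace F₂ D) := by
    have : Module.Finite F₂ ((RRspace F₂ D) ⧸ (LinearMap.ker φ)) :=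
      Module.Finite.equiv φ.quotKerEquivRange.symm
    exact Module.Finite.of_submodule_quotient (LinearMap.ker φ)
  have hrk := LinearMap.finrank_range_add_finrank_ker φ
  rw [hex, LinearMap.finrank_range_of_inj hj] at hrk
  have hle2 : Module.finrank F₂ (LinearMap.range φ) ≤ placeDegree F₂ P := Submodule.finrank_le _
  refine ⟨hfd, ?_, ?_⟩
  · unfold ell; omega
  · intro h f hf
    have htop : LinearMap.range φ = ⊤ := by
      apply Submodule.eq_top_of_finrank_eq
      unfold ell at h
      rw [placeDegree_eq] at *
      omega
    obtain ⟨l, hl⟩ := LinearMap.range_eq_top.1 htop (r ⟨f, hf⟩)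
    refine ⟨l, l.2, ?_⟩
    have : r (⟨f, hf⟩ - Submodule.inclusion hle l) = 0 := by
      rw [map_sub, sub_eq_zero]; exact hl.symm
    rw [hk] at this
    exact this

end Places

section Riemann

variable {K : Type} [Field K] [Algebra (ZMod 2) K]

lemma integral_of_forall_place (S : Subring K) (f : K)
    (h : ∀ P : Place F₂ K, (∀ s ∈ S, s ∈ P.1) → f ∈ P.1) : IsIntegral S f := by
  have h1 : f ∈ (⨅ V : {V : ValuationSubring K // (S : Set K) ⊆ V.toSubring}, V.1.toSubring) := by
    rw [Subring.mem_iInf]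
    rintro ⟨V, hV⟩
    by_cases hT : V = ⊤
    · subst hT; trivial
    · exact h (mkPlace V hT) (fun s hs => hV hs)
  rw [iInf_valuationSubring_superset] at h1
  have h2 : IsIntegral (Subring.closure (S : Set K)) f := h1
  rwa [Subring.closure_eq] at h2

variable [GenusFour K]

lemma exists_constant {f : K} (h : ∀ P : Place F₂ K, f ∈ P.1) : f = 0 ∨ f = 1 := by
  have h1 := integral_of_forall_place ((⊥ : Subalgebra F₂ K).toSubring) f (fun P _ => h P)
  have h2 : IsIntegral (⊥ : Subalgebra F₂ K) f := h1
  have h3 : IsIntegral F₂ f := isIntegral_trans (A := (⊥ : Subalgebra F₂ K)) f h2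
  obtain ⟨c, rfl⟩ := GenusFour.const (K := K) f h3.isAlgebraic
  fin_cases c
  · left; exact map_zero _
  · right; exact map_one _

lemma one_mem_RR {D : Divisor F₂ K} (hD : 0 ≤ D) : (1 : K) ∈ RRspace F₂ D := by
  rw [mem_RR]; intro P
  rw [mem_lev_iff one_ne_zero, ordAt_one]
  have := hD P
  simp only [Finsupp.zero_apply] at this
  omega

lemma RR_zero : RRspace F₂ (0 : Divisor F₂ K) = Submodule.span F₂ {1} := by
  apply le_antisymm
  · intro f hf
    have : f = 0 ∨ f = 1 := by
      apply exists_constant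
      intro P
      rw [← mem_lev_zero]
      simpa using mem_RR.1 hf P
    rcases this with rfl | rfl
    · exact Submodule.zero_mem _
    · exact Submodule.mem_span_singleton_self _
  · rw [Submodule.span_le]
    simpa using one_mem_RR le_rfl

lemma ell_zero : ell F₂ (0 : Divisor F₂ K) = 1 := by
  unfold ell; rw [RR_zero, finrank_span_singleton one_ne_zero]

omit [GenusFour K] in
lemma divisor_induction {p : Divisor F₂ K → Prop} (h0 : p 0)
    (h : ∀ D P, p D ↔ p (D + Finsupp.single P 1)) (D : Divisor F₂ K) : p D := by
  let G : AddSubgroup (Divisor F₂ K) :=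
    { carrier := {E | ∀ D, p D ↔ p (D + E)}
      zero_mem' := by intro D; rw [add_zero]
      add_mem' := by intro a b ha hb D; rw [ha D, hb (D + a), add_assoc]
      neg_mem' := by intro a ha D; rw [ha (D + -a), neg_add_cancel_right] }
  have hG : ∀ E, E ∈ G := by
    intro E
    induction E using Finsupp.induction_linear with
    | zero => exact G.zero_mem
    | add a b ha hb => exact G.add_mem ha hb
    | single P n =>
      have h1 : Finsupp.single P (1 : ℤ) ∈ G := fun D => h D P
      have := G.zsmul_mem h1 n
      simpa using this
  have := (hG D) 0
  rw [zero_add] at this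
  exact this.1 h0

instance RR_finite (D : Divisor F₂ K) : FiniteDimensional F₂ (RRspace F₂ D) := by
  refine divisor_induction (p := fun D => FiniteDimensional F₂ (RRspace F₂ D)) ?_ ?_ D
  · rw [RR_zero]; infer_instance
  · intro D P
    constructor
    · intro h
      have : FiniteDimensional F₂ (RRspace F₂ (D + Finsupp.single P 1 - Finsupp.single P 1)) := by
        rwa [add_sub_cancel_right]
      exact (RR_step (D + Finsupp.single P 1) P).1
    · intro h
      have hle : RRspace F₂ D ≤ RRspace F₂ (D + Finsupp.single P 1) := RR_mono (by simp)
      exact Submodule.finiteDimensional_of_le hle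

instance (D : Divisor F₂ K) : Finite (RRspace F₂ D) := Module.finite_of_finite F₂

lemma ell_mono {D D' : Divisor F₂ K} (h : D ≤ D') : ell F₂ D ≤ ell F₂ D' :=
  Submodule.finrank_mono (RR_mono h)

lemma ell_step (D : Divisor F₂ K) (P : Place F₂ K) :
    ell F₂ (D + Finsupp.single P 1) ≤ ell F₂ D + placeDegree F₂ P := by
  have := (RR_step (D + Finsupp.single P 1) P).2.1
  rwa [add_sub_cancel_right] at this

lemma RR_surj (D : Divisor F₂ K) (P : Place F₂ K)
    (h : ell F₂ D + placeDegree F₂ P ≤ ell F₂ (D + Finsupp.single P 1))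
    (f : K) (hf : f ∈ lev P (-D P - 1)) :
    ∃ l ∈ RRspace F₂ (D + Finsupp.single P 1), f - l ∈ lev P (-D P) := by
  have := (RR_step (D + Finsupp.single P 1) P).2.2
  rw [add_sub_cancel_right] at this
  have h2 : (D + Finsupp.single P 1 : Divisor F₂ K) P = D P + 1 := by simp
  rw [h2] at this
  have e1 : -(D P + 1) = -D P - 1 := by ring
  have e2 : -(D P + 1) + 1 = -D P := by ring
  rw [e2, e1] at this
  exact this h f hf

/-- The degree of a divisor. -/
def deg : Divisor F₂ K →+ ℤ := degHom F₂ K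

omit [GenusFour K] in
lemma deg_single (P : Place F₂ K) (n : ℤ) : deg (Finsupp.single P n) = n * placeDegree F₂ P :=
  degHom_single P n

omit [GenusFour K] in
lemma deg_nonneg {D : Divisor F₂ K} (h : 0 ≤ D) : 0 ≤ deg D := by
  unfold deg degHom
  rw [Finsupp.liftAddHom_apply]
  apply Finset.sum_nonneg
  intro P _
  exact mul_nonneg (h P) (by positivity)

omit [GenusFour K] in
lemma deg_mono {D D' : Divisor F₂ K} (h : D ≤ D') : deg D ≤ deg D' := by
  have := deg_nonneg (sub_nonneg.2 h)
  rw [map_sub] at this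
  omega

/-- The index of speciality. -/
def spec (D : Divisor F₂ K) : ℤ := ell F₂ D - deg D + 3

lemma spec_nonneg (D : Divisor F₂ K) : 0 ≤ spec D := by
  have hg := GenusFour.gen (K := K)
  unfold genus at hg
  by_contra hcon
  unfold spec deg at hcon
  set S := {g : ℕ | ∃ D : Divisor F₂ K, (g : ℤ) = degHom F₂ K D + 1 - ell F₂ D} with hS
  have hbdd : BddAbove S := by
    by_contra hb
    rw [Nat.sSup_of_not_bddAbove hb] at hg
    omega
  have hmem : (degHom F₂ K D + 1 - ell F₂ D).toNat ∈ S := by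
    refine ⟨D, ?_⟩
    rw [Int.toNat_of_nonneg]; omega
  have := le_csSup hbdd hmem
  rw [hg] at this
  omega

lemma exists_spec_zero : ∃ D : Divisor F₂ K, spec D = 0 := by
  have hg := GenusFour.gen (K := K)
  unfold genus at hg
  set S := {g : ℕ | ∃ D : Divisor F₂ K, (g : ℤ) = degHom F₂ K D + 1 - ell F₂ D} with hS
  have hne : S.Nonempty := by
    by_contra h
    rw [Set.not_nonempty_iff_eq_empty] at h
    rw [h] at hg; simp at hg
  have hbdd : BddAbove S := by
    by_contra hb
    rw [Nat.sSup_of_not_bddAbove hb] at hg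
    omega
  have := Nat.sSup_mem hne hbdd
  rw [hg] at this
  obtain ⟨D, hD⟩ := this
  refine ⟨D, ?_⟩
  unfold spec deg
  push_cast at hD
  omega

lemma spec_step (D : Divisor F₂ K) (P : Place F₂ K) : spec (D + Finsupp.single P 1) ≤ spec D := by
  have := ell_step D P
  unfold spec
  rw [map_add, deg_single]
  omega

lemma spec_anti {D D' : Divisor F₂ K} (h : D ≤ D') : spec D' ≤ spec D := by
  obtain ⟨E, hE⟩ : ∃ E, E = D' - D := ⟨_, rfl⟩
  have hE0 : 0 ≤ E := by rw [hE]; exact sub_nonneg.2 h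
  have hD' : D' = D + E := by rw [hE]; abel
  subst hD'
  clear hE h
  have key : ∀ (n : ℕ) (P : Place F₂ K) (D : Divisor F₂ K), spec (D + Finsupp.single P (n : ℤ)) ≤ spec D := by
    intro n P D
    induction n with
    | zero => simp
    | succ n ih =>
      push_cast
      rw [Finsupp.single_add, ← add_assoc]
      exact (spec_step _ _).trans ih
  induction E using Finsupp.induction generalizing D with
  | zero => simp
  | single_add P n E hP hn ih =>
    have hn0 : 0 ≤ n := by
      have := hE0 P
      rw [Finsupp.add_apply, Finsupp.single_eq_same, Finsupp.notMem_support_iff.1 hP] at this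
      simpa using this
    have hE' : 0 ≤ E := by
      intro Q
      have := hE0 Q
      by_cases hQ : P = Q
      · subst hQ; rw [Finsupp.notMem_support_iff.1 hP]; simp
      · simpa [Finsupp.single_apply, hQ] using this
    lift n to ℕ using hn0
    rw [← add_assoc]
    exact (ih hE').trans (key n P D)

/-- Multiplication by a nonzero element identifies Riemann-Roch spaces of equivalent divisors. -/
lemma ell_add_div (D : Divisor F₂ K) {f : K} (hf : f ≠ 0) : ell F₂ (D + div f) = ell F₂ D := by
  have key : ∀ (D : Divisor F₂ K) (f : K), f ≠ 0 → ell F₂ (D + div f) ≤ ell F₂ D := by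
    intro D f hf
    have h1 : ∀ x ∈ RRspace F₂ (D + div f), (LinearMap.mulLeft F₂ f) x ∈ RRspace F₂ D := by
      intro x hx
      by_cases hx0 : x = 0
      · rw [hx0, map_zero]; exact Submodule.zero_mem _
      rw [LinearMap.mulLeft_apply]
      rw [mem_RR_iff hx0] at hx
      rw [mem_RR_iff (mul_ne_zero hf hx0), div_mul hf hx0]
      have : div f + div x + D = div x + (D + div f) := by abel
      rwa [this]
    let φ := ((LinearMap.mulLeft F₂ f).restrict h1)
    refine LinearMap.finrank_le_finrank_of_injective (f := φ) ?_
    intro x y hxy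
    have := congrArg Subtype.val hxy
    exact Subtype.ext (mul_left_cancel₀ hf this)
  apply le_antisymm (key D f hf)
  have := key (D + div f) f⁻¹ (inv_ne_zero hf)
  rwa [div_inv hf, add_neg_cancel_right] at this

lemma div_pow {f : K} (hf : f ≠ 0) (n : ℕ) : div (f ^ n) = (n : ℤ) • div f := by
  ext P
  rw [Finsupp.smul_apply, div_apply hf, div_apply (pow_ne_zero n hf), ordAt_pow hf]; rfl

lemma deg_div {f : K} (hf : f ≠ 0) : deg (div f) = 0 := by
  have key : ∀ f : K, f ≠ 0 → deg (div f) ≤ 0 := by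
    intro f hf
    by_contra hcon
    push Not at hcon
    have h := spec_nonneg (0 + div (f ^ 5))
    unfold spec at h
    rw [ell_add_div _ (pow_ne_zero _ hf), ell_zero, zero_add, div_pow hf, map_zsmul] at h
    simp only [smul_eq_mul] at h
    push_cast at h
    omega
  apply le_antisymm (key f hf)
  have := key f⁻¹ (inv_ne_zero hf)
  rw [div_inv hf, map_neg] at this
  omega

lemma exists_div_of_deg_zero {D : Divisor F₂ K} (hD : deg D = 0) : ∃ f : K, f ≠ 0 ∧ D = div f := by
  have hh := GenusFour.cls (K := K)
  unfold classNumber at hh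
  rw [Nat.card_eq_one_iff_unique] at hh
  have hsub := hh.1
  have h1 : (⟨D, hD⟩ : zeroDivisors F₂ K) ∈
      (principalDivisors F₂ K).addSubgroupOf (zeroDivisors F₂ K) := by
    have : (QuotientAddGroup.mk (⟨D, hD⟩ : zeroDivisors F₂ K) : zeroDivisors F₂ K ⧸
        (principalDivisors F₂ K).addSubgroupOf (zeroDivisors F₂ K)) = QuotientAddGroup.mk 0 :=
      hsub.elim _ _
    rw [QuotientAddGroup.eq] at this
    simpa using this
  rw [AddSubgroup.mem_addSubgroupOf] at h1
  change D ∈ principalDivisors F₂ K at h1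
  unfold principalDivisors at h1
  induction h1 using AddSubgroup.closure_induction with
  | mem x hx =>
    obtain ⟨f, hf, h⟩ := hx
    exact ⟨f, hf, by ext P; rw [h, div_apply hf]⟩
  | zero => exact ⟨1, one_ne_zero, by ext P; rw [div_apply one_ne_zero, ordAt_one]; rfl⟩
  | add x y hx hy ihx ihy =>
    have hz : ∀ x, x ∈ AddSubgroup.closure
        {D : Divisor F₂ K | ∃ f : K, f ≠ 0 ∧ ∀ p : Place F₂ K, D p = ordAt p.1 f} → deg x = 0 := by
      intro x hx
      induction hx using AddSubgroup.closure_induction with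
      | mem x hx =>
        obtain ⟨f, hf, h⟩ := hx
        have : x = div f := by ext P; rw [h, div_apply hf]
        rw [this, deg_div hf]
      | zero => exact map_zero _
      | add x y _ _ h1 h2 => rw [map_add]; omega
      | neg x _ h1 => rw [map_neg]; omega
    have hm : ∀ x (hx : x ∈ AddSubgroup.closure
        {D : Divisor F₂ K | ∃ f : K, f ≠ 0 ∧ ∀ p : Place F₂ K, D p = ordAt p.1 f}) (h0 : deg x = 0),
        (⟨x, h0⟩ : zeroDivisors F₂ K) ∈
          (principalDivisors F₂ K).addSubgroupOf (zeroDivisors F₂ K) := fun x hx h0 => hx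
    obtain ⟨f, hf, rfl⟩ := ihx (hz x hx)
    obtain ⟨g, hg, rfl⟩ := ihy (hz y hy)
    exact ⟨f * g, mul_ne_zero hf hg, (div_mul hf hg).symm⟩
  | neg x hx ih =>
    have h0 : deg x = 0 := by rw [map_neg] at hD; omega
    obtain ⟨f, hf, rfl⟩ := ih h0
    exact ⟨f⁻¹, inv_ne_zero hf, (div_inv hf).symm⟩

lemma exists_equiv {D D' : Divisor F₂ K} (h : deg D = deg D') :
    ∃ f : K, f ≠ 0 ∧ D = D' + div f := by
  have : deg (D - D') = 0 := by
    rw [map_sub, h, sub_self]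
  obtain ⟨f, hf, h2⟩ := exists_div_of_deg_zero this
  exact ⟨f, hf, by rw [← h2]; abel⟩

lemma ell_eq_of_deg {D D' : Divisor F₂ K} (h : deg D = deg D') : ell F₂ D = ell F₂ D' := by
  obtain ⟨f, hf, rfl⟩ := exists_equiv h
  exact ell_add_div D' hf

lemma exists_effective {D : Divisor F₂ K} (h : 0 < ell F₂ D) :
    ∃ f : K, f ≠ 0 ∧ f ∈ RRspace F₂ D ∧ 0 ≤ D + div f := by
  unfold ell at h
  have : Nontrivial (RRspace F₂ D) := Module.finrank_pos_iff.1 h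
  obtain ⟨x, hx⟩ := exists_ne (0 : RRspace F₂ D)
  have hx0 : (x : K) ≠ 0 := fun h => hx (Subtype.ext h)
  refine ⟨x, hx0, x.2, ?_⟩
  rw [add_comm]
  exact (mem_RR_iff hx0).1 x.2

lemma ell_neg {D : Divisor F₂ K} (h : deg D < 0) : ell F₂ D = 0 := by
  by_contra hcon
  obtain ⟨f, hf, -, h2⟩ := exists_effective (Nat.pos_of_ne_zero hcon)
  have := deg_nonneg h2
  have h3 := deg_div hf
  rw [map_add] at this
  omega

lemma spec_zero_of_large : ∃ N : ℤ, ∀ D : Divisor F₂ K, N ≤ deg D → spec D = 0 := by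
  obtain ⟨D₁, hD₁⟩ := exists_spec_zero (K := K)
  refine ⟨deg D₁ + 4, ?_⟩
  intro D hD
  have h1 := spec_nonneg (D - D₁)
  unfold spec at h1
  rw [map_sub] at h1
  obtain ⟨f, hf, -, h2⟩ := exists_effective (D := D - D₁) (by omega)
  have h3 : spec (D + div f) ≤ spec D₁ := by
    apply spec_anti
    rw [← sub_nonneg]
    have : D + div f - D₁ = D - D₁ + div f := by abel
    rwa [this]
  have h4 : spec (D + div f) = spec D := by
    have := deg_div hf
    unfold spec
    rw [ell_add_div _ hf, map_add, this, add_zero]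
  have := spec_nonneg D
  omega

end Riemann

section LinAlg

variable {k V W : Type*} [Field k] [AddCommGroup V] [Module k V] [AddCommGroup W] [Module k W]
  [FiniteDimensional k W]

lemma finrank_quot_sup (A C C' : Submodule k V) (hC : C ≤ C') (r : C' →ₗ[k] W)
    (hr : Function.Surjective r) (hk : ∀ x, r x = 0 ↔ (x : V) ∈ C)
    [FiniteDimensional k (V ⧸ (A ⊔ C'))] :
    FiniteDimensional k (V ⧸ (A ⊔ C)) ∧
    Module.finrank k (V ⧸ (A ⊔ C)) + Module.finrank k ((A.comap C'.subtype).map r) =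
      Module.finrank k (V ⧸ (A ⊔ C')) + Module.finrank k W := by
  set S := (A.comap C'.subtype).map r with hS
  have hle : A ⊔ C ≤ A ⊔ C' := sup_le_sup_left hC A
  let φ : (V ⧸ (A ⊔ C)) →ₗ[k] (V ⧸ (A ⊔ C')) := Submodule.factor hle
  have hφ : Function.Surjective φ := Submodule.factor_surjective hle
  let χ : C' →ₗ[k] (V ⧸ (A ⊔ C)) := (A ⊔ C).mkQ ∘ₗ C'.subtype
  have hχφ : LinearMap.range χ = LinearMap.ker φ := by
    ext z
    obtain ⟨v, rfl⟩ := Submodule.mkQ_surjective _ z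
    rw [LinearMap.mem_ker, LinearMap.mem_range]
    have hv : φ ((A ⊔ C).mkQ v) = 0 ↔ v ∈ A ⊔ C' := by
      change (A ⊔ C').mkQ v = 0 ↔ _
      rw [Submodule.mkQ_apply, Submodule.Quotient.mk_eq_zero]
    rw [hv, Submodule.mem_sup]
    constructor
    · rintro ⟨y, hy⟩
      have hy' : (A ⊔ C).mkQ (y : V) = (A ⊔ C).mkQ v := hy
      rw [← sub_eq_zero, ← map_sub, Submodule.mkQ_apply, Submodule.Quotient.mk_eq_zero] at hy'
      have := hle hy'
      rw [← Submodule.mem_sup]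
      have h2 := (A ⊔ C').sub_mem (Submodule.mem_sup_right y.2) this
      rwa [sub_sub_cancel] at h2
    · rintro ⟨a, ha, c, hc, rfl⟩
      refine ⟨⟨c, hc⟩, ?_⟩
      change (A ⊔ C).mkQ c = (A ⊔ C).mkQ (a + c)
      rw [map_add, eq_comm, add_eq_right, Submodule.mkQ_apply, Submodule.Quotient.mk_eq_zero]
      exact Submodule.mem_sup_left ha
  have hker : LinearMap.ker χ = LinearMap.ker (S.mkQ ∘ₗ r) := by
    ext x
    rw [LinearMap.mem_ker, LinearMap.mem_ker]
    change (A ⊔ C).mkQ (x : V) = 0 ↔ S.mkQ (r x) = 0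
    rw [Submodule.mkQ_apply, Submodule.Quotient.mk_eq_zero, Submodule.mkQ_apply,
      Submodule.Quotient.mk_eq_zero, Submodule.mem_sup, hS]
    constructor
    · rintro ⟨a, ha, c, hc, h⟩
      refine ⟨x - ⟨c, hC hc⟩, ?_, ?_⟩
      · change (x : V) - c ∈ A
        rw [← h, add_sub_cancel_right]; exact ha
      · rw [map_sub, (hk ⟨c, hC hc⟩).2 hc, sub_zero]
    · rintro ⟨y, hy, h⟩
      refine ⟨y, hy, x - y, ?_, by abel⟩
      have := (hk (x - y)).1 (by rw [map_sub, h, sub_self])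
      exact this
  have hsurj : Function.Surjective (S.mkQ ∘ₗ r) := (Submodule.mkQ_surjective S).comp hr
  let e1 := LinearMap.quotKerEquivOfSurjective (S.mkQ ∘ₗ r) hsurj
  let e2 := LinearMap.quotKerEquivRange χ
  let e : LinearMap.ker φ ≃ₗ[k] (W ⧸ S) :=
    (LinearEquiv.ofEq _ _ hχφ.symm).trans (e2.symm.trans ((Submodule.quotEquivOfEq _ _ hker).trans e1))
  have h1 : FiniteDimensional k (LinearMap.ker φ) := Module.Finite.equiv e.symm
  have h2 : FiniteDimensional k ((V ⧸ (A ⊔ C)) ⧸ LinearMap.ker φ) :=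
    Module.Finite.equiv (LinearMap.quotKerEquivOfSurjective φ hφ).symm
  have h3 : FiniteDimensional k (V ⧸ (A ⊔ C)) := Module.Finite.of_submodule_quotient (LinearMap.ker φ)
  refine ⟨h3, ?_⟩
  have h4 := LinearMap.finrank_range_add_finrank_ker φ
  rw [LinearMap.range_eq_top.2 hφ, finrank_top, LinearEquiv.finrank_eq e] at h4
  have h5 := Submodule.finrank_quotient_add_finrank S
  omega

end LinAlg

section Duality

variable {K : Type} [Field K] [Algebra (ZMod 2) K] [GenusFour K]

lemma exists_place : Nonempty (Place F₂ K) := by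
  by_contra h
  rw [not_nonempty_iff] at h
  obtain ⟨t, ht⟩ := GenusFour.sep (K := K)
  rcases exists_constant (f := t) (fun P => (h.false P).elim) with rfl | rfl
  · exact ht.tr isAlgebraic_zero
  · exact ht.tr isAlgebraic_one

variable (Q : Place F₂ K)

/-- Elements satisfying the conditions of `L(D)` away from `Q`. -/
def away (D : Divisor F₂ K) : Submodule F₂ K := ⨅ P : Place F₂ K, ⨅ _ : P ≠ Q, lev P (-D P)

variable {Q}

lemma mem_away {D : Divisor F₂ K} {f : K} : f ∈ away Q D ↔ ∀ P, P ≠ Q → f ∈ lev P (-D P) := by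
  simp [away, Submodule.mem_iInf]

variable (Q) in
/-- Principal adeles split as away from `Q` and at `Q`. -/
def adl (D : Divisor F₂ K) : Submodule F₂ K := away Q D ⊔ lev Q (-D Q)

lemma RR_le_away {D : Divisor F₂ K} : RRspace F₂ D ≤ away Q D := by
  intro f hf
  rw [mem_away]
  exact fun P _ => mem_RR.1 hf P

lemma away_inf_lev {D : Divisor F₂ K} : away Q D ⊓ lev Q (-D Q) = RRspace F₂ D := by
  ext f
  rw [Submodule.mem_inf, mem_away, mem_RR]
  constructor
  · rintro ⟨h1, h2⟩ P
    by_cases h : P = Q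
    · subst h; exact h2
    · exact h1 P h
  · intro h; exact ⟨fun P _ => h P, h Q⟩

lemma away_congr {D D' : Divisor F₂ K} (h : ∀ P, P ≠ Q → D P = D' P) : away Q D = away Q D' := by
  ext f
  rw [mem_away, mem_away]
  refine forall_congr' fun P => forall_congr' fun hP => ?_
  rw [h P hP]

omit [GenusFour K] in
lemma add_single_apply_ne {D : Divisor F₂ K} {P Q : Place F₂ K} (h : P ≠ Q) (n : ℤ) :
    (D + Finsupp.single Q n : Divisor F₂ K) P = D P := by
  rw [Finsupp.add_apply, Finsupp.single_apply, if_neg (Ne.symm h), add_zero]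

omit [GenusFour K] in
lemma add_single_apply_self {D : Divisor F₂ K} {Q : Place F₂ K} (n : ℤ) :
    (D + Finsupp.single Q n : Divisor F₂ K) Q = D Q + n := by
  rw [Finsupp.add_apply, Finsupp.single_eq_same]

omit [GenusFour K] in
lemma le_add_single (D : Divisor F₂ K) (Q : Place F₂ K) {n : ℤ} (hn : 0 ≤ n) :
    D ≤ D + Finsupp.single Q n := by
  rw [le_add_iff_nonneg_right]; exact Finsupp.single_nonneg.2 hn

/-- A full step in dimension occurs as soon as the index of speciality vanishes. -/
lemma RR_surj_of_spec {D : Divisor F₂ K} {P : Place F₂ K} (h : spec D = 0)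
    (f : K) (hf : f ∈ lev P (-D P - 1)) :
    ∃ l ∈ RRspace F₂ (D + Finsupp.single P 1), f - l ∈ lev P (-D P) := by
  apply RR_surj D P _ f hf
  have h1 := spec_step D P
  have h2 := spec_nonneg (D + Finsupp.single P 1)
  unfold spec at *
  rw [map_add, deg_single] at *
  omega

lemma adl_eq_top {D : Divisor F₂ K} (h : spec D = 0) : adl Q D = ⊤ := by
  have key : ∀ (n : ℕ) (f : K), f ∈ lev Q (-D Q - n) → f ∈ adl Q D := by
    intro n
    induction n with
    | zero =>
      intro f hf
      apply Submodule.mem_sup_right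
      simpa using hf
    | succ n ih =>
      intro f hf
      have h1 : spec (D + Finsupp.single Q (n : ℤ)) = 0 := by
        have h2 := spec_anti (le_add_single D Q (n := (n : ℤ)) (by positivity))
        have := spec_nonneg (D + Finsupp.single Q (n : ℤ))
        omega
      obtain ⟨l, hl, hfl⟩ := RR_surj_of_spec (P := Q) h1 f (by
        rw [add_single_apply_self]
        have : -(D Q + (n : ℤ)) - 1 = -D Q - ((n + 1 : ℕ) : ℤ) := by push_cast; ring
        rwa [this])
      have h3 : l ∈ adl Q D := by
        apply Submodule.mem_sup_left
        have := RR_le_away (Q := Q) hl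
        rwa [add_assoc, ← Finsupp.single_add, away_congr (D' := D)] at this
        intro P hP
        exact add_single_apply_ne hP _
      have h4 : f - l ∈ adl Q D := by
        apply ih
        rw [add_single_apply_self] at hfl
        have : -(D Q + (n : ℤ)) = -D Q - (n : ℤ) := by ring
        rwa [this] at hfl
      have := (adl Q D).add_mem h4 h3
      rwa [sub_add_cancel] at this
  rw [eq_top_iff]
  intro f _
  by_cases hf : f = 0
  · rw [hf]; exact Submodule.zero_mem _
  · apply key ((-D Q - ordAt Q.1 f).toNat)
    rw [mem_lev_iff hf]
    have := Int.self_le_toNat (-D Q - ordAt Q.1 f)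
    omega

lemma exists_spec_add_zero (D : Divisor F₂ K) (Q : Place F₂ K) :
    ∃ n : ℕ, spec (D + Finsupp.single Q (n : ℤ)) = 0 := by
  obtain ⟨N, hN⟩ := spec_zero_of_large (K := K)
  refine ⟨(N - deg D).toNat, hN _ ?_⟩
  rw [map_add, deg_single]
  have h1 := Int.self_le_toNat (N - deg D)
  have h2 : (1 : ℤ) ≤ placeDegree F₂ Q := by exact_mod_cast placeDegree_pos Q
  nlinarith [Int.natCast_nonneg (N - deg D).toNat]

lemma finrank_adl_step (D : Divisor F₂ K)
    (h : FiniteDimensional F₂ (K ⧸ adl Q (D + Finsupp.single Q 1)) ∧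
      (Module.finrank F₂ (K ⧸ adl Q (D + Finsupp.single Q 1)) : ℤ) = spec (D + Finsupp.single Q 1)) :
    FiniteDimensional F₂ (K ⧸ adl Q D) ∧ (Module.finrank F₂ (K ⧸ adl Q D) : ℤ) = spec D := by
  set D' := D + Finsupp.single Q 1 with hD'
  have hQ : -D' Q = -D Q - 1 := by rw [hD', add_single_apply_self]; ring
  obtain ⟨r, hr, hk⟩ := exists_red Q (-D' Q)
  have hA : away Q D' = away Q D := away_congr fun P hP => add_single_apply_ne hP _
  have hk' : ∀ x, r x = 0 ↔ (x : K) ∈ lev Q (-D Q) := by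
    intro x; rw [hk]
    have : -D' Q + 1 = -D Q := by omega
    rw [this]
  have hle : lev Q (-D Q) ≤ lev Q (-D' Q) := lev_mono Q (by omega)
  have h1 : FiniteDimensional F₂ (K ⧸ (away Q D ⊔ lev Q (-D' Q))) := by
    rw [← hA]; exact h.1
  obtain ⟨h2, h3⟩ := finrank_quot_sup (away Q D) (lev Q (-D Q)) (lev Q (-D' Q)) hle r hr hk'
  refine ⟨h2, ?_⟩
  have hle2 : RRspace F₂ D' ≤ lev Q (-D' Q) := fun f hf => mem_RR.1 hf Q
  let φ := r ∘ₗ Submodule.inclusion hle2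
  have hrange : LinearMap.range φ = ((away Q D).comap (lev Q (-D' Q)).subtype).map r := by
    ext z
    rw [LinearMap.mem_range, Submodule.mem_map]
    constructor
    · rintro ⟨y, rfl⟩
      refine ⟨Submodule.inclusion hle2 y, ?_, rfl⟩
      rw [Submodule.mem_comap, ← hA]
      exact RR_le_away y.2
    · rintro ⟨y, hy, rfl⟩
      have hy' : (y : K) ∈ RRspace F₂ D' := by
        rw [← away_inf_lev (Q := Q), hA]
        exact ⟨hy, y.2⟩
      exact ⟨⟨y, hy'⟩, rfl⟩
  have hsub : RRspace F₂ D ≤ RRspace F₂ D' := RR_mono (le_add_single D Q zero_le_one)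
  let j := Submodule.inclusion hsub
  have hex : LinearMap.ker φ = LinearMap.range j := by
    ext x
    rw [LinearMap.mem_ker, LinearMap.mem_range]
    change r _ = 0 ↔ _
    rw [hk']
    constructor
    · intro hx
      have hx2 : (x : K) ∈ RRspace F₂ D := by
        rw [← away_inf_lev (Q := Q), ← hA]
        exact ⟨RR_le_away x.2, hx⟩
      exact ⟨⟨x, hx2⟩, rfl⟩
    · rintro ⟨y, rfl⟩
      exact mem_RR.1 y.2 Q
  have hrk := LinearMap.finrank_range_add_finrank_ker φ
  rw [hex, LinearMap.finrank_range_of_inj (Submodule.inclusion_injective hsub), hrange] at hrk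
  have h4 := h.2
  unfold adl at h4 ⊢
  rw [hA] at h4
  rw [← placeDegree_eq] at h3
  have h5 : deg D' = deg D + placeDegree F₂ Q := by
    rw [hD', map_add, deg_single, one_mul]
  unfold spec at *
  unfold ell at *
  rw [h5] at h4
  omega

lemma finrank_adl (D : Divisor F₂ K) :
    FiniteDimensional F₂ (K ⧸ adl Q D) ∧ (Module.finrank F₂ (K ⧸ adl Q D) : ℤ) = spec D := by
  obtain ⟨n, hn⟩ := exists_spec_add_zero D Q
  induction n generalizing D with
  | zero =>
    have hn' : spec D = 0 := by simpa using hn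
    rw [adl_eq_top hn', hn']
    have : Subsingleton (K ⧸ (⊤ : Submodule F₂ K)) := inferInstance
    exact ⟨inferInstance, by exact_mod_cast Module.finrank_zero_of_subsingleton⟩
  | succ n ih =>
    apply finrank_adl_step
    apply ih
    rw [add_assoc, ← Finsupp.single_add]
    have : (1 + (n : ℤ)) = ((n + 1 : ℕ) : ℤ) := by push_cast; ring
    rwa [this]

variable (Q) in
/-- Weil differentials bounded by `D`. -/
def Om (D : Divisor F₂ K) : Submodule F₂ (Module.Dual F₂ K) := (adl Q D).dualAnnihilator

lemma mem_Om {D : Divisor F₂ K} {ω : Module.Dual F₂ K} :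
    ω ∈ Om Q D ↔ (∀ f ∈ away Q D, ω f = 0) ∧ ∀ f ∈ lev Q (-D Q), ω f = 0 := by
  rw [Om, Submodule.mem_dualAnnihilator]
  constructor
  · intro h
    exact ⟨fun f hf => h f (Submodule.mem_sup_left hf), fun f hf => h f (Submodule.mem_sup_right hf)⟩
  · rintro ⟨h1, h2⟩ f hf
    obtain ⟨a, ha, c, hc, rfl⟩ := Submodule.mem_sup.1 hf
    rw [map_add, h1 a ha, h2 c hc, add_zero]

instance Om_finite (D : Divisor F₂ K) : FiniteDimensional F₂ (Om Q D) := by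
  have := (finrank_adl (Q := Q) D).1
  exact Module.Finite.equiv (adl Q D).dualQuotEquivDualAnnihilator

lemma finrank_Om (D : Divisor F₂ K) : (Module.finrank F₂ (Om Q D) : ℤ) = spec D := by
  have := (finrank_adl (Q := Q) D).1
  have h1 := (adl Q D).dualQuotEquivDualAnnihilator.finrank_eq
  rw [Subspace.dual_finrank_eq] at h1
  rw [← (finrank_adl (Q := Q) D).2, h1]
  rfl

lemma Om_anti {D D' : Divisor F₂ K} (h : D ≤ D') : Om Q D' ≤ Om Q D := by
  intro ω hω
  rw [mem_Om] at *
  constructor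
  · intro f hf
    apply hω.1 f
    rw [mem_away] at *
    exact fun P hP => lev_mono P (neg_le_neg (h P)) (hf P hP)
  · intro f hf
    exact hω.2 f (lev_mono Q (neg_le_neg (h Q)) hf)

/-- The action of the function field on functionals. -/
def act (f : K) (ω : Module.Dual F₂ K) : Module.Dual F₂ K := ω ∘ₗ LinearMap.mulLeft F₂ f

omit [GenusFour K] in
lemma act_apply (f : K) (ω : Module.Dual F₂ K) (g : K) : act f ω g = ω (f * g) := rfl

lemma act_mem {D E : Divisor F₂ K} {f : K} {ω : Module.Dual F₂ K} (hf : f ∈ RRspace F₂ E)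
    (hω : ω ∈ Om Q D) : act f ω ∈ Om Q (D - E) := by
  rw [mem_Om] at *
  rw [mem_RR] at hf
  have h2 : ∀ P, -E P + -(D - E : Divisor F₂ K) P = -D P := by
    intro P; rw [Finsupp.sub_apply]; ring
  constructor
  · intro g hg
    rw [act_apply]
    apply hω.1
    rw [mem_away] at *
    intro P hP
    have := mul_mem_lev (hf P) (hg P hP)
    rwa [h2] at this
  · intro g hg
    rw [act_apply]
    apply hω.2
    have := mul_mem_lev (hf Q) hg
    rwa [h2] at this

lemma Om_inf {D D' : Divisor F₂ K} {ω : Module.Dual F₂ K} (P : Place F₂ K)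
    (hω : ω ∈ Om Q D) (hω' : ω ∈ Om Q D') (h : D' P = D P + 1) (hle : ∀ R, R ≠ P → D' R ≤ D R) :
    ω ∈ Om Q (D + Finsupp.single P 1) := by
  rw [mem_Om] at hω hω' ⊢
  by_cases hPQ : P = Q
  · subst hPQ
    constructor
    · intro f hf
      apply hω.1
      rwa [away_congr (D' := D)] at hf
      intro R hR; exact add_single_apply_ne hR _
    · intro f hf
      apply hω'.2
      rwa [add_single_apply_self, ← h] at hf
  · have hQP : Q ≠ P := Ne.symm hPQ
    constructor
    · intro f hf
      obtain ⟨n, hn⟩ := exists_spec_add_zero (D' - Finsupp.single P 1) Q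
      set E := D' - Finsupp.single P 1 + Finsupp.single Q (n : ℤ) with hE
      have hEP : E P = D P := by
        rw [hE, add_single_apply_ne hPQ, Finsupp.sub_apply, Finsupp.single_eq_same, h]; ring
      have hEP' : ∀ R, R ≠ P → R ≠ Q → E R = D' R := by
        intro R hR hRQ
        rw [hE, add_single_apply_ne hRQ, Finsupp.sub_apply, Finsupp.single_apply, if_neg (Ne.symm hR),
          sub_zero]
      rw [mem_away] at hf
      obtain ⟨l, hl, hfl⟩ := RR_surj_of_spec (P := P) hn f (by
        have := hf P hPQ
        rw [add_single_apply_self] at this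
        rw [hEP]
        have e : -D P - 1 = -(D P + 1) := by ring
        rwa [e])
      rw [mem_RR] at hl
      have h1 : ω l = 0 := by
        apply hω'.1
        rw [mem_away]
        intro R hR
        have h3 := hl R
        by_cases hRP : R = P
        · subst hRP; rwa [add_single_apply_self, hEP, ← h] at h3
        · rwa [add_single_apply_ne hRP, hEP' R hRP hR] at h3
      have h2 : ω (f - l) = 0 := by
        apply hω.1
        rw [mem_away]
        intro R hR
        by_cases hRP : R = P
        · subst hRP; rwa [hEP] at hfl
        · apply Submodule.sub_mem
          · have := hf R hR
            rwa [add_single_apply_ne hRP] at this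
          · have h3 := hl R
            rw [add_single_apply_ne hRP, hEP' R hRP hR] at h3
            exact lev_mono R (neg_le_neg (hle R hRP)) h3
      rw [map_sub, h1, sub_zero] at h2
      exact h2
    · intro f hf
      apply hω.2
      rwa [add_single_apply_ne hQP] at hf

omit [GenusFour K] in
lemma act_ne_zero {f : K} (hf : f ≠ 0) {ω : Module.Dual F₂ K} (h : act f ω = 0) : ω = 0 := by
  ext g
  have := congrArg (fun η => η (f⁻¹ * g)) h
  simp only [act_apply, mul_inv_cancel_left₀ hf] at this
  exact this

lemma exists_act {D D' : Divisor F₂ K} {ω ω' : Module.Dual F₂ K} (hω : ω ∈ Om Q D)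
    (hω' : ω' ∈ Om Q D') (h0 : ω ≠ 0) : ∃ f : K, ω' = act f ω := by
  by_contra hcon
  push Not at hcon
  obtain ⟨B, hB1, hB2⟩ : ∃ B : Divisor F₂ K, B ≤ D ∧ B ≤ D' := ⟨D ⊓ D', inf_le_left, inf_le_right⟩
  replace hω := Om_anti hB1 hω
  replace hω' := Om_anti hB2 hω'
  have key : ∀ n : ℕ, 2 * ((n : ℤ) * placeDegree F₂ Q - 3) ≤ spec (B - Finsupp.single Q (n : ℤ)) := by
    intro n
    set M : Divisor F₂ K := Finsupp.single Q (n : ℤ) with hM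
    let φ : (RRspace F₂ M × RRspace F₂ M) →+ Om Q (B - M) :=
      { toFun := fun p => ⟨act (p.1 : K) ω + act (p.2 : K) ω',
          Submodule.add_mem _ (act_mem p.1.2 hω) (act_mem p.2.2 hω')⟩
        map_zero' := by
          apply Subtype.ext; ext g; simp [act_apply]
        map_add' := by
          intro a b
          apply Subtype.ext; ext g
          simp [act_apply, add_mul]; ring }
    have hφ : Function.Injective φ := by
      rw [injective_iff_map_eq_zero]
      rintro ⟨a, b⟩ hab
      have h1 : act (a : K) ω + act (b : K) ω' = 0 := congrArg Subtype.val hab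
      have hb : (b : K) = 0 := by
        by_contra hb
        apply hcon (-((b : K)⁻¹ * a))
        ext g
        have := congrArg (fun η => η ((b : K)⁻¹ * g)) h1
        simp only [LinearMap.add_apply, act_apply, mul_inv_cancel_left₀ hb, LinearMap.zero_apply] at this
        rw [act_apply, neg_mul, map_neg]
        rw [show (b : K)⁻¹ * a * g = a * ((b : K)⁻¹ * g) by ring]
        linear_combination this
      have ha : (a : K) = 0 := by
        by_contra ha
        apply h0
        apply act_ne_zero ha
        rw [hb] at h1
        ext g
        have := congrArg (fun η => η g) h1
        simpa [act_apply] using this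
      exact Prod.ext (Subtype.ext ha) (Subtype.ext hb)
    have h2 := LinearMap.finrank_le_finrank_of_injective (f := φ.toZModLinearMap 2) hφ
    rw [Module.finrank_prod] at h2
    have h3 := finrank_Om (Q := Q) (B - M)
    have h4 := spec_nonneg M
    unfold spec at h4
    unfold ell at h4
    rw [hM, deg_single, ← hM] at h4
    omega
  have h1 := key ((10 + |deg B|).toNat)
  have hpos : (1 : ℤ) ≤ placeDegree F₂ Q := by exact_mod_cast placeDegree_pos Q
  have habs : 0 ≤ |deg B| := abs_nonneg _
  have habs2 := le_abs_self (deg B)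
  have habs3 := neg_abs_le (deg B)
  set n := (10 + |deg B|).toNat with hn
  have hn' : (n : ℤ) = 10 + |deg B| := by rw [hn, Int.toNat_of_nonneg]; omega
  have hnd : (n : ℤ) ≤ n * placeDegree F₂ Q := by nlinarith
  have h2 : deg (B - Finsupp.single Q (n : ℤ)) = deg B - n * placeDegree F₂ Q := by
    rw [map_sub, deg_single]
  have h3 := ell_neg (D := B - Finsupp.single Q (n : ℤ)) (by omega)
  unfold spec at h1
  rw [h2, h3] at h1
  push_cast at h1
  omega

/-- Riemann–Roch: existence of a canonical divisor. -/
theorem exists_canonical : ∃ W : Divisor F₂ K, ∀ D, spec D = ell F₂ (W - D) := by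
  obtain ⟨Q⟩ := exists_place (K := K)
  obtain ⟨N, hN⟩ := spec_zero_of_large (K := K)
  let p : ℤ → Prop := fun d => ∃ D : Divisor F₂ K, deg D = d ∧ 0 < spec D
  obtain ⟨m, ⟨W, rfl, hW⟩, hmax⟩ := Int.exists_greatest_of_bdd (P := p)
    ⟨N, by
      rintro z ⟨D, rfl, hD⟩
      by_contra hlt
      have := hN D (by omega)
      omega⟩
    ⟨_, 0, rfl, by unfold spec; rw [ell_zero, map_zero]; norm_num⟩
  have hne : ∃ ω ∈ Om Q W, ω ≠ 0 := by
    have : 0 < Module.finrank F₂ (Om Q W) := by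
      have := finrank_Om (Q := Q) W; omega
    have : Nontrivial (Om Q W) := Module.finrank_pos_iff.1 this
    obtain ⟨x, hx⟩ := exists_ne (0 : Om Q W)
    exact ⟨x, x.2, fun h => hx (Subtype.ext h)⟩
  obtain ⟨ω, hω, hω0⟩ := hne
  have hle : ∀ D, ω ∈ Om Q D → D ≤ W := by
    intro D hD P
    by_contra hlt
    push Not at hlt
    let D' : Divisor F₂ K := D ⊓ (W + Finsupp.single P 1)
    have hD' : ω ∈ Om Q D' := Om_anti inf_le_left hD
    have h1 : ω ∈ Om Q (W + Finsupp.single P 1) := by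
      apply Om_inf P hω hD'
      · change D P ⊓ (W + Finsupp.single P 1 : Divisor F₂ K) P = _
        rw [add_single_apply_self, inf_eq_right]; omega
      · intro R hR
        change D R ⊓ (W + Finsupp.single P 1 : Divisor F₂ K) R ≤ _
        rw [add_single_apply_ne hR]; exact inf_le_right
    have h2 : 0 < spec (W + Finsupp.single P 1) := by
      rw [← finrank_Om (Q := Q)]
      have : Nontrivial (Om Q (W + Finsupp.single P 1)) :=
        ⟨⟨ω, h1⟩, 0, fun h => hω0 (congrArg Subtype.val h)⟩
      exact_mod_cast Module.finrank_pos
    have h3 := hmax _ ⟨_, rfl, h2⟩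
    rw [map_add, deg_single] at h3
    have := placeDegree_pos P
    omega
  refine ⟨W, fun D => ?_⟩
  rw [← finrank_Om (Q := Q)]
  let φ : RRspace F₂ (W - D) →+ Om Q D :=
    { toFun := fun a => ⟨act (a : K) ω, by
        have := act_mem a.2 hω
        rwa [sub_sub_cancel] at this⟩
      map_zero' := by apply Subtype.ext; ext g; simp [act_apply]
      map_add' := by
        intro a b; apply Subtype.ext; ext g; simp [act_apply, add_mul] }
  have hinj : Function.Injective φ := by
    rw [injective_iff_map_eq_zero]
    intro a ha
    by_contra hne
    apply hω0
    exact act_ne_zero (f := (a : K)) (fun h => hne (Subtype.ext h)) (congrArg Subtype.val ha)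
  have hsurj : Function.Surjective φ := by
    rintro ⟨ω', hω'⟩
    obtain ⟨f, rfl⟩ := exists_act hω hω' hω0
    by_cases hf : f = 0
    · exact ⟨0, by apply Subtype.ext; ext g; simp [φ, hf, act_apply]⟩
    have h1 : f⁻¹ ∈ RRspace F₂ (div f) := by
      rw [mem_RR_iff (inv_ne_zero hf), div_inv hf, neg_add_cancel]
    have h2 := act_mem h1 hω'
    have h3 : act f⁻¹ (act f ω) = ω := by
      ext g; rw [act_apply, act_apply, mul_inv_cancel_left₀ hf]
    rw [h3] at h2
    have h4 := hle _ h2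
    refine ⟨⟨f, ?_⟩, rfl⟩
    rw [mem_RR_iff hf]
    rw [sub_le_iff_le_add] at h4
    have : div f + (W - D) = (W + div f) - D := by abel
    rw [this, sub_nonneg]; exact h4
  have e := LinearEquiv.ofBijective (φ.toZModLinearMap 2) ⟨hinj, hsurj⟩
  unfold ell
  exact_mod_cast e.finrank_eq.symm

end Duality

section Generator

variable {K : Type} [Field K] [Algebra (ZMod 2) K]

/-- Linear independence over the polynomials in `T`. -/
def PolyIndep (T : K) {ι : Type} [Fintype ι] (f : ι → K) : Prop :=
  ∀ p : ι → Polynomial F₂, ∑ i, Polynomial.aeval T (p i) * f i = 0 → p = 0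

/-- `T` generates a rational subfield of degree five. -/
structure DegFive (T : K) : Prop where
  sep : IsSep T
  up : ∀ (ι : Type) [Fintype ι] (f : ι → K), PolyIndep T f → Fintype.card ι ≤ 5
  down : ∃ f : Fin 5 → K, PolyIndep T f ∧ ∀ i, ∀ P : Place F₂ K, T ∈ P.1 → f i ∈ P.1

variable [Algebra (RatFunc (ZMod 2)) K] [IsScalarTower (ZMod 2) (RatFunc (ZMod 2)) K]

lemma aeval_X_ratFunc (p : Polynomial F₂) :
    Polynomial.aeval (algebraMap (RatFunc F₂) K RatFunc.X) p =
      algebraMap (RatFunc F₂) K (algebraMap (Polynomial F₂) (RatFunc F₂) p) := by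
  rw [Polynomial.aeval_algebraMap_apply]
  congr 1
  have h : (algebraMap (Polynomial F₂) (RatFunc F₂)) Polynomial.X = RatFunc.X := RatFunc.algebraMap_X
  rw [← h, Polynomial.aeval_algebraMap_apply, Polynomial.aeval_X_left_apply]

lemma transcendental_T : Transcendental F₂ (algebraMap (RatFunc F₂) K RatFunc.X) := by
  rw [transcendental_iff]
  intro p hp
  rw [aeval_X_ratFunc, map_eq_zero_iff _ (algebraMap (RatFunc F₂) K).injective,
    map_eq_zero_iff _ (IsFractionRing.injective (Polynomial F₂) (RatFunc F₂))] at hp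
  exact hp

lemma isSep_T (hdeg : Module.finrank (RatFunc (ZMod 2)) K = 5) :
    IsSep (algebraMap (RatFunc F₂) K RatFunc.X) := by
  have hfin : FiniteDimensional (RatFunc F₂) K := Module.finite_of_finrank_pos (by omega)
  have hsep : Algebra.IsSeparable (RatFunc F₂) K := by
    have h2 : ExpChar (RatFunc F₂) 2 := by
      have : CharP (RatFunc F₂) 2 := inferInstance
      exact ExpChar.prime Nat.prime_two
    obtain ⟨n, hn⟩ := finInsepDegree_eq_pow (F := RatFunc F₂) (E := K) 2
    have h3 := Field.finSepDegree_mul_finInsepDegree (RatFunc F₂) K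
    rw [hdeg, hn] at h3
    have h4 : n = 0 := by
      by_contra hn0
      obtain ⟨m, rfl⟩ := Nat.exists_eq_succ_of_ne_zero hn0
      have h5 : 2 ∣ 5 := ⟨_, h3.symm.trans (by rw [pow_succ, ← mul_assoc, mul_comm])⟩
      omega
    rw [h4, pow_zero, mul_one] at h3
    exact (Field.finSepDegree_eq_finrank_iff (RatFunc F₂) K).1 (by rw [h3, hdeg])
  set T := algebraMap (RatFunc F₂) K RatFunc.X with hT
  let E := IntermediateField.adjoin F₂ {T}
  have hmem : ∀ x : RatFunc F₂, algebraMap (RatFunc F₂) K x ∈ E := by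
    have hp : ∀ p : Polynomial F₂,
        algebraMap (RatFunc F₂) K (algebraMap (Polynomial F₂) (RatFunc F₂) p) ∈ E := by
      intro p
      rw [← aeval_X_ratFunc]
      rw [Polynomial.aeval_eq_sum_range]
      exact sum_mem fun j _ => E.smul_mem (pow_mem (IntermediateField.mem_adjoin_simple_self F₂ T) j)
    intro x
    obtain ⟨a, b, -, rfl⟩ := IsFractionRing.div_surjective (A := Polynomial F₂) x
    rw [map_div₀]
    exact div_mem (hp a) (hp b)
  let : Algebra (RatFunc F₂) E := ((algebraMap (RatFunc F₂) K).codRestrict E.toSubfield hmem).toAlgebra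
  have hst : IsScalarTower (RatFunc F₂) E K := IsScalarTower.of_algebraMap_eq (fun x => rfl)
  refine ⟨transcendental_T, FiniteDimensional.right (RatFunc F₂) E K, ?_⟩
  exact Algebra.isSeparable_tower_top_of_isSeparable (RatFunc F₂) E K

lemma polyIndep_iff {ι : Type} [Fintype ι] {f : ι → K} :
    PolyIndep (algebraMap (RatFunc F₂) K RatFunc.X) f ↔ LinearIndependent (RatFunc F₂) f := by
  let : Algebra (Polynomial F₂) K :=
    (Polynomial.aeval (algebraMap (RatFunc F₂) K RatFunc.X) : Polynomial F₂ →ₐ[F₂] K).toAlgebra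
  have hst : IsScalarTower (Polynomial F₂) (RatFunc F₂) K :=
    IsScalarTower.of_algebraMap_eq (fun p => aeval_X_ratFunc p)
  rw [← LinearIndependent.iff_fractionRing (R := Polynomial F₂) (K := RatFunc F₂), Fintype.linearIndependent_iff]
  refine ⟨fun h g hg i => ?_, fun h p hp => funext fun i => h p ?_ i⟩
  · rw [h g]
    · rfl
    · rw [← hg]; rfl
  · rw [← hp]; rfl

lemma degFive_T (hdeg : Module.finrank (RatFunc (ZMod 2)) K = 5) :
    DegFive (algebraMap (RatFunc F₂) K RatFunc.X) := by
  have hfin : FiniteDimensional (RatFunc F₂) K := Module.finite_of_finrank_pos (by omega)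
  set T := algebraMap (RatFunc F₂) K RatFunc.X with hT
  let : Algebra (Polynomial F₂) K := (Polynomial.aeval T : Polynomial F₂ →ₐ[F₂] K).toAlgebra
  have hst : IsScalarTower (Polynomial F₂) (RatFunc F₂) K :=
    IsScalarTower.of_algebraMap_eq (fun p => aeval_X_ratFunc p)
  refine ⟨isSep_T hdeg, ?_, ?_⟩
  · intro ι _ f hf
    rw [polyIndep_iff] at hf
    have := hf.fintype_card_le_finrank
    omega
  · obtain ⟨s, b, hb⟩ := FiniteDimensional.exists_is_basis_integral (Polynomial F₂) (RatFunc F₂) K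
    have hc : Fintype.card s = 5 := by rw [← Module.finrank_eq_card_basis b, hdeg]
    let e : Fin 5 ≃ s := (finCongr hc.symm).trans (Fintype.equivFin s).symm
    refine ⟨fun i => b (e i), ?_, ?_⟩
    · rw [hT, polyIndep_iff]
      exact b.linearIndependent.comp e e.injective
    · intro i P hP
      have hAO : ∀ a : Polynomial F₂, Polynomial.aeval T a ∈ P.1 := by
        intro a
        rw [Polynomial.aeval_eq_sum_range]
        refine sum_mem fun j _ => ?_
        rw [Algebra.smul_def]
        exact P.1.mul_mem _ _ (algebraMap_mem P.1 _) (pow_mem hP j)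
      obtain ⟨p, hp, hpb⟩ := hb (e i)
      have : IsIntegral P.1 (b (e i)) := by
        let j : Polynomial F₂ →+* P.1 := (Polynomial.aeval T : Polynomial F₂ →ₐ[F₂] K).toRingHom.codRestrict P.1.toSubring hAO
        refine ⟨p.map j, hp.map j, ?_⟩
        rw [Polynomial.eval₂_map]
        exact hpb
      obtain ⟨y, hy⟩ := (IsIntegrallyClosed.isIntegral_iff (R := P.1) (K := K)).1 this
      change b (e i) ∈ P.1
      rw [← hy]; exact y.2

end Generator

section PoleDivisor

variable {K : Type} [Field K] [Algebra (ZMod 2) K] [GenusFour K]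

/-- The divisor of poles of `x`. -/
def poleDiv (x : K) : Divisor F₂ K := (div x).mapRange (fun n => max 0 (-n)) (by simp)

lemma poleDiv_apply (x : K) (P : Place F₂ K) : poleDiv x P = max 0 (-(div x P)) :=
  Finsupp.mapRange_apply ..

lemma poleDiv_nonneg (x : K) : 0 ≤ poleDiv x := fun P => by
  rw [poleDiv_apply]; exact le_max_left _ _

lemma mem_RR_poleDiv (x : K) : x ∈ RRspace F₂ (poleDiv x) := by
  rcases eq_or_ne x 0 with rfl | hx
  · exact zero_mem _
  rw [mem_RR_iff hx]
  intro P
  change 0 ≤ div x P + poleDiv x P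
  rw [poleDiv_apply]
  have := le_max_right 0 (-(div x P))
  omega

lemma poleDiv_le {x : K} (hx : x ≠ 0) {D : Divisor F₂ K} (hD : 0 ≤ D) (h : x ∈ RRspace F₂ D) :
    poleDiv x ≤ D := by
  rw [mem_RR_iff hx] at h
  intro P
  have h1 : 0 ≤ div x P + D P := h P
  have h2 : 0 ≤ D P := hD P
  rw [poleDiv_apply]
  exact max_le h2 (by omega)

lemma poleDiv_eq_zero_iff {x : K} {P : Place F₂ K} : poleDiv x P = 0 ↔ x ∈ P.1 := by
  rcases eq_or_ne x 0 with rfl | hx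
  · rw [poleDiv_apply]
    unfold div
    simp [zero_mem]
  · rw [poleDiv_apply, div_apply hx, mem_iff_ordAt hx]
    omega

lemma pow_mem_RR {D : Divisor F₂ K} {f : K} (hf : f ∈ RRspace F₂ D) (j : ℕ) :
    f ^ j ∈ RRspace F₂ ((j : ℤ) • D) := by
  induction j with
  | zero => simpa using one_mem_RR (le_refl 0)
  | succ j ih =>
    rw [pow_succ, Nat.cast_succ, add_smul, one_smul]
    exact mul_mem_RR ih hf

omit [GenusFour K] in
lemma smul_le_smul_div {D : Divisor F₂ K} (hD : 0 ≤ D) {m n : ℤ} (h : m ≤ n) : m • D ≤ n • D := by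
  intro P
  change m * D P ≤ n * D P
  exact mul_le_mul_of_nonneg_right h (hD P)

omit [GenusFour K] in
lemma deg_smul (n : ℤ) (D : Divisor F₂ K) : deg (n • D) = n * deg D := by
  rw [map_zsmul, smul_eq_mul]

lemma aeval_mem_RR {D : Divisor F₂ K} (hD : 0 ≤ D) {x : K} (hx : x ∈ RRspace F₂ D) {d : ℕ}
    {q : Polynomial F₂} (hq : q.degree < d) :
    Polynomial.aeval x q ∈ RRspace F₂ (((d : ℤ) - 1) • D) := by
  rw [Polynomial.aeval_def, Polynomial.eval₂_eq_sum, Polynomial.sum]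
  refine sum_mem fun j hj => ?_
  rw [← Algebra.smul_def]
  refine Submodule.smul_mem _ _ (RR_mono (smul_le_smul_div hD ?_) (pow_mem_RR hx j))
  have := Polynomial.le_degree_of_mem_supp _ hj
  have h2 : (j : WithBot ℕ) < d := lt_of_le_of_lt this hq
  have h3 : j < d := by exact_mod_cast h2
  omega

lemma mem_RR_of_pow_mul {x g : K} {d : ℕ} {n : ℤ}
    (hg : g ∈ RRspace F₂ ((n + 1) • poleDiv x))
    (h : x ^ d * g ∈ RRspace F₂ ((d + n) • poleDiv x)) : g ∈ RRspace F₂ (n • poleDiv x) := by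
  rw [mem_RR] at *
  intro P
  have h1 := hg P
  have h2 := h P
  change g ∈ lev P (-(n * poleDiv x P))
  change g ∈ lev P (-((n + 1) * poleDiv x P)) at h1
  change x ^ d * g ∈ lev P (-((d + n) * poleDiv x P)) at h2
  by_cases h0 : poleDiv x P = 0
  · rw [h0] at h1 ⊢; simpa using h1
  rcases eq_or_ne x 0 with rfl | hx
  · exact absurd (poleDiv_eq_zero_iff.2 (zero_mem P.1)) h0
  rcases eq_or_ne g 0 with rfl | hg0
  · exact zero_mem _
  have h3 : poleDiv x P = - ordAt P.1 x := by
    have := div_apply hx P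
    have := poleDiv_apply x P
    omega
  rw [mem_lev_iff hg0]
  rw [mem_lev_iff (mul_ne_zero (pow_ne_zero _ hx) hg0), ordAt_mul (pow_ne_zero _ hx) hg0,
    ordAt_pow hx] at h2
  rw [h3] at h2 ⊢
  linarith

omit [GenusFour K] in
lemma exists_lift {U V : Submodule F₂ K} [FiniteDimensional F₂ U] (h : V ≤ U) :
    ∃ b : Fin (Module.finrank F₂ U - Module.finrank F₂ V) → K, (∀ i, b i ∈ U) ∧
      ∀ c : Fin (Module.finrank F₂ U - Module.finrank F₂ V) → F₂, ∑ i, c i • b i ∈ V → c = 0 := by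
  have h1 : Module.finrank F₂ (U ⧸ V.submoduleOf U) =
      Module.finrank F₂ U - Module.finrank F₂ V := by
    have h2 := Submodule.finrank_quotient_add_finrank (V.submoduleOf U)
    rw [(Submodule.submoduleOfEquivOfLe h).finrank_eq] at h2
    omega
  let q := Module.finBasisOfFinrankEq F₂ (U ⧸ V.submoduleOf U) h1
  choose b hb using fun i => (V.submoduleOf U).mkQ_surjective (q i)
  refine ⟨fun i => b i, fun i => (b i).2, fun c hc => ?_⟩
  have h3 : ∑ i, c i • b i ∈ V.submoduleOf U := by
    rw [Submodule.submoduleOf, Submodule.mem_comap]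
    simpa using hc
  rw [← Submodule.Quotient.mk_eq_zero] at h3
  have h4 : ∑ i, c i • q i = 0 := by
    rw [← h3]
    simp only [← Submodule.mkQ_apply, map_sum, map_smul, hb]
  exact funext (Fintype.linearIndependent_iff.1 q.linearIndependent c h4)

lemma polyIndep_of_lead {x : K} {n : ℤ} {r : ℕ} {b : Fin r → K}
    (hb : ∀ i, b i ∈ RRspace F₂ ((n + 1) • poleDiv x))
    (hc : ∀ c : Fin r → F₂, ∑ i, c i • b i ∈ RRspace F₂ (n • poleDiv x) → c = 0) :
    PolyIndep x b := by
  have key : ∀ d : ℕ, ∀ p : Fin r → Polynomial F₂, (∀ i, (p i).degree < d) →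
      ∑ i, Polynomial.aeval x (p i) * b i = 0 → p = 0 := by
    intro d
    induction d with
    | zero =>
      intro p hp _
      funext i
      ext m
      exact (Polynomial.degree_lt_iff_coeff_zero _ _).1 (hp i) m (Nat.zero_le m)
    | succ d ih =>
      intro p hp h0
      let c : Fin r → F₂ := fun i => (p i).coeff d
      let q : Fin r → Polynomial F₂ := fun i => p i - Polynomial.monomial d (c i)
      have hq : ∀ i, (q i).degree < d := by
        intro i
        rw [Polynomial.degree_lt_iff_coeff_zero]
        intro m hm
        rw [Polynomial.coeff_sub, Polynomial.coeff_monomial]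
        split_ifs with hdm
        · rw [← hdm]; exact sub_self _
        · rw [sub_zero]
          exact (Polynomial.degree_lt_iff_coeff_zero _ _).1 (hp i) m (by omega)
      have hpq : ∀ i, Polynomial.aeval x (p i) * b i =
          Polynomial.aeval x (q i) * b i + x ^ d * (c i • b i) := by
        intro i
        simp only [q, map_sub, Polynomial.aeval_monomial, Algebra.smul_def]
        ring
      have hsum : x ^ d * ∑ i, c i • b i = -∑ i, Polynomial.aeval x (q i) * b i := by
        rw [Finset.sum_congr rfl fun i _ => hpq i, Finset.sum_add_distrib, ← Finset.mul_sum] at h0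
        exact eq_neg_of_add_eq_zero_right h0
      have hc0 : c = 0 := by
        refine hc c (mem_RR_of_pow_mul (d := d) (sum_mem fun i _ => Submodule.smul_mem _ _ (hb i)) ?_)
        rw [hsum]
        refine neg_mem (sum_mem fun i _ => ?_)
        have := mul_mem_RR (aeval_mem_RR (poleDiv_nonneg x) (mem_RR_poleDiv x) (hq i)) (hb i)
        rw [← add_smul] at this
        convert this using 2
        ring_nf
      have hpq' : p = q := by
        funext i
        have : c i = 0 := congrFun hc0 i
        simp only [q, this, map_zero, sub_zero]
      rw [hpq'] at h0 ⊢
      exact ih q hq h0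
  intro p hp
  refine key (Finset.univ.sup (fun i => (p i).natDegree) + 1) p (fun i => ?_) hp
  refine lt_of_le_of_lt Polynomial.degree_le_natDegree ?_
  exact_mod_cast Nat.lt_succ_of_le (Finset.le_sup (f := fun i => (p i).natDegree) (Finset.mem_univ i))

lemma ell_le_deg {D : Divisor F₂ K} (hD : 0 ≤ D) : (ell F₂ D : ℤ) ≤ deg D + 1 := by
  have h := spec_anti hD
  have h0 : spec (0 : Divisor F₂ K) = 4 := by
    unfold spec
    rw [ell_zero, map_zero]; norm_num
  rw [h0] at h
  unfold spec at h
  omega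

lemma deg_poleDiv_le {x : K} (hx : DegFive x) : deg (poleDiv x) ≤ 5 := by
  have hm := deg_nonneg (poleDiv_nonneg x)
  obtain ⟨N, hN⟩ := spec_zero_of_large (K := K)
  by_contra hlt
  push Not at hlt
  have hn : N ≤ deg ((N.toNat : ℤ) • poleDiv x) := by
    rw [deg_smul]
    have := Int.self_le_toNat N
    nlinarith
  have hn' : N ≤ deg (((N.toNat : ℤ) + 1) • poleDiv x) := by
    rw [deg_smul] at hn ⊢
    linarith
  have h1 := hN _ hn
  have h2 := hN _ hn'
  rw [spec, deg_smul] at h1 h2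
  obtain ⟨b, hb, hc⟩ := exists_lift (U := RRspace F₂ (((N.toNat : ℤ) + 1) • poleDiv x))
    (V := RRspace F₂ ((N.toNat : ℤ) • poleDiv x))
    (RR_mono (smul_le_smul_div (poleDiv_nonneg x) (by omega)))
  have h3 := hx.up _ b (polyIndep_of_lead hb hc)
  rw [Fintype.card_fin] at h3
  change ell F₂ _ - ell F₂ _ ≤ 5 at h3
  have h4 : (ell F₂ (((N.toNat : ℤ) + 1) • poleDiv x) : ℤ) - ell F₂ ((N.toNat : ℤ) • poleDiv x) =
    deg (poleDiv x) := by linarith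
  omega

lemma exists_mem_smul {x f : K} (h : ∀ P : Place F₂ K, x ∈ P.1 → f ∈ P.1) :
    ∃ c : ℕ, f ∈ RRspace F₂ ((c : ℤ) • poleDiv x) := by
  let c : ℤ := (poleDiv f).sum fun _ v => v
  have hc0 : 0 ≤ c := Finset.sum_nonneg fun P _ => poleDiv_nonneg f P
  obtain ⟨n, hn⟩ := Int.eq_ofNat_of_zero_le hc0
  refine ⟨n, RR_mono ?_ (mem_RR_poleDiv f)⟩
  intro P
  change poleDiv f P ≤ n * poleDiv x P
  by_cases h0 : poleDiv x P = 0
  · have := poleDiv_eq_zero_iff.2 (h P (poleDiv_eq_zero_iff.1 h0))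
    rw [this, h0, mul_zero]
  · have h1 : 0 ≤ poleDiv x P := poleDiv_nonneg x P
    by_cases h2 : poleDiv f P = 0
    · rw [h2]; positivity
    have h3 : poleDiv f P ≤ c :=
      Finset.single_le_sum (f := fun P => poleDiv f P) (fun Q _ => poleDiv_nonneg f Q)
        (Finsupp.mem_support_iff.2 h2)
    rw [hn] at h3
    have h4 : 1 ≤ poleDiv x P := by omega
    have h5 : (0 : ℤ) ≤ n := by positivity
    calc poleDiv f P ≤ n := h3
      _ ≤ n * poleDiv x P := by nlinarith

lemma le_deg_poleDiv {x : K} (hx : DegFive x) : 5 ≤ deg (poleDiv x) := by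
  obtain ⟨f, hf, hfx⟩ := hx.down
  choose c hc using fun i => exists_mem_smul (hfx i)
  let C : ℕ := ∑ i, c i
  have hC : ∀ i, c i ≤ C := fun i => Finset.single_le_sum (fun _ _ => Nat.zero_le _) (Finset.mem_univ i)
  by_contra hlt
  push Not at hlt
  have hm := deg_nonneg (poleDiv_nonneg x)
  have key : ∀ n : ℕ, 5 * (n + 1) ≤ ell F₂ (((n + C : ℕ) : ℤ) • poleDiv x) := by
    intro n
    have hmem : ∀ ij : Fin 5 × Fin (n + 1),
        x ^ (ij.2 : ℕ) * f ij.1 ∈ RRspace F₂ (((n + C : ℕ) : ℤ) • poleDiv x) := by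
      intro ij
      have := mul_mem_RR (pow_mem_RR (mem_RR_poleDiv x) (ij.2 : ℕ)) (hc ij.1)
      rw [← add_smul] at this
      refine RR_mono (smul_le_smul_div (poleDiv_nonneg x) ?_) this
      have := hC ij.1
      have := ij.2.2
      omega
    have hli : LinearIndependent F₂ fun ij : Fin 5 × Fin (n + 1) =>
        (⟨_, hmem ij⟩ : RRspace F₂ (((n + C : ℕ) : ℤ) • poleDiv x)) := by
      rw [Fintype.linearIndependent_iff]
      intro a ha ij
      have h1 := hf (fun i => ∑ j : Fin (n + 1), Polynomial.monomial (j : ℕ) (a (i, j))) (by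
        have h2 := congrArg Subtype.val ha
        rw [Fintype.sum_prod_type] at h2
        simp only [AddSubmonoidClass.coe_finsetSum, SetLike.val_smul, ZeroMemClass.coe_zero] at h2
        rw [← h2]
        refine Finset.sum_congr rfl fun i _ => ?_
        rw [map_sum, Finset.sum_mul]
        refine Finset.sum_congr rfl fun j _ => ?_
        rw [Polynomial.aeval_monomial, Algebra.smul_def, mul_assoc])
      have h3 := congrArg (fun p => Polynomial.coeff p (ij.2 : ℕ)) (congrFun h1 ij.1)
      simp only [Polynomial.finsetSum_coeff, Polynomial.coeff_monomial, Pi.zero_apply,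
        Polynomial.coeff_zero, Fin.val_inj] at h3
      simpa using h3
    have := hli.fintype_card_le_finrank
    simpa [ell] using this
  have h1 := key (4 * C + 10)
  have h2 := ell_le_deg (D := ((4 * C + 10 + C : ℕ) : ℤ) • poleDiv x) (by
    intro P
    exact mul_nonneg (by positivity) (poleDiv_nonneg x P))
  rw [deg_smul] at h2
  have h3 : ((4 * C + 10 + C : ℕ) : ℤ) * deg (poleDiv x) ≤ ((4 * C + 10 + C : ℕ) : ℤ) * 4 :=
    mul_le_mul_of_nonneg_left (by omega) (by positivity)
  push_cast at *
  omega

lemma deg_poleDiv {x : K} (hx : DegFive x) : deg (poleDiv x) = 5 :=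
  le_antisymm (deg_poleDiv_le hx) (le_deg_poleDiv hx)

end PoleDivisor

section Sequence

/-- Function fields as in `GenusFour` having a rational subfield of degree five. -/
class GenusFourFive (K : Type) [Field K] [Algebra (ZMod 2) K] : Prop extends GenusFour K where
  gener : ∃ T : K, DegFive T

/-- The dimension of the Riemann-Roch spaces of divisors of degree `n`. -/
def lseq (K : Type) [Field K] [Algebra (ZMod 2) K] (n : ℤ) : ℕ :=
  if h : ∃ D : Divisor F₂ K, deg D = n then ell F₂ h.choose else 0

variable {K : Type} [Field K] [Algebra (ZMod 2) K]

lemma ell_eq_lseq [GenusFour K] (D : Divisor F₂ K) : ell F₂ D = lseq K (deg D) := by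
  have h : ∃ D' : Divisor F₂ K, deg D' = deg D := ⟨D, rfl⟩
  rw [lseq, dif_pos h]
  exact ell_eq_of_deg h.choose_spec.symm

variable [GenusFourFive K]

lemma exists_deg (n : ℤ) : ∃ D : Divisor F₂ K, deg D = n := by
  obtain ⟨T, hT⟩ := GenusFourFive.gener (K := K)
  obtain ⟨W, hW⟩ := exists_canonical (K := K)
  have h5 := deg_poleDiv hT
  have h6 : deg W = 6 := by
    have h1 := hW 0
    have h2 := hW W
    rw [sub_self] at h2
    rw [sub_zero] at h1
    rw [spec, ell_zero] at h1 h2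
    rw [map_zero] at h1
    omega
  refine ⟨n • (W - poleDiv T), ?_⟩
  rw [deg_smul, map_sub, h5, h6]
  ring

variable (K)

lemma lseq_symm (n : ℤ) : (lseq K n : ℤ) = n - 3 + lseq K (6 - n) := by
  obtain ⟨W, hW⟩ := exists_canonical (K := K)
  have h6 : deg W = 6 := by
    have h1 := hW 0
    have h2 := hW W
    rw [sub_self] at h2
    rw [sub_zero] at h1
    rw [spec, ell_zero] at h1 h2
    rw [map_zero] at h1
    omega
  obtain ⟨D, rfl⟩ := exists_deg (K := K) n
  have := hW D
  rw [spec, ell_eq_lseq, ell_eq_lseq, map_sub, h6] at this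
  linarith

lemma lseq_zero : lseq K 0 = 1 := by
  rw [← ell_zero (K := K), ell_eq_lseq, map_zero]

lemma lseq_neg {n : ℤ} (hn : n < 0) : lseq K n = 0 := by
  obtain ⟨D, rfl⟩ := exists_deg (K := K) n
  rw [← ell_eq_lseq]
  exact ell_neg hn

lemma lseq_six : lseq K 6 = 4 := by
  have h := lseq_symm K 6
  rw [sub_self, lseq_zero] at h
  omega

lemma lseq_large {n : ℤ} (hn : 7 ≤ n) : (lseq K n : ℤ) = n - 3 := by
  have h := lseq_symm K n
  rw [lseq_neg K (n := 6 - n) (by omega)] at h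
  omega

lemma lseq_four : lseq K 4 = 1 + lseq K 2 := by
  have h := lseq_symm K 4
  norm_num at h
  omega

lemma lseq_five : lseq K 5 = 2 + lseq K 1 := by
  have h := lseq_symm K 5
  norm_num at h
  omega

variable {K}

lemma exists_effective_deg {n : ℤ} (h : 0 < lseq K n) :
    ∃ D : Divisor F₂ K, 0 ≤ D ∧ deg D = n := by
  obtain ⟨D, rfl⟩ := exists_deg (K := K) n
  rw [← ell_eq_lseq] at h
  obtain ⟨f, hf, -, hD⟩ := exists_effective h
  refine ⟨_, hD, ?_⟩
  rw [map_add, deg_div hf, add_zero]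

lemma lseq_pos_of_effective {D : Divisor F₂ K} (hD : 0 ≤ D) : 0 < lseq K (deg D) := by
  rw [← ell_eq_lseq]
  have := ell_mono hD
  rw [ell_zero] at this
  omega

/-- Two distinct effective divisors of the same degree. -/
lemma two_le_lseq {D D' : Divisor F₂ K} (hD : 0 ≤ D) (hD' : 0 ≤ D') (hne : D ≠ D')
    (h : deg D = deg D') : 2 ≤ lseq K (deg D) := by
  obtain ⟨f, hf, hff⟩ := exists_equiv h
  have h1 : f ∈ RRspace F₂ D' := by
    rw [mem_RR_iff hf, add_comm, ← hff]; exact hD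
  rw [h, ← ell_eq_lseq]
  by_contra hlt
  have h2 : ell F₂ D' = 1 := by
    have := lseq_pos_of_effective hD'
    rw [← ell_eq_lseq] at this
    omega
  have h3 : RRspace F₂ (0 : Divisor F₂ K) = RRspace F₂ D' := by
    refine Submodule.eq_of_le_of_finrank_eq (RR_mono hD') ?_
    change ell F₂ _ = ell F₂ _
    rw [h2, ell_zero]
  rw [← h3, RR_zero, Submodule.mem_span_singleton] at h1
  obtain ⟨c, rfl⟩ := h1
  have hc : c = 1 := by
    have h4 : ∀ c : F₂, c = 0 ∨ c = 1 := by decide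
    rcases h4 c with rfl | rfl
    · exact absurd (zero_smul _ _) hf
    · rfl
  apply hne
  rw [hff, hc, one_smul]
  have : div (1 : K) = 0 := by
    have := div_mul (K := K) (f := 1) (g := 1) one_ne_zero one_ne_zero
    rw [mul_one] at this
    exact left_eq_add.1 this
  rw [this, add_zero]

omit [GenusFourFive K] in
lemma deg_place (P : Place F₂ K) : deg (Finsupp.single P 1) = placeDegree F₂ P := by
  rw [deg_single, one_mul]

omit [GenusFourFive K] in
lemma single_nonneg (P : Place F₂ K) : (0 : Divisor F₂ K) ≤ Finsupp.single P 1 := by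
  rw [Finsupp.single_nonneg]; exact zero_le_one

lemma lseq_pos_of_place (P : Place F₂ K) : 0 < lseq K (placeDegree F₂ P) := by
  rw [← deg_place]
  exact lseq_pos_of_effective (single_nonneg P)

lemma two_le_of_places {P Q : Place F₂ K} (h : P ≠ Q) (hd : placeDegree F₂ P = placeDegree F₂ Q) :
    2 ≤ lseq K (placeDegree F₂ P) := by
  rw [← deg_place]
  refine two_le_lseq (single_nonneg P) (single_nonneg Q) ?_ (by rw [deg_place, deg_place, hd])
  intro he
  exact h ((Finsupp.single_left_inj one_ne_zero).1 he)

end Sequence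

section Homs

variable {K : Type} [Field K] [Algebra (ZMod 2) K] [GenusFour K]

/-- The ring of functions regular outside the support of `D`. -/
def affineRing (D : Divisor F₂ K) : Subring K where
  carrier := {f | ∀ P : Place F₂ K, D P = 0 → f ∈ P.1}
  mul_mem' ha hb P hP := P.1.mul_mem _ _ (ha P hP) (hb P hP)
  one_mem' P _ := P.1.one_mem
  add_mem' ha hb P hP := P.1.add_mem _ _ (ha P hP) (hb P hP)
  zero_mem' P _ := P.1.zero_mem
  neg_mem' ha P hP := P.1.neg_mem _ (ha P hP)

omit [GenusFour K] in
lemma mem_affineRing {D : Divisor F₂ K} {f : K} :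
    f ∈ affineRing D ↔ ∀ P : Place F₂ K, D P = 0 → f ∈ P.1 := Iff.rfl

lemma mem_affineRing_of_RR {D : Divisor F₂ K} {n : ℤ} {f : K} (h : f ∈ RRspace F₂ (n • D)) :
    f ∈ affineRing D := by
  intro P hP
  have := mem_RR.1 h P
  change f ∈ lev P (-(n * D P)) at this
  rw [hP, mul_zero, neg_zero] at this
  exact mem_lev_zero.1 this

lemma affineRing_mem_RR {D : Divisor F₂ K} (hD : 0 ≤ D) {f : K} (h : f ∈ affineRing D) :
    ∃ n : ℕ, f ∈ RRspace F₂ ((n : ℤ) • D) := by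
  let c : ℤ := (poleDiv f).sum fun _ v => v
  have hc0 : 0 ≤ c := Finset.sum_nonneg fun P _ => poleDiv_nonneg f P
  obtain ⟨n, hn⟩ := Int.eq_ofNat_of_zero_le hc0
  refine ⟨n, RR_mono ?_ (mem_RR_poleDiv f)⟩
  intro P
  change poleDiv f P ≤ n * D P
  by_cases h0 : D P = 0
  · rw [poleDiv_eq_zero_iff.2 (h P h0), h0, mul_zero]
  · have h1 : 0 ≤ D P := hD P
    by_cases h2 : poleDiv f P = 0
    · rw [h2]; positivity
    have h3 : poleDiv f P ≤ c :=
      Finset.single_le_sum (f := fun P => poleDiv f P) (fun Q _ => poleDiv_nonneg f Q)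
        (Finsupp.mem_support_iff.2 h2)
    rw [hn] at h3
    have h4 : 1 ≤ D P := by omega
    have h5 : (0 : ℤ) ≤ n := by positivity
    calc poleDiv f P ≤ n := h3
      _ ≤ n * D P := by nlinarith

lemma deg_pos {D : Divisor F₂ K} (hD : 0 ≤ D) (hD0 : D ≠ 0) : 0 < deg D := by
  obtain ⟨P, hP⟩ := DFunLike.ne_iff.1 hD0
  have h1 : 0 ≤ D P := hD P
  have h2 : Finsupp.single P 1 ≤ D := by
    intro Q
    by_cases hQ : P = Q
    · subst hQ
      rw [Finsupp.single_eq_same]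
      have : D P ≠ 0 := hP
      omega
    · rw [Finsupp.single_eq_of_ne (Ne.symm hQ)]; exact hD Q
  have h3 := deg_mono h2
  rw [deg_single, one_mul] at h3
  have := placeDegree_pos P
  omega

/-- Approximation at one place by functions regular outside `D`. -/
lemma exists_affineRing_sub_mem {D : Divisor F₂ K} (hD : 0 ≤ D) (hD0 : D ≠ 0) {P : Place F₂ K}
    (hP : D P = 0) {f : K} (hf : f ∈ P.1) : ∃ b ∈ affineRing D, f - b ∈ lev P 1 := by
  obtain ⟨N, hN⟩ := spec_zero_of_large (K := K)
  have hdeg := deg_pos hD hD0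
  let n : ℤ := |N| + placeDegree F₂ P
  have h1 : spec (n • D - Finsupp.single P 1) = 0 := by
    apply hN
    rw [map_sub, deg_smul, deg_single, one_mul]
    have := le_abs_self N
    have : 0 ≤ n := by positivity
    nlinarith
  have h2 : (n • D - Finsupp.single P 1 : Divisor F₂ K) P = -1 := by
    change n * D P - Finsupp.single P (1 : ℤ) P = -1
    rw [hP, Finsupp.single_eq_same, mul_zero, zero_sub]
  obtain ⟨l, hl, hfl⟩ := RR_surj_of_spec h1 f (by
    rw [h2]; norm_num; exact mem_lev_zero.2 hf)
  rw [sub_add_cancel] at hl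
  rw [h2] at hfl
  exact ⟨l, mem_affineRing_of_RR hl, by simpa using hfl⟩

/-- Reduction of `affineRing D` at a place outside `D`. -/
lemma exists_residue {D : Divisor F₂ K} (hD : 0 ≤ D) (hD0 : D ≠ 0) {P : Place F₂ K}
    (hDP : D P = 0) : ∃ ρ : affineRing D →+* IsLocalRing.ResidueField P.1,
      Function.Surjective ρ ∧ ∀ b, ρ b = 0 ↔ (b : K) ∈ lev P 1 := by
  have hsub : ∀ b ∈ affineRing D, b ∈ P.1 := fun b hb => hb P hDP
  let ρ : affineRing D →+* IsLocalRing.ResidueField P.1 :=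
    (IsLocalRing.residue P.1).comp (Subring.inclusion (fun b hb => hsub b hb : affineRing D ≤ P.1.toSubring))
  have hρ : Function.Surjective ρ := by
    intro y
    obtain ⟨f, rfl⟩ := IsLocalRing.residue_surjective y
    obtain ⟨b, hb, hfb⟩ := exists_affineRing_sub_mem hD hD0 hDP f.2
    refine ⟨⟨b, hb⟩, ?_⟩
    have h1 := (mem_maximalIdeal_iff (P := P) (f - ⟨b, hsub b hb⟩)).2 hfb
    rw [← IsLocalRing.residue_eq_zero_iff, map_sub, sub_eq_zero] at h1
    exact h1.symm
  refine ⟨ρ, hρ, fun b => ?_⟩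
  change IsLocalRing.residue P.1 ⟨b, _⟩ = 0 ↔ _
  rw [IsLocalRing.residue_eq_zero_iff, mem_maximalIdeal_iff]

/-- A homomorphism from `affineRing D` to a finite field determines a place. -/
theorem exists_place_of_hom {D : Divisor F₂ K} (hD : 0 ≤ D) (hD0 : D ≠ 0) {L : Type} [Field L]
    [Finite L] (χ : affineRing D →+* L) :
    ∃ P : Place F₂ K, D P = 0 ∧ 2 ^ placeDegree F₂ P = Nat.card χ.range ∧
      ∀ b : affineRing D, χ b = 0 ↔ (b : K) ∈ lev P 1 := by
  have hker : RingHom.ker χ ≠ ⊤ := RingHom.ker_ne_top χ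
  obtain ⟨O, hO1, hO2⟩ := Ideal.image_subset_nonunits_valuationSubring (RingHom.ker χ) hker
  have hdeg := deg_pos hD hD0
  obtain ⟨N, hN⟩ := spec_zero_of_large (K := K)
  have hO : O ≠ ⊤ := by
    rintro rfl
    have hinj : Function.Injective χ := by
      rw [RingHom.injective_iff_ker_eq_bot, eq_bot_iff]
      intro b hb
      have h1 : (b : K) ∈ (⊤ : ValuationSubring K).nonunits := hO2 ⟨b, hb, rfl⟩
      by_contra hb0
      have hb0' : (b : K) ≠ 0 := fun h => hb0 (Subtype.ext h)
      rw [ValuationSubring.mem_nonunits_iff_or] at h1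
      rcases h1 with h1 | h1
      · exact hb0' h1
      · exact h1 (ValuationSubring.mem_top _)
    have hfin : Finite (affineRing D) := Finite.of_injective χ hinj
    let n : ℕ := N.toNat + Nat.card (affineRing D) + 3
    have h2 : Nat.card (RRspace F₂ ((n : ℤ) • D)) ≤ Nat.card (affineRing D) :=
      Nat.card_le_card_of_injective
        (fun f : RRspace F₂ ((n : ℤ) • D) => (⟨f, mem_affineRing_of_RR f.2⟩ : affineRing D))
        (fun f g h => Subtype.ext (congrArg (Subtype.val : affineRing D → K) h))
    rw [Module.natCard_eq_pow_finrank (K := F₂), Nat.card_zmod] at h2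
    have h3 := Nat.lt_two_pow_self (n := ell F₂ ((n : ℤ) • D))
    have h4 := hN ((n : ℤ) • D) (by
      rw [deg_smul]
      have := Int.self_le_toNat N
      have : (N.toNat : ℤ) ≤ n := by simp only [n]; push_cast; linarith [Nat.cast_nonneg (α := ℤ) (Nat.card (affineRing D))]
      nlinarith)
    rw [spec, deg_smul] at h4
    have h5 : (n : ℤ) ≤ n * deg D := by nlinarith
    have h6 : ell F₂ ((n : ℤ) • D) < Nat.card (affineRing D) := lt_of_lt_of_le h3 h2
    omega
  let P := mkPlace O hO
  have hsub : ∀ b ∈ affineRing D, b ∈ P.1 := fun b hb => hO1 hb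
  have hDP : D P = 0 := by
    by_contra h0
    have h1 : 1 ≤ D P := by
      have : 0 ≤ D P := hD P
      omega
    let n : ℤ := |N|
    have hn : 0 ≤ n := abs_nonneg N
    obtain ⟨f, hf0, hf⟩ := exists_ordAt_eq (O := P.1) (-(n * D P) - 1)
    obtain ⟨l, hl, hfl⟩ := RR_surj_of_spec (D := n • D) (P := P) (hN _ (by
      rw [deg_smul]; have := le_abs_self N; nlinarith)) f ((mem_lev_iff hf0).2 hf.ge)
    change f - l ∈ lev P (-(n * D P)) at hfl
    have hle : n • D + Finsupp.single P 1 ≤ (n + 1) • D := by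
      rw [add_smul, one_smul]
      refine add_le_add le_rfl ?_
      intro Q
      by_cases hQ : P = Q
      · subst hQ; rw [Finsupp.single_eq_same]; exact h1
      · rw [Finsupp.single_eq_of_ne (Ne.symm hQ)]; exact hD Q
    have hlP : l ∈ P.1 := hsub l (mem_affineRing_of_RR (RR_mono hle hl))
    have h2 : l ∈ lev P (-(n * D P)) :=
      lev_mono P (by nlinarith) (mem_lev_zero.2 hlP)
    have h3 := add_mem hfl h2
    rw [sub_add_cancel, mem_lev_iff hf0, hf] at h3
    omega
  have hkP : ∀ b : affineRing D, χ b = 0 → (b : K) ∈ lev P 1 := by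
    intro b hb
    have h1 : (b : K) ∈ O.nonunits := hO2 ⟨b, hb, rfl⟩
    rw [ValuationSubring.mem_nonunits_iff_exists_mem_maximalIdeal] at h1
    obtain ⟨h2, h3⟩ := h1
    exact (mem_maximalIdeal_iff (P := P) ⟨b, h2⟩).1 h3
  have hone : (1 : K) ∉ lev P 1 := by
    rw [mem_lev_iff one_ne_zero, ordAt_one]; norm_num
  have hiff : ∀ b : affineRing D, χ b = 0 ↔ (b : K) ∈ lev P 1 := by
    intro b
    refine ⟨hkP b, fun h => ?_⟩
    by_contra hb
    have h1 : IsOfFinOrder (Units.mk0 (χ b) hb) := isOfFinOrder_of_finite _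
    obtain ⟨m, hm, hm1⟩ := isOfFinOrder_iff_pow_eq_one.1 h1
    have h2 : χ (b ^ m - 1) = 0 := by
      rw [map_sub, map_pow, map_one, sub_eq_zero]
      simpa using congrArg Units.val hm1
    have h3 := hkP _ h2
    obtain ⟨j, rfl⟩ := Nat.exists_eq_succ_of_ne_zero hm.ne'
    have h4 : (b : K) ^ (j + 1) ∈ lev P 1 := by
      have h5 : (b : K) ^ j ∈ lev P 0 := mem_lev_zero.2 (pow_mem (hsub b b.2) j)
      have := mul_mem_lev h5 h
      rwa [zero_add, ← pow_succ] at this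
    apply hone
    have h6 := sub_mem h4 h3
    simpa using h6
  refine ⟨P, hDP, ?_, hiff⟩
  obtain ⟨ρ, hρ, hρ0⟩ := exists_residue hD hD0 hDP
  have hkk : RingHom.ker ρ = RingHom.ker χ := by
    ext b
    rw [RingHom.mem_ker, RingHom.mem_ker, hiff, hρ0]
  rw [← card_residue]
  refine Nat.card_congr ?_
  exact ((RingHom.quotientKerEquivOfSurjective hρ).symm.trans
    ((Ideal.quotEquivOfEq hkk).trans (RingHom.quotientKerEquivRange χ))).toEquiv

end Homs

section PolySpan

variable {R : Type} [CommRing R] [Algebra (ZMod 2) R]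

/-- The span of `h` over the polynomials in `z`. -/
def polySpan (z : R) {ι : Type} [Fintype ι] (h : ι → R) : Submodule F₂ R where
  carrier := {r | ∃ p : ι → Polynomial F₂, r = ∑ k, Polynomial.aeval z (p k) * h k}
  add_mem' := by
    rintro _ _ ⟨p, rfl⟩ ⟨q, rfl⟩
    exact ⟨p + q, by simp [add_mul, Finset.sum_add_distrib]⟩
  zero_mem' := ⟨0, by simp⟩
  smul_mem' := by
    rintro c _ ⟨p, rfl⟩
    exact ⟨c • p, by simp [Finset.smul_sum]⟩

variable {z : R} {ι : Type} [Fintype ι] {h : ι → R}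

lemma aeval_mul_mem_polySpan {r : R} (hr : r ∈ polySpan z h) (q : Polynomial F₂) :
    Polynomial.aeval z q * r ∈ polySpan z h := by
  obtain ⟨p, rfl⟩ := hr
  exact ⟨fun k => q * p k, by simp [Finset.mul_sum, mul_assoc]⟩

lemma mul_mem_polySpan_self {r : R} (hr : r ∈ polySpan z h) : z * r ∈ polySpan z h := by
  simpa using aeval_mul_mem_polySpan hr Polynomial.X

lemma pow_mul_mem_polySpan {r : R} (hr : r ∈ polySpan z h) (n : ℕ) :
    z ^ n * r ∈ polySpan z h := by
  simpa using aeval_mul_mem_polySpan hr (Polynomial.X ^ n)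

lemma mem_polySpan (i : ι) : h i ∈ polySpan z h := by
  refine ⟨Pi.single i 1, ?_⟩
  rw [Finset.sum_eq_single i]
  · simp
  · intro j _ hj
    simp [hj]
  · simp

lemma polySpan_mul (hmul : ∀ i j, h i * h j ∈ polySpan z h) {a b : R} (ha : a ∈ polySpan z h)
    (hb : b ∈ polySpan z h) : a * b ∈ polySpan z h := by
  obtain ⟨p, rfl⟩ := ha
  rw [Finset.sum_mul]
  refine sum_mem fun i _ => ?_
  obtain ⟨q, rfl⟩ := hb
  rw [Finset.mul_sum]
  refine sum_mem fun j _ => ?_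
  rw [mul_mul_mul_comm, ← map_mul]
  exact aeval_mul_mem_polySpan (hmul i j) _

lemma aeval_prod {K L : Type} [CommRing K] [CommRing L] [Algebra (ZMod 2) K] [Algebra (ZMod 2) L]
    (x : K) (a : L) (p : Polynomial F₂) :
    Polynomial.aeval (x, a) p = (Polynomial.aeval x p, Polynomial.aeval a p) := by
  refine Prod.ext ?_ ?_
  · exact (Polynomial.aeval_algHom_apply (AlgHom.fst F₂ K L) (x, a) p).symm
  · exact (Polynomial.aeval_algHom_apply (AlgHom.snd F₂ K L) (x, a) p).symm

lemma mem_polySpan_prod {K L : Type} [CommRing K] [CommRing L] [Algebra (ZMod 2) K]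
    [Algebra (ZMod 2) L] {x : K} {a : L} {f : ι → K} {g : ι → L} {m : K × L} :
    m ∈ polySpan (x, a) (fun i => (f i, g i)) ↔ ∃ p : ι → Polynomial F₂,
      m.1 = ∑ k, Polynomial.aeval x (p k) * f k ∧ m.2 = ∑ k, Polynomial.aeval a (p k) * g k := by
  refine exists_congr fun p => ?_
  rw [Prod.ext_iff, Prod.fst_sum, Prod.snd_sum]
  simp only [aeval_prod, Prod.mk_mul_mk]

/-- Homomorphisms from a ring with a basis over the polynomials in `x`. -/
theorem exists_hom_of_basis {K L : Type} [Field K] [Field L] [Algebra (ZMod 2) K]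
    [Algebra (ZMod 2) L] {x : K} {f : ι → K} (hind : PolyIndep x f) {B : Subring K}
    (hB : ∀ b ∈ B, b ∈ polySpan x f) (a : L) (g : ι → L)
    (h1 : (1 : K × L) ∈ polySpan (x, a) (fun i => (f i, g i)))
    (hmul : ∀ i j, (f i, g i) * (f j, g j) ∈ polySpan (x, a) (fun i => (f i, g i))) :
    ∃ χ : B →+* L, ∀ m ∈ polySpan (x, a) (fun i => (f i, g i)), ∀ h : m.1 ∈ B,
      χ ⟨m.1, h⟩ = m.2 := by
  choose p hp using fun b : B => hB b b.2
  let χ : B → L := fun b => ∑ k, Polynomial.aeval a (p b k) * g k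
  have hχ : ∀ b : B, ((b : K), χ b) ∈ polySpan (x, a) (fun i => (f i, g i)) := fun b =>
    mem_polySpan_prod.2 ⟨p b, hp b, rfl⟩
  have key : ∀ m ∈ polySpan (x, a) (fun i => (f i, g i)), ∀ h : m.1 ∈ B, χ ⟨m.1, h⟩ = m.2 := by
    intro m hm h
    obtain ⟨q, hq1, hq2⟩ := mem_polySpan_prod.1 hm
    have h2 := hp ⟨m.1, h⟩
    have h3 : p ⟨m.1, h⟩ - q = 0 := by
      apply hind
      simp only [Pi.sub_apply, map_sub, sub_mul, Finset.sum_sub_distrib]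
      rw [← hq1, ← h2, sub_self]
    rw [hq2, ← sub_eq_zero.1 h3]
  refine ⟨{ toFun := χ, map_one' := ?_, map_mul' := ?_, map_zero' := ?_, map_add' := ?_ }, key⟩
  · exact key 1 h1 B.one_mem
  · intro b c
    exact key _ (polySpan_mul hmul (hχ b) (hχ c)) (B.mul_mem b.2 c.2)
  · exact key 0 (zero_mem _) B.zero_mem
  · intro b c
    exact key _ (add_mem (hχ b) (hχ c)) (B.add_mem b.2 c.2)

end PolySpan

section GaloisFields

/-- Multiplication of bit strings of length `e` with multiplication table `t`. -/
def tabMul (e t a b : ℕ) : ℕ := Nat.mod (Nat.shiftRight t (Nat.mul e (Nat.add (Nat.mul (Nat.pow 2 e) a) b))) (Nat.pow 2 e)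

/-- Bit strings of length `e`, with multiplication table `t`. -/
def GF (e _t : ℕ) : Type := Fin (2 ^ e)

namespace GF

variable {e t : ℕ}

instance : DecidableEq (GF e t) := inferInstanceAs (DecidableEq (Fin (2 ^ e)))
instance : Fintype (GF e t) := inferInstanceAs (Fintype (Fin (2 ^ e)))
instance : Zero (GF e t) := ⟨⟨0, Nat.two_pow_pos e⟩⟩
instance : Add (GF e t) := ⟨fun a b => ⟨Nat.xor a.1 b.1, Nat.xor_lt_two_pow a.2 b.2⟩⟩
instance : Mul (GF e t) := ⟨fun a b => ⟨tabMul e t a.1 b.1, Nat.mod_lt _ (Nat.two_pow_pos e)⟩⟩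
instance : Neg (GF e t) := ⟨fun a => a⟩

/-- The table `t` defines a field. -/
class Valid (e t : ℕ) : Prop where
  pos : 1 < 2 ^ e
  zero_mul : ∀ a : GF e t, 0 * a = 0
  mul_assoc : ∀ a b c : GF e t, a * b * c = a * (b * c)
  mul_comm : ∀ a b : GF e t, a * b = b * a
  left_distrib : ∀ a b c : GF e t, a * (b + c) = a * b + a * c
  one_mul : ∀ a : GF e t, HMul.hMul (α := GF e t) (⟨1, pos⟩ : Fin (2 ^ e)) a = a
  domain : ∀ a b : GF e t, a * b = 0 → a = 0 ∨ b = 0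

variable [Valid e t]

instance : One (GF e t) := ⟨⟨1, Valid.pos t⟩⟩

instance : CommRing (GF e t) where
  add_assoc a b c := Fin.ext (Nat.xor_assoc a.1 b.1 c.1)
  zero_add a := Fin.ext (Nat.zero_xor a.1)
  add_zero a := Fin.ext (Nat.xor_zero a.1)
  add_comm a b := Fin.ext (Nat.xor_comm a.1 b.1)
  neg_add_cancel a := Fin.ext (Nat.xor_self a.1)
  nsmul := nsmulRec
  zsmul := zsmulRec
  mul_assoc := Valid.mul_assoc
  mul_comm := Valid.mul_comm
  left_distrib := Valid.left_distrib
  right_distrib a b c := by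
    rw [Valid.mul_comm, Valid.left_distrib, Valid.mul_comm c a, Valid.mul_comm c b]
  one_mul := Valid.one_mul
  mul_one a := by rw [Valid.mul_comm]; exact Valid.one_mul a
  zero_mul := Valid.zero_mul
  mul_zero a := by rw [Valid.mul_comm]; exact Valid.zero_mul a

instance : IsDomain (GF e t) :=
  have : Nontrivial (GF e t) := ⟨0, 1, fun h => absurd (congrArg Fin.val h) (show ¬ (0 = 1) by decide)⟩
  have : NoZeroDivisors (GF e t) := ⟨fun h => Valid.domain _ _ h⟩
  NoZeroDivisors.to_isDomain _

instance : Field (GF e t) := Fintype.fieldOfDomain (GF e t)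

instance : CharP (GF e t) 2 := CharTwo.of_one_ne_zero_of_two_eq_zero one_ne_zero
  (by rw [← one_add_one_eq_two]; exact Fin.ext (Nat.xor_self 1))

instance : Algebra (ZMod 2) (GF e t) := ZMod.algebra _ 2

omit [Valid e t] in
lemma val_add (a b : GF e t) : (a + b).1 = Nat.xor a.1 b.1 := rfl
omit [Valid e t] in
lemma val_mul (a b : GF e t) : (a * b).1 = tabMul e t a.1 b.1 := rfl

end GF

/-- A multiplication table of the field with four elements. -/
def tabFour : ℕ := 0x9c78e400

instance : GF.Valid 2 tabFour where
  pos := by decide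
  zero_mul := by decide +kernel
  mul_assoc := by decide +kernel
  mul_comm := by decide +kernel
  left_distrib := by decide +kernel
  one_mul := by decide +kernel
  domain := by decide +kernel

/-- A multiplication table of the field with eight elements. -/
def tabEight : ℕ := 0x73157889d3f0cfa868356ee0467b98bcbd10fac688000000

instance : GF.Valid 3 tabEight where
  pos := by decide
  zero_mul := by decide +kernel
  mul_assoc := by decide +kernel
  mul_comm := by decide +kernel
  left_distrib := by decide +kernel
  one_mul := by decide +kernel
  domain := by decide +kernel

/-- A multiplication table of the field with sixteen elements. -/
def tabSixteen : ℕ := 0xa5783ce1b4692df05ba48679c23d1fe07ae36bf258c149d0843fd16a2e957bc0386d92c74f1ae5b0c6b1285f394ed7a0e7f6c5d4a3b28190192a7f4cd5e6b380bc5243ad618f9e70428ef93517dbac6063c914be8d27fa509d15ae26fb73c8402147ed8b9afc5630df9b5713eca86420fedcba98765432100000000000000000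

instance : GF.Valid 4 tabSixteen where
  pos := by decide
  zero_mul := by decide +kernel
  mul_assoc := by decide +kernel
  mul_comm := by decide +kernel
  left_distrib := by decide +kernel
  one_mul := by decide +kernel
  domain := by decide +kernel

end GaloisFields

section Degrees

/-- The order of a finite field is a power of the order of a subring. -/
lemma card_eq_pow_of_subring {L : Type} [Field L] [Finite L] (S : Subring L) :
    ∃ m : ℕ, Nat.card L = Nat.card S ^ m := by
  have : Fintype L := Fintype.ofFinite L
  let F : Subfield L :=
    { S with
      inv_mem' := by
        intro x hx
        rcases eq_or_ne x 0 with rfl | h0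
        · rw [inv_zero]; exact S.zero_mem
        · have h1 := FiniteField.pow_card_sub_one_eq_one x h0
          have h2 : 1 ≤ Fintype.card L - 1 := by
            have := Fintype.one_lt_card (α := L)
            omega
          obtain ⟨j, hj⟩ := Nat.exists_eq_add_of_le h2
          rw [hj, add_comm, pow_succ] at h1
          rw [inv_eq_of_mul_eq_one_left h1]
          exact S.pow_mem hx j }
  exact ⟨_, Module.natCard_eq_pow_finrank (K := F) (V := L)⟩

variable {K : Type} [Field K] [Algebra (ZMod 2) K] [GenusFour K]

/-- A homomorphism to a field with `2 ^ e` elements gives a place whose degree divides `e`. -/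
theorem exists_place_dvd {D : Divisor F₂ K} (hD : 0 ≤ D) (hD0 : D ≠ 0) {L : Type} [Field L]
    [Finite L] {e : ℕ} (hL : Nat.card L = 2 ^ e) (χ : affineRing D →+* L) :
    ∃ P : Place F₂ K, D P = 0 ∧ placeDegree F₂ P ∣ e ∧
      2 ^ placeDegree F₂ P = Nat.card χ.range ∧ ∀ b : affineRing D, χ b = 0 ↔ (b : K) ∈ lev P 1 := by
  obtain ⟨P, h1, h2, h3⟩ := exists_place_of_hom hD hD0 χ
  refine ⟨P, h1, ?_, h2, h3⟩
  obtain ⟨m, hm⟩ := card_eq_pow_of_subring χ.range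
  rw [hL, ← h2, ← pow_mul] at hm
  exact ⟨m, Nat.pow_right_injective le_rfl hm⟩

lemma GF.card (e t : ℕ) : Nat.card (GF e t) = 2 ^ e := Nat.card_fin _

/-- The number of homomorphisms giving the same place is at most its degree. -/
theorem card_le_of_same_place {D : Divisor F₂ K} (hD : 0 ≤ D) (hD0 : D ≠ 0) {P : Place F₂ K}
    (hP : D P = 0) {L : Type} [Field L] [Algebra (ZMod 2) L] {ι : Type} [Fintype ι]
    {χ : ι → affineRing D →+* L} (hχ : Function.Injective χ)
    (h : ∀ i b, χ i b = 0 ↔ (b : K) ∈ lev P 1) : Fintype.card ι ≤ placeDegree F₂ P := by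
  obtain ⟨ρ, hρ, hρ0⟩ := exists_residue hD hD0 hP
  have hker : ∀ i, RingHom.ker ρ ≤ RingHom.ker (χ i) := fun i b hb => (h i b).2 ((hρ0 b).1 hb)
  let τ : ι → (IsLocalRing.ResidueField P.1 →+* L) := fun i =>
    (ρ.liftOfSurjective hρ) ⟨χ i, hker i⟩
  have hτ : ∀ i b, τ i (ρ b) = χ i b := fun i b =>
    RingHom.liftOfRightInverse_comp_apply ρ _ _ ⟨χ i, hker i⟩ b
  let σ : ι → (IsLocalRing.ResidueField P.1 →ₐ[F₂] L) := fun i =>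
    { τ i with commutes' := fun r => DFunLike.congr_fun (RingHom.ext_zmod
        ((τ i).comp (algebraMap F₂ _)) (algebraMap F₂ L)) r }
  have hσ : Function.Injective σ := by
    intro i j hij
    apply hχ
    ext b
    rw [← hτ i, ← hτ j]
    exact DFunLike.congr_fun hij (ρ b)
  rw [← Nat.card_eq_fintype_card]
  exact (Nat.card_le_card_of_injective σ hσ).trans (card_algHom_le_finrank F₂ _ L)

end Degrees

section Rational

variable {K : Type} [Field K] [Algebra (ZMod 2) K] [GenusFourFive K]

/-- The system of divisors of degree five has no base divisor. -/
lemma lseq_sub_lt {G : Divisor F₂ K} (hG : 0 ≤ G) (hG0 : G ≠ 0) :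
    lseq K (5 - deg G) < lseq K 5 := by
  obtain ⟨T, hT⟩ := GenusFourFive.gener (K := K)
  have h5 := deg_poleDiv hT
  by_contra hlt
  push Not at hlt
  rw [← h5, ← map_sub, ← ell_eq_lseq, ← ell_eq_lseq] at hlt
  have h1 : RRspace F₂ (poleDiv T - G) = RRspace F₂ (poleDiv T) :=
    Submodule.eq_of_le_of_finrank_le (RR_mono (sub_le_self _ hG)) hlt
  have h2 : (1 : K) ∈ RRspace F₂ (poleDiv T - G) := by
    rw [h1]; exact one_mem_RR (poleDiv_nonneg T)
  have h3 : T ∈ RRspace F₂ (poleDiv T - G) := by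
    rw [h1]; exact mem_RR_poleDiv T
  have hT0 : T ≠ 0 := by
    rintro rfl
    exact hT.sep.tr isAlgebraic_zero
  have h4 : 0 ≤ poleDiv T - G := by
    rw [mem_RR_iff one_ne_zero] at h2
    have : div (1 : K) = 0 := by
      have := div_mul (K := K) (f := 1) (g := 1) one_ne_zero one_ne_zero
      rw [mul_one] at this
      exact left_eq_add.1 this
    rwa [this, zero_add] at h2
  have h5 := poleDiv_le hT0 h4 h3
  exact hG0 (le_antisymm ((le_sub_self_iff _).1 h5) hG)

end Rational

section Poles

variable {K : Type} [Field K] [Algebra (ZMod 2) K] [GenusFour K] {P : Place F₂ K}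

/-- `f` has a pole of exact order `n` at `P` and no other poles. -/
def HasPole (P : Place F₂ K) (n : ℤ) (f : K) : Prop :=
  f ∈ RRspace F₂ (n • Finsupp.single P 1) ∧ f ∉ lev P (-n + 1)

lemma smul_single_apply (n : ℤ) : (n • Finsupp.single P 1 : Divisor F₂ K) P = n := by
  simp

lemma HasPole.ne_zero {n : ℤ} {f : K} (h : HasPole P n f) : f ≠ 0 := by
  rintro rfl; exact h.2 (zero_mem _)

lemma HasPole.ordAt {n : ℤ} {f : K} (h : HasPole P n f) : ordAt P.1 f = -n := by
  have h1 := mem_RR.1 h.1 P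
  have h2 := h.2
  rw [smul_single_apply, mem_lev_iff h.ne_zero] at h1
  rw [mem_lev_iff h.ne_zero] at h2
  omega

lemma HasPole.mul {m n : ℤ} {f g : K} (hf : HasPole P m f) (hg : HasPole P n g) :
    HasPole P (m + n) (f * g) := by
  refine ⟨?_, ?_⟩
  · rw [add_smul]; exact mul_mem_RR hf.1 hg.1
  · rw [mem_lev_iff (mul_ne_zero hf.ne_zero hg.ne_zero), ordAt_mul hf.ne_zero hg.ne_zero,
      hf.ordAt, hg.ordAt]
    omega

lemma hasPole_one : HasPole P 0 (1 : K) := by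
  refine ⟨?_, ?_⟩
  · rw [zero_smul]; exact one_mem_RR le_rfl
  · rw [mem_lev_iff one_ne_zero, ordAt_one]; norm_num

lemma HasPole.pow {n : ℤ} {f : K} (hf : HasPole P n f) (j : ℕ) : HasPole P (j * n) (f ^ j) := by
  induction j with
  | zero => simpa using hasPole_one
  | succ j ih =>
    rw [pow_succ]
    convert ih.mul hf using 1
    push_cast; ring

lemma RR_sub_one {n : ℤ} {f : K} (hf : f ∈ RRspace F₂ (n • Finsupp.single P 1))
    (h : f ∈ lev P (-n + 1)) : f ∈ RRspace F₂ ((n - 1) • Finsupp.single P 1) := by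
  rw [sub_smul, one_smul]
  exact mem_RR_sub hf (by rwa [smul_single_apply])

lemma not_hasPole_iff {n : ℤ} {f : K} (hf : f ∈ RRspace F₂ (n • Finsupp.single P 1)) :
    ¬ HasPole P n f ↔ f ∈ RRspace F₂ ((n - 1) • Finsupp.single P 1) := by
  constructor
  · intro h
    refine RR_sub_one hf ?_
    by_contra h2
    exact h ⟨hf, h2⟩
  · intro h h2
    apply h2.2
    have := mem_RR.1 h P
    rw [smul_single_apply] at this
    rwa [show -n + 1 = -(n - 1) by ring]

lemma HasPole.sub_of_mem {n : ℤ} {f g : K} (hf : HasPole P n f)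
    (hg : g ∈ RRspace F₂ ((n - 1) • Finsupp.single P 1)) : HasPole P n (f + g) := by
  have hg' : g ∈ RRspace F₂ (n • Finsupp.single P 1) :=
    RR_mono (smul_le_smul_div (single_nonneg P) (by omega)) hg
  by_contra h
  rw [not_hasPole_iff (add_mem hf.1 hg')] at h
  have := sub_mem h hg
  rw [add_sub_cancel_right] at this
  exact (not_hasPole_iff hf.1).2 this hf

/-- Functions with poles of distinct orders are independent. -/
lemma sum_ne_zero_of_poles {ι : Type} {s : Finset ι} (hs : s.Nonempty) {f : ι → K} {n : ι → ℤ}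
    (hn : Set.InjOn n s) (hf : ∀ i ∈ s, HasPole P (n i) (f i)) : ∑ i ∈ s, f i ≠ 0 := by
  obtain ⟨i, hi, hmax⟩ := Finset.exists_max_image s n hs
  rw [← Finset.add_sum_erase s f hi]
  refine (HasPole.sub_of_mem (hf i hi) (sum_mem fun j hj => ?_)).ne_zero
  have hj' := Finset.mem_of_mem_erase hj
  refine RR_mono (smul_le_smul_div (single_nonneg P) ?_) (hf j hj').1
  have h1 := hmax j hj'
  have h2 : n j ≠ n i := fun h => (Finset.ne_of_mem_erase hj) (hn hj' hi h)
  omega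

lemma HasPole.aeval {d : ℤ} (hd : 0 < d) {x : K} (hx : HasPole P d x) {p : Polynomial F₂}
    (hp : p ≠ 0) : HasPole P (p.natDegree * d) (Polynomial.aeval x p) := by
  have h2 : ∀ c : F₂, c ≠ 0 → c = 1 := by decide
  rw [Polynomial.aeval_eq_sum_range, Finset.sum_range_succ, add_comm,
    h2 _ (show p.coeff p.natDegree ≠ 0 from Polynomial.leadingCoeff_ne_zero.2 hp), one_smul]
  refine (hx.pow _).sub_of_mem (sum_mem fun j hj => Submodule.smul_mem _ _ ?_)
  have h3 := Finset.mem_range.1 hj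
  refine RR_mono (smul_le_smul_div (single_nonneg P) ?_) (hx.pow j).1
  have : (j : ℤ) + 1 ≤ p.natDegree := by exact_mod_cast h3
  nlinarith

lemma polyIndep_of_poles {d : ℤ} (hd : 0 < d) {x : K} (hx : HasPole P d x) {ι : Type} [Fintype ι]
    {f : ι → K} {n : ι → ℤ} (hf : ∀ i, HasPole P (n i) (f i))
    (hn : ∀ i j, d ∣ n i - n j → i = j) : PolyIndep x f := by
  intro p hp
  by_contra h0
  let s := Finset.univ.filter fun i => p i ≠ 0
  have hs : s.Nonempty := by
    obtain ⟨i, hi⟩ := Function.ne_iff.1 h0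
    exact ⟨i, Finset.mem_filter.2 ⟨Finset.mem_univ i, hi⟩⟩
  refine sum_ne_zero_of_poles (P := P) (f := fun i => Polynomial.aeval x (p i) * f i)
    (n := fun i => (p i).natDegree * d + n i) hs ?_ ?_ ?_
  · intro i _ j _ hij
    apply hn
    have hij' : (p i).natDegree * d + n i = (p j).natDegree * d + n j := hij
    exact ⟨(p j).natDegree - (p i).natDegree, by linarith⟩
  · intro i hi
    exact ((hx.aeval hd (Finset.mem_filter.1 hi).2)).mul (hf i)
  · rw [← hp]
    refine Finset.sum_subset (Finset.subset_univ s) fun i _ hi => ?_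
    have : p i = 0 := by
      by_contra h
      exact hi (Finset.mem_filter.2 ⟨Finset.mem_univ i, h⟩)
    rw [this, map_zero, zero_mul]

end Poles

section DegreeOne

variable {K : Type} [Field K] [Algebra (ZMod 2) K] [GenusFourFive K] {P : Place F₂ K}

lemma deg_smul_single (hP : placeDegree F₂ P = 1) (n : ℤ) :
    deg (n • Finsupp.single P 1 : Divisor F₂ K) = n := by
  rw [deg_smul, deg_place, hP]; simp

lemma HasPole.lseq_lt (hP : placeDegree F₂ P = 1) {n : ℤ} {e : K} (he : HasPole P n e) :
    lseq K (n - 1) < lseq K n := by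
  by_contra h
  push Not at h
  have h1 : RRspace F₂ ((n - 1) • Finsupp.single P 1 : Divisor F₂ K) =
      RRspace F₂ (n • Finsupp.single P 1) := by
    refine Submodule.eq_of_le_of_finrank_le
      (RR_mono (smul_le_smul_div (single_nonneg P) (by omega))) ?_
    change ell F₂ _ ≤ ell F₂ _
    rwa [ell_eq_lseq, ell_eq_lseq, deg_smul_single hP, deg_smul_single hP]
  exact (not_hasPole_iff he.1).2 (h1 ▸ he.1) he

lemma exists_hasPole (hP : placeDegree F₂ P = 1) {n : ℤ} (h : lseq K (n - 1) < lseq K n) :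
    ∃ e, HasPole P n e := by
  by_contra h1
  push Not at h1
  have h2 : RRspace F₂ (n • Finsupp.single P 1 : Divisor F₂ K) ≤
      RRspace F₂ ((n - 1) • Finsupp.single P 1) := fun f hf => (not_hasPole_iff hf).1 (h1 f)
  have h3 := Submodule.finrank_mono h2
  change ell F₂ _ ≤ ell F₂ _ at h3
  rw [ell_eq_lseq, ell_eq_lseq, deg_smul_single hP, deg_smul_single hP] at h3
  omega

lemma HasPole.sub_mem (hP : placeDegree F₂ P = 1) {n : ℤ} {e f : K} (he : HasPole P n e)
    (hf : HasPole P n f) : f - e ∈ RRspace F₂ ((n - 1) • Finsupp.single P 1) := by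
  refine RR_sub_one (_root_.sub_mem hf.1 he.1) ?_
  obtain ⟨r, -, hr⟩ := exists_red P (-n)
  have hm : ∀ {g : K}, g ∈ RRspace F₂ (n • Finsupp.single P 1) → g ∈ lev P (-n) := by
    intro g hg
    have := mem_RR.1 hg P
    rwa [smul_single_apply] at this
  have h1 : r ⟨e, hm he.1⟩ ≠ 0 := fun h => he.2 ((hr _).1 h)
  have h2 : r ⟨f, hm hf.1⟩ ≠ 0 := fun h => hf.2 ((hr _).1 h)
  have hc := card_residue P
  rw [hP, pow_one] at hc
  have h3 : r ⟨f, hm hf.1⟩ = r ⟨e, hm he.1⟩ := by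
    by_contra hne
    have hfin : Finite (IsLocalRing.ResidueField P.1) := Nat.finite_of_card_ne_zero (by omega)
    have hft : Fintype (IsLocalRing.ResidueField P.1) := Fintype.ofFinite _
    rw [Nat.card_eq_fintype_card] at hc
    have := Finset.card_le_univ ({0, r ⟨e, hm he.1⟩, r ⟨f, hm hf.1⟩} : Finset _)
    rw [hc, Finset.card_eq_three.2 ⟨_, _, _, h1.symm, h2.symm, Ne.symm hne, rfl⟩] at this
    omega
  exact (hr (⟨f, hm hf.1⟩ - ⟨e, hm he.1⟩)).1 (by rw [map_sub, h3, sub_self])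

lemma RR_le_of_poles (hP : placeDegree F₂ P = 1) (S : Submodule F₂ K) (N : ℕ)
    (h : ∀ m : ℕ, m ≤ N → (∃ e ∈ S, HasPole P m e) ∨ lseq K m ≤ lseq K (m - 1)) :
    RRspace F₂ ((N : ℤ) • Finsupp.single P 1) ≤ S := by
  have key : ∀ M : ℕ, M ≤ N + 1 → RRspace F₂ (((M : ℤ) - 1) • Finsupp.single P 1) ≤ S := by
    intro M
    induction M with
    | zero =>
      intro _ f hf
      by_cases h0 : f = 0
      · rw [h0]; exact zero_mem _
      · have h1 : ell F₂ ((((0 : ℕ) : ℤ) - 1) • Finsupp.single P 1 : Divisor F₂ K) = 0 :=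
          ell_neg (by rw [deg_smul_single hP]; norm_num)
        have h2 := Submodule.finrank_eq_zero.1 h1
        rw [h2] at hf
        rw [(Submodule.mem_bot _).1 hf]; exact zero_mem _
    | succ M ih =>
      intro hM f hf
      have ih := ih (by omega)
      rw [Nat.cast_succ, add_sub_cancel_right] at hf
      by_cases hp : HasPole P M f
      · rcases h M (by omega) with ⟨e, heS, he⟩ | hl
        · have := S.add_mem (ih (he.sub_mem hP hp)) heS
          rwa [sub_add_cancel] at this
        · exact absurd (hp.lseq_lt hP) (not_lt.2 hl)
      · exact ih ((not_hasPole_iff hf).1 hp)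
  have := key (N + 1) le_rfl
  rwa [Nat.cast_succ, add_sub_cancel_right] at this

lemma exists_hasPole_of_place (hP : placeDegree F₂ P = 1) {Q : Place F₂ K}
    (hQ : (Finsupp.single P 1 : Divisor F₂ K) Q = 0) : ∃ e, HasPole P (placeDegree F₂ Q) e := by
  obtain ⟨f, hf, h⟩ := exists_equiv (D := Finsupp.single Q 1)
    (D' := (placeDegree F₂ Q : ℤ) • Finsupp.single P 1)
    (by rw [deg_smul_single hP, deg_place])
  have hPQ : Q ≠ P := by
    rintro rfl
    simp at hQ
  refine ⟨f, ?_, ?_⟩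
  · rw [mem_RR_iff hf, add_comm, ← h]
    exact single_nonneg Q
  · have h1 := DFunLike.congr_fun h P
    rw [Finsupp.add_apply, smul_single_apply, div_apply hf, Finsupp.single_eq_of_ne hPQ.symm] at h1
    rw [mem_lev_iff hf]
    omega

lemma exists_bool (c : F₂) : ∃ b : Bool, ∀ {M : Type} [AddCommGroup M] [Module F₂ M] (m : M),
    c • m = cond b m 0 := by
  have : c = 0 ∨ c = 1 := by revert c; decide
  rcases this with rfl | rfl
  · exact ⟨false, fun m => zero_smul _ m⟩
  · exact ⟨true, fun m => one_smul _ m⟩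

/-- Expansion in functions with prescribed poles, coefficients being bits. -/
lemma exists_expansion {m : ℕ} {e : Fin m → K} {f : K}
    (hf : f ∈ Submodule.span F₂ (Set.range e)) :
    ∃ b : Fin m → Bool, f = ∑ i, cond (b i) (e i) 0 := by
  obtain ⟨c, hc⟩ := (Submodule.mem_span_range_iff_exists_fun F₂).1 hf
  choose b hb using fun i => exists_bool (c i)
  exact ⟨b, by rw [← hc]; exact Finset.sum_congr rfl fun i _ => hb i _⟩

/-- There is no place of degree one with a point of small degree in the complement. -/
lemma lseq_lt_of_hom (hP : placeDegree F₂ P = 1) {L : Type} [Field L] [Finite L] {e : ℕ}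
    (hL : Nat.card L = 2 ^ e) (χ : affineRing (Finsupp.single P 1 : Divisor F₂ K) →+* L) :
    ∃ d : ℕ, 0 < d ∧ d ∣ e ∧ lseq K (d - 1) < lseq K d := by
  have h0 : (Finsupp.single P 1 : Divisor F₂ K) ≠ 0 := by simp
  obtain ⟨Q, hQ, hd, -, -⟩ := exists_place_dvd (single_nonneg P) h0 hL χ
  obtain ⟨f, hf⟩ := exists_hasPole_of_place hP hQ
  exact ⟨_, placeDegree_pos Q, hd, hf.lseq_lt hP⟩

end DegreeOne

section Closure

variable {R : Type} [CommRing R] [Algebra (ZMod 2) R] {z : R}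

lemma cond_mem {M : Type} [AddCommGroup M] [Module F₂ M] {S : Submodule F₂ M} {m : M} (hm : m ∈ S)
    (b : Bool) : cond b m 0 ∈ S := by
  cases b
  exacts [zero_mem _, hm]

lemma polySpan_cond_mul {ι : Type} [Fintype ι] {h : ι → R} {m u : R}
    (hm : m * u ∈ polySpan z h) (b : Bool) : cond b m 0 * u ∈ polySpan z h := by
  cases b
  · simp
  · exact hm

lemma polySpan_mul_left {ι : Type} [Fintype ι] {h : ι → R} {u : R}
    (hu : ∀ i, u * h i ∈ polySpan z h) {r : R} (hr : r ∈ polySpan z h) :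
    u * r ∈ polySpan z h := by
  obtain ⟨p, rfl⟩ := hr
  rw [Finset.mul_sum]
  refine sum_mem fun i _ => ?_
  rw [mul_left_comm]
  exact aeval_mul_mem_polySpan (hu i) _

end Closure

section Search

/-- The sum of a selection of bit strings. -/
def dot (l : List Bool) : List ℕ → ℕ :=
  List.rec (fun _ => 0)
    (fun b _ ih vs => List.rec 0 (fun v vs' _ => Nat.xor (cond b v 0) (ih vs')) vs) l

/-- Test a predicate on all bit strings of length `n`. -/
def allBits (n : ℕ) : (List Bool → Bool) → Bool :=
  Nat.rec (fun f => f [])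
    (fun _ ih f => cond (ih fun l => f (false :: l)) (ih fun l => f (true :: l)) false) n

lemma allBits_spec {n : ℕ} {f : List Bool → Bool} (h : allBits n f = true) (b : Fin n → Bool) :
    f (List.ofFn b) = true := by
  induction n generalizing f with
  | zero => exact h
  | succ n ih =>
    have h' : cond (allBits n fun l => f (false :: l)) (allBits n fun l => f (true :: l)) false =
      true := h
    rw [List.ofFn_succ]
    cases h1 : allBits n fun l => f (false :: l) with
    | false => rw [h1] at h'; exact absurd h' (by simp)
    | true =>
      rw [h1] at h'
      cases b 0
      · exact ih h1 fun i => b i.succ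
      · exact ih h' fun i => b i.succ

/-- Evaluate the argument first. -/
def force {α : Type} (n : ℕ) (f : ℕ → α) : α := Nat.rec (f 0) (fun m _ => f (Nat.succ m)) n

lemma force_eq {α : Type} (n : ℕ) (f : ℕ → α) : force n f = f n := by cases n <;> rfl

/-- The position of the highest bit of a number below `2 ^ 2 ^ k`. -/
def topBit (k : ℕ) : ℕ → ℕ → ℕ :=
  Nat.rec (fun _ a => a)
    (fun k ih z a => force (Nat.shiftRight z (Nat.pow 2 k)) fun y =>
      Nat.rec (ih z a) (fun _ _ => ih y (Nat.add a (Nat.pow 2 k))) y) k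

/-- Find a vanishing block of `e` bits, the lowest bits of the blocks being `mask`. -/
def zeroBlock (e k mask w : ℕ) (f : ℕ → Bool) : Bool :=
  force w fun w =>
  force (Nat.rec w (fun i u => Nat.lor u (Nat.shiftRight w (Nat.succ i))) (Nat.pred e)) fun u =>
  force (Nat.xor mask (Nat.land mask u)) fun z =>
  force (Nat.div (topBit k z 0) e) f

lemma exists_of_zeroBlock {e k mask w : ℕ} {f : ℕ → Bool} (h : zeroBlock e k mask w f = true) :
    ∃ p, f p = true := by
  simp only [zeroBlock, force_eq] at h
  exact ⟨_, h⟩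

/-- The values of a function at the first `n` points, as blocks of `e` bits. -/
def pointTable (e n : ℕ) (f : ℕ → ℕ) : ℕ :=
  Nat.rec 0 (fun p s => Nat.add s (Nat.shiftLeft (f p) (Nat.mul e p))) n

/-- The values of `m` functions at the first `n` points. -/
def withTables (e n m : ℕ) (f : ℕ → List ℕ) (k : List ℕ → Bool) : Bool :=
  (Nat.rec k (fun i ih l => force (pointTable e n fun p => List.getD (f p) i 0) fun t => ih (t :: l)) m
    : List ℕ → Bool) []

lemma exists_of_withTables {e n m : ℕ} {f : ℕ → List ℕ} {k : List ℕ → Bool} (h : withTables e n m f k = true) :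
    ∃ l, k l = true := by
  have key : ∀ m l, (Nat.rec k (fun i ih l => force (pointTable e n fun p => List.getD (f p) i 0)
      fun t => ih (t :: l)) m : List ℕ → Bool) l = true → ∃ l, k l = true := by
    intro m
    induction m with
    | zero => exact fun l h => ⟨l, h⟩
    | succ m ih =>
      intro l h
      exact ih _ ((force_eq _ _).symm.trans h)
  exact key m [] h

lemma GF.val_sum_cond {e t : ℕ} [GF.Valid e t] {m : ℕ} (b : Fin m → Bool) (g : Fin m → GF e t) :
    (∑ i, cond (b i) (g i) 0).1 = dot (List.ofFn b) (List.ofFn fun i => (g i).1) := by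
  induction m with
  | zero => rfl
  | succ m ih =>
    rw [Fin.sum_univ_succ, GF.val_add, ih, List.ofFn_succ, List.ofFn_succ]
    change _ = Nat.xor (cond (b 0) (g 0).1 0) _
    congr 1
    cases b 0 <;> rfl

lemma fst_sum_cond {A B : Type} [CommRing A] [CommRing B] {m : ℕ} (b : Fin m → Bool)
    (g : Fin m → A × B) : (∑ i, cond (b i) (g i) 0).1 = ∑ i, cond (b i) (g i).1 0 := by
  rw [Prod.fst_sum]
  exact Finset.sum_congr rfl fun i _ => by cases b i <;> rfl

lemma snd_sum_cond {A B : Type} [CommRing A] [CommRing B] {m : ℕ} (b : Fin m → Bool)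
    (g : Fin m → A × B) : (∑ i, cond (b i) (g i) 0).2 = ∑ i, cond (b i) (g i).2 0 := by
  rw [Prod.snd_sum]
  exact Finset.sum_congr rfl fun i _ => by cases b i <;> rfl

end Search

section ThreeFive

/-- Monomials of pole order less than fifteen, for poles of orders three and five. -/
def monThreeFive {R : Type} [CommRing R] (x y : R) : Fin 11 → R :=
  ![1, x, x * x, x * x * x, x * x * x * x, y, x * y, x * x * y, x * x * x * y, y * y, x * (y * y)]

/-- Values of `monThreeFive`. -/
def rowThreeFive (x y : ℕ) : List ℕ :=
  let m := tabMul 4 tabSixteen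
  [1, x, m x x, m (m x x) x, m (m (m x x) x) x, y, m x y, m (m x x) y, m (m (m x x) x) y,
    m y y, m x (m y y)]

/-- The lowest bits of the blocks. -/
def maskThreeFive : ℕ := Nat.div (Nat.pow 2 1024) 15

/-- The values of `y ^ 3 - x ^ 5` and of the monomials. -/
def valuesThreeFive (p : ℕ) : List ℕ :=
  force (Nat.mod (Nat.div p 16) 16) fun x => force (Nat.mod p 16) fun y =>
    let m := tabMul 4 tabSixteen
    Nat.xor (m (m y y) y) (m (m (m (m x x) x) x) x) :: rowThreeFive x y

/-- A solution of the equation with given coefficients. -/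
def checkThreeFive (l : List Bool) (v : List ℕ) : Bool :=
  zeroBlock 4 10 maskThreeFive (dot (true :: l) v) fun p =>
    force (Nat.mod (Nat.div p 16) 16) fun x =>
    force (Nat.mod p 16) fun y =>
    let m := tabMul 4 tabSixteen
    Nat.beq (m (m y y) y) (Nat.xor (m (m (m (m x x) x) x) x) (dot l (rowThreeFive x y)))

lemma checkThreeFive_all :
    withTables 4 256 12 valuesThreeFive (fun v => allBits 11 fun l => checkThreeFive l v) = true := by
  decide +kernel

lemma exists_solution_threeFive (b : Fin 11 → Bool) : ∃ x y : GF 4 tabSixteen,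
    y * y * y = x * x * x * x * x + ∑ i, cond (b i) (monThreeFive x y i) 0 := by
  obtain ⟨v, hv⟩ := exists_of_withTables checkThreeFive_all
  have h := allBits_spec hv b
  obtain ⟨p, hp⟩ := exists_of_zeroBlock h
  simp only [force_eq] at hp
  refine ⟨⟨Nat.mod (Nat.div p 16) 16, Nat.mod_lt _ (by norm_num)⟩,
    ⟨Nat.mod p 16, Nat.mod_lt _ (by norm_num)⟩, Fin.ext ?_⟩
  rw [GF.val_add, GF.val_sum_cond]
  exact Nat.eq_of_beq_eq_true hp

end ThreeFive

section ThreeFive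

lemma mul_mem_threeFive {R : Type} [CommRing R] [Algebra (ZMod 2) R] {x y : R} {b : Fin 11 → Bool}
    (h : y * y * y = x * x * x * x * x + ∑ i, cond (b i) (monThreeFive x y i) 0) (i j : Fin 3) :
    ![1, y, y * y] i * ![1, y, y * y] j ∈ polySpan x ![1, y, y * y] := by
  have hm : ∀ (a : ℕ) (j : Fin 3), x ^ a * ![1, y, y * y] j ∈ polySpan x ![1, y, y * y] :=
    fun a j => pow_mul_mem_polySpan (mem_polySpan j) a
  have hmon : ∀ i, monThreeFive x y i ∈ polySpan x ![1, y, y * y] := by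
    intro i
    fin_cases i
    · simpa [monThreeFive] using hm 0 0
    · simpa [monThreeFive] using hm 1 0
    · simpa [pow_succ, monThreeFive] using hm 2 0
    · simpa [pow_succ, monThreeFive] using hm 3 0
    · simpa [pow_succ, monThreeFive] using hm 4 0
    · simpa [pow_succ, monThreeFive] using hm 0 1
    · simpa [pow_succ, monThreeFive] using hm 1 1
    · simpa [pow_succ, monThreeFive] using hm 2 1
    · simpa [pow_succ, monThreeFive] using hm 3 1
    · simpa [pow_succ, monThreeFive] using hm 0 2
    · simpa [pow_succ, monThreeFive] using hm 1 2
  have hy : ∀ k, y * ![1, y, y * y] k ∈ polySpan x ![1, y, y * y] := by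
    intro k
    fin_cases k
    · simpa [monThreeFive] using hm 0 1
    · simpa [monThreeFive] using hm 0 2
    · change y * (y * y) ∈ _
      rw [← mul_assoc, h]
      refine add_mem ?_ (sum_mem fun i _ => cond_mem (hmon i) _)
      simpa [pow_succ, monThreeFive] using hm 5 0
  fin_cases i
  · simpa [monThreeFive] using hm 0 j
  · exact hy j
  · change y * y * _ ∈ _
    rw [mul_assoc]
    exact polySpan_mul_left hy (hy j)

variable {K : Type} [Field K] [Algebra (ZMod 2) K] [GenusFourFive K] {P : Place F₂ K}

lemma fst_monThreeFive {A B : Type} [CommRing A] [CommRing B] (p q : A × B) (i : Fin 11) :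
    (monThreeFive p q i).1 = monThreeFive p.1 q.1 i ∧
      (monThreeFive p q i).2 = monThreeFive p.2 q.2 i := by
  fin_cases i <;> exact ⟨rfl, rfl⟩

/-- The pole orders at a place of degree one do not begin with three and five. -/
lemma not_threeFive (hP : placeDegree F₂ P = 1) (h1 : lseq K 1 = 1) (h2 : lseq K 2 = 1)
    (h3 : lseq K 3 = 2) (h4 : lseq K 4 = 2) (h5 : lseq K 5 = 3) : False := by
  have h0 := lseq_zero (K := K)
  have h6 := lseq_six (K := K)
  have h7 : ∀ n : ℤ, 7 ≤ n → (lseq K n : ℤ) = n - 3 := fun n hn => lseq_large _ hn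
  obtain ⟨x, hx⟩ := exists_hasPole hP (n := 3) (by norm_num [h2, h3])
  obtain ⟨y, hy⟩ := exists_hasPole hP (n := 5) (by norm_num [h4, h5])
  have hm : ∀ a c : ℕ, HasPole P (a * 3 + c * 5) (x ^ a * y ^ c) := fun a c =>
    (hx.pow a).mul (hy.pow c)
  -- the equation
  obtain ⟨b, hb⟩ : ∃ b : Fin 11 → Bool,
      y * y * y - x * x * x * x * x = ∑ i, cond (b i) (monThreeFive x y i) 0 := by
    refine exists_expansion ?_
    have hy3 : HasPole P 15 (y * y * y) := by simpa [pow_succ, monThreeFive] using hm 0 3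
    have hx5 : HasPole P 15 (x * x * x * x * x) := by simpa [pow_succ, monThreeFive] using hm 5 0
    have hd := hx5.sub_mem hP hy3
    have hs : ∀ i, monThreeFive x y i ∈ Submodule.span F₂ (Set.range (monThreeFive x y)) :=
      fun i => Submodule.subset_span ⟨i, rfl⟩
    refine RR_le_of_poles hP _ 14 ?_ hd
    intro m hm14
    interval_cases m
    · exact .inl ⟨_, hs 0, by simpa [pow_succ, monThreeFive] using hm 0 0⟩
    · right; norm_num [h0, h1]
    · right; norm_num [h2, h1]
    · exact .inl ⟨_, hs 1, by simpa [pow_succ, monThreeFive] using hm 1 0⟩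
    · right; norm_num [h3, h4]
    · exact .inl ⟨_, hs 5, by simpa [pow_succ, monThreeFive] using hm 0 1⟩
    · exact .inl ⟨_, hs 2, by simpa [pow_succ, monThreeFive] using hm 2 0⟩
    · right; have := h7 7 le_rfl; norm_num [h6]; omega
    · exact .inl ⟨_, hs 6, by simpa [pow_succ, monThreeFive] using hm 1 1⟩
    · exact .inl ⟨_, hs 3, by simpa [pow_succ, monThreeFive] using hm 3 0⟩
    · exact .inl ⟨_, hs 9, by simpa [pow_succ, monThreeFive] using hm 0 2⟩
    · exact .inl ⟨_, hs 7, by simpa [pow_succ, monThreeFive] using hm 2 1⟩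
    · exact .inl ⟨_, hs 4, by simpa [pow_succ, monThreeFive] using hm 4 0⟩
    · exact .inl ⟨_, hs 10, by simpa [pow_succ, monThreeFive] using hm 1 2⟩
    · exact .inl ⟨_, hs 8, by simpa [pow_succ, monThreeFive] using hm 3 1⟩
  obtain ⟨a, c, hac⟩ := exists_solution_threeFive b
  have hrel : (y, c) * (y, c) * (y, c) = (x, a) * (x, a) * (x, a) * (x, a) * (x, a) +
      ∑ i, cond (b i) (monThreeFive (x, a) (y, c) i) 0 := by
    refine Prod.ext ?_ ?_
    · rw [Prod.fst_add, fst_sum_cond]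
      simp only [fst_monThreeFive, Prod.fst_mul, ← hb]
      ring
    · rw [Prod.snd_add, snd_sum_cond]
      simp only [fst_monThreeFive, Prod.snd_mul, hac]
  have hmul := mul_mem_threeFive hrel
  have hfg : (![1, (y, c), (y, c) * (y, c)] : Fin 3 → K × GF 4 tabSixteen) =
      fun i => (![1, y, y * y] i, ![1, c, c * c] i) := by
    funext i; fin_cases i <;> rfl
  rw [hfg] at hmul
  have hpole : ∀ i : Fin 3, HasPole P (5 * (i : ℕ) : ℤ) (![1, y, y * y] i) := by
    intro i
    fin_cases i
    · simpa [pow_succ, monThreeFive] using hm 0 0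
    · simpa [pow_succ, monThreeFive] using hm 0 1
    · simpa [pow_succ, monThreeFive] using hm 0 2
  have hind : PolyIndep x ![1, y, y * y] := by
    refine polyIndep_of_poles (by norm_num) hx hpole ?_
    intro i j hij
    ext
    omega
  have hB : ∀ g ∈ affineRing (Finsupp.single P 1 : Divisor F₂ K), g ∈ polySpan x ![1, y, y * y] := by
    intro g hg
    obtain ⟨N, hN⟩ := affineRing_mem_RR (single_nonneg P) hg
    refine RR_le_of_poles hP _ N ?_ hN
    intro m _
    have hpm : ∀ (a : ℕ) (j : Fin 3), (∃ e ∈ polySpan x ![1, y, y * y],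
        HasPole P (a * 3 + 5 * (j : ℕ) : ℤ) e) := fun a j =>
      ⟨_, pow_mul_mem_polySpan (mem_polySpan j) a, (hx.pow a).mul (hpole j)⟩
    by_cases hgap : m = 1 ∨ m = 2 ∨ m = 4 ∨ m = 7
    · right
      rcases hgap with rfl | rfl | rfl | rfl
      · norm_num [h0, h1]
      · norm_num [h2, h1]
      · norm_num [h3, h4]
      · have := h7 7 le_rfl; norm_num [h6]; omega
    · left
      have : ∃ (a : ℕ) (j : Fin 3), m = a * 3 + 5 * (j : ℕ) := by
        have h3 : m % 3 = 0 ∨ m % 3 = 1 ∨ m % 3 = 2 := by omega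
        rcases h3 with h3 | h3 | h3
        · exact ⟨m / 3, 0, by simp; omega⟩
        · exact ⟨(m - 10) / 3, 2, by simp; omega⟩
        · exact ⟨(m - 5) / 3, 1, by simp; omega⟩
      obtain ⟨a, j, hmj⟩ := this
      obtain ⟨e, he, hp⟩ := hpm a j
      refine ⟨e, he, ?_⟩
      rw [hmj]; push_cast; exact hp
  have hone : (1 : K × GF 4 tabSixteen) ∈
      polySpan (x, a) (fun i => (![1, y, y * y] i, ![1, c, c * c] i)) := by
    rw [← hfg]
    exact mem_polySpan (h := ![1, (y, c), (y, c) * (y, c)]) 0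
  obtain ⟨χ, -⟩ := exists_hom_of_basis hind hB a ![1, c, c * c] hone hmul
  obtain ⟨d, hd0, hd, hlt⟩ := lseq_lt_of_hom hP (GF.card 4 tabSixteen) χ
  have := Nat.le_of_dvd (by norm_num) hd
  interval_cases d
  · norm_num [h0, h1] at hlt
  · norm_num [h2, h1] at hlt
  · omega
  · norm_num [h3, h4] at hlt

end ThreeFive

section Search

/-- The lowest bits of the vanishing blocks of `e` bits. -/
def zeroMask (e mask w : ℕ) (f : ℕ → Bool) : Bool :=
  force w fun w =>
  force (Nat.rec w (fun i u => Nat.lor u (Nat.shiftRight w (Nat.succ i))) (Nat.pred e)) fun u =>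
  force (Nat.xor mask (Nat.land mask u)) f

/-- Extract the highest marked block. -/
def nextBlock (e k z : ℕ) (f : ℕ → ℕ → Bool) : Bool :=
  force (topBit k z 0) fun q => force (Nat.xor z (Nat.pow 2 q)) fun z' =>
    force (Nat.div q e) fun p => f p z'

lemma exists_of_zeroMask {e mask w : ℕ} {f : ℕ → Bool} (h : zeroMask e mask w f = true) :
    ∃ z, f z = true := by
  simp only [zeroMask, force_eq] at h
  exact ⟨_, h⟩

lemma exists_of_nextBlock {e k z : ℕ} {f : ℕ → ℕ → Bool} (h : nextBlock e k z f = true) :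
    ∃ p z', f p z' = true := by
  simp only [nextBlock, force_eq] at h
  exact ⟨_, _, h⟩

lemma of_cond_false {a b : Bool} (h : cond a b false = true) : a = true ∧ b = true := by
  cases a
  · exact absurd h (by simp)
  · exact ⟨rfl, h⟩

lemma of_cond_true {a b : Bool} (h : cond a true b = true) : a = true ∨ b = true := by
  cases a
  · exact .inr h
  · exact .inl rfl

/-- A point given by three coordinates of `e` bits. -/
def withCoords {α : Type} (e p : ℕ) (f : ℕ → ℕ → ℕ → α) : α :=
  force (Nat.pow 2 e) fun q =>
  force (Nat.mod (Nat.div (Nat.div p q) q) q) fun x => force (Nat.mod (Nat.div p q) q) fun y =>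
    force (Nat.mod p q) fun z => f x y z

lemma withCoords_eq {α : Type} (e p : ℕ) (f : ℕ → ℕ → ℕ → α) :
    withCoords e p f = f (p / 2 ^ e / 2 ^ e % 2 ^ e) (p / 2 ^ e % 2 ^ e) (p % 2 ^ e) := by
  simp only [withCoords, force_eq]
  rfl

/-- The coordinates of a point. -/
def coords (e t p : ℕ) : GF e t × GF e t × GF e t :=
  (⟨p / 2 ^ e / 2 ^ e % 2 ^ e, Nat.mod_lt _ (Nat.two_pow_pos e)⟩,
    ⟨p / 2 ^ e % 2 ^ e, Nat.mod_lt _ (Nat.two_pow_pos e)⟩,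
    ⟨p % 2 ^ e, Nat.mod_lt _ (Nat.two_pow_pos e)⟩)

end Search

section FourFiveSix

/-- Monomials of pole order less than ten, for poles of orders four, five and six. -/
def monFirst {R : Type} [CommRing R] (w t z : R) : Fin 6 → R := ![1, w, t, z, w * w, w * t]

/-- Monomials of pole order less than twelve, for poles of orders four, five and six. -/
def monSecond {R : Type} [CommRing R] (w t z : R) : Fin 8 → R :=
  ![1, w, t, z, w * w, w * t, w * z, t * z]

/-- Test a solution of the equations for poles of orders four, five and six. -/
def testFourFiveSix (e tab : ℕ) (l₁ l₂ : List Bool) (p : ℕ) : Bool :=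
  withCoords e p fun w t z =>
    let m := tabMul e tab
    cond (Nat.beq (m t t) (Nat.xor (m w z) (dot l₁ [1, w, t, z, m w w, m w t])))
      (Nat.beq (m z z) (Nat.xor (m (m w w) w) (dot l₂ [1, w, t, z, m w w, m w t, m w z, m t z])))
      false

lemma testFourFiveSix_spec {e tab : ℕ} [GF.Valid e tab] {b₁ : Fin 6 → Bool} {b₂ : Fin 8 → Bool}
    {p : ℕ} (h : testFourFiveSix e tab (List.ofFn b₁) (List.ofFn b₂) p = true) :
    ∃ w t z : GF e tab, t * t = w * z + ∑ i, cond (b₁ i) (monFirst w t z i) 0 ∧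
      z * z = w * w * w + ∑ i, cond (b₂ i) (monSecond w t z i) 0 := by
  rw [testFourFiveSix, withCoords_eq] at h
  obtain ⟨h₁, h₂⟩ := of_cond_false h
  refine ⟨(coords e tab p).1, (coords e tab p).2.1, (coords e tab p).2.2, Fin.ext ?_, Fin.ext ?_⟩
  · rw [GF.val_add, GF.val_sum_cond]
    exact Nat.eq_of_beq_eq_true h₁
  · rw [GF.val_add, GF.val_sum_cond]
    exact Nat.eq_of_beq_eq_true h₂

/-- The values of the monomials and of the constant parts of the equations. -/
def valuesFourFiveSix (e tab p : ℕ) : List ℕ :=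
  withCoords e p fun w t z =>
    let m := tabMul e tab
    [Nat.add (Nat.xor (m t t) (m w z)) (Nat.shiftLeft (Nat.xor (m z z) (m (m w w) w)) e),
      1, w, t, z, m w w, m w t, m w z, m t z]

/-- Find a solution of the equations for poles of orders four, five and six. -/
def checkFourFiveSix : Bool :=
  withTables 4 64 9 (valuesFourFiveSix 2 tabFour) fun u => withTables 6 512 9 (valuesFourFiveSix 3 tabEight) fun v =>
  allBits 6 fun l₁ =>
    force (dot (true :: l₁) u) fun s₄ =>
    force (dot (true :: l₁) v) fun s₈ =>
    allBits 8 fun l₂ =>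
      cond (zeroBlock 4 8 (Nat.div (Nat.pow 2 256) 15) (Nat.xor s₄ (Nat.shiftLeft (dot (false :: l₂) u) 2))
          (testFourFiveSix 2 tabFour l₁ l₂)) true
        (zeroBlock 6 12 (Nat.div (Nat.pow 2 3072) 63)
          (Nat.xor s₈ (Nat.shiftLeft (dot (false :: l₂) v) 3)) (testFourFiveSix 3 tabEight l₁ l₂))

lemma checkFourFiveSix_eq : checkFourFiveSix = true := by decide +kernel

theorem exists_solution_fourFiveSix (b₁ : Fin 6 → Bool) (b₂ : Fin 8 → Bool) :
    (∃ w t z : GF 2 tabFour, t * t = w * z + ∑ i, cond (b₁ i) (monFirst w t z i) 0 ∧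
      z * z = w * w * w + ∑ i, cond (b₂ i) (monSecond w t z i) 0) ∨
    ∃ w t z : GF 3 tabEight, t * t = w * z + ∑ i, cond (b₁ i) (monFirst w t z i) 0 ∧
      z * z = w * w * w + ∑ i, cond (b₂ i) (monSecond w t z i) 0 := by
  obtain ⟨u, hu⟩ := exists_of_withTables checkFourFiveSix_eq
  obtain ⟨v, hv⟩ := exists_of_withTables hu
  have h := allBits_spec hv b₁
  rw [force_eq, force_eq] at h
  refine (of_cond_true (allBits_spec h b₂)).imp (fun h => ?_) fun h => ?_
  · obtain ⟨p, hp⟩ := exists_of_zeroBlock h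
    exact testFourFiveSix_spec hp
  · obtain ⟨p, hp⟩ := exists_of_zeroBlock h
    exact testFourFiveSix_spec hp

end FourFiveSix

section DegreeTwo

/-- Monomials with a pole of order at most two at a place of degree two. -/
def monTwo {R : Type} [CommRing R] (x g h : R) : Fin 7 → R :=
  ![1, x, g, h, x * x, x * g, x * h]

/-- Test a solution of the equations at a place of degree two. -/
def testTwo (e tab : ℕ) (l₁ l₂ : List Bool) (p : ℕ) : Bool :=
  withCoords e p fun x g h =>
    let m := tabMul e tab
    cond (Nat.beq (Nat.xor (Nat.xor (m g g) (m g h)) (m h h))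
      (dot l₁ [1, x, g, h, m x x, m x g, m x h]))
      (Nat.beq (m g g) (Nat.xor (m (m x x) x) (dot l₂ [1, x, g, h, m x x, m x g, m x h])))
      false

lemma testTwo_spec {e tab : ℕ} [GF.Valid e tab] {b₁ : Fin 7 → Bool} {b₂ : Fin 7 → Bool}
    {p : ℕ} (h : testTwo e tab (List.ofFn b₁) (List.ofFn b₂) p = true) {x g k : GF e tab}
    (hp : coords e tab p = (x, g, k)) :
    g * g + g * k + k * k = ∑ i, cond (b₁ i) (monTwo x g k i) 0 ∧
      g * g = x * x * x + ∑ i, cond (b₂ i) (monTwo x g k i) 0 := by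
  rw [testTwo, withCoords_eq] at h
  obtain ⟨h₁, h₂⟩ := of_cond_false h
  obtain rfl : (coords e tab p).1 = x := by rw [hp]
  obtain rfl : (coords e tab p).2.1 = g := by rw [hp]
  obtain rfl : (coords e tab p).2.2 = k := by rw [hp]
  refine ⟨Fin.ext ?_, Fin.ext ?_⟩
  · rw [GF.val_sum_cond]
    exact Nat.eq_of_beq_eq_true h₁
  · rw [GF.val_add, GF.val_sum_cond]
    exact Nat.eq_of_beq_eq_true h₂

/-- The values of the monomials and of the constant parts of the equations. -/
def valuesTwo (e tab p : ℕ) : List ℕ :=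
  withCoords e p fun x g h =>
    let m := tabMul e tab
    [Nat.add (Nat.xor (Nat.xor (m g g) (m g h)) (m h h)) (Nat.shiftLeft (Nat.xor (m g g) (m (m x x) x)) e),
      1, x, g, h, m x x, m x g, m x h]

/-- Find four solutions over the field with eight elements. -/
def fourSolutions (z : ℕ) (f : ℕ → Bool) : Bool :=
  nextBlock 6 12 z fun p z => cond (f p) (nextBlock 6 12 z fun q z => cond (f q)
    (cond (Nat.blt q p) (nextBlock 6 12 z fun r z => cond (f r) (cond (Nat.blt r q)
      (nextBlock 6 12 z fun s _ => cond (f s) (Nat.blt s r) false) false) false) false) false) false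

lemma fourSolutions_spec {z : ℕ} {f : ℕ → Bool} (h : fourSolutions z f = true) :
    ∃ p : Fin 4 → ℕ, Function.Injective p ∧ ∀ i, f (p i) = true := by
  obtain ⟨p, z, h⟩ := exists_of_nextBlock h
  obtain ⟨hp, h⟩ := of_cond_false h
  obtain ⟨q, z, h⟩ := exists_of_nextBlock h
  obtain ⟨hq, h⟩ := of_cond_false h
  obtain ⟨hpq, h⟩ := of_cond_false h
  obtain ⟨r, z, h⟩ := exists_of_nextBlock h
  obtain ⟨hr, h⟩ := of_cond_false h
  obtain ⟨hqr, h⟩ := of_cond_false h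
  obtain ⟨s, z, h⟩ := exists_of_nextBlock h
  obtain ⟨hs, hrs⟩ := of_cond_false h
  simp only [Nat.blt, Nat.ble_eq] at hpq hqr hrs
  refine ⟨![p, q, r, s], ?_, ?_⟩
  · intro i j hij
    fin_cases i <;> fin_cases j <;> simp at hij ⊢ <;> omega
  · intro i
    fin_cases i <;> assumption

/-- Test a solution over the field with eight elements, with a bound for the index. -/
def testTwoEight (l₁ l₂ : List Bool) (p : ℕ) : Bool :=
  cond (Nat.blt p 512) (testTwo 3 tabEight l₁ l₂ p) false

/-- Find solutions of the equations at a place of degree two. -/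
def checkTwo : Bool :=
  withTables 4 64 8 (valuesTwo 2 tabFour) fun u => withTables 6 512 8 (valuesTwo 3 tabEight) fun v =>
  allBits 7 fun l₁ =>
    force (dot (true :: l₁) u) fun s₄ =>
    force (dot (true :: l₁) v) fun s₈ =>
    allBits 7 fun l₂ =>
      cond (zeroBlock 4 8 (Nat.div (Nat.pow 2 256) 15) (Nat.xor s₄ (Nat.shiftLeft (dot (false :: l₂) u) 2))
          (testTwo 2 tabFour l₁ l₂)) true
        (zeroMask 6 (Nat.div (Nat.pow 2 3072) 63)
          (Nat.xor s₈ (Nat.shiftLeft (dot (false :: l₂) v) 3)) fun z => fourSolutions z (testTwoEight l₁ l₂))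

lemma checkTwo_eq : checkTwo = true := by decide +kernel

lemma coords_injOn {p q : ℕ} (hp : p < 512) (hq : q < 512)
    (h : coords 3 tabEight p = coords 3 tabEight q) : p = q := by
  have h1 : p / 2 ^ 3 / 2 ^ 3 % 2 ^ 3 = q / 2 ^ 3 / 2 ^ 3 % 2 ^ 3 := congrArg (fun c => c.1.1) h
  have h2 : p / 2 ^ 3 % 2 ^ 3 = q / 2 ^ 3 % 2 ^ 3 := congrArg (fun c => c.2.1.1) h
  have h3 : p % 2 ^ 3 = q % 2 ^ 3 := congrArg (fun c => c.2.2.1) h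
  omega

theorem exists_solution_two (b₁ b₂ : Fin 7 → Bool) :
    (∃ x g h : GF 2 tabFour, g * g + g * h + h * h = ∑ i, cond (b₁ i) (monTwo x g h i) 0 ∧
      g * g = x * x * x + ∑ i, cond (b₂ i) (monTwo x g h i) 0) ∨
    ∃ c : Fin 4 → GF 3 tabEight × GF 3 tabEight × GF 3 tabEight, Function.Injective c ∧
      ∀ j x g h, c j = (x, g, h) → g * g + g * h + h * h = ∑ i, cond (b₁ i) (monTwo x g h i) 0 ∧
        g * g = x * x * x + ∑ i, cond (b₂ i) (monTwo x g h i) 0 := by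
  obtain ⟨u, hu⟩ := exists_of_withTables checkTwo_eq
  obtain ⟨v, hv⟩ := exists_of_withTables hu
  have h := allBits_spec hv b₁
  rw [force_eq, force_eq] at h
  refine (of_cond_true (allBits_spec h b₂)).imp (fun h => ?_) fun h => ?_
  · obtain ⟨p, hp⟩ := exists_of_zeroBlock h
    exact ⟨_, _, _, testTwo_spec hp rfl⟩
  · obtain ⟨z, hz⟩ := exists_of_zeroMask h
    obtain ⟨p, hp, hf⟩ := fourSolutions_spec hz
    have hlt : ∀ j, p j < 512 := fun j => by
      have := (of_cond_false (hf j)).1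
      simp only [Nat.blt, Nat.ble_eq] at this; exact this
    refine ⟨fun j => coords 3 tabEight (p j), fun i j hij => hp (coords_injOn (hlt i) (hlt j) hij),
      fun j x g k hj => testTwo_spec (of_cond_false (hf j)).2 hj⟩

end DegreeTwo

section FourFiveSix

lemma mul_mem_fourFiveSix {R : Type} [CommRing R] [Algebra (ZMod 2) R] {w t z : R}
    {b₁ : Fin 6 → Bool} {b₂ : Fin 8 → Bool}
    (h₁ : t * t = w * z + ∑ i, cond (b₁ i) (monFirst w t z i) 0)
    (h₂ : z * z = w * w * w + ∑ i, cond (b₂ i) (monSecond w t z i) 0) (i j : Fin 4) :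
    ![1, t, z, t * z] i * ![1, t, z, t * z] j ∈ polySpan w ![1, t, z, t * z] := by
  have hw : ∀ (a : ℕ) {r : R}, r ∈ polySpan w ![1, t, z, t * z] →
      w ^ a * r ∈ polySpan w ![1, t, z, t * z] := fun a r hr => pow_mul_mem_polySpan hr a
  have hm : ∀ (a : ℕ) (j : Fin 4), w ^ a * ![1, t, z, t * z] j ∈ polySpan w ![1, t, z, t * z] :=
    fun a j => hw a (mem_polySpan j)
  have htt : t * t ∈ polySpan w ![1, t, z, t * z] := by
    rw [h₁]
    refine add_mem (by simpa using hm 1 2) (sum_mem fun i _ => cond_mem ?_ _)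
    fin_cases i
    · simpa [monFirst] using hm 0 0
    · simpa [monFirst] using hm 1 0
    · simpa [monFirst] using hm 0 1
    · simpa [monFirst] using hm 0 2
    · simpa [monFirst, pow_succ] using hm 2 0
    · simpa [monFirst] using hm 1 1
  have hzz : z * z ∈ polySpan w ![1, t, z, t * z] := by
    rw [h₂]
    refine add_mem (by simpa [pow_succ] using hm 3 0) (sum_mem fun i _ => cond_mem ?_ _)
    fin_cases i
    · simpa [monSecond] using hm 0 0
    · simpa [monSecond] using hm 1 0
    · simpa [monSecond] using hm 0 1
    · simpa [monSecond] using hm 0 2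
    · simpa [monSecond, pow_succ] using hm 2 0
    · simpa [monSecond] using hm 1 1
    · simpa [monSecond] using hm 1 2
    · simpa [monSecond] using hm 0 3
  have htz : t * z ∈ polySpan w ![1, t, z, t * z] := by simpa using hm 0 3
  have htzz : t * t * z ∈ polySpan w ![1, t, z, t * z] := by
    rw [h₁, add_mul, Finset.sum_mul]
    refine add_mem (by simpa [mul_assoc] using hw 1 hzz)
      (sum_mem fun i _ => polySpan_cond_mul ?_ _)
    fin_cases i
    · simpa [monFirst] using hm 0 2
    · simpa [monFirst] using hm 1 2
    · simpa [monFirst] using hm 0 3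
    · simpa [monFirst] using hzz
    · simpa [monFirst, pow_succ] using hm 2 2
    · simpa [monFirst, mul_assoc] using hm 1 3
  have hzzt : z * z * t ∈ polySpan w ![1, t, z, t * z] := by
    rw [h₂, add_mul, Finset.sum_mul]
    refine add_mem (by simpa [pow_succ] using hm 3 1)
      (sum_mem fun i _ => polySpan_cond_mul ?_ _)
    fin_cases i
    · simpa [monSecond] using hm 0 1
    · simpa [monSecond] using hm 1 1
    · simpa [monSecond] using htt
    · simpa [monSecond, mul_comm z t] using htz
    · simpa [monSecond, pow_succ] using hm 2 1
    · simpa [monSecond, mul_assoc] using hw 1 htt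
    · simpa [monSecond, mul_assoc, mul_comm z t] using hw 1 htz
    · simpa [monSecond, mul_right_comm t z t] using htzz
  have ht : ∀ k, t * ![1, t, z, t * z] k ∈ polySpan w ![1, t, z, t * z] := by
    intro k
    fin_cases k
    · simpa using hm 0 1
    · exact htt
    · exact htz
    · simpa [mul_assoc] using htzz
  have hz : ∀ k, z * ![1, t, z, t * z] k ∈ polySpan w ![1, t, z, t * z] := by
    intro k
    fin_cases k
    · simpa using hm 0 2
    · simpa [mul_comm z t] using htz
    · exact hzz
    · simpa [mul_assoc, mul_comm z t] using hzzt
  fin_cases i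
  · simpa using hm 0 j
  · exact ht j
  · exact hz j
  · change t * z * _ ∈ _
    rw [mul_assoc]
    exact polySpan_mul_left ht (hz j)

lemma fst_monFirst {A B : Type} [CommRing A] [CommRing B] (w t z : A × B) (i : Fin 6) :
    (monFirst w t z i).1 = monFirst w.1 t.1 z.1 i ∧
      (monFirst w t z i).2 = monFirst w.2 t.2 z.2 i := by
  fin_cases i <;> exact ⟨rfl, rfl⟩

lemma fst_monSecond {A B : Type} [CommRing A] [CommRing B] (w t z : A × B) (i : Fin 8) :
    (monSecond w t z i).1 = monSecond w.1 t.1 z.1 i ∧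
      (monSecond w t z i).2 = monSecond w.2 t.2 z.2 i := by
  fin_cases i <;> exact ⟨rfl, rfl⟩

variable {K : Type} [Field K] [Algebra (ZMod 2) K] [GenusFourFive K] {P : Place F₂ K}

/-- The pole orders at a place of degree one do not begin with four, five and six. -/
lemma not_fourFiveSix (hP : placeDegree F₂ P = 1) (h1 : lseq K 1 = 1) (h2 : lseq K 2 = 1)
    (h3 : lseq K 3 = 1) (h4 : lseq K 4 = 2) (h5 : lseq K 5 = 3) : False := by
  have h0 := lseq_zero (K := K)
  have h6 := lseq_six (K := K)
  have h7 : ∀ n : ℤ, 7 ≤ n → (lseq K n : ℤ) = n - 3 := fun n hn => lseq_large _ hn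
  obtain ⟨w, hw⟩ := exists_hasPole hP (n := 4) (by norm_num [h3, h4])
  obtain ⟨t, ht⟩ := exists_hasPole hP (n := 5) (by norm_num [h4, h5])
  obtain ⟨z, hz⟩ := exists_hasPole hP (n := 6) (by norm_num [h5, h6])
  have hm : ∀ a c d : ℕ, HasPole P (a * 4 + c * 5 + d * 6) (w ^ a * t ^ c * z ^ d) :=
    fun a c d => ((hw.pow a).mul (ht.pow c)).mul (hz.pow d)
  obtain ⟨b₁, hb₁⟩ : ∃ b : Fin 6 → Bool,
      t * t - w * z = ∑ i, cond (b i) (monFirst w t z i) 0 := by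
    refine exists_expansion ?_
    have hl : HasPole P 10 (t * t) := by simpa [pow_succ] using hm 0 2 0
    have hr : HasPole P 10 (w * z) := by simpa [pow_succ] using hm 1 0 1
    have hd := hr.sub_mem hP hl
    have hs : ∀ i, monFirst w t z i ∈ Submodule.span F₂ (Set.range (monFirst w t z)) :=
      fun i => Submodule.subset_span ⟨i, rfl⟩
    refine RR_le_of_poles hP _ 9 ?_ hd
    intro m hm9
    interval_cases m
    · exact .inl ⟨_, hs 0, by simpa [pow_succ, monFirst] using hm 0 0 0⟩
    · right; norm_num [h0, h1]
    · right; norm_num [h2, h1]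
    · right; norm_num [h2, h3]
    · exact .inl ⟨_, hs 1, by simpa [pow_succ, monFirst] using hm 1 0 0⟩
    · exact .inl ⟨_, hs 2, by simpa [pow_succ, monFirst] using hm 0 1 0⟩
    · exact .inl ⟨_, hs 3, by simpa [pow_succ, monFirst] using hm 0 0 1⟩
    · right; have := h7 7 le_rfl; norm_num [h6]; omega
    · exact .inl ⟨_, hs 4, by simpa [pow_succ, monFirst] using hm 2 0 0⟩
    · exact .inl ⟨_, hs 5, by simpa [pow_succ, monFirst] using hm 1 1 0⟩
  obtain ⟨b₂, hb₂⟩ : ∃ b : Fin 8 → Bool,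
      z * z - w * w * w = ∑ i, cond (b i) (monSecond w t z i) 0 := by
    refine exists_expansion ?_
    have hl : HasPole P 12 (z * z) := by simpa [pow_succ] using hm 0 0 2
    have hr : HasPole P 12 (w * w * w) := by simpa [pow_succ] using hm 3 0 0
    have hd := hr.sub_mem hP hl
    have hs : ∀ i, monSecond w t z i ∈ Submodule.span F₂ (Set.range (monSecond w t z)) :=
      fun i => Submodule.subset_span ⟨i, rfl⟩
    refine RR_le_of_poles hP _ 11 ?_ hd
    intro m hm11
    interval_cases m
    · exact .inl ⟨_, hs 0, by simpa [pow_succ, monSecond] using hm 0 0 0⟩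
    · right; norm_num [h0, h1]
    · right; norm_num [h2, h1]
    · right; norm_num [h2, h3]
    · exact .inl ⟨_, hs 1, by simpa [pow_succ, monSecond] using hm 1 0 0⟩
    · exact .inl ⟨_, hs 2, by simpa [pow_succ, monSecond] using hm 0 1 0⟩
    · exact .inl ⟨_, hs 3, by simpa [pow_succ, monSecond] using hm 0 0 1⟩
    · right; have := h7 7 le_rfl; norm_num [h6]; omega
    · exact .inl ⟨_, hs 4, by simpa [pow_succ, monSecond] using hm 2 0 0⟩
    · exact .inl ⟨_, hs 5, by simpa [pow_succ, monSecond] using hm 1 1 0⟩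
    · exact .inl ⟨_, hs 6, by simpa [pow_succ, monSecond] using hm 1 0 1⟩
    · exact .inl ⟨_, hs 7, by simpa [pow_succ, monSecond] using hm 0 1 1⟩
  have hpole : ∀ i : Fin 4, HasPole P (![0, 5, 6, 11] i) (![1, t, z, t * z] i) := by
    intro i
    fin_cases i
    · simpa using hm 0 0 0
    · simpa using hm 0 1 0
    · simpa using hm 0 0 1
    · simpa using hm 0 1 1
  have hind : PolyIndep w ![1, t, z, t * z] := by
    refine polyIndep_of_poles (by norm_num) hw hpole ?_
    intro i j
    fin_cases i <;> fin_cases j <;> simp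
  have hB : ∀ g ∈ affineRing (Finsupp.single P 1 : Divisor F₂ K),
      g ∈ polySpan w ![1, t, z, t * z] := by
    intro g hg
    obtain ⟨N, hN⟩ := affineRing_mem_RR (single_nonneg P) hg
    refine RR_le_of_poles hP _ N ?_ hN
    intro m _
    by_cases hgap : m = 1 ∨ m = 2 ∨ m = 3 ∨ m = 7
    · right
      rcases hgap with rfl | rfl | rfl | rfl
      · norm_num [h0, h1]
      · norm_num [h2, h1]
      · norm_num [h3, h2]
      · have := h7 7 le_rfl; norm_num [h6]; omega
    · left
      have : ∃ (a : ℕ) (j : Fin 4), (m : ℤ) = a * 4 + (![0, 5, 6, 11] j : ℤ) := by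
        have h4 : m % 4 = 0 ∨ m % 4 = 1 ∨ m % 4 = 2 ∨ m % 4 = 3 := by omega
        rcases h4 with h4 | h4 | h4 | h4
        · exact ⟨m / 4, 0, by simp; omega⟩
        · exact ⟨(m - 5) / 4, 1, by simp; omega⟩
        · exact ⟨(m - 6) / 4, 2, by simp; omega⟩
        · exact ⟨(m - 11) / 4, 3, by simp; omega⟩
      obtain ⟨a, j, hmj⟩ := this
      refine ⟨_, pow_mul_mem_polySpan (mem_polySpan j) a, ?_⟩
      rw [hmj]
      exact (hw.pow a).mul (hpole j)
  have key : ∀ {L : Type} [Field L] [Algebra F₂ L] [Finite L] (e : ℕ), Nat.card L = 2 ^ e →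
      (∃ a c d : L, c * c = a * d + ∑ i, cond (b₁ i) (monFirst a c d i) 0 ∧
        d * d = a * a * a + ∑ i, cond (b₂ i) (monSecond a c d i) 0) →
      ∃ d : ℕ, 0 < d ∧ d ∣ e ∧ lseq K (d - 1) < lseq K d := by
    rintro L _ _ _ e hL ⟨a, c, d, hac, hcd⟩
    have hr₁ : (t, c) * (t, c) = (w, a) * (z, d) +
        ∑ i, cond (b₁ i) (monFirst (w, a) (t, c) (z, d) i) 0 := by
      refine Prod.ext ?_ ?_
      · rw [Prod.fst_add, fst_sum_cond]
        simp only [fst_monFirst, Prod.fst_mul, ← hb₁]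
        ring
      · rw [Prod.snd_add, snd_sum_cond]
        simp only [fst_monFirst, Prod.snd_mul, hac]
    have hr₂ : (z, d) * (z, d) = (w, a) * (w, a) * (w, a) +
        ∑ i, cond (b₂ i) (monSecond (w, a) (t, c) (z, d) i) 0 := by
      refine Prod.ext ?_ ?_
      · rw [Prod.fst_add, fst_sum_cond]
        simp only [fst_monSecond, Prod.fst_mul, ← hb₂]
        ring
      · rw [Prod.snd_add, snd_sum_cond]
        simp only [fst_monSecond, Prod.snd_mul, hcd]
    have hmul := mul_mem_fourFiveSix hr₁ hr₂
    have hone := mem_polySpan (z := (w, a)) (h := ![1, (t, c), (z, d), (t, c) * (z, d)]) 0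
    have hfg : (![1, (t, c), (z, d), (t, c) * (z, d)] : Fin 4 → K × L) =
        fun i => (![1, t, z, t * z] i, ![1, c, d, c * d] i) := by
      funext i; fin_cases i <;> rfl
    rw [hfg] at hmul hone
    obtain ⟨χ, -⟩ := exists_hom_of_basis hind hB a ![1, c, d, c * d] hone hmul
    exact lseq_lt_of_hom hP hL χ
  rcases exists_solution_fourFiveSix b₁ b₂ with h | h
  · obtain ⟨d, hd0, hd, hlt⟩ := key 2 (GF.card 2 tabFour) h
    have := Nat.le_of_dvd (by norm_num) hd
    interval_cases d
    · norm_num [h0, h1] at hlt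
    · norm_num [h2, h1] at hlt
  · obtain ⟨d, hd0, hd, hlt⟩ := key 3 (GF.card 3 tabEight) h
    have := Nat.le_of_dvd (by norm_num) hd
    interval_cases d
    · norm_num [h0, h1] at hlt
    · norm_num [h2, h1] at hlt
    · norm_num [h3, h2] at hlt

end FourFiveSix

section NoDegreeOne

variable {K : Type} [Field K] [Algebra (ZMod 2) K] [GenusFourFive K]

lemma lseq_succ_of_place {P : Place F₂ K} (hP : placeDegree F₂ P = 1) (n : ℤ) :
    lseq K n ≤ lseq K (n + 1) ∧ lseq K (n + 1) ≤ lseq K n + 1 := by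
  have h1 := ell_step (n • Finsupp.single P 1 : Divisor F₂ K) P
  have h2 := ell_mono (K := K) (smul_le_smul_div (single_nonneg P) (m := n) (n := n + 1) (by omega))
  have h3 : (n • Finsupp.single P 1 + Finsupp.single P 1 : Divisor F₂ K) =
      (n + 1) • Finsupp.single P 1 := by rw [add_smul, one_smul]
  rw [h3] at h1
  rw [ell_eq_lseq, ell_eq_lseq, deg_smul_single hP, deg_smul_single hP] at h1 h2
  exact ⟨h2, by rwa [hP] at h1⟩

lemma placeDegree_ne_one (P : Place F₂ K) : placeDegree F₂ P ≠ 1 := by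
  intro hP
  have hlt := lseq_sub_lt (single_nonneg P) (by simp)
  rw [deg_place, hP] at hlt
  have hpos := lseq_pos_of_place P
  rw [hP] at hpos
  norm_num at hlt hpos
  have h0 := lseq_zero (K := K)
  have h4 := lseq_four K
  have h5 := lseq_five K
  have s0 := lseq_succ_of_place hP 0
  have s1 := lseq_succ_of_place hP 1
  have s2 := lseq_succ_of_place hP 2
  have s3 := lseq_succ_of_place hP 3
  norm_num at s0 s1 s2 s3
  have h1 : lseq K 1 = 1 := by
    by_contra h
    obtain ⟨x, hx⟩ := exists_hasPole hP (n := 1) (by norm_num; omega)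
    have := (hx.pow 2).lseq_lt hP
    norm_num at this
    omega
  rcases (by omega : lseq K 3 = 1 ∨ lseq K 3 = 2) with h3 | h3
  · exact not_fourFiveSix hP h1 (by omega) h3 (by omega) (by omega)
  · exact not_threeFive hP h1 (by omega) h3 (by omega) (by omega)

end NoDegreeOne

section LeadingTerms

variable {K : Type} [Field K] [Algebra (ZMod 2) K] [GenusFour K] {P : Place F₂ K}

lemma HasPole.mem_lev {n : ℤ} {f : K} (h : HasPole P n f) : f ∈ lev P (-n) := by
  have := mem_RR.1 h.1 P
  rwa [smul_single_apply] at this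

lemma aeval_sub_pow_mem_lev {d : ℤ} (hd : 0 < d) {x : K} (hx : HasPole P d x) {p : Polynomial F₂}
    (hp : p ≠ 0) : x ^ p.natDegree - Polynomial.aeval x p ∈ lev P (-(p.natDegree * d) + 1) := by
  have h2 : ∀ c : F₂, c ≠ 0 → c = 1 := by decide
  rw [Polynomial.aeval_eq_sum_range, Finset.sum_range_succ,
    h2 _ (show p.coeff p.natDegree ≠ 0 from Polynomial.leadingCoeff_ne_zero.2 hp), one_smul,
    sub_add_cancel_right]
  refine neg_mem (sum_mem fun j hj => Submodule.smul_mem _ _ ?_)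
  have h3 := Finset.mem_range.1 hj
  refine lev_mono P ?_ (hx.pow j).mem_lev
  have : (j : ℤ) + 1 ≤ p.natDegree := by exact_mod_cast h3
  nlinarith

/-- Independence over the polynomials in `x`, tested on leading terms. -/
lemma polyIndep_of_leading {d : ℤ} (hd : 0 < d) {x : K} (hx : HasPole P d x) {ι : Type} [Fintype ι]
    {f : ι → K} {n : ι → ℤ} (hf : ∀ i, HasPole P (n i) (f i))
    (hJ : ∀ (J : Finset ι) (a : ι → ℕ) (M : ℤ), J.Nonempty → (∀ i ∈ J, a i * d + n i = M) →
      ∑ i ∈ J, x ^ a i * f i ∉ lev P (-M + 1)) : PolyIndep x f := by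
  intro p hp
  by_contra h0
  let s := Finset.univ.filter fun i => p i ≠ 0
  have hs : s.Nonempty := by
    obtain ⟨i, hi⟩ := Function.ne_iff.1 h0
    exact ⟨i, Finset.mem_filter.2 ⟨Finset.mem_univ i, hi⟩⟩
  obtain ⟨i₀, hi₀, hmax⟩ := Finset.exists_max_image s (fun i => ((p i).natDegree * d + n i : ℤ)) hs
  let M : ℤ := (p i₀).natDegree * d + n i₀
  let J := s.filter fun i => ((p i).natDegree * d + n i : ℤ) = M
  refine hJ J (fun i => (p i).natDegree) M ⟨i₀, Finset.mem_filter.2 ⟨hi₀, rfl⟩⟩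
    (fun i hi => (Finset.mem_filter.1 hi).2) ?_
  have h1 : ∑ i ∈ J, x ^ (p i).natDegree * f i =
      ∑ i, ((if i ∈ J then x ^ (p i).natDegree * f i else 0) - Polynomial.aeval x (p i) * f i) := by
    rw [Finset.sum_sub_distrib, hp, sub_zero, Finset.sum_ite_mem, Finset.univ_inter]
  rw [h1]
  refine sum_mem fun i _ => ?_
  by_cases hpi : p i = 0
  · have : i ∉ J := fun h => (Finset.mem_filter.1 (Finset.mem_filter.1 h).1).2 hpi
    rw [if_neg this, hpi, map_zero, zero_mul, sub_zero]
    exact zero_mem _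
  by_cases hiJ : i ∈ J
  · rw [if_pos hiJ, ← sub_mul]
    have hM := (Finset.mem_filter.1 hiJ).2
    have := mul_mem_lev (aeval_sub_pow_mem_lev hd hx hpi) (hf i).mem_lev
    rwa [show -((p i).natDegree * d) + 1 + -n i = -M + 1 by rw [← hM]; ring] at this
  · rw [if_neg hiJ, zero_sub]
    have his : i ∈ s := Finset.mem_filter.2 ⟨Finset.mem_univ i, hpi⟩
    have h2 := hmax i his
    have h3 : ((p i).natDegree * d + n i : ℤ) ≠ M := fun h => hiJ (Finset.mem_filter.2 ⟨his, h⟩)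
    refine neg_mem (lev_mono P ?_ (((hx.aeval hd hpi).mul (hf i)).mem_lev))
    change (p i).natDegree * d + n i ≤ M at h2
    omega

lemma RR_le_of_steps (S : Submodule F₂ K) (N : ℕ)
    (h : ∀ m : ℕ, m ≤ N → RRspace F₂ ((m : ℤ) • Finsupp.single P 1) ≤
      RRspace F₂ (((m : ℤ) - 1) • Finsupp.single P 1) ⊔ S) :
    RRspace F₂ ((N : ℤ) • Finsupp.single P 1) ≤ S := by
  have key : ∀ M : ℕ, M ≤ N + 1 → RRspace F₂ (((M : ℤ) - 1) • Finsupp.single P 1) ≤ S := by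
    intro M
    induction M with
    | zero =>
      intro _ f hf
      by_cases h0 : f = 0
      · rw [h0]; exact zero_mem _
      exfalso
      have h1 : 0 < ell F₂ ((((0 : ℕ) : ℤ) - 1) • Finsupp.single P 1 : Divisor F₂ K) := by
        unfold ell
        rw [Module.finrank_pos_iff]
        exact ⟨⟨f, hf⟩, 0, fun h => h0 (congrArg Subtype.val h)⟩
      rw [ell_neg] at h1
      · exact absurd h1 (lt_irrefl 0)
      · rw [deg_smul, deg_single]
        have := placeDegree_pos P
        push_cast
        omega
    | succ M ih =>
      intro hM
      have h1 := h M (by omega)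
      rw [sup_eq_right.2 (ih (by omega))] at h1
      push_cast
      rwa [add_sub_cancel_right]
  have := key (N + 1) le_rfl
  push_cast at this
  rwa [add_sub_cancel_right] at this

lemma RR_le_sup_span {n : ℤ} {e : K} (he : HasPole P n e)
    (h : ell F₂ (n • Finsupp.single P 1 : Divisor F₂ K) ≤
      ell F₂ ((n - 1) • Finsupp.single P 1 : Divisor F₂ K) + 1) :
    RRspace F₂ (n • Finsupp.single P 1) ≤
      RRspace F₂ ((n - 1) • Finsupp.single P 1) ⊔ Submodule.span F₂ {e} := by
  have hle : RRspace F₂ ((n - 1) • Finsupp.single P 1) ⊔ Submodule.span F₂ {e} ≤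
      RRspace F₂ (n • Finsupp.single P 1) := by
    refine sup_le (RR_mono (smul_le_smul_div (single_nonneg P) (by omega))) ?_
    rw [Submodule.span_singleton_le_iff_mem]
    exact he.1
  have hlt : RRspace F₂ ((n - 1) • Finsupp.single P 1) <
      RRspace F₂ ((n - 1) • Finsupp.single P 1) ⊔ Submodule.span F₂ {e} := by
    refine lt_of_le_of_ne le_sup_left fun heq => ?_
    have h1 : e ∈ RRspace F₂ ((n - 1) • Finsupp.single P 1) := by
      rw [heq]
      exact Submodule.mem_sup_right (Submodule.mem_span_singleton_self e)
    exact (not_hasPole_iff he.1).2 h1 he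
  have hfin : FiniteDimensional F₂ ↥(RRspace F₂ ((n - 1) • Finsupp.single P 1) ⊔
      Submodule.span F₂ {e}) := Submodule.finiteDimensional_of_le hle
  have h2 := Submodule.finrank_lt_finrank_of_lt hlt
  refine (Submodule.eq_of_le_of_finrank_le hle ?_).ge
  unfold ell at h
  omega

/-- The residue field at a place of degree two, in terms of functions. -/
lemma exists_four_residue (hP : placeDegree F₂ P = 2) : ∃ u ∈ lev P 0, u * u + u + 1 ∈ lev P 1 ∧
    ∀ c ∈ lev P 0, c ∈ lev P 1 ∨ c - 1 ∈ lev P 1 ∨ c - u ∈ lev P 1 ∨ c - (1 + u) ∈ lev P 1 := by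
  have hcard := card_residue P
  rw [hP] at hcard
  let κ := IsLocalRing.ResidueField P.1
  have : Finite κ := Nat.finite_of_card_ne_zero (by rw [hcard]; norm_num)
  let _ : Fintype κ := Fintype.ofFinite κ
  have h4 : ∀ c : κ, c ^ 4 = c := by
    intro c
    have := FiniteField.pow_card c
    rwa [← Nat.card_eq_fintype_card, hcard] at this
  have h2 : (2 : κ) = 0 := by
    have h := h4 2
    have h3 : (2 : κ) * 7 = 0 := by linear_combination h
    rcases mul_eq_zero.1 h3 with h5 | h5
    · exact h5
    · have h6 : ((algebraMap F₂ κ) 2) = 2 := map_ofNat _ 2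
      rw [← h6, show (2 : F₂) = 0 from rfl, map_zero]
  obtain ⟨w, hw0, hw1⟩ : ∃ w : κ, w ≠ 0 ∧ w ≠ 1 := by
    by_contra h
    push Not at h
    have hsub : (Finset.univ : Finset κ) ⊆ {0, 1} := by
      intro c _
      by_cases hc : c = 0
      · simp [hc]
      · simp [h c hc]
    have h5 := Finset.card_le_card hsub
    rw [Finset.card_univ, ← Nat.card_eq_fintype_card, hcard] at h5
    have := Finset.card_le_two (a := (0 : κ)) (b := 1)
    omega
  have hw : w * w + w + 1 = 0 := by
    have : w * ((w - 1) * (w * w + w + 1)) = 0 := by linear_combination h4 w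
    rcases mul_eq_zero.1 this with h | h
    · exact absurd h hw0
    rcases mul_eq_zero.1 h with h | h
    · exact absurd (sub_eq_zero.1 h) hw1
    · exact h
  have hall : ∀ c : κ, c = 0 ∨ c = 1 ∨ c = w ∨ c = 1 + w := by
    intro c
    have : c * ((c - 1) * ((c - w) * (c - (1 + w)))) = 0 := by
      linear_combination h4 c + (c * (c - 1)) * hw + (c * (c - 1)) * (-c - c * w - 1) * h2
    rcases mul_eq_zero.1 this with h | h
    · exact .inl h
    rcases mul_eq_zero.1 h with h | h
    · exact .inr (.inl (sub_eq_zero.1 h))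
    rcases mul_eq_zero.1 h with h | h
    · exact .inr (.inr (.inl (sub_eq_zero.1 h)))
    · exact .inr (.inr (.inr (sub_eq_zero.1 h)))
  obtain ⟨u, hu⟩ := IsLocalRing.residue_surjective (R := P.1) w
  have hz : ∀ f : P.1, IsLocalRing.residue P.1 f = 0 ↔ (f : K) ∈ lev P 1 := fun f => by
    rw [IsLocalRing.residue_eq_zero_iff, mem_maximalIdeal_iff]
  refine ⟨u, mem_lev_zero.2 u.2, ?_, fun c hc => ?_⟩
  · refine (hz (u * u + u + 1)).1 ?_
    rw [map_add, map_add, map_mul, hu, map_one, hw]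
  · obtain ⟨c, rfl⟩ : ∃ c' : P.1, (c' : K) = c := ⟨⟨c, mem_lev_zero.1 hc⟩, rfl⟩
    rcases hall (IsLocalRing.residue P.1 c) with h | h | h | h
    · exact .inl ((hz c).1 h)
    · refine .inr (.inl ((hz (c - 1)).1 ?_))
      rw [map_sub, h, map_one, sub_self]
    · refine .inr (.inr (.inl ((hz (c - u)).1 ?_)))
      rw [map_sub, h, hu, sub_self]
    · refine .inr (.inr (.inr ((hz (c - (1 + u))).1 ?_)))
      rw [map_sub, map_add, h, hu, map_one, sub_self]

lemma RR_le_sup_pair {u : K} (hu : ∀ c ∈ lev P 0, c ∈ lev P 1 ∨ c - 1 ∈ lev P 1 ∨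
      c - u ∈ lev P 1 ∨ c - (1 + u) ∈ lev P 1) {n : ℤ} {S : Submodule F₂ K} {e e' : K}
    (he : HasPole P n e) (he' : e' ∈ RRspace F₂ (n • Finsupp.single P 1))
    (hee : e' - u * e ∈ lev P (-n + 1)) (hS : e ∈ S) (hS' : e' ∈ S) :
    RRspace F₂ (n • Finsupp.single P 1) ≤ RRspace F₂ ((n - 1) • Finsupp.single P 1) ⊔ S := by
  intro f hf
  have he0 := he.ne_zero
  have key : ∀ s ∈ S, s ∈ RRspace F₂ (n • Finsupp.single P 1) → f - s ∈ lev P (-n + 1) →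
      f ∈ RRspace F₂ ((n - 1) • Finsupp.single P 1) ⊔ S := by
    intro s hs hs' h
    rw [← sub_add_cancel f s]
    exact add_mem (Submodule.mem_sup_left (RR_sub_one (sub_mem hf hs') h))
      (Submodule.mem_sup_right hs)
  have hmul : ∀ c : K, c ∈ lev P 1 → e * c ∈ lev P (-n + 1) := fun c hc => mul_mem_lev he.mem_lev hc
  have hf' : f ∈ lev P (-n) := by
    have := mem_RR.1 hf P
    rwa [smul_single_apply] at this
  have hinv : e⁻¹ ∈ lev P n := by
    rw [mem_lev_iff (inv_ne_zero he0), ordAt_inv he0, he.ordAt]; omega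
  have hc : f * e⁻¹ ∈ lev P 0 := by
    have := mul_mem_lev hf' hinv
    rwa [neg_add_cancel] at this
  have hfe : e * (f * e⁻¹) = f := by field_simp
  rcases hu _ hc with h | h | h | h
  · refine key 0 (zero_mem _) (zero_mem _) ?_
    rw [sub_zero, ← hfe]; exact hmul _ h
  · refine key e hS he.1 ?_
    have := hmul _ h
    rwa [mul_sub, hfe, mul_one] at this
  · refine key e' hS' he' ?_
    have := sub_mem (hmul _ h) hee
    rw [mul_sub, hfe] at this
    convert this using 1; ring
  · refine key (e + e') (add_mem hS hS') (add_mem he.1 he') ?_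
    have := sub_mem (hmul _ h) hee
    rw [mul_sub, hfe] at this
    convert this using 1; ring

end LeadingTerms

section LowDegree

variable {K : Type} [Field K] [Algebra (ZMod 2) K] [GenusFourFive K]

omit [GenusFourFive K] in
lemma exists_single_le {D : Divisor F₂ K} (hD : 0 ≤ D) (h : D ≠ 0) :
    ∃ P : Place F₂ K, Finsupp.single P 1 ≤ D := by
  obtain ⟨P, hP⟩ := DFunLike.ne_iff.1 h
  refine ⟨P, fun Q => ?_⟩
  by_cases hQ : P = Q
  · subst hQ
    rw [Finsupp.single_eq_same]
    have h0 : 0 ≤ D P := hD P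
    have : D P ≠ 0 := hP
    omega
  · rw [Finsupp.single_eq_of_ne (Ne.symm hQ)]; exact hD Q

lemma two_le_placeDegree (P : Place F₂ K) : 2 ≤ placeDegree F₂ P := by
  have h1 := placeDegree_pos P
  have h2 := placeDegree_ne_one P
  omega

/-- Effective divisors of degree at most three are places. -/
lemma exists_place_of_deg_le {D : Divisor F₂ K} (hD : 0 ≤ D) (h : D ≠ 0) (h3 : deg D ≤ 3) :
    ∃ P : Place F₂ K, D = Finsupp.single P 1 := by
  obtain ⟨P, hP⟩ := exists_single_le hD h
  refine ⟨P, ?_⟩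
  by_contra hne
  obtain ⟨Q, hQ⟩ := exists_single_le (sub_nonneg.2 hP) (sub_ne_zero.2 hne)
  have h4 := deg_mono hQ
  rw [map_sub, deg_place, deg_place] at h4
  have := two_le_placeDegree P
  have := two_le_placeDegree Q
  omega

variable (K) in
lemma lseq_one : lseq K 1 = 0 := by
  by_contra h
  obtain ⟨D, hD, h1⟩ := exists_effective_deg (Nat.pos_of_ne_zero h)
  obtain ⟨P, rfl⟩ := exists_place_of_deg_le hD (by rintro rfl; simp at h1) (by omega)
  rw [deg_place] at h1
  exact placeDegree_ne_one P (by exact_mod_cast h1)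

end LowDegree

section DegreeTwo

lemma mul_mem_two {R : Type} [CommRing R] [Algebra (ZMod 2) R] {x g h : R}
    {b₁ : Fin 7 → Bool} {b₂ : Fin 7 → Bool}
    (h₁ : g * g + g * h + h * h = ∑ i, cond (b₁ i) (monTwo x g h i) 0)
    (h₂ : g * g = x * x * x + ∑ i, cond (b₂ i) (monTwo x g h i) 0) (i j : Fin 4) :
    ![1, g, h, g * h] i * ![1, g, h, g * h] j ∈ polySpan x ![1, g, h, g * h] := by
  have hx : ∀ (a : ℕ) {r : R}, r ∈ polySpan x ![1, g, h, g * h] →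
      x ^ a * r ∈ polySpan x ![1, g, h, g * h] := fun a r hr => pow_mul_mem_polySpan hr a
  have hm : ∀ (a : ℕ) (j : Fin 4), x ^ a * ![1, g, h, g * h] j ∈ polySpan x ![1, g, h, g * h] :=
    fun a j => hx a (mem_polySpan j)
  have hsum : ∀ (b : Fin 7 → Bool) (v : R), v ∈ polySpan x ![1, g, h, g * h] →
      g * v ∈ polySpan x ![1, g, h, g * h] → h * v ∈ polySpan x ![1, g, h, g * h] →
      (∑ i, cond (b i) (monTwo x g h i) 0) * v ∈ polySpan x ![1, g, h, g * h] := by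
    intro b v hv hgv hhv
    rw [Finset.sum_mul]
    refine sum_mem fun i _ => polySpan_cond_mul ?_ _
    fin_cases i
    · simpa [monTwo] using hv
    · simpa [monTwo] using hx 1 hv
    · simpa [monTwo] using hgv
    · simpa [monTwo] using hhv
    · simpa [monTwo, pow_succ] using hx 2 hv
    · simpa [monTwo, mul_assoc] using hx 1 hgv
    · simpa [monTwo, mul_assoc] using hx 1 hhv
  have hg : g ∈ polySpan x ![1, g, h, g * h] := by simpa using hm 0 1
  have hh : h ∈ polySpan x ![1, g, h, g * h] := by simpa using hm 0 2
  have hgh : g * h ∈ polySpan x ![1, g, h, g * h] := by simpa using hm 0 3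
  have h1 : (1 : R) ∈ polySpan x ![1, g, h, g * h] := by simpa using hm 0 0
  have hhg : h * g ∈ polySpan x ![1, g, h, g * h] := by
    rw [mul_comm h g]
    exact hgh
  have hgg : g * g ∈ polySpan x ![1, g, h, g * h] := by
    rw [h₂]
    refine add_mem (by simpa [pow_succ] using hm 3 0) ?_
    simpa using hsum b₂ 1 h1 (by simpa using hg) (by simpa using hh)
  have hhh : h * h ∈ polySpan x ![1, g, h, g * h] := by
    rw [show h * h = g * g + g * h + h * h - g * g - g * h by ring, h₁]
    refine sub_mem (sub_mem ?_ hgg) hgh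
    simpa using hsum b₁ 1 h1 (by simpa using hg) (by simpa using hh)
  have hggg : g * g * g ∈ polySpan x ![1, g, h, g * h] := by
    rw [h₂, add_mul]
    exact add_mem (by simpa [pow_succ] using hm 3 1) (hsum b₂ g hg hgg hhg)
  have hggh : g * g * h ∈ polySpan x ![1, g, h, g * h] := by
    rw [h₂, add_mul]
    exact add_mem (by simpa [pow_succ] using hm 3 2) (hsum b₂ h hh hgh hhh)
  have hhhg : h * h * g ∈ polySpan x ![1, g, h, g * h] := by
    rw [show h * h * g = (g * g + g * h + h * h) * g - g * g * g - g * g * h by ring, h₁]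
    exact sub_mem (sub_mem (hsum b₁ g hg hgg hhg) hggg) hggh
  have hgm : ∀ k, g * ![1, g, h, g * h] k ∈ polySpan x ![1, g, h, g * h] := by
    intro k
    fin_cases k
    · simpa using hm 0 1
    · exact hgg
    · exact hgh
    · simpa [mul_assoc] using hggh
  have hhm : ∀ k, h * ![1, g, h, g * h] k ∈ polySpan x ![1, g, h, g * h] := by
    intro k
    fin_cases k
    · simpa using hm 0 2
    · exact hhg
    · exact hhh
    · simpa [mul_assoc, mul_comm h g] using hhhg
  fin_cases i
  · simpa using hm 0 j
  · exact hgm j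
  · exact hhm j
  · change g * h * _ ∈ _
    rw [mul_assoc]
    exact polySpan_mul_left hgm (hhm j)

lemma fst_monTwo {A B : Type} [CommRing A] [CommRing B] (x g h : A × B) (i : Fin 7) :
    (monTwo x g h i).1 = monTwo x.1 g.1 h.1 i ∧ (monTwo x g h i).2 = monTwo x.2 g.2 h.2 i := by
  fin_cases i <;> exact ⟨rfl, rfl⟩

variable {K : Type} [Field K] [Algebra (ZMod 2) K] [GenusFourFive K]

lemma ell_smul_two {P : Place F₂ K} (hP : placeDegree F₂ P = 2) (n : ℤ) :
    ell F₂ (n • Finsupp.single P 1 : Divisor F₂ K) = lseq K (n * 2) := by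
  rw [ell_eq_lseq, deg_smul, deg_place, hP]; rfl

/-- A normalised system of functions with poles at a place of degree two. -/
structure TwoSystem (P : Place F₂ K) (u x g h : K) : Prop where
  mem : u ∈ lev P 0
  rel : u * u + u + 1 ∈ lev P 1
  res : ∀ c ∈ lev P 0, c ∈ lev P 1 ∨ c - 1 ∈ lev P 1 ∨ c - u ∈ lev P 1 ∨ c - (1 + u) ∈ lev P 1
  polex : HasPole P 2 x
  poleg : HasPole P 3 g
  poleh : HasPole P 3 h
  leadh : h - u * g ∈ lev P (-2)
  leadx : g * g - x * x * x ∈ lev P (-5)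

lemma exists_twoSystem {P : Place F₂ K} (hP : placeDegree F₂ P = 2) (h2 : lseq K 2 = 1) :
    ∃ u x g h : K, TwoSystem P u x g h := by
  have h4 := lseq_four K
  have h6 := lseq_six (K := K)
  obtain ⟨u, hu0, hu, hres⟩ := exists_four_residue hP
  obtain ⟨x, hx⟩ : ∃ x, HasPole P 2 x := by
    by_contra hno
    push Not at hno
    have h5 : RRspace F₂ ((2 : ℤ) • Finsupp.single P 1 : Divisor F₂ K) ≤
        RRspace F₂ (((2 : ℤ) - 1) • Finsupp.single P 1) := fun f hf => (not_hasPole_iff hf).1 (hno f)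
    have h7 := Submodule.finrank_mono h5
    change ell F₂ _ ≤ ell F₂ _ at h7
    rw [ell_smul_two hP, ell_smul_two hP] at h7
    norm_num at h7
    omega
  have hx0 := hx.ne_zero
  have hsurj : ∀ f ∈ lev P (-3), ∃ l ∈ RRspace F₂ ((3 : ℤ) • Finsupp.single P 1), f - l ∈ lev P (-2) := by
    intro f hf
    have hs : (2 : ℤ) • Finsupp.single P 1 + Finsupp.single P 1 =
        ((3 : ℤ) • Finsupp.single P 1 : Divisor F₂ K) := by
      rw [show (3 : ℤ) = 2 + 1 by norm_num, add_smul (2 : ℤ) 1, one_smul]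
    obtain ⟨l, hl, hfl⟩ := RR_surj ((2 : ℤ) • Finsupp.single P 1) P (by
      rw [hs, ell_smul_two hP, ell_smul_two hP, hP]; norm_num; omega) f (by
      rw [smul_single_apply]; norm_num; exact hf)
    rw [smul_single_apply] at hfl
    exact ⟨l, by rwa [hs] at hl, hfl⟩
  obtain ⟨π, hπ0, hπ⟩ := exists_ordAt_eq (O := P.1) 1
  let c := x ^ 3 * π ^ 6
  let f := x ^ 6 * π ^ 9
  have hox : ordAt P.1 x = -2 := hx.ordAt
  have hc0 : c ≠ 0 := mul_ne_zero (pow_ne_zero _ hx0) (pow_ne_zero _ hπ0)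
  have hf0 : f ≠ 0 := mul_ne_zero (pow_ne_zero _ hx0) (pow_ne_zero _ hπ0)
  have hoc : ordAt P.1 c = 0 := by
    rw [ordAt_mul (pow_ne_zero _ hx0) (pow_ne_zero _ hπ0), ordAt_pow hx0, ordAt_pow hπ0, hox, hπ]
    norm_num
  have hof : ordAt P.1 f = -3 := by
    rw [ordAt_mul (pow_ne_zero _ hx0) (pow_ne_zero _ hπ0), ordAt_pow hx0, ordAt_pow hπ0, hox, hπ]
    norm_num
  have hcm : c ∈ lev P 0 := by rw [mem_lev_iff hc0, hoc]
  have hfm : f ∈ lev P (-3) := by rw [mem_lev_iff hf0, hof]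
  have hcube : c ^ 3 - 1 ∈ lev P 1 := by
    have hone : (1 : K) ∈ lev P 0 := mem_lev_zero.2 P.1.one_mem
    have hcc : c * c ∈ lev P 0 := mul_mem_lev hcm hcm
    have hk : ∀ {a b : K}, a ∈ lev P 1 → b ∈ lev P 0 → a * b ∈ lev P 1 := fun ha hb =>
      mul_mem_lev ha hb
    have h20 : (2 : K) = 0 := by
      have h6 : ((algebraMap F₂ K) 2) = 2 := map_ofNat _ 2
      rw [← h6, show (2 : F₂) = 0 from rfl, map_zero]
    rcases hres c hcm with h | h | h | h
    · rw [mem_lev_iff hc0, hoc] at h; omega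
    · have := hk h (add_mem (add_mem hcc hcm) hone)
      convert this using 1; ring
    · have e1 := hk h (add_mem (add_mem hcc (mul_mem_lev hcm hu0)) (mul_mem_lev hu0 hu0))
      have e2 := hk hu (sub_mem hu0 hone)
      convert add_mem e1 e2 using 1; ring
    · have hu1 : 1 + u ∈ lev P 0 := add_mem hone hu0
      have e1 := hk h (add_mem (add_mem hcc (mul_mem_lev hcm hu1)) (mul_mem_lev hu1 hu1))
      have e2 := hk hu (add_mem hu0 (add_mem hone hone))
      convert add_mem e1 e2 using 1
      linear_combination (-1 : K) * h20
  obtain ⟨g, hg, hfg⟩ := hsurj f hfm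
  have hgm : g ∈ lev P (-3) := by
    have := mem_RR.1 hg P
    rwa [smul_single_apply] at this
  have hgp : HasPole P 3 g := by
    refine ⟨hg, fun h => ?_⟩
    have := add_mem hfg h
    rw [sub_add_cancel, mem_lev_iff hf0, hof] at this
    norm_num at this
  obtain ⟨h, hh, hfh⟩ := hsurj (u * g) (mul_mem_lev hu0 hgm)
  have hhu : h - u * g ∈ lev P (-2) := by rw [← neg_sub]; exact neg_mem hfh
  have hu1 : u ∉ lev P 1 := by
    intro hu1
    have h1 : (1 : K) ∈ lev P 1 := by
      have := sub_mem hu (mul_mem_lev hu1 (add_mem hu0 (mem_lev_zero.2 P.1.one_mem) : u + 1 ∈ lev P 0))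
      convert this using 1; ring
    rw [mem_lev_iff one_ne_zero, ordAt_one] at h1
    omega
  have hu00 : u ≠ 0 := by rintro rfl; exact hu1 (zero_mem _)
  refine ⟨u, x, g, h, hu0, hu, hres, hx, hgp, ⟨hh, fun hl => ?_⟩, hhu, ?_⟩
  · have := sub_mem hl hhu
    rw [sub_sub_cancel, mem_lev_iff (mul_ne_zero hu00 hgp.ne_zero),
      ordAt_mul hu00 hgp.ne_zero, hgp.ordAt] at this
    rw [mem_lev_iff hu00] at hu1
    omega
  · have e1 := mul_mem_lev hfg (add_mem hfm hgm)
    have e2 : x ^ 3 * (c ^ 3 - 1) ∈ lev P (-5) := by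
      have := mul_mem_lev (hx.pow 3).mem_lev hcube
      norm_num at this
      exact this
    convert sub_mem e2 e1 using 1
    simp only [c, f]
    ring

variable {P : Place F₂ K} {u x g h : K}

lemma TwoSystem.leadgh (H : TwoSystem P u x g h) : g * h - u * x ^ 3 ∈ lev P (-5) := by
  have e1 := mul_mem_lev H.poleg.mem_lev H.leadh
  have e2 := mul_mem_lev H.mem H.leadx
  norm_num at e1 e2
  convert add_mem e1 e2 using 1
  ring

lemma TwoSystem.one_add_not_mem (H : TwoSystem P u x g h) : 1 + u ∉ lev P 1 := by
  intro hu1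
  have h1 : (1 : K) ∈ lev P 1 := by
    have := sub_mem H.rel (mul_mem_lev hu1 H.mem)
    convert this using 1; ring
  rw [mem_lev_iff one_ne_zero, ordAt_one] at h1
  omega

lemma not_mem_lev_mul {n : ℤ} {f v : K} (hf : HasPole P n f) (hv : v ∉ lev P 1) :
    f * v ∉ lev P (-n + 1) := by
  have hv0 : v ≠ 0 := by rintro rfl; exact hv (zero_mem _)
  rw [mem_lev_iff hv0] at hv
  rw [mem_lev_iff (mul_ne_zero hf.ne_zero hv0), ordAt_mul hf.ne_zero hv0, hf.ordAt]
  omega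

lemma TwoSystem.polegh (H : TwoSystem P u x g h) : HasPole P 6 (g * h) := by
  have := H.poleg.mul H.poleh
  rwa [show (3 : ℤ) + 3 = 6 by norm_num] at this

lemma TwoSystem.polyIndep (H : TwoSystem P u x g h) : PolyIndep x ![1, g, h, g * h] := by
  have pgh : HasPole P 6 (g * h) := H.polegh
  have p1 : HasPole P 0 (1 : K) := hasPole_one
  refine polyIndep_of_leading (n := (![0, 3, 3, 6] : Fin 4 → ℤ)) (by norm_num) H.polex ?_ ?_
  · rw [Fin.forall_fin_succ, Fin.forall_fin_succ, Fin.forall_fin_succ, Fin.forall_fin_one]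
    exact ⟨p1, H.poleg, H.poleh, pgh⟩
  intro J a M hJ ha
  have hp : ∀ (b : ℕ) (n : ℤ) {f : K}, HasPole P n f → (b : ℤ) * 2 + n = M →
      x ^ b * f ∉ lev P (-M + 1) := fun b n f hf hb => by
    rw [← hb]; exact ((H.polex.pow b).mul hf).2
  have h0 : 0 ∈ J → (a 0 : ℤ) * 2 + 0 = M := fun hi => by simpa using ha 0 hi
  have h1 : 1 ∈ J → (a 1 : ℤ) * 2 + 3 = M := fun hi => by simpa using ha 1 hi
  have h2 : 2 ∈ J → (a 2 : ℤ) * 2 + 3 = M := fun hi => by simpa using ha 2 hi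
  have h3 : 3 ∈ J → (a 3 : ℤ) * 2 + 6 = M := fun hi => by simpa using ha 3 hi
  have hsum : ∑ i ∈ J, x ^ a i * ![1, g, h, g * h] i =
      ∑ i, if i ∈ J then x ^ a i * ![1, g, h, g * h] i else 0 := by
    rw [Finset.sum_ite_mem, Finset.univ_inter]
  rw [hsum, Fin.sum_univ_four]
  have hne : 0 ∈ J ∨ 1 ∈ J ∨ 2 ∈ J ∨ 3 ∈ J := by
    obtain ⟨i, hi⟩ := hJ
    fin_cases i
    exacts [.inl hi, .inr (.inl hi), .inr (.inr (.inl hi)), .inr (.inr (.inr hi))]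
  have q0 := fun hi => hp (a 0) 0 p1 (h0 hi)
  have q1 := fun hi => hp (a 1) 3 H.poleg (h1 hi)
  have q2 := fun hi => hp (a 2) 3 H.poleh (h2 hi)
  have q3 := fun hi => hp (a 3) 6 pgh (h3 hi)
  have q03 : 0 ∈ J → 3 ∈ J → x ^ a 0 * 1 + x ^ a 3 * (g * h) ∉ lev P (-M + 1) := by
    intro i0 i3 hmem
    have e0 := h0 i0
    have e3 := h3 i3
    have ha0 : a 0 = a 3 + 3 := by omega
    have e1 := mul_mem_lev (H.polex.pow (a 3)).mem_lev H.leadgh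
    rw [show -((a 3 : ℤ) * 2) + -5 = -M + 1 by omega] at e1
    have e4 := sub_mem hmem e1
    refine not_mem_lev_mul (H.polex.pow (a 0)) H.one_add_not_mem ?_
    rw [show -((a 0 : ℤ) * 2) + 1 = -M + 1 by omega]
    convert e4 using 1
    rw [ha0]
    ring
  have q12 : 1 ∈ J → 2 ∈ J → x ^ a 1 * g + x ^ a 2 * h ∉ lev P (-M + 1) := by
    intro i0 i3 hmem
    have e0 := h1 i0
    have e3 := h2 i3
    have ha0 : a 1 = a 2 := by omega
    have e1 := mul_mem_lev (H.polex.pow (a 2)).mem_lev H.leadh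
    rw [show -((a 2 : ℤ) * 2) + -2 = -M + 1 by omega] at e1
    have e4 := sub_mem hmem e1
    refine not_mem_lev_mul ((H.polex.pow (a 1)).mul H.poleg) H.one_add_not_mem ?_
    rw [show -((a 1 : ℤ) * 2 + 3) + 1 = -M + 1 by omega]
    convert e4 using 1
    rw [ha0]
    ring
  by_cases i0 : 0 ∈ J <;> by_cases i1 : 1 ∈ J <;> by_cases i2 : 2 ∈ J <;> by_cases i3 : 3 ∈ J <;>
    first
    | (exfalso; have := h0 i0; have := h1 i1; omega)
    | (exfalso; have := h0 i0; have := h2 i2; omega)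
    | (exfalso; have := h3 i3; have := h1 i1; omega)
    | (exfalso; have := h3 i3; have := h2 i2; omega)
    | simpa [i0, i1, i2, i3] using q03 i0 i3
    | simpa [i0, i1, i2, i3] using q12 i1 i2
    | simpa [i0, i1, i2, i3] using q0 i0
    | simpa [i0, i1, i2, i3] using q1 i1
    | simpa [i0, i1, i2, i3] using q2 i2
    | simpa [i0, i1, i2, i3] using q3 i3
    | simp [i0, i1, i2, i3] at hne

lemma TwoSystem.step (H : TwoSystem P u x g h) (hP : placeDegree F₂ P = 2) (h2 : lseq K 2 = 1)
    {S : Submodule F₂ K} {m : ℕ} (h0S : 1 ∈ S) (h2S : m = 2 → x ∈ S) (h4S : m = 4 → x * x ∈ S)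
    (hodd : ∀ a : ℕ, m = 2 * a + 3 → x ^ a * g ∈ S ∧ x ^ a * h ∈ S)
    (heven : ∀ a : ℕ, m = 2 * a + 6 → x ^ (a + 3) ∈ S ∧ x ^ a * (g * h) ∈ S) :
    RRspace F₂ ((m : ℤ) • Finsupp.single P 1) ≤
      RRspace F₂ (((m : ℤ) - 1) • Finsupp.single P 1) ⊔ S := by
  have h4 := lseq_four K
  have h6 := lseq_six (K := K)
  have h8 : (lseq K 8 : ℤ) = 8 - 3 := lseq_large _ (by norm_num)
  have hcases : m = 0 ∨ m = 1 ∨ m = 2 ∨ m = 4 ∨ (∃ a, m = 2 * a + 3) ∨ ∃ a, m = 2 * a + 6 := by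
    rcases Nat.even_or_odd' m with ⟨k, rfl | rfl⟩
    · rcases (by omega : k = 0 ∨ k = 1 ∨ k = 2 ∨ 3 ≤ k) with rfl | rfl | rfl | hk
      · simp
      · simp
      · simp
      · exact .inr (.inr (.inr (.inr (.inr ⟨k - 3, by omega⟩))))
    · rcases (by omega : k = 0 ∨ 1 ≤ k) with rfl | hk
      · simp
      · exact .inr (.inr (.inr (.inr (.inl ⟨k - 1, by omega⟩))))
  rcases hcases with rfl | rfl | rfl | rfl | ⟨a, rfl⟩ | ⟨a, rfl⟩
  · refine le_sup_of_le_right ?_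
    rw [Nat.cast_zero, zero_smul, RR_zero, Submodule.span_singleton_le_iff_mem]
    exact h0S
  · refine le_sup_of_le_left (Submodule.eq_of_le_of_finrank_le
      (RR_mono (smul_le_smul_div (single_nonneg P) (by norm_num))) ?_).ge
    change ell F₂ _ ≤ ell F₂ _
    rw [ell_smul_two hP, ell_smul_two hP]
    norm_num [lseq_zero, h2]
  · refine (RR_le_sup_span H.polex ?_).trans (sup_le_sup_left ?_ _)
    · rw [ell_smul_two hP, ell_smul_two hP]; norm_num; omega
    · rw [Submodule.span_singleton_le_iff_mem]; exact h2S rfl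
  · refine (RR_le_sup_span (e := x * x) (H.polex.mul H.polex) ?_).trans (sup_le_sup_left ?_ _)
    · rw [ell_smul_two hP, ell_smul_two hP]; norm_num; omega
    · rw [Submodule.span_singleton_le_iff_mem]; exact h4S rfl
  · have hm : ((2 * a + 3 : ℕ) : ℤ) = a * 2 + 3 := by push_cast; ring
    rw [hm]
    refine RR_le_sup_pair H.res ((H.polex.pow a).mul H.poleg) ((H.polex.pow a).mul H.poleh).1 ?_
      (hodd a rfl).1 (hodd a rfl).2
    have e1 := mul_mem_lev (H.polex.pow a).mem_lev H.leadh
    rw [show -((a : ℤ) * 2) + -2 = -(a * 2 + 3) + 1 by ring] at e1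
    convert e1 using 1; ring
  · have hm : ((2 * a + 6 : ℕ) : ℤ) = ((a + 3 : ℕ) : ℤ) * 2 := by push_cast; ring
    rw [hm]
    refine RR_le_sup_pair H.res (H.polex.pow (a + 3)) (e' := x ^ a * (g * h)) ?_ ?_
      (heven a rfl).1 (heven a rfl).2
    · have := ((H.polex.pow a).mul H.polegh).1
      rwa [show (a : ℤ) * 2 + 6 = ((a + 3 : ℕ) : ℤ) * 2 by push_cast; ring] at this
    have e1 := mul_mem_lev (H.polex.pow a).mem_lev H.leadgh
    rw [show -((a : ℤ) * 2) + -5 = -(((a + 3 : ℕ) : ℤ) * 2) + 1 by push_cast; ring] at e1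
    convert e1 using 1; ring

lemma TwoSystem.mem_span (H : TwoSystem P u x g h) (hP : placeDegree F₂ P = 2)
    (h2 : lseq K 2 = 1) {f : K} (hf : f ∈ RRspace F₂ ((6 : ℤ) • Finsupp.single P 1))
    (hl : f ∈ lev P (-5)) : ∃ b : Fin 7 → Bool, f = ∑ i, cond (b i) (monTwo x g h i) 0 := by
  refine exists_expansion ?_
  have h5 := RR_sub_one hf (by rw [show -(6 : ℤ) + 1 = -5 by norm_num]; exact hl)
  rw [show (6 : ℤ) - 1 = ((5 : ℕ) : ℤ) by norm_num] at h5
  have hs : ∀ i, monTwo x g h i ∈ Submodule.span F₂ (Set.range (monTwo x g h)) :=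
    fun i => Submodule.subset_span ⟨i, rfl⟩
  refine RR_le_of_steps (Submodule.span F₂ (Set.range (monTwo x g h))) 5 (fun m hm => H.step hP h2 (hs 0) (fun _ => hs 1) (fun _ => hs 4) ?_ ?_) h5
  · intro a ha
    rcases (by omega : a = 0 ∨ a = 1) with rfl | rfl
    · exact ⟨by simpa [monTwo] using hs 2, by simpa [monTwo] using hs 3⟩
    · exact ⟨by simpa [monTwo] using hs 5, by simpa [monTwo] using hs 6⟩
  · intro a ha
    omega

lemma TwoSystem.mem_polySpan (H : TwoSystem P u x g h) (hP : placeDegree F₂ P = 2)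
    (h2 : lseq K 2 = 1) {f : K} (hf : f ∈ affineRing (Finsupp.single P 1 : Divisor F₂ K)) :
    f ∈ polySpan x ![1, g, h, g * h] := by
  obtain ⟨N, hN⟩ := affineRing_mem_RR (single_nonneg P) hf
  have hm : ∀ (a : ℕ) (j : Fin 4), x ^ a * ![1, g, h, g * h] j ∈ polySpan x ![1, g, h, g * h] :=
    fun a j => pow_mul_mem_polySpan (CFF.mem_polySpan j) a
  refine RR_le_of_steps _ N (fun m _ => H.step hP h2 ?_ ?_ ?_ ?_ ?_) hN
  · simpa using hm 0 0
  · intro _; simpa using hm 1 0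
  · intro _; simpa [pow_succ] using hm 2 0
  · intro a _; exact ⟨hm a 1, hm a 2⟩
  · intro a _; exact ⟨by simpa using hm (a + 3) 0, hm a 3⟩

/-- There is not exactly one effective divisor of degree two. -/
theorem lseq_two_ne_one : lseq K 2 ≠ 1 := by
  intro h2
  obtain ⟨D, hD, hD2⟩ := exists_effective_deg (K := K) (n := 2) (by omega)
  have hD0 : D ≠ 0 := by rintro rfl; simp at hD2
  have h3 := lseq_sub_lt hD hD0
  rw [hD2, lseq_five, lseq_one] at h3
  norm_num at h3
  obtain ⟨P, rfl⟩ := exists_place_of_deg_le hD hD0 (by omega)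
  have hP : placeDegree F₂ P = 2 := by rw [deg_place] at hD2; exact_mod_cast hD2
  obtain ⟨u, x, g, h, H⟩ := exists_twoSystem hP h2
  obtain ⟨b₁, hb₁⟩ := H.mem_span hP h2 (f := g * g + g * h + h * h)
    (add_mem (add_mem (H.poleg.mul H.poleg).1 (H.poleg.mul H.poleh).1) (H.poleh.mul H.poleh).1) (by
      have e1 := mul_mem_lev (H.poleg.mul H.poleg).mem_lev H.rel
      have e2 := mul_mem_lev H.leadh (add_mem (add_mem H.poleh.mem_lev
        (mul_mem_lev H.mem H.poleg.mem_lev : u * g ∈ lev P (-3))) H.poleg.mem_lev)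
      norm_num at e1 e2
      convert add_mem e1 e2 using 1
      ring)
  obtain ⟨b₂, hb₂⟩ := H.mem_span hP h2 (f := g * g - x * x * x)
    (sub_mem (H.poleg.mul H.poleg).1 ((H.polex.mul H.polex).mul H.polex).1) H.leadx
  have key : ∀ {L : Type} [Field L] [Algebra F₂ L] (a c d : L),
      c * c + c * d + d * d = ∑ i, cond (b₁ i) (monTwo a c d i) 0 →
      c * c = a * a * a + ∑ i, cond (b₂ i) (monTwo a c d i) 0 →
      ∃ χ : affineRing (Finsupp.single P 1 : Divisor F₂ K) →+* L,
        χ ⟨x, mem_affineRing_of_RR H.polex.1⟩ = a ∧ χ ⟨g, mem_affineRing_of_RR H.poleg.1⟩ = c ∧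
        χ ⟨h, mem_affineRing_of_RR H.poleh.1⟩ = d := by
    intro L _ _ a c d hac hcd
    have hr₁ : (g, c) * (g, c) + (g, c) * (h, d) + (h, d) * (h, d) =
        ∑ i, cond (b₁ i) (monTwo (x, a) (g, c) (h, d) i) 0 := by
      refine Prod.ext ?_ ?_
      · rw [fst_sum_cond]
        simp only [fst_monTwo, Prod.fst_mul, Prod.fst_add, hb₁]
      · rw [snd_sum_cond]
        simp only [fst_monTwo, Prod.snd_mul, Prod.snd_add, hac]
    have hr₂ : (g, c) * (g, c) = (x, a) * (x, a) * (x, a) +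
        ∑ i, cond (b₂ i) (monTwo (x, a) (g, c) (h, d) i) 0 := by
      refine Prod.ext ?_ ?_
      · rw [Prod.fst_add, fst_sum_cond]
        simp only [fst_monTwo, Prod.fst_mul, ← hb₂]
        ring
      · rw [Prod.snd_add, snd_sum_cond]
        simp only [fst_monTwo, Prod.snd_mul, hcd]
    have hmul := mul_mem_two hr₁ hr₂
    have hmem := fun i => CFF.mem_polySpan (z := (x, a)) (h := ![1, (g, c), (h, d), (g, c) * (h, d)]) i
    have hfg : (![1, (g, c), (h, d), (g, c) * (h, d)] : Fin 4 → K × L) =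
        fun i => (![1, g, h, g * h] i, ![1, c, d, c * d] i) := by
      funext i; fin_cases i <;> rfl
    have hxa := mul_mem_polySpan_self (hmem 0)
    rw [hfg] at hmul hmem hxa
    obtain ⟨χ, hχ⟩ := exists_hom_of_basis H.polyIndep (fun b => H.mem_polySpan hP h2) a
      ![1, c, d, c * d] (hmem 0) hmul
    refine ⟨χ, ?_, hχ _ (hmem 1) _, hχ _ (hmem 2) _⟩
    have hxa' : ((x, a) : K × L) ∈ polySpan (x, a) fun i => (![1, g, h, g * h] i, ![1, c, d, c * d] i) := by
      simpa using hxa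
    exact hχ _ hxa' _
  have hS0 : (Finsupp.single P 1 : Divisor F₂ K) ≠ 0 := hD0
  rcases exists_solution_two b₁ b₂ with ⟨a, c, d, hac, hcd⟩ | ⟨s, hs, hsol⟩
  · obtain ⟨χ, -⟩ := key a c d hac hcd
    obtain ⟨Q, hQ, hd, -, -⟩ := exists_place_dvd hD hS0 (GF.card 2 tabFour) χ
    have h22 := Nat.le_of_dvd (by norm_num) hd
    have hQ2 := two_le_placeDegree Q
    have hQP : Q ≠ P := by rintro rfl; simp at hQ
    have := two_le_of_places hQP (by omega)
    rw [show placeDegree F₂ Q = 2 by omega] at this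
    norm_num at this
    omega
  · choose χ hχx hχg hχh using fun j => key _ _ _ (hsol j _ _ _ rfl).1 (hsol j _ _ _ rfl).2
    choose Q hQ hd hcard hker using fun j => exists_place_dvd hD hS0 (GF.card 3 tabEight) (χ j)
    have hQ3 : ∀ j, placeDegree F₂ (Q j) = 3 := by
      intro j
      have h22 := Nat.le_of_dvd (by norm_num) (hd j)
      have hQ2 := two_le_placeDegree (Q j)
      have := hd j
      interval_cases placeDegree F₂ (Q j)
      · omega
      · rfl
    have hsame : ∀ j, Q j = Q 0 := by
      intro j
      by_contra hne
      have := two_le_of_places hne (by rw [hQ3, hQ3])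
      rw [hQ3] at this
      norm_num at this
      omega
    have hinj : Function.Injective χ := by
      intro i j hij
      apply hs
      refine Prod.ext ?_ (Prod.ext ?_ ?_)
      · rw [← hχx i, ← hχx j, hij]
      · rw [← hχg i, ← hχg j, hij]
      · rw [← hχh i, ← hχh j, hij]
    have := card_le_of_same_place hD hS0 (hQ 0) hinj (fun i b => by rw [← hsame i]; exact hker i b)
    rw [hQ3, Fintype.card_fin] at this
    omega

end DegreeTwo

section FivePlaces

variable {K : Type} [Field K] [Algebra (ZMod 2) K] [GenusFourFive K]

omit [GenusFourFive K] in
lemma two_eq_zero : (2 : K) = 0 := by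
  rw [← map_ofNat (algebraMap F₂ K) 2, show (OfNat.ofNat 2 : F₂) = 0 from by decide, map_zero]

lemma lseq_five_eq : lseq K 5 = 2 := by
  rw [lseq_five, lseq_one]

lemma not_two_and_three {P Q : Place F₂ K} (hP : placeDegree F₂ P = 2)
    (hQ : placeDegree F₂ Q = 3) : False := by
  have h1 := lseq_pos_of_place P
  have h2 := lseq_sub_lt (single_nonneg Q) (by simp)
  rw [deg_place, hQ, lseq_five_eq] at h2
  rw [hP] at h1
  have h3 := lseq_two_ne_one (K := K)
  norm_num at h1 h2
  omega

lemma deg_pos_of_ne {D : Divisor F₂ K} (hD : 0 ≤ D) (h : D ≠ 0) : 2 ≤ deg D := by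
  obtain ⟨P, hP⟩ := exists_single_le hD h
  have := deg_mono hP
  rw [deg_place] at this
  have := two_le_placeDegree P
  omega

/-- Effective divisors of degree five are places. -/
lemma exists_place_of_deg_five {D : Divisor F₂ K} (hD : 0 ≤ D) (h5 : deg D = 5) :
    ∃ P : Place F₂ K, D = Finsupp.single P 1 := by
  obtain ⟨P, hP⟩ := exists_single_le hD (by rintro rfl; simp at h5)
  refine ⟨P, ?_⟩
  by_contra hne
  have h1 := sub_nonneg.2 hP
  have h1' := sub_ne_zero.2 hne
  have h2 := deg_pos_of_ne h1 h1'
  have h3 : deg (D - Finsupp.single P 1) = 5 - placeDegree F₂ P := by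
    rw [map_sub, h5, deg_place]
  have h4 := two_le_placeDegree P
  obtain ⟨Q, hQ⟩ := exists_place_of_deg_le h1 h1' (by omega)
  rw [hQ, deg_place] at h3 h2
  rcases (by omega : placeDegree F₂ P = 2 ∧ placeDegree F₂ Q = 3 ∨
    placeDegree F₂ Q = 2 ∧ placeDegree F₂ P = 3) with h | h <;> exact not_two_and_three h.1 h.2

omit [GenusFourFive K] in
/-- A prime divisor is not a sum of nonzero effective divisors. -/
lemma single_ne_add {P : Place F₂ K} {A B : Divisor F₂ K} (hA : 0 ≤ A) (hB : 0 ≤ B) (hA0 : A ≠ 0)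
    (hB0 : B ≠ 0) : Finsupp.single P 1 ≠ A + B := by
  intro h
  obtain ⟨Q, hQ⟩ := exists_single_le hA hA0
  obtain ⟨R, hR⟩ := exists_single_le hB hB0
  have hPQ : Q = P := by
    by_contra hne
    have h1 := hQ Q
    have h2 : (0 : ℤ) ≤ B Q := hB Q
    have h3 := DFunLike.congr_fun h Q
    simp only [Finsupp.add_apply, Finsupp.single_eq_same,
      Finsupp.single_eq_of_ne hne] at h1 h3
    omega
  have hPR : R = P := by
    by_contra hne
    have h1 := hR R
    have h2 : (0 : ℤ) ≤ A R := hA R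
    have h3 := DFunLike.congr_fun h R
    simp only [Finsupp.add_apply, Finsupp.single_eq_same,
      Finsupp.single_eq_of_ne hne] at h1 h3
    omega
  subst hPQ
  subst hPR
  have h1 := hQ R
  have h2 := hR R
  have h3 := DFunLike.congr_fun h R
  simp only [Finsupp.add_apply, Finsupp.single_eq_same] at h1 h2 h3
  omega

lemma single_ne_of_mul {P R : Place F₂ K} {f a b : K} (hf : f ≠ 0)
    (ha : a ∈ RRspace F₂ (Finsupp.single R 1)) (hb : b ∈ RRspace F₂ (Finsupp.single R 1))
    (hab : f = a * b) :
    Finsupp.single P 1 ≠ (2 : ℤ) • Finsupp.single R 1 + div f := by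
  subst hab
  have ha0 := left_ne_zero_of_mul hf
  have hb0 := right_ne_zero_of_mul hf
  have key : ∀ c : K, c ≠ 0 → Finsupp.single R 1 + div c ≠ 0 := by
    intro c hc h
    have h1 := congrArg deg h
    rw [map_add, deg_div hc, deg_place, map_zero] at h1
    have := two_le_placeDegree R
    omega
  rw [mem_RR_iff ha0, add_comm] at ha
  rw [mem_RR_iff hb0, add_comm] at hb
  have := single_ne_add (P := P) ha hb (key a ha0) (key b hb0)
  intro h
  apply this
  rw [h, div_mul ha0 hb0, two_smul]
  abel

lemma place_four_unique {P Q : Place F₂ K} (hP : placeDegree F₂ P = 4)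
    (hQ : placeDegree F₂ Q = 4) : P = Q := by
  by_contra hne
  have h4 := two_le_of_places hne (by rw [hP, hQ])
  have h4' := lseq_four K
  have h2 := lseq_two_ne_one (K := K)
  rw [hP] at h4
  norm_num at h4
  obtain ⟨D, hD, hD2⟩ := exists_effective_deg (n := 2) (K := K) (by omega)
  obtain ⟨R, rfl⟩ := exists_place_of_deg_le hD (by rintro rfl; simp at hD2) (by omega)
  rw [deg_place] at hD2
  have hdeg : ∀ n : ℤ, deg (n • Finsupp.single R 1 : Divisor F₂ K) = 2 * n := by
    intro n
    rw [map_zsmul, deg_place, hD2, smul_eq_mul, mul_comm]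
  obtain ⟨x, hx⟩ : ∃ x, HasPole R 1 x := by
    by_contra h
    push Not at h
    have h1 : RRspace F₂ ((1 : ℤ) • Finsupp.single R 1) ≤ RRspace F₂ ((0 : ℤ) • Finsupp.single R 1) :=
      fun f hf => by simpa using (not_hasPole_iff hf).1 (h f)
    have h3 := RR_finite ((0 : ℤ) • Finsupp.single R 1 : Divisor F₂ K)
    have h2 := Submodule.finrank_mono h1
    change ell F₂ _ ≤ ell F₂ _ at h2
    rw [ell_eq_lseq, ell_eq_lseq, hdeg, hdeg] at h2
    norm_num at h2
    have := lseq_zero (K := K)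
    omega
  have hle := ell_step (K := K) 0 R
  rw [zero_add, ell_zero, ell_eq_lseq, deg_place, hD2] at hle
  have h6 := lseq_six (K := K)
  have hlt : lseq K 4 < lseq K 6 := by
    have h7 := RR_finite ((3 : ℤ) • Finsupp.single R 1 : Divisor F₂ K)
    have h8 : RRspace F₂ ((2 : ℤ) • Finsupp.single R 1) < RRspace F₂ ((3 : ℤ) • Finsupp.single R 1) := by
      refine lt_of_le_of_ne (RR_mono (smul_le_smul_div (single_nonneg R) (by norm_num))) fun he => ?_
      have h9 := hx.pow 3
      norm_num at h9
      exact (not_hasPole_iff h9.1).2 (by rw [show (3 : ℤ) - 1 = 2 by norm_num, he]; exact h9.1) h9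
    have h9 := Submodule.finrank_lt_finrank_of_lt h8
    change ell F₂ _ < ell F₂ _ at h9
    rwa [ell_eq_lseq, ell_eq_lseq, hdeg, hdeg] at h9
  have hl2 : lseq K 2 = 2 := by omega
  have hx1 : x ∈ RRspace F₂ (Finsupp.single R 1) := by simpa using hx.1
  have hspan1 : RRspace F₂ (Finsupp.single R 1) ≤ Submodule.span F₂ {1} ⊔ Submodule.span F₂ {x} := by
    have h := RR_le_sup_span hx (by
      rw [ell_eq_lseq, ell_eq_lseq, hdeg, hdeg]
      norm_num
      rw [hl2, lseq_zero])
    simpa [RR_zero] using h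
  have hspan2 : RRspace F₂ ((2 : ℤ) • Finsupp.single R 1) ≤
      (Submodule.span F₂ {1} ⊔ Submodule.span F₂ {x}) ⊔ Submodule.span F₂ {x ^ 2} := by
    have hx2 := hx.pow 2
    norm_num at hx2
    have h := RR_le_sup_span hx2 (by
      rw [ell_eq_lseq, ell_eq_lseq, hdeg, hdeg]
      norm_num
      rw [hl2, h4', hl2])
    refine h.trans (sup_le_sup ?_ le_rfl)
    simpa using hspan1
  have key : ∀ S : Place F₂ K, placeDegree F₂ S = 4 →
      Finsupp.single S 1 = (2 : ℤ) • Finsupp.single R 1 + div (1 + x + x ^ 2) := by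
    intro S hS
    obtain ⟨f, hf, he⟩ := exists_equiv (K := K) (D := Finsupp.single S 1)
      (D' := (2 : ℤ) • Finsupp.single R 1) (by rw [deg_place, hdeg, hS]; norm_num)
    have hfm : f ∈ RRspace F₂ ((2 : ℤ) • Finsupp.single R 1) := by
      rw [mem_RR_iff hf, add_comm, ← he]
      exact single_nonneg S
    obtain ⟨u, hu, w, hw, huw⟩ := Submodule.mem_sup.1 (hspan2 hfm)
    obtain ⟨v, hv, v', hv', hvv⟩ := Submodule.mem_sup.1 hu
    obtain ⟨a, rfl⟩ := Submodule.mem_span_singleton.1 hv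
    obtain ⟨b, rfl⟩ := Submodule.mem_span_singleton.1 hv'
    obtain ⟨c, rfl⟩ := Submodule.mem_span_singleton.1 hw
    have h1 := one_mem_RR (single_nonneg R)
    have hbin : ∀ c : F₂, c = 0 ∨ c = 1 := by decide
    have two : (2 : K) = 0 := two_eq_zero
    subst hvv
    subst huw
    have hne : ∀ {u v : K}, u ∈ RRspace F₂ (Finsupp.single R 1) → v ∈ RRspace F₂ (Finsupp.single R 1) →
        a • 1 + b • x + c • x ^ 2 = u * v → False :=
      fun hu hv h => single_ne_of_mul hf hu hv h he
    rcases hbin a with rfl | rfl <;> rcases hbin b with rfl | rfl <;> rcases hbin c with rfl | rfl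
    · simp at hf
    · exact (hne hx1 hx1 (by simp; ring)).elim
    · exact (hne h1 hx1 (by simp)).elim
    · exact (hne hx1 (add_mem h1 hx1) (by simp; ring)).elim
    · exact (hne h1 h1 (by simp)).elim
    · exact (hne (add_mem h1 hx1) (add_mem h1 hx1)
        (by simp only [one_smul, zero_smul, add_zero]; linear_combination (-x) * two)).elim
    · exact (hne h1 (add_mem h1 hx1) (by simp)).elim
    · simpa using he
  exact hne ((Finsupp.single_left_inj one_ne_zero).1 ((key P hP).trans (key Q hQ).symm))

end FivePlaces

section ThirtyTwo

/-- A multiplication table of the field with thirty-two elements; odd strings have trace one. -/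
def tabThirtyTwo : ℕ := 0x9b17426f83367c18b9362eba29355583d173e3e064ac8f84bb8bd75173065520ec9c7dba5b326bc05daeaaa1346460d93dd3c149936f47f887e0f3a0a215674a0cd9cb90f7e3bad356c66fc10da17b8027eae1e24982c3abb0ddc8913f15f46db8754760d8512c09713f68e27aedb30bfabcdc543234cf40e153092cfed0df6a34382762854fe616eee657201ee8c4c7c66d7423fe085cf840e6ce2f64a7df003459b81f4dcba647e0b2a0fc91551f5f036eaae0cbe275f475760d0e2a82db6654fc3766892f22c0f2e050d1fa99ba8664574f0f2b0f0d2455fdbaa00d5b9d3ac22411cfae673495eea6251ddfbc328088a41b92877f19f4e95946d78775beb16a680e60771fd679bfc2b2bd23693d4d42dc9688e02986404e1df35c302d05356dbca9243d2facca3cfb1e20b1a63eb70890ae7ca78cd2bef88684f3b6ba96002ab17cd88ba6d2641ebafc04d1b3d17067c975e0d50ab133b31b792dd48a879e141af949ed88fdc0ec0894163cf4cea59a5f13f76be9c30b315a65a013b359fd044965ec506f686dae40eb32bb1bed80964cdf5541126dd717511a2fc793709e0ecfd16069f712be79afc69edd6161b5023a58a7848e594050f5379bf640711693b4f5dc7d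c962e5585cc120af4efa70cefdda5f59848e46b8604adcd21d490085ff86a8455b083b473e724269d39bacb5d43ce07a444b437de6a3728d0e09d8ac7ab3953f95b4c043466e66f20914fac3db9db1d38989d7e3472ca0bcfda38dcab4bfb309ebe62b1620a1ee6906a480390225258fefb7884ed594697ff33a42dcd29860c6b9e8ceb7521cc184e5eff3ba5a127b56931040ffbbcdeb38bdab49ca307b9ac5a928398a4188200000000000000000000000000000000000000000

instance : GF.Valid 5 tabThirtyTwo where
  pos := by decide
  zero_mul := by decide +kernel
  mul_assoc := by decide +kernel
  mul_comm := by decide +kernel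
  left_distrib := by decide +kernel
  one_mul := by decide +kernel
  domain := by decide +kernel

/-- Multiplication of elements of trace zero, projected along the unit element. -/
def tabStar : ℕ := 0x940d7ae3a73e49d04b963ce15a872df00918e7f66f7e8190d683a1f492c7e5b073eac85162fbd940ac718e539f42bd60eeff5544aabb11003164134657027520a56969a5f03c3cf07af22fa70d8558d0387cf4b0387cf4b0e7e7b2b2c5c59090428edb1735f9ac609d159d15c840c840df9b4602fdb964200000000000000000

/-- Multiplication of elements of trace zero, projected along the unit element. -/
def star (x y : ℕ) : ℕ := tabMul 4 tabStar x y

lemma star_lt (x y : ℕ) : star x y < 16 := Nat.mod_lt _ (by decide)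

lemma star_comm : ∀ x < 16, ∀ y < 16, star x y = star y x := by decide +kernel

lemma star_add : ∀ x < 16, ∀ y < 16, ∀ z < 16, star (x ^^^ y) z = star x z ^^^ star y z := by
  decide +kernel

/-- The elements of the field with thirty-two elements. -/
abbrev F32 : Type := GF 5 tabThirtyTwo

namespace F32

/-- The trace. -/
def tr (c : F32) : F₂ := cond (Nat.testBit c.1 0) 1 0

/-- The projection to the elements of trace zero. -/
def half (c : F32) : ℕ := c.1 / 2

/-- The elements of trace zero. -/
def dbl (x : ℕ) : F32 := ⟨2 * x % 32, Nat.mod_lt _ (by decide)⟩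

lemma half_lt (c : F32) : half c < 16 := by
  have : c.1 < 32 := c.2
  unfold half
  omega

lemma tr_add : ∀ c d : F32, tr (c + d) = tr c + tr d := by decide +kernel
lemma tr_zero : tr 0 = 0 := by decide +kernel
lemma tr_one : tr 1 = 1 := by decide +kernel
lemma half_zero : half 0 = 0 := by decide +kernel
lemma half_add : ∀ c d : F32, half (c + d) = half c ^^^ half d := by decide +kernel
lemma half_one : half 1 = 0 := by decide +kernel
lemma half_mul : ∀ c d : F32, tr c = 0 → tr d = 0 → half (c * d) = star (half c) (half d) := by
  decide +kernel
lemma tr_dbl : ∀ x < 16, tr (dbl x) = 0 := by decide +kernel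
lemma half_dbl : ∀ x < 16, half (dbl x) = x := by decide +kernel
lemma eq_zero : ∀ c : F32, tr c = 0 → half c = 0 → c = 0 := by decide +kernel

lemma smul_eq (a : F₂) (c : F32) : a • c = if a = 1 then c else 0 := by
  have : a = 0 ∨ a = 1 := by revert a; decide
  rcases this with rfl | rfl <;> simp

lemma tr_smul_one (a : F₂) : tr (a • (1 : F32)) = a := by
  have : a = 0 ∨ a = 1 := by revert a; decide
  rcases this with rfl | rfl
  · rw [zero_smul, tr_zero]
  · rw [one_smul, tr_one]

lemma half_smul_one (a : F₂) : half (a • (1 : F32)) = 0 := by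
  have : a = 0 ∨ a = 1 := by revert a; decide
  rcases this with rfl | rfl
  · rw [zero_smul, half_zero]
  · rw [one_smul, half_one]

lemma ext_of {c d : F32} (h1 : tr c = tr d) (h2 : half c = half d) : c = d := by
  rw [← sub_eq_zero]
  have h3 : c - d = c + d := by rw [CharTwo.sub_eq_add]
  rw [h3]
  apply eq_zero
  · rw [tr_add, h1, CharTwo.add_self_eq_zero]
  · rw [half_add, h2, Nat.xor_self]

end F32

end ThirtyTwo

section Residue

variable {K : Type} [Field K] [Algebra (ZMod 2) K] [GenusFour K]

/-- A residue map with values in the field with thirty-two elements. -/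
structure Res (P : Place F₂ K) (r : K → F32) : Prop where
  add : ∀ f ∈ lev P 0, ∀ g ∈ lev P 0, r (f + g) = r f + r g
  mul : ∀ f ∈ lev P 0, ∀ g ∈ lev P 0, r (f * g) = r f * r g
  one : r 1 = 1
  zero_iff : ∀ f ∈ lev P 0, r f = 0 ↔ f ∈ lev P 1
  surj : ∀ c, ∃ f ∈ lev P 0, r f = c

variable {P : Place F₂ K}

lemma exists_res (hP : placeDegree F₂ P = 5) : ∃ r, Res P r := by
  have hcard := card_residue P
  rw [hP] at hcard
  let κ := IsLocalRing.ResidueField P.1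
  have : Finite κ := Nat.finite_of_card_ne_zero (by rw [hcard]; norm_num)
  let _ : Fintype κ := Fintype.ofFinite κ
  let φ : κ ≃+* F32 := FiniteField.ringEquivOfCardEq (by
    rw [← Nat.card_eq_fintype_card, ← Nat.card_eq_fintype_card, hcard, GF.card])
  let ρ : P.1 →+* F32 := (φ : κ →+* F32).comp (IsLocalRing.residue P.1)
  have hρ : ∀ f : P.1, ρ f = 0 ↔ (f : K) ∈ lev P 1 := by
    intro f
    change φ (IsLocalRing.residue P.1 f) = 0 ↔ _
    rw [map_eq_zero_iff φ φ.injective, IsLocalRing.residue_eq_zero_iff, mem_maximalIdeal_iff]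
  let r : K → F32 := fun f => if h : f ∈ P.1 then ρ ⟨f, h⟩ else 0
  have hr : ∀ f (h : f ∈ P.1), r f = ρ ⟨f, h⟩ := fun f h => dif_pos h
  refine ⟨r, ?_, ?_, ?_, ?_, ?_⟩
  · intro f hf g hg
    rw [mem_lev_zero] at hf hg
    rw [hr _ hf, hr _ hg, hr _ (P.1.add_mem _ _ hf hg), ← map_add]
    rfl
  · intro f hf g hg
    rw [mem_lev_zero] at hf hg
    rw [hr _ hf, hr _ hg, hr _ (P.1.mul_mem _ _ hf hg), ← map_mul]
    rfl
  · rw [hr _ P.1.one_mem]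
    exact map_one ρ
  · intro f hf
    rw [mem_lev_zero] at hf
    rw [hr _ hf, hρ]
  · intro c
    obtain ⟨x, hx⟩ := φ.surjective c
    obtain ⟨f, rfl⟩ := IsLocalRing.residue_surjective x
    refine ⟨f, mem_lev_zero.2 f.2, ?_⟩
    rw [hr _ f.2]
    exact hx

namespace Res

variable {r : K → F32} (hr : Res P r)
include hr

lemma zero : r 0 = 0 := (hr.zero_iff 0 (zero_mem _)).2 (zero_mem _)

lemma smul (a : F₂) (f : K) : r (a • f) = a • r f := by
  have : a = 0 ∨ a = 1 := by revert a; decide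
  rcases this with rfl | rfl
  · rw [zero_smul, zero_smul, hr.zero]
  · rw [one_smul, one_smul]

lemma congr {f g : K} (hf : f ∈ lev P 0) (h : f - g ∈ lev P 1) : r f = r g := by
  have h1 := lev_mono P zero_le_one h
  have h2 : g ∈ lev P 0 := by simpa using sub_mem hf h1
  have h3 := hr.add _ h1 _ h2
  rw [sub_add_cancel, (hr.zero_iff _ h1).2 h, zero_add] at h3
  exact h3

end Res

lemma mem_RR_mul_iff {D : Divisor F₂ K} {f g : K} (hg : g ≠ 0) :
    f * g ∈ RRspace F₂ D ↔ f ∈ RRspace F₂ (D + div g) := by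
  rcases eq_or_ne f 0 with rfl | hf
  · simp
  rw [mem_RR_iff hf, mem_RR_iff (mul_ne_zero hf hg), div_mul hf hg, add_assoc, add_comm D]

lemma mem_lev_mul_iff {n : ℤ} {f g : K} (hg : g ≠ 0) :
    f * g ∈ lev P n ↔ f ∈ lev P (n - ordAt P.1 g) := by
  rcases eq_or_ne f 0 with rfl | hf
  · simp
  rw [mem_lev_iff hf, mem_lev_iff (mul_ne_zero hf hg), ordAt_mul hf hg]
  omega

end Residue

variable {K : Type} [Field K] [Algebra (ZMod 2) K] [GenusFourFive K]

omit [GenusFourFive K] in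
lemma charTwo : CharP K 2 := charP_of_injective_algebraMap (algebraMap F₂ K).injective 2

section Triple

/-- The divisors of `T` and `T + 1`, which are supported on three places of degree five. -/
structure Triple (T : K) (P : Fin 3 → Place F₂ K) : Prop where
  ne_zero : T ≠ 0
  ne_one : T + 1 ≠ 0
  div_zero : div T = Finsupp.single (P 0) 1 - Finsupp.single (P 2) 1
  div_one : div (T + 1) = Finsupp.single (P 1) 1 - Finsupp.single (P 2) 1
  inj : Function.Injective P
  degree : ∀ p, placeDegree F₂ (P p) = 5

lemma exists_triple {T : K} (hT : DegFive T) : ∃ P : Fin 3 → Place F₂ K, Triple T P := by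
  have h5 := deg_poleDiv hT
  obtain ⟨R, hR⟩ := exists_place_of_deg_five (poleDiv_nonneg T) h5
  have hmem : T ∈ RRspace F₂ (Finsupp.single R 1) := hR ▸ mem_RR_poleDiv T
  have hRne : T ∉ R.1 := by
    intro h
    have := poleDiv_eq_zero_iff.2 h
    rw [hR, Finsupp.single_eq_same] at this
    exact one_ne_zero this
  have h0 : T ≠ 0 := by rintro rfl; exact hRne R.1.zero_mem
  have h1 : T + 1 ≠ 0 := by
    intro h
    apply hRne
    rw [eq_neg_of_add_eq_zero_left h]
    exact R.1.neg_mem _ R.1.one_mem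
  have hdR : deg (Finsupp.single R 1 : Divisor F₂ K) = 5 := hR ▸ h5
  have key : ∀ x : K, x ≠ 0 → x ∈ RRspace F₂ (Finsupp.single R 1) →
      ∃ Q : Place F₂ K, div x = Finsupp.single Q 1 - Finsupp.single R 1 := by
    intro x hx hxR
    rw [mem_RR_iff hx] at hxR
    obtain ⟨Q, hQ⟩ := exists_place_of_deg_five hxR (by rw [map_add, deg_div hx, hdR, zero_add])
    exact ⟨Q, by rw [← hQ, add_sub_cancel_right]⟩
  obtain ⟨Q, hQ⟩ := key T h0 hmem
  obtain ⟨Q', hQ'⟩ := key (T + 1) h1 (add_mem hmem (one_mem_RR (single_nonneg R)))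
  have hR' : T + 1 ∉ R.1 := fun h => hRne (by simpa using R.1.toSubring.sub_mem h R.1.one_mem)
  have hne : ∀ (x : K) (Q : Place F₂ K), x ≠ 0 → x ∉ R.1 →
      div x = Finsupp.single Q 1 - Finsupp.single R 1 → Q ≠ R := by
    rintro x Q hx hxR hQ rfl
    rw [sub_self] at hQ
    apply hxR
    rw [mem_iff_ordAt hx, ← div_apply hx, hQ]
    exact le_rfl
  have hQR := hne T Q h0 hRne hQ
  have hQR' := hne _ Q' h1 hR' hQ'
  have hQQ : Q ≠ Q' := by
    rintro rfl
    have a1 : T ∈ lev Q 1 := by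
      rw [mem_lev_iff h0, ← div_apply h0, hQ, Finsupp.sub_apply, Finsupp.single_eq_same,
        Finsupp.single_eq_of_ne hQR, sub_zero]
    have a2 : T + 1 ∈ lev Q 1 := by
      rw [mem_lev_iff h1, ← div_apply h1, hQ', Finsupp.sub_apply, Finsupp.single_eq_same,
        Finsupp.single_eq_of_ne hQR, sub_zero]
    have a3 := sub_mem a2 a1
    rw [add_sub_cancel_left, mem_lev_iff one_ne_zero, ordAt_one] at a3
    omega
  have hd : ∀ (x : K) (Q : Place F₂ K), x ≠ 0 →
      div x = Finsupp.single Q 1 - Finsupp.single R 1 → placeDegree F₂ Q = 5 := by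
    intro x Q hx h
    have h2 := deg_div hx
    rw [h, map_sub, hdR, deg_place] at h2
    omega
  refine ⟨![Q, Q', R], h0, h1, hQ, hQ', ?_, ?_⟩
  · intro i j h
    fin_cases i <;> fin_cases j <;> first | rfl | exact absurd h (by simp [hQR, hQR.symm, hQR', hQR'.symm, hQQ, hQQ.symm])
  · intro p
    fin_cases p
    · exact hd T Q h0 hQ
    · exact hd _ Q' h1 hQ'
    · have : (placeDegree F₂ R : ℤ) = 5 := by rw [← deg_place, hdR]
      exact_mod_cast this

end Triple

/-- Three places of degree five together with residue maps. -/
structure Setup (T : K) (P : Fin 3 → Place F₂ K) (r : Fin 3 → K → F32) : Prop extends Triple T P where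
  res : ∀ p, Res (P p) (r p)

namespace Setup

variable {T : K} {P : Fin 3 → Place F₂ K} {r : Fin 3 → K → F32}

/-- Local parameters inverse to the pole divisor of `T`. -/
def scale (T : K) (p : Fin 3) : K := if p = 2 then T⁻¹ else 1

/-- Evaluation of functions with poles of order at most `n`. -/
def ev (T : K) (r : Fin 3 → K → F32) (n : ℕ) (p : Fin 3) (f : K) : F32 := r p (f * scale T p ^ n)

/-- The pole divisor of `T`. -/
abbrev pole (P : Fin 3 → Place F₂ K) : Divisor F₂ K := Finsupp.single (P 2) 1

variable (S : Setup T P r)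
include S

lemma ordAt_T (p : Fin 3) : ordAt (P p).1 T = if p = 0 then 1 else if p = 2 then -1 else 0 := by
  have h := DFunLike.congr_fun S.div_zero (P p)
  rw [div_apply S.ne_zero, Finsupp.sub_apply, Finsupp.single_apply, Finsupp.single_apply] at h
  simp only [S.inj.eq_iff] at h
  rw [h]
  fin_cases p <;> decide

lemma ordAt_T_one (p : Fin 3) : ordAt (P p).1 (T + 1) = if p = 1 then 1 else if p = 2 then -1 else 0 := by
  have h := DFunLike.congr_fun S.div_one (P p)
  rw [div_apply S.ne_one, Finsupp.sub_apply, Finsupp.single_apply, Finsupp.single_apply] at h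
  simp only [S.inj.eq_iff] at h
  rw [h]
  fin_cases p <;> decide

lemma scale_ne (p : Fin 3) : scale T p ≠ 0 := by
  unfold scale
  split_ifs
  · exact inv_ne_zero S.ne_zero
  · exact one_ne_zero

lemma ordAt_scale (p : Fin 3) : ordAt (P p).1 (scale T p) = pole P (P p) := by
  unfold scale pole
  rw [Finsupp.single_apply]
  simp only [S.inj.eq_iff]
  split_ifs with h1 h2 h2
  · subst h1
    rw [ordAt_inv S.ne_zero, S.ordAt_T]; decide
  · exact absurd h1.symm h2
  · exact absurd h2.symm h1
  · rw [ordAt_one]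

lemma mem_lev_scale {n : ℕ} {m : ℤ} (p : Fin 3) (f : K) :
    f * scale T p ^ n ∈ lev (P p) m ↔ f ∈ lev (P p) (-(((n : ℤ) • pole P) (P p)) + m) := by
  rw [mem_lev_mul_iff (pow_ne_zero _ (S.scale_ne p)), ordAt_pow (S.scale_ne p), S.ordAt_scale,
    Finsupp.smul_apply, smul_eq_mul]
  ring_nf

lemma mem_lev_of_RR {n : ℕ} {f : K} (hf : f ∈ RRspace F₂ ((n : ℤ) • pole P)) (p : Fin 3) :
    f * scale T p ^ n ∈ lev (P p) 0 := by
  rw [S.mem_lev_scale, add_zero]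
  exact mem_RR.1 hf _

lemma ev_add {n : ℕ} {f g : K} (hf : f ∈ RRspace F₂ ((n : ℤ) • pole P))
    (hg : g ∈ RRspace F₂ ((n : ℤ) • pole P)) (p : Fin 3) :
    ev T r n p (f + g) = ev T r n p f + ev T r n p g := by
  unfold ev
  rw [add_mul, (S.res p).add _ (S.mem_lev_of_RR hf p) _ (S.mem_lev_of_RR hg p)]

lemma ev_smul (n : ℕ) (f : K) (a : F₂) (p : Fin 3) : ev T r n p (a • f) = a • ev T r n p f := by
  unfold ev
  rw [smul_mul_assoc, (S.res p).smul]

lemma ev_mul {m n : ℕ} {f g : K} (hf : f ∈ RRspace F₂ ((m : ℤ) • pole P))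
    (hg : g ∈ RRspace F₂ ((n : ℤ) • pole P)) (p : Fin 3) :
    ev T r (m + n) p (f * g) = ev T r m p f * ev T r n p g := by
  unfold ev
  rw [pow_add, mul_mul_mul_comm, (S.res p).mul _ (S.mem_lev_of_RR hf p) _ (S.mem_lev_of_RR hg p)]

lemma ev_eq_zero_iff {n : ℕ} {f : K} (hf : f ∈ RRspace F₂ ((n : ℤ) • pole P)) (p : Fin 3) :
    ev T r n p f = 0 ↔ f ∈ RRspace F₂ ((n : ℤ) • pole P - Finsupp.single (P p) 1) := by
  unfold ev
  rw [(S.res p).zero_iff _ (S.mem_lev_of_RR hf p), S.mem_lev_scale]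
  exact ⟨mem_RR_sub hf, lev_of_mem_RR_sub⟩

lemma T_mem : T ∈ RRspace F₂ (((1 : ℕ) : ℤ) • pole P) := by
  rw [mem_RR_iff S.ne_zero, S.div_zero]
  simp

lemma pow_mem {j n : ℕ} (h : j ≤ n) : T ^ j ∈ RRspace F₂ ((n : ℤ) • pole P) := by
  have := pow_mem_RR S.T_mem j
  rw [smul_smul, Nat.cast_one, mul_one] at this
  have hjn : (j : ℤ) ≤ n := by exact_mod_cast h
  exact RR_mono (smul_le_smul_div (single_nonneg _) hjn) this

lemma ev_pow (n j : ℕ) (hj : j ≤ n) (p : Fin 3) :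
    ev T r n p (T ^ j) = if p = 0 then (if j = 0 then 1 else 0) else
      if p = 2 then (if j = n then 1 else 0) else 1 := by
  have hr := S.res p
  unfold ev scale
  fin_cases p
  · simp only [Fin.zero_eta, Fin.isValue, if_true, show ((0 : Fin 3) = 2) = False by simp, if_false,
      one_pow, mul_one]
    split_ifs with h
    · rw [h, pow_zero]; exact hr.one
    · have h1 : T ^ j ∈ lev (P 0) 1 := by
        rw [mem_lev_iff (pow_ne_zero _ S.ne_zero), ordAt_pow S.ne_zero, S.ordAt_T]
        simp only [if_true]; omega
      exact (hr.zero_iff _ (lev_mono _ zero_le_one h1)).2 h1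
  · simp only [Fin.mk_one, Fin.isValue, show ((1 : Fin 3) = 2) = False by simp,
      show ((1 : Fin 3) = 0) = False by simp, if_false, one_pow, mul_one]
    rw [← hr.one]
    have h1 : T ^ j - 1 ∈ lev (P 1) 1 := by
      have h0 : T ∈ lev (P 1) 0 := by
        rw [mem_lev_iff S.ne_zero, S.ordAt_T]; simp
      have h2 : T - 1 ∈ lev (P 1) 1 := by
        have := charTwo (K := K)
        rw [CharTwo.sub_eq_add, mem_lev_iff S.ne_one, S.ordAt_T_one]; simp
      obtain ⟨c, hc⟩ := sub_dvd_pow_sub_pow (⟨T, mem_lev_zero.1 h0⟩ : (P 1).1) 1 j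
      have h3 := congrArg Subtype.val hc
      change T ^ j - 1 ^ j = (T - 1) * c at h3
      rw [one_pow] at h3
      rw [h3]
      simpa using mul_mem_lev h2 (mem_lev_zero.2 c.2)
    refine hr.congr ?_ h1
    have := add_mem (lev_mono _ zero_le_one h1) (show (1 : K) ∈ lev (P 1) 0 from mem_lev_zero.2 (P 1).1.one_mem)
    simpa using this
  · simp only [Fin.reduceFinMk, Fin.isValue, show ((2 : Fin 3) = 0) = False by simp, if_true, if_false]
    split_ifs with h
    · rw [h, inv_pow, mul_inv_cancel₀ (pow_ne_zero _ S.ne_zero)]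
      exact hr.one
    · have h1 : T ^ j * T⁻¹ ^ n ∈ lev (P 2) 1 := by
        rw [mem_lev_iff (mul_ne_zero (pow_ne_zero _ S.ne_zero) (pow_ne_zero _ (inv_ne_zero S.ne_zero))),
          ordAt_mul (pow_ne_zero _ S.ne_zero) (pow_ne_zero _ (inv_ne_zero S.ne_zero)),
          ordAt_pow S.ne_zero, ordAt_pow (inv_ne_zero S.ne_zero), ordAt_inv S.ne_zero, S.ordAt_T]
        simp only [show ((2 : Fin 3) = 0) = False by simp, if_true, if_false]; omega
      exact (hr.zero_iff _ (lev_mono _ zero_le_one h1)).2 h1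

lemma mem_line {f : K} (hf : f ∈ RRspace F₂ (pole P)) : ∃ a b : F₂, f = a • 1 + b • T := by
  have hd : deg (Finsupp.single (P 2) 1 : Divisor F₂ K) = 5 := by
    rw [deg_place, S.degree]; rfl
  have hp : HasPole (P 2) 1 T := by
    refine ⟨by simpa using S.T_mem, ?_⟩
    rw [mem_lev_iff S.ne_zero, S.ordAt_T]; simp
  have h := RR_le_sup_span hp (by
    rw [ell_eq_lseq, ell_eq_lseq, map_zsmul, map_zsmul, hd]
    norm_num
    rw [lseq_five_eq, lseq_zero])
  have h1 := h (by simpa using hf)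
  rw [sub_self, zero_smul, RR_zero, Submodule.mem_sup] at h1
  obtain ⟨y, hy, z, hz, rfl⟩ := h1
  obtain ⟨a, rfl⟩ := Submodule.mem_span_singleton.1 hy
  obtain ⟨b, rfl⟩ := Submodule.mem_span_singleton.1 hz
  exact ⟨a, b, rfl⟩

end Setup

variable {K : Type} [Field K] [Algebra (ZMod 2) K] [GenusFourFive K]

namespace Setup

variable {T : K} {P : Fin 3 → Place F₂ K} {r : Fin 3 → K → F32} (S : Setup T P r)

section
include S

lemma smul_pow_mem {j n : ℕ} (h : j ≤ n) (a : F₂) : a • T ^ j ∈ RRspace F₂ ((n : ℤ) • pole P) :=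
  Submodule.smul_mem _ _ (S.pow_mem h)

lemma poly_mem {n : ℕ} (hn : 1 ≤ n) (a b c : F₂) :
    a • T ^ 0 + b • T ^ 1 + c • T ^ n ∈ RRspace F₂ ((n : ℤ) • pole P) :=
  add_mem (add_mem (S.smul_pow_mem (Nat.zero_le _) a) (S.smul_pow_mem hn b)) (S.smul_pow_mem le_rfl c)

lemma ev_poly {n : ℕ} (hn : 2 ≤ n) (a b c : F₂) (p : Fin 3) :
    ev T r n p (a • T ^ 0 + b • T ^ 1 + c • T ^ n) =
      (if p = 0 then a else if p = 2 then c else a + b + c) • (1 : F32) := by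
  rw [S.ev_add (add_mem (S.smul_pow_mem (Nat.zero_le _) a) (S.smul_pow_mem (by omega) b))
    (S.smul_pow_mem le_rfl c), S.ev_add (S.smul_pow_mem (Nat.zero_le _) a) (S.smul_pow_mem (by omega) b),
    S.ev_smul, S.ev_smul, S.ev_smul, S.ev_pow n 0 (Nat.zero_le _), S.ev_pow n 1 (by omega),
    S.ev_pow n n le_rfl]
  have h0 : ¬ (0 = n) := by omega
  have h1 : ¬ (1 = n) := by omega
  have h2 : ¬ (n = 0) := by omega
  by_cases hp0 : p = 0
  · simp [hp0, h2]
  · by_cases hp2 : p = 2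
    · simp [hp2, h0, h1]
    · simp [hp0, hp2, add_smul]

lemma ev_zero (n : ℕ) (p : Fin 3) : ev T r n p 0 = 0 := by
  rw [S.ev_eq_zero_iff (zero_mem _)]; exact zero_mem _

end

/-- Functions with poles of order at most two all of whose values have trace zero. -/
structure Traceless (T : K) (P : Fin 3 → Place F₂ K) (r : Fin 3 → K → F32) (f : K) : Prop where
  mem : f ∈ RRspace F₂ (((2 : ℕ) : ℤ) • pole P)
  tr : ∀ p, F32.tr (ev T r 2 p f) = 0

include S

lemma traceless_zero : Traceless T P r 0 := ⟨zero_mem _, fun p => by rw [S.ev_zero, F32.tr_zero]⟩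

lemma traceless_add {f g : K} (hf : Traceless T P r f) (hg : Traceless T P r g) :
    Traceless T P r (f + g) :=
  ⟨add_mem hf.mem hg.mem, fun p => by
    rw [S.ev_add hf.mem hg.mem, F32.tr_add, hf.tr, hg.tr, add_zero]⟩

lemma exists_poly {n : ℕ} (hn : 2 ≤ n) {f : K} (hf : f ∈ RRspace F₂ ((n : ℤ) • pole P)) :
    ∃ a b c : F₂, ∃ v ∈ RRspace F₂ ((n : ℤ) • pole P), f = a • T ^ 0 + b • T ^ 1 + c • T ^ n + v ∧
      (∀ p, F32.tr (ev T r n p v) = 0) ∧ ∀ p, F32.half (ev T r n p v) = F32.half (ev T r n p f) := by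
  obtain ⟨t, ht⟩ : ∃ t : Fin 3 → F₂, ∀ p, F32.tr (ev T r n p f) = t p := ⟨_, fun _ => rfl⟩
  have hg := S.poly_mem (n := n) (by omega) (t 0) (t 0 + t 1 + t 2) (t 2)
  have hev := S.ev_poly hn (t 0) (t 0 + t 1 + t 2) (t 2)
  set g := t 0 • T ^ 0 + (t 0 + t 1 + t 2) • T ^ 1 + t 2 • T ^ n with hgdef
  have hval : ∀ p, (if p = 0 then t 0 else if p = 2 then t 2 else t 0 + (t 0 + t 1 + t 2) + t 2) = t p := by
    intro p
    fin_cases p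
    · rfl
    · change t 0 + (t 0 + t 1 + t 2) + t 2 = t 1
      generalize t 0 = a
      generalize t 1 = b
      generalize t 2 = c
      revert a b c; decide
    · rfl
  have hv := sub_mem hf hg
  have hsum : ∀ p, ev T r n p f = t p • (1 : F32) + ev T r n p (f - g) := by
    intro p
    rw [← hval p, ← hev p, ← S.ev_add hg hv, add_sub_cancel]
  refine ⟨t 0, t 0 + t 1 + t 2, t 2, f - g, hv, (add_sub_cancel g f).symm, fun p => ?_, fun p => ?_⟩
  · have h := congrArg F32.tr (hsum p)
    rw [ht, F32.tr_add, F32.tr_smul_one] at h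
    exact left_eq_add.1 h
  · rw [hsum, F32.half_add, F32.half_smul_one, Nat.zero_xor]

lemma eq_zero_of_ev {f : K} (hf : Traceless T P r f) (p : Fin 3)
    (h : F32.half (ev T r 2 p f) = 0) : f = 0 := by
  have hev := F32.eq_zero _ (hf.tr p) h
  rw [S.ev_eq_zero_iff hf.mem] at hev
  have hpoly : ∃ a b c : F₂, f = a • T ^ 0 + b • T ^ 1 + c • T ^ 2 := by
    have key : ∀ g : K, g ≠ 0 → div g = Finsupp.single (P p) 1 - pole P →
        ∃ a b : F₂, f = (a • 1 + b • T) * g := by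
      intro g hg hdg
      have h1 : f / g ∈ RRspace F₂ (pole P) := by
        have h2 := (mem_RR_mul_iff (D := ((2 : ℕ) : ℤ) • pole P - Finsupp.single (P p) 1) (f := f / g) hg).1
          (by rwa [div_mul_cancel₀ f hg])
        convert h2 using 2
        rw [hdg, Nat.cast_two, two_smul]
        abel
      obtain ⟨a, b, hab⟩ := S.mem_line h1
      exact ⟨a, b, by rw [← hab, div_mul_cancel₀ f hg]⟩
    fin_cases p
    · obtain ⟨a, b, rfl⟩ := key T S.ne_zero S.div_zero
      refine ⟨0, a, b, ?_⟩
      simp only [Algebra.smul_def, map_zero]; ring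
    · obtain ⟨a, b, rfl⟩ := key (T + 1) S.ne_one S.div_one
      refine ⟨a, a + b, b, ?_⟩
      simp only [Algebra.smul_def, map_add]; ring
    · obtain ⟨a, b, rfl⟩ := key 1 one_ne_zero (by
        have : div (1 : K) = 0 := by
          ext Q; rw [div_apply one_ne_zero, ordAt_one]; rfl
        rw [this]
        exact (sub_self _).symm)
      refine ⟨a, b, 0, ?_⟩
      simp only [Algebra.smul_def, map_zero]; ring
  obtain ⟨a, b, c, rfl⟩ := hpoly
  have ht := hf.tr
  simp only [S.ev_poly le_rfl, F32.tr_smul_one] at ht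
  have h0 := ht 0
  have h1 := ht 1
  have h2 := ht 2
  simp at h0 h1 h2
  rw [h0, h2] at h1 ⊢
  simp at h1
  rw [h1]; simp

lemma exists_traceless (p : Fin 3) {x : ℕ} (hx : x < 16) :
    ∃ v, Traceless T P r v ∧ F32.half (ev T r 2 p v) = x := by
  obtain ⟨φ, hφ, hφr⟩ := (S.res p).surj (F32.dbl x)
  set D : Divisor F₂ K := ((2 : ℕ) : ℤ) • pole P - Finsupp.single (P p) 1 with hD
  have hdeg : deg D = 5 := by
    rw [hD, map_sub, deg_smul, deg_place, deg_place, S.degree, S.degree]; norm_num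
  have hspec : spec D = 0 := by
    unfold spec
    rw [ell_eq_lseq, hdeg, lseq_five_eq]; norm_num
  have hs := pow_ne_zero 2 (S.scale_ne p)
  have hDP : D (P p) = (((2 : ℕ) : ℤ) • pole P) (P p) - 1 := by
    rw [hD, Finsupp.sub_apply, Finsupp.single_eq_same]
  obtain ⟨l, hl, hfl⟩ := RR_surj_of_spec hspec (φ / scale T p ^ 2) (by
    rw [hDP, show -((((2 : ℕ) : ℤ) • pole P) (P p) - 1) - 1 = -((((2 : ℕ) : ℤ) • pole P) (P p)) + 0 by ring,
      ← S.mem_lev_scale, div_mul_cancel₀ _ hs]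
    exact hφ)
  rw [hD, sub_add_cancel] at hl
  have hev : ev T r 2 p l = F32.dbl x := by
    rw [← hφr]
    symm
    refine (S.res p).congr hφ ?_
    rw [hDP, show -((((2 : ℕ) : ℤ) • pole P) (P p) - 1) = -((((2 : ℕ) : ℤ) • pole P) (P p)) + 1 by ring,
      ← S.mem_lev_scale, sub_mul, div_mul_cancel₀ _ hs] at hfl
    exact hfl
  obtain ⟨a, b, c, v, hv, -, h1, h2⟩ := S.exists_poly le_rfl hl
  exact ⟨v, ⟨hv, h1⟩, by rw [h2, hev, F32.half_dbl x hx]⟩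

end Setup

/-- Linear combinations indexed by four-bit strings. -/
def vec (v : Fin 4 → K) (x : ℕ) : K := ∑ i : Fin 4, if x.testBit i then v i else 0

omit [Algebra (ZMod 2) K] [GenusFourFive K] in
lemma vec_zero (v : Fin 4 → K) : vec v 0 = 0 := by simp [vec]

omit [GenusFourFive K] in
lemma vec_xor (v : Fin 4 → K) (x y : ℕ) : vec v (x ^^^ y) = vec v x + vec v y := by
  have := charTwo (K := K)
  unfold vec
  rw [← Finset.sum_add_distrib]
  refine Finset.sum_congr rfl fun i _ => ?_
  rw [Nat.testBit_xor]
  cases x.testBit i <;> cases y.testBit i <;> simp [CharTwo.add_self_eq_zero]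

omit [Algebra (ZMod 2) K] [GenusFourFive K] in
lemma vec_two_pow (v : Fin 4 → K) (i : Fin 4) : vec v (2 ^ (i : ℕ)) = v i := by
  unfold vec
  rw [Finset.sum_eq_single i]
  · simp
  · intro j _ hj
    rw [Nat.testBit_two_pow_of_ne (fun h => hj (Fin.ext h.symm))]; rfl
  · simp

/-- Mutually inverse additive bijections of four-bit strings. -/
structure CodeIso (p q : ℕ → ℕ) : Prop where
  lt : ∀ x < 16, p x < 16
  xor : ∀ x < 16, ∀ y < 16, p (x ^^^ y) = p x ^^^ p y
  lt_inv : ∀ y < 16, q y < 16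
  left : ∀ x < 16, q (p x) = x
  right : ∀ y < 16, p (q y) = y

namespace Setup

variable {T : K} {P : Fin 3 → Place F₂ K} {r : Fin 3 → K → F32} (S : Setup T P r)

/-- A basis of the traceless functions adapted to the first place. -/
structure Adapted (T : K) (P : Fin 3 → Place F₂ K) (r : Fin 3 → K → F32) (v : Fin 4 → K) : Prop where
  traceless : ∀ i, Traceless T P r (v i)
  half : ∀ i, F32.half (ev T r 2 0 (v i)) = 2 ^ (i : ℕ)

/-- The values of linear combinations of basis elements. -/
def code (T : K) (r : Fin 3 → K → F32) (v : Fin 4 → K) (p : Fin 3) (x : ℕ) : ℕ :=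
  F32.half (ev T r 2 p (vec v x))

include S

lemma exists_adapted : ∃ v, Adapted T P r v := by
  have h : ∀ i : Fin 4, ∃ v, Traceless T P r v ∧ F32.half (ev T r 2 0 v) = 2 ^ (i : ℕ) := fun i =>
    S.exists_traceless 0 (by fin_cases i <;> decide)
  choose v h1 h2 using h
  exact ⟨v, h1, h2⟩

variable {v : Fin 4 → K} (hv : Adapted T P r v)
include hv

lemma traceless_vec (x : ℕ) : Traceless T P r (vec v x) := by
  unfold vec
  have : ∀ s : Finset (Fin 4), Traceless T P r (∑ i ∈ s, if x.testBit i then v i else 0) := by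
    intro s
    induction s using Finset.induction_on with
    | empty => simpa using S.traceless_zero
    | insert i s hi ih =>
      rw [Finset.sum_insert hi]
      refine S.traceless_add ?_ ih
      split_ifs
      · exact hv.traceless i
      · exact S.traceless_zero
  exact this _

lemma code_xor (p : Fin 3) (x y : ℕ) : code T r v p (x ^^^ y) = code T r v p x ^^^ code T r v p y := by
  unfold code
  rw [vec_xor, S.ev_add (S.traceless_vec hv x).mem (S.traceless_vec hv y).mem, F32.half_add]

omit [GenusFourFive K] S in
lemma code_two_pow (i : Fin 4) : code T r v 0 (2 ^ (i : ℕ)) = 2 ^ (i : ℕ) := by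
  unfold code
  rw [vec_two_pow, hv.half]

lemma code_zero (x : ℕ) (hx : x < 16) : code T r v 0 x = x := by
  have h0 : code T r v 0 0 = 0 := by
    unfold code; rw [vec_zero, S.ev_zero, F32.half_zero]
  have h1 := code_two_pow hv 0
  have h2 := code_two_pow hv 1
  have h3 := code_two_pow hv 2
  have h4 := code_two_pow hv 3
  simp at h1 h2 h3 h4
  have key : ∀ a b : ℕ, code T r v 0 a = a → code T r v 0 b = b → code T r v 0 (a ^^^ b) = a ^^^ b := by
    intro a b ha hb
    rw [S.code_xor hv, ha, hb]
  have e3 := key 1 2 h1 h2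
  have e5 := key 1 4 h1 h3
  have e6 := key 2 4 h2 h3
  have e7 := key 3 4 e3 h3
  have e9 := key 1 8 h1 h4
  have e10 := key 2 8 h2 h4
  have e11 := key 3 8 e3 h4
  have e12 := key 4 8 h3 h4
  have e13 := key 5 8 e5 h4
  have e14 := key 6 8 e6 h4
  have e15 := key 7 8 e7 h4
  interval_cases x <;> assumption

lemma vec_code {f : K} (hf : Traceless T P r f) : f = vec v (F32.half (ev T r 2 0 f)) := by
  have := charTwo (K := K)
  rw [← sub_eq_zero, CharTwo.sub_eq_add]
  refine S.eq_zero_of_ev (S.traceless_add hf (S.traceless_vec hv _)) 0 ?_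
  rw [S.ev_add hf.mem (S.traceless_vec hv _).mem, F32.half_add]
  change _ ^^^ code T r v 0 _ = 0
  rw [S.code_zero hv _ (F32.half_lt _), Nat.xor_self]

lemma exists_codeIso (p : Fin 3) : ∃ q, CodeIso (code T r v p) q := by
  have h : ∀ y : ℕ, ∃ x, x < 16 ∧ (y < 16 → code T r v p x = y) := by
    intro y
    by_cases hy : y < 16
    · obtain ⟨f, hf, hfy⟩ := S.exists_traceless p hy
      refine ⟨_, F32.half_lt (ev T r 2 0 f), fun _ => ?_⟩
      unfold code
      rw [← S.vec_code hv hf, hfy]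
    · exact ⟨0, by norm_num, fun h => absurd h hy⟩
  choose q hq1 hq2 using h
  refine ⟨q, fun x _ => F32.half_lt _, fun x _ y _ => S.code_xor hv p x y, fun y _ => hq1 y, fun x hx => ?_, hq2⟩
  have h1 := hq2 (code T r v p x) (F32.half_lt _)
  have h2 : vec v (q (code T r v p x) ^^^ x) = 0 := by
    refine S.eq_zero_of_ev (S.traceless_vec hv _) p ?_
    change code T r v p _ = 0
    rw [S.code_xor hv, h1, Nat.xor_self]
  have h3 : code T r v 0 (q (code T r v p x) ^^^ x) = 0 := by
    rw [code, h2, S.ev_zero, F32.half_zero]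
  rw [S.code_zero hv _ (Nat.xor_lt_two_pow (n := 4) (hq1 _) hx)] at h3
  exact Nat.xor_eq_zero_iff.1 h3

end Setup

/-- Commutative biadditive products on four-bit strings. -/
structure Product (m : ℕ → ℕ → ℕ) : Prop where
  lt : ∀ x < 16, ∀ y < 16, m x y < 16
  comm : ∀ x < 16, ∀ y < 16, m x y = m y x
  add : ∀ x < 16, ∀ y < 16, ∀ z < 16, m (x ^^^ y) z = m x z ^^^ m y z

/-- Transport of the standard product. -/
def conj (p q : ℕ → ℕ) (x y : ℕ) : ℕ := q (star (p x) (p y))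

lemma xor_lt {x y : ℕ} (hx : x < 16) (hy : y < 16) : x ^^^ y < 16 := Nat.xor_lt_two_pow (n := 4) hx hy

lemma CodeIso.xor_inv {p q : ℕ → ℕ} (h : CodeIso p q) {x y : ℕ} (hx : x < 16) (hy : y < 16) :
    q (x ^^^ y) = q x ^^^ q y := by
  have h1 := h.lt_inv x hx
  have h2 := h.lt_inv y hy
  rw [← h.left _ (xor_lt h1 h2), h.xor _ h1 _ h2, h.right x hx, h.right y hy]

lemma CodeIso.product {p q : ℕ → ℕ} (h : CodeIso p q) : Product (conj p q) where
  lt x _ y _ := h.lt_inv _ (star_lt _ _)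
  comm x hx y hy := by unfold conj; rw [star_comm _ (h.lt x hx) _ (h.lt y hy)]
  add x hx y hy z hz := by
    unfold conj
    rw [h.xor x hx y hy, star_add _ (h.lt x hx) _ (h.lt y hy) _ (h.lt z hz),
      h.xor_inv (star_lt _ _) (star_lt _ _)]

variable {K : Type} [Field K] [Algebra (ZMod 2) K]

/-- A basis over the polynomials in `T` whose multiplication is governed by three products. -/
structure Frame (T : K) (v : Fin 4 → K) (m₀ m₁ m₂ : ℕ → ℕ → ℕ) : Prop where
  indep : PolyIndep T (Fin.cons 1 v : Fin 5 → K)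
  product₀ : Product m₀
  product₁ : Product m₁
  product₂ : Product m₂
  rel : ∀ x < 16, ∀ y < 16, ∃ c : Polynomial F₂, vec v x * vec v y = Polynomial.aeval T c +
    (T + 1) * vec v (m₀ x y) + T * vec v (m₁ x y) + (T ^ 2 + T) * vec v (m₂ x y)

variable [GenusFourFive K]

namespace Setup

variable {T : K} {P : Fin 3 → Place F₂ K} {r : Fin 3 → K → F32} (S : Setup T P r)

include S

lemma poleDiv_eq : poleDiv T = pole P := by
  ext Q
  have hinj := S.inj
  rw [poleDiv_apply, S.div_zero, Finsupp.sub_apply, pole]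
  have h0 : (Finsupp.single (P 0) 1 : Divisor F₂ K) Q = if P 0 = Q then 1 else 0 := Finsupp.single_apply
  have h2 : (Finsupp.single (P 2) 1 : Divisor F₂ K) Q = if P 2 = Q then 1 else 0 := Finsupp.single_apply
  rw [h0, h2]
  split_ifs with a b b
  · exact absurd (hinj (a.trans b.symm)) (by decide)
  · rfl
  · rfl
  · rfl

/-- A function vanishing at all three places. -/
lemma mem_of_ev_eq_zero {n : ℕ} {f : K} (hf : f ∈ RRspace F₂ ((n : ℤ) • pole P))
    (h : ∀ p, ev T r n p f = 0) : f ∈ RRspace F₂ ((n : ℤ) • pole P - Finsupp.single (P 0) 1 -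
      Finsupp.single (P 1) 1 - Finsupp.single (P 2) 1) := by
  have hp : ∀ p, f ∈ lev (P p) (-(((n : ℤ) • pole P) (P p)) + 1) := fun p =>
    lev_of_mem_RR_sub ((S.ev_eq_zero_iff hf p).1 (h p))
  have hne : ∀ i j : Fin 3, i ≠ j → (Finsupp.single (P i) 1 : Divisor F₂ K) (P j) = 0 := fun i j hij =>
    Finsupp.single_eq_of_ne fun h => hij (S.inj h.symm)
  refine mem_RR_sub (mem_RR_sub (mem_RR_sub hf (hp 0)) ?_) ?_
  · rw [Finsupp.sub_apply, hne 0 1 (by decide), sub_zero]; exact hp 1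
  · rw [Finsupp.sub_apply, Finsupp.sub_apply, hne 0 2 (by decide), hne 1 2 (by decide), sub_zero, sub_zero]
    exact hp 2

variable {v : Fin 4 → K} (hv : Adapted T P r v)
include hv

omit [GenusFourFive K] S hv in
lemma smul_vec (c : Fin 4 → F₂) : ∃ x < 16, (∀ i : Fin 4, x.testBit i = true ↔ c i = 1) ∧
    ∑ i, c i • v i = vec v x := by
  have h : ∀ c : Fin 4 → F₂, ∃ x < 16, ∀ i : Fin 4, x.testBit i = true ↔ c i = 1 := by decide
  obtain ⟨x, hx, hc⟩ := h c
  refine ⟨x, hx, hc, ?_⟩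
  unfold vec
  refine Finset.sum_congr rfl fun i _ => ?_
  have h01 : ∀ a : F₂, a = 0 ∨ a = 1 := by decide
  have := hc i
  rcases h01 (c i) with h | h
  · rw [h] at this ⊢
    simp at this
    rw [this, zero_smul]; rfl
  · rw [h] at this ⊢
    rw [this.2 rfl, one_smul]; rfl

lemma indep : PolyIndep T (Fin.cons 1 v : Fin 5 → K) := by
  have h1 : PolyIndep T (Fin.cons (T ^ 2) v : Fin 5 → K) := by
    refine polyIndep_of_lead (n := 1) ?_ ?_
    · rw [S.poleDiv_eq]
      intro i
      refine Fin.cases ?_ (fun i => ?_) i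
      · exact S.pow_mem (n := 2) le_rfl
      · exact (hv.traceless i).mem
    · intro c hc
      rw [S.poleDiv_eq, one_smul, Fin.sum_univ_succ] at hc
      simp only [Fin.cons_zero, Fin.cons_succ] at hc
      obtain ⟨x, hx, hxc, hsum⟩ := smul_vec (v := v) fun i => c i.succ
      rw [hsum] at hc
      obtain ⟨a, b, hab⟩ := S.mem_line hc
      have h2 : vec v x = a • T ^ 0 + b • T ^ 1 + (-c 0) • T ^ 2 := by
        rw [pow_zero, pow_one, ← hab, neg_smul]; ring
      have ht := (S.traceless_vec hv x).tr
      rw [h2] at ht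
      simp only [S.ev_poly le_rfl, F32.tr_smul_one] at ht
      have e0 := ht 0
      have e1 := ht 1
      have e2 := ht 2
      simp at e0 e1 e2
      rw [e0, e2] at e1
      simp at e1
      rw [e0, e1, e2] at h2
      simp at h2
      have h3 := S.code_zero hv x hx
      rw [code, h2, S.ev_zero, F32.half_zero] at h3
      funext i
      refine Fin.cases e2 (fun i => ?_) i
      have := hxc i
      rw [← h3, Nat.zero_testBit] at this
      have h01 : ∀ a : F₂, a = 0 ∨ a = 1 := by decide
      exact (h01 _).resolve_right fun h => Bool.false_ne_true (this.2 h)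
  intro p hp
  have h2 : (Fin.cons (p 0) (fun i => Polynomial.X ^ 2 * p i.succ) : Fin 5 → Polynomial F₂) = 0 := by
    apply h1
    rw [Fin.sum_univ_succ] at hp ⊢
    simp only [Fin.cons_zero, Fin.cons_succ, map_mul, map_pow, Polynomial.aeval_X] at hp ⊢
    have h3 := congrArg (fun z => T ^ 2 * z) hp
    simp only [mul_zero, mul_add, Finset.mul_sum] at h3
    rw [← h3]
    congr 1
    · ring
    · exact Finset.sum_congr rfl fun i _ => by ring
  funext i
  refine Fin.cases (congrFun h2 0) (fun i => ?_) i
  have h3 := congrFun h2 i.succ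
  simp only [Fin.cons_succ, Pi.zero_apply] at h3
  exact (mul_eq_zero.1 h3).resolve_left (pow_ne_zero 2 Polynomial.X_ne_zero)

lemma mem_span_of_RR (n : ℕ) : ∀ f ∈ RRspace F₂ ((n : ℤ) • pole P),
    f ∈ polySpan T (Fin.cons 1 v : Fin 5 → K) := by
  have hone : (1 : K) ∈ polySpan T (Fin.cons 1 v : Fin 5 → K) :=
    mem_polySpan (h := (Fin.cons 1 v : Fin 5 → K)) 0
  have hpow : ∀ (j : ℕ) (a : F₂), a • T ^ j ∈ polySpan T (Fin.cons 1 v : Fin 5 → K) := fun j a => by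
    simpa using Submodule.smul_mem _ a (pow_mul_mem_polySpan hone j)
  induction n with
  | zero =>
    intro f hf
    rw [Nat.cast_zero, zero_smul, RR_zero] at hf
    obtain ⟨a, rfl⟩ := Submodule.mem_span_singleton.1 hf
    exact Submodule.smul_mem _ _ hone
  | succ n ih =>
    intro f hf
    rcases n with _ | n
    · rw [zero_add, Nat.cast_one, one_smul] at hf
      obtain ⟨a, b, rfl⟩ := S.mem_line hf
      have h1 := hpow 1 b
      rw [pow_one] at h1
      exact add_mem (Submodule.smul_mem _ _ hone) h1
    · obtain ⟨a, b, c, w, hw, rfl, htr, -⟩ := S.exists_poly (by omega) hf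
      refine add_mem (add_mem (add_mem (hpow _ _) (hpow _ _)) (hpow _ _)) ?_
      obtain ⟨u, hu, huw⟩ := S.exists_traceless 2 (F32.half_lt (ev T r (n + 1 + 1) 2 w))
      have huv : u ∈ polySpan T (Fin.cons 1 v : Fin 5 → K) := by
        rw [S.vec_code hv hu]
        unfold vec
        refine sum_mem fun i _ => ?_
        split_ifs
        · exact mem_polySpan (h := (Fin.cons 1 v : Fin 5 → K)) i.succ
        · exact zero_mem _
      have hTn := S.pow_mem (j := n) (n := n) le_rfl
      have hprod : T ^ n * u ∈ RRspace F₂ (((n + 1 + 1 : ℕ) : ℤ) • pole P) := by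
        have := mul_mem_RR hTn hu.mem
        rwa [← add_smul, ← Nat.cast_add] at this
      have hev : ev T r (n + 1 + 1) 2 (T ^ n * u) = ev T r (n + 1 + 1) 2 w := by
        rw [show n + 1 + 1 = n + 2 from rfl, S.ev_mul hTn hu.mem, S.ev_pow n n le_rfl]
        simp only [show ((2 : Fin 3) = 0) = False by simp, if_true, if_false, one_mul]
        exact F32.ext_of (by rw [hu.tr]; exact (htr 2).symm) huw
      have hdiff : w - T ^ n * u ∈ RRspace F₂ (((n + 1 : ℕ) : ℤ) • pole P) := by
        have h1 := sub_mem hw hprod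
        have h2 := S.ev_add h1 hprod 2
        rw [sub_add_cancel, hev] at h2
        have h3 := (S.ev_eq_zero_iff h1 2).1 (left_eq_add.1 (by rw [add_comm]; exact h2))
        convert h3 using 2
        rw [Nat.cast_succ (n + 1), add_smul, one_smul, add_sub_cancel_right]
      have := add_mem (ih _ hdiff) (pow_mul_mem_polySpan huv n)
      rwa [sub_add_cancel] at this

lemma rel {q : Fin 3 → ℕ → ℕ} (hq : ∀ p, CodeIso (code T r v p) (q p)) (x y : ℕ) :
    ∃ c : Polynomial F₂, vec v x * vec v y = Polynomial.aeval T c +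
      (T + 1) * vec v (conj (code T r v 0) (q 0) x y) + T * vec v (conj (code T r v 1) (q 1) x y) +
        (T ^ 2 + T) * vec v (conj (code T r v 2) (q 2) x y) := by
  obtain ⟨m, hm⟩ : ∃ m : Fin 3 → ℕ, ∀ p, m p = conj (code T r v p) (q p) x y := ⟨_, fun _ => rfl⟩
  rw [← hm, ← hm, ← hm]
  have hmem := fun x => (S.traceless_vec hv x).mem
  have hcode : ∀ p, F32.half (ev T r 2 p (vec v (m p))) = star (code T r v p x) (code T r v p y) := by
    intro p
    rw [hm]
    exact (hq p).right _ (star_lt _ _)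
  have hf : vec v x * vec v y ∈ RRspace F₂ (((4 : ℕ) : ℤ) • pole P) := by
    have := mul_mem_RR (hmem x) (hmem y)
    rwa [← add_smul] at this
  have hfev : ∀ p, F32.half (ev T r 4 p (vec v x * vec v y)) = F32.half (ev T r 2 p (vec v (m p))) := by
    intro p
    rw [hcode, show 4 = 2 + 2 from rfl, S.ev_mul (hmem x) (hmem y),
      F32.half_mul _ _ ((S.traceless_vec hv x).tr p) ((S.traceless_vec hv y).tr p)]
    rfl
  have hTj : ∀ j ≤ 2, ∀ x, T ^ j * vec v x ∈ RRspace F₂ (((4 : ℕ) : ℤ) • pole P) ∧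
      ∀ p, ev T r 4 p (T ^ j * vec v x) = ev T r 2 p (T ^ j) * ev T r 2 p (vec v x) := by
    intro j hj x
    have h1 := S.pow_mem hj
    refine ⟨?_, fun p => S.ev_mul h1 (hmem x) p⟩
    have := mul_mem_RR h1 (hmem x)
    rwa [← add_smul] at this
  set R := T ^ 0 * vec v (m 0) + T ^ 1 * vec v (m 0) + T ^ 1 * vec v (m 1) +
    (T ^ 1 * vec v (m 2) + T ^ 2 * vec v (m 2)) with hR
  have k0 := hTj 0 (by norm_num) (m 0)
  have k1 := hTj 1 (by norm_num) (m 0)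
  have k2 := hTj 1 (by norm_num) (m 1)
  have k3 := hTj 1 (by norm_num) (m 2)
  have k4 := hTj 2 (by norm_num) (m 2)
  have hRmem : R ∈ RRspace F₂ (((4 : ℕ) : ℤ) • pole P) :=
    add_mem (add_mem (add_mem k0.1 k1.1) k2.1) (add_mem k3.1 k4.1)
  have hRev : ∀ p, ev T r 4 p R = ev T r 2 p (vec v (m p)) := by
    intro p
    rw [hR, S.ev_add (add_mem (add_mem k0.1 k1.1) k2.1) (add_mem k3.1 k4.1),
      S.ev_add (add_mem k0.1 k1.1) k2.1, S.ev_add k0.1 k1.1, S.ev_add k3.1 k4.1,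
      k0.2, k1.2, k2.2, k3.2, k4.2, S.ev_pow 2 0 (by norm_num), S.ev_pow 2 1 (by norm_num),
      S.ev_pow 2 2 (by norm_num)]
    fin_cases p
    · simp
    · simp [CharTwo.add_self_eq_zero]
    · simp
  obtain ⟨a, b, c, w, hw, hfw, htr, hhalf⟩ := S.exists_poly (n := 4) (by norm_num) (sub_mem hf hRmem)
  have hwzero : ∀ p, ev T r 4 p w = 0 := by
    intro p
    refine F32.eq_zero _ (htr p) ?_
    have h1 := S.ev_add (sub_mem hf hRmem) hRmem p
    rw [sub_add_cancel] at h1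
    have h2 := congrArg F32.half h1
    rw [F32.half_add, hfev, hRev] at h2
    have h3 := congrArg (· ^^^ F32.half (ev T r 2 p (vec v (m p)))) h2
    simp only [Nat.xor_assoc, Nat.xor_self, Nat.xor_zero] at h3
    rw [hhalf, ← h3]
  have h3 := S.mem_of_ev_eq_zero hw hwzero
  have hg : T * (T + 1) ≠ 0 := mul_ne_zero S.ne_zero S.ne_one
  obtain ⟨d, e, hde⟩ : ∃ d e : F₂, w / (T * (T + 1)) = d • 1 + e • T := by
    apply S.mem_line
    have h4 := (mem_RR_mul_iff (f := w / (T * (T + 1))) hg).1 (by rw [div_mul_cancel₀ _ hg]; exact h3)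
    convert h4 using 2
    rw [div_mul S.ne_zero S.ne_one, S.div_zero, S.div_one]
    ext Q
    simp only [Finsupp.add_apply, Finsupp.sub_apply, Finsupp.smul_apply, smul_eq_mul]
    push_cast
    ring
  rw [div_eq_iff hg] at hde
  refine ⟨Polynomial.C a + Polynomial.C b * Polynomial.X + Polynomial.C c * Polynomial.X ^ 4 +
    (Polynomial.C d + Polynomial.C e * Polynomial.X) * (Polynomial.X * (Polynomial.X + 1)), ?_⟩
  rw [sub_eq_iff_eq_add] at hfw
  rw [hfw, hR, hde]
  simp only [map_add, map_mul, map_pow, map_one, Polynomial.aeval_C, Polynomial.aeval_X, Algebra.smul_def]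
  ring

lemma frame {q : Fin 3 → ℕ → ℕ} (hq : ∀ p, CodeIso (code T r v p) (q p)) :
    Frame T v (conj (code T r v 0) (q 0)) (conj (code T r v 1) (q 1)) (conj (code T r v 2) (q 2)) :=
  ⟨S.indep hv, (hq 0).product, (hq 1).product, (hq 2).product, fun x _ y _ => S.rel hv hq x y⟩

end Setup

open Polynomial in
lemma trace_mul_self (A : Matrix (Fin 5) (Fin 5) F₂[X]) : (A * A).trace = A.trace ^ 2 := by
  have h2 : (2 : F₂[X]) = 0 := CharTwo.two_eq_zero
  simp only [Matrix.trace, Matrix.diag, Matrix.mul_apply, Fin.sum_univ_five]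
  linear_combination (A 0 1 * A 1 0 + A 0 2 * A 2 0 + A 0 3 * A 3 0 + A 0 4 * A 4 0 + A 1 2 * A 2 1 +
    A 1 3 * A 3 1 + A 1 4 * A 4 1 + A 2 3 * A 3 2 + A 2 4 * A 4 2 + A 3 4 * A 4 3 -
    A 0 0 * A 1 1 - A 0 0 * A 2 2 - A 0 0 * A 3 3 - A 0 0 * A 4 4 - A 1 1 * A 2 2 -
    A 1 1 * A 3 3 - A 1 1 * A 4 4 - A 2 2 * A 3 3 - A 2 2 * A 4 4 - A 3 3 * A 4 4) * h2

variable {K : Type} [Field K] [Algebra (ZMod 2) K]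

section Matrix

variable {T : K} {ι : Type} [Fintype ι]

/-- Multiplication by `g` has matrix `A` in the system `f`. -/
def HasMatrix (T : K) (f : ι → K) (g : K) (A : Matrix ι ι (Polynomial F₂)) : Prop :=
  ∀ j, g * f j = ∑ i, Polynomial.aeval T (A i j) * f i

variable {f : ι → K} {g h : K} {A B : Matrix ι ι (Polynomial F₂)}

lemma HasMatrix.mul (hg : HasMatrix T f g A) (hh : HasMatrix T f h B) :
    HasMatrix T f (g * h) (A * B) := by
  intro j
  simp only [Matrix.mul_apply, map_sum, map_mul, Finset.sum_mul]
  rw [mul_assoc, hh j, Finset.mul_sum, Finset.sum_comm]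
  refine Finset.sum_congr rfl fun i _ => ?_
  rw [mul_left_comm, hg i, Finset.mul_sum]
  exact Finset.sum_congr rfl fun l _ => by ring

lemma HasMatrix.add (hg : HasMatrix T f g A) (hh : HasMatrix T f h B) :
    HasMatrix T f (g + h) (A + B) := by
  intro j
  rw [add_mul, hg j, hh j, ← Finset.sum_add_distrib]
  exact Finset.sum_congr rfl fun i _ => by rw [Matrix.add_apply, map_add, add_mul]

lemma HasMatrix.aeval_mul (hg : HasMatrix T f g A) (p : Polynomial F₂) :
    HasMatrix T f (Polynomial.aeval T p * g) (p • A) := by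
  intro j
  rw [mul_assoc, hg j, Finset.mul_sum]
  exact Finset.sum_congr rfl fun i _ => by rw [Matrix.smul_apply, smul_eq_mul, map_mul, mul_assoc]

lemma HasMatrix.one [DecidableEq ι] : HasMatrix T f 1 (1 : Matrix ι ι (Polynomial F₂)) := by
  intro j
  rw [Finset.sum_eq_single j, Matrix.one_apply_eq, map_one]
  · intro i _ hi
    rw [Matrix.one_apply_ne hi, map_zero, zero_mul]
  · exact fun h => absurd (Finset.mem_univ j) h

lemma HasMatrix.unique (hf : PolyIndep T f) (hA : HasMatrix T f g A) (hB : HasMatrix T f g B) : A = B := by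
  ext1 i j
  have := hf (fun i => A i j - B i j) (by
    simp only [map_sub, sub_mul, Finset.sum_sub_distrib]
    rw [← hA j, ← hB j, sub_self])
  exact sub_eq_zero.1 (congrFun this i)

end Matrix

/-- Vanishing of all traces of a product. -/
def Balanced (m : ℕ → ℕ → ℕ) : Prop :=
  ∀ x < 16, ∑ i : Fin 4, (if (m x (2 ^ (i : ℕ))).testBit i then (1 : F₂) else 0) = 0

/-- The coordinates of `vec v x`. -/
def bits (x : ℕ) : Fin 5 → Polynomial F₂ := Fin.cons 0 fun i : Fin 4 => if x.testBit i then 1 else 0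

lemma vec_eq_sum (T : K) (v : Fin 4 → K) (x : ℕ) :
    vec v x = ∑ i, Polynomial.aeval T (bits x i) * (Fin.cons 1 v : Fin 5 → K) i := by
  rw [Fin.sum_univ_succ]
  simp only [bits, Fin.cons_zero, Fin.cons_succ, map_zero, zero_mul, zero_add, vec]
  refine Finset.sum_congr rfl fun i _ => ?_
  split_ifs <;> simp

lemma eq_of_bits {x y : ℕ} (hx : x < 16) (hy : y < 16) (h : ∀ i : Fin 4, x.testBit i = y.testBit i) :
    x = y := by
  refine Nat.eq_of_testBit_eq fun i => ?_
  by_cases hi : i < 4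
  · exact h ⟨i, hi⟩
  · have h16 : 2 ^ 4 ≤ 2 ^ i := Nat.pow_le_pow_right (by norm_num) (by omega)
    rw [Nat.testBit_lt_two_pow (by omega), Nat.testBit_lt_two_pow (by omega)]

lemma two_pow_lt (i : Fin 4) : 2 ^ (i : ℕ) < 16 := Nat.pow_lt_pow_right (n := 4) (by norm_num) i.2

/-- The matrix of multiplication by `vec v x`, in terms of three products and constant coefficients. -/
def multMatrix (m₀ m₁ m₂ : ℕ → ℕ → ℕ) (x : ℕ) (c : Fin 4 → Polynomial F₂) :
    Matrix (Fin 5) (Fin 5) (Polynomial F₂) :=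
  Matrix.of fun i j => Fin.cases (bits x i) (fun j => (if i = 0 then c j else 0) +
    (Polynomial.X + 1) * bits (m₀ x (2 ^ (j : ℕ))) i + Polynomial.X * bits (m₁ x (2 ^ (j : ℕ))) i +
      (Polynomial.X ^ 2 + Polynomial.X) * bits (m₂ x (2 ^ (j : ℕ))) i) j

lemma hasMatrix_multMatrix {T : K} {v : Fin 4 → K} {m₀ m₁ m₂ : ℕ → ℕ → ℕ} {x : ℕ}
    {c : Fin 4 → Polynomial F₂} (hc : ∀ j : Fin 4, vec v x * vec v (2 ^ (j : ℕ)) = Polynomial.aeval T (c j) +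
      (T + 1) * vec v (m₀ x (2 ^ (j : ℕ))) + T * vec v (m₁ x (2 ^ (j : ℕ))) +
      (T ^ 2 + T) * vec v (m₂ x (2 ^ (j : ℕ)))) :
    HasMatrix T (Fin.cons 1 v : Fin 5 → K) (vec v x) (multMatrix m₀ m₁ m₂ x c) := by
  intro j
  refine Fin.cases ?_ (fun j => ?_) j
  · simp only [multMatrix, Matrix.of_apply, Fin.cases_zero, Fin.cons_zero, mul_one]
    exact vec_eq_sum T v x
  · have h := hc j
    rw [vec_two_pow] at h
    simp only [multMatrix, Matrix.of_apply, Fin.cases_succ, Fin.cons_succ, map_add, map_mul, map_pow, map_one,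
      Polynomial.aeval_X, add_mul _ _ ((Fin.cons 1 v : Fin 5 → K) _), Finset.sum_add_distrib, mul_assoc, ← Finset.mul_sum]
    rw [h, vec_eq_sum T v (m₀ x _), vec_eq_sum T v (m₁ x _), vec_eq_sum T v (m₂ x _)]
    congr 3
    rw [Fin.sum_univ_succ]
    simp

namespace Frame

variable {T : K} {v : Fin 4 → K} {m₀ m₁ m₂ : ℕ → ℕ → ℕ} (F : Frame T v m₀ m₁ m₂)

include F

lemma congr {n₀ n₁ n₂ : ℕ → ℕ → ℕ} (h₀ : ∀ x < 16, ∀ y < 16, m₀ x y = n₀ x y)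
    (h₁ : ∀ x < 16, ∀ y < 16, m₁ x y = n₁ x y) (h₂ : ∀ x < 16, ∀ y < 16, m₂ x y = n₂ x y) :
    Frame T v n₀ n₁ n₂ := by
  have key : ∀ {m n : ℕ → ℕ → ℕ}, (∀ x < 16, ∀ y < 16, m x y = n x y) → Product m → Product n := by
    intro m n h hm
    refine ⟨fun x hx y hy => ?_, fun x hx y hy => ?_, fun x hx y hy z hz => ?_⟩
    · rw [← h x hx y hy]; exact hm.lt x hx y hy
    · rw [← h x hx y hy, ← h y hy x hx]; exact hm.comm x hx y hy
    · rw [← h _ (xor_lt hx hy) z hz, ← h x hx z hz, ← h y hy z hz]; exact hm.add x hx y hy z hz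
  refine ⟨F.indep, key h₀ F.product₀, key h₁ F.product₁, key h₂ F.product₂, fun x hx y hy => ?_⟩
  rw [← h₀ x hx y hy, ← h₁ x hx y hy, ← h₂ x hx y hy]
  exact F.rel x hx y hy

lemma exists_matrix (h₀ : Balanced m₀) (h₁ : Balanced m₁) (h₂ : Balanced m₂) (x : ℕ) (hx : x < 16) :
    ∃ A, HasMatrix T (Fin.cons 1 v : Fin 5 → K) (vec v x) A ∧ A.trace = 0 := by
  choose c hc using fun i : Fin 4 => F.rel x hx _ (two_pow_lt i)
  refine ⟨_, hasMatrix_multMatrix hc, ?_⟩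
  · have hb : ∀ {m : ℕ → ℕ → ℕ}, Balanced m → ∑ j : Fin 4, bits (m x (2 ^ (j : ℕ))) j.succ = 0 := by
      intro m hm
      have := congrArg (Polynomial.C : F₂ → Polynomial F₂) (hm x hx)
      rw [map_sum, map_zero] at this
      rw [← this]
      refine Finset.sum_congr rfl fun i _ => ?_
      simp only [bits, Fin.cons_succ]
      split_ifs <;> simp
    simp only [multMatrix, Matrix.trace, Matrix.diag, Matrix.of_apply]
    rw [Fin.sum_univ_succ]
    simp only [Fin.cases_zero, Fin.cases_succ, Fin.succ_ne_zero, if_false, zero_add,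
      Finset.sum_add_distrib, ← Finset.mul_sum, hb h₀, hb h₁, hb h₂, mul_zero]
    simp [bits]

/-- Squares have no constant term. -/
lemma sq (h₀ : Balanced m₀) (h₁ : Balanced m₁) (h₂ : Balanced m₂) (x : ℕ) (hx : x < 16) :
    vec v x * vec v x = (T + 1) * vec v (m₀ x x) + T * vec v (m₁ x x) + (T ^ 2 + T) * vec v (m₂ x x) := by
  obtain ⟨c, hc⟩ := F.rel x hx x hx
  obtain ⟨A, hA, hA0⟩ := F.exists_matrix h₀ h₁ h₂ x hx
  obtain ⟨A₀, hA₀, h0⟩ := F.exists_matrix h₀ h₁ h₂ _ (F.product₀.lt x hx x hx)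
  obtain ⟨A₁, hA₁, h1⟩ := F.exists_matrix h₀ h₁ h₂ _ (F.product₁.lt x hx x hx)
  obtain ⟨A₂, hA₂, h2⟩ := F.exists_matrix h₀ h₁ h₂ _ (F.product₂.lt x hx x hx)
  have e1 := hA.mul hA
  have e2 := (((HasMatrix.one.aeval_mul c).add (hA₀.aeval_mul (Polynomial.X + 1))).add
    (hA₁.aeval_mul Polynomial.X)).add (hA₂.aeval_mul (Polynomial.X ^ 2 + Polynomial.X))
  simp only [map_add, map_pow, map_one, Polynomial.aeval_X, mul_one] at e2
  rw [← hc] at e2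
  have e3 := congrArg Matrix.trace (e1.unique F.indep e2)
  rw [trace_mul_self, hA0, Matrix.trace_add, Matrix.trace_add, Matrix.trace_add, Matrix.trace_smul,
    Matrix.trace_smul, Matrix.trace_smul, Matrix.trace_smul, h0, h1, h2, Matrix.trace_one, Fintype.card_fin] at e3
  have e4 : ((5 : ℕ) : Polynomial F₂) = 1 := by
    have : (2 : Polynomial F₂) = 0 := CharTwo.two_eq_zero
    push_cast
    linear_combination 2 * this
  rw [e4] at e3
  have hc0 : c = 0 := by simpa using e3.symm
  rw [hc, hc0, map_zero, zero_add]

end Frame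

/-- The failure of squaring for `n` to be a derivation along squaring for `m`. -/
def defect (m n : ℕ → ℕ → ℕ) (x y : ℕ) : ℕ :=
  n (m x y) (m x y) ^^^ n (m x x) (m y y) ^^^ m (n x x) (m y y) ^^^ m (m x x) (n y y)

lemma Product.add_right {m : ℕ → ℕ → ℕ} (hm : Product m) {x y z : ℕ} (hx : x < 16) (hy : y < 16)
    (hz : z < 16) : m x (y ^^^ z) = m x y ^^^ m x z := by
  rw [hm.comm x hx _ (xor_lt hy hz), hm.add y hy z hz x hx, hm.comm y hy x hx, hm.comm z hz x hx]

variable {K : Type} [Field K] [Algebra (ZMod 2) K]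

variable (K) in
lemma two_eq_zero_of_algebra : (2 : K) = 0 := by
  have := congrArg (algebraMap F₂ K) (show (2 : F₂) = 0 by decide)
  rwa [map_ofNat, map_zero] at this

omit [Algebra (ZMod 2) K] in
lemma square_identity (h2 : (2 : K) = 0)
    (T A B c c1 c2 c3 p0 p1 p2 z0 z1 z2 x0 x1 x2 y0 y1 y2 u0 u1 u2 r0 r1 r2 s0 s1 s2 : K)
    (hc : A * B = c + (T + 1) * p0 + T * p1 + (T ^ 2 + T) * p2)
    (hz : p0 * p0 = (T + 1) * z0 + T * z1 + (T ^ 2 + T) * z2)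
    (hx : A * A = (T + 1) * x0 + T * x1 + (T ^ 2 + T) * x2)
    (hy : B * B = (T + 1) * y0 + T * y1 + (T ^ 2 + T) * y2)
    (e1 : x0 * y0 = c1 + (T + 1) * u0 + T * u1 + (T ^ 2 + T) * u2)
    (e2 : x0 * (y0 + y1 + y2) = c2 + (T + 1) * r0 + T * r1 + (T ^ 2 + T) * r2)
    (e3 : (x0 + x1 + x2) * y0 = c3 + (T + 1) * s0 + T * s1 + (T ^ 2 + T) * s2) :
    z0 + T * (z0 + z1 + z2) = u0 + T * (u0 + u1 + u2 + r0 + s0) + (c ^ 2 + c1 + T * (c2 + c3)) +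
      T ^ 2 * (z2 + p0 * p0 + p1 * p1 + (T + 1) * ((T + 1) * (p2 * p2)) + u2 + (r0 + r1 + (T + 1) * r2) +
        (s0 + s1 + (T + 1) * s2) + (x0 + x1 + x2) * (y0 + y1 + y2) +
          x2 * (y0 + T * (y0 + y1 + y2) + T * (T * y2)) + y2 * (x0 + T * (x0 + x1 + x2))) := by
  have hl : (A * B) * (A * B) = (A * A) * (B * B) := by ring
  rw [hx, hy, hc] at hl
  linear_combination hl + hz + e1 + T * e2 + T * e3 + (z0 + z0 * T + T * z1 + T * z2 - T * c * p0 -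
    T * c * p1 - T * c * p2 - T * p0 * p1 - T * p0 * p2 - T * p0 ^ 2 - T ^ 2 * c * p2 - T ^ 2 * p0 * p1 -
    2 * T ^ 2 * p0 * p2 - T ^ 2 * p0 ^ 2 - T ^ 2 * p1 * p2 - T ^ 2 * p1 ^ 2 - T ^ 2 * p2 ^ 2 -
    T ^ 3 * p0 * p2 - T ^ 3 * p1 * p2 - 2 * T ^ 3 * p2 ^ 2 - T ^ 4 * p2 ^ 2 - c * p0 - c ^ 2 - p0 ^ 2) * h2

namespace Frame

variable {T : K} {v : Fin 4 → K} {m₀ m₁ m₂ : ℕ → ℕ → ℕ} (F : Frame T v m₀ m₁ m₂)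

omit [Algebra (ZMod 2) K] in
lemma aeval_comp_add_one [Algebra (ZMod 2) K] (c : Polynomial F₂) :
    Polynomial.aeval (T + 1) (c.comp (Polynomial.X + 1)) = Polynomial.aeval T c := by
  have h2 := two_eq_zero_of_algebra K
  rw [Polynomial.aeval_comp]
  congr 2
  simp only [map_add, Polynomial.aeval_X, map_one]
  linear_combination h2

include F

/-- The frame of `T + 1`. -/
lemma swap : Frame (T + 1) v m₁ m₀ m₂ := by
  have h2 := two_eq_zero_of_algebra K
  refine ⟨fun p hp => ?_, F.product₁, F.product₀, F.product₂, fun x hx y hy => ?_⟩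
  · have h := F.indep (fun i => (p i).comp (Polynomial.X + 1)) (by
      rw [← hp]
      refine Finset.sum_congr rfl fun i _ => ?_
      rw [Polynomial.aeval_comp, map_add, Polynomial.aeval_X, map_one])
    funext i
    have h1 := congrArg (fun c : Polynomial F₂ => c.comp (Polynomial.X + 1)) (congrFun h i)
    have h3 : (Polynomial.X + 1 + 1 : Polynomial F₂) = Polynomial.X := by
      have : (2 : Polynomial F₂) = 0 := CharTwo.two_eq_zero
      linear_combination this
    simpa [Polynomial.comp_assoc, h3] using h1
  · obtain ⟨c, hc⟩ := F.rel x hx y hy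
    refine ⟨c.comp (Polynomial.X + 1), ?_⟩
    rw [hc, aeval_comp_add_one]
    linear_combination (-(vec v (m₁ x y)) - (T + 1) * vec v (m₂ x y)) * h2

omit F in
lemma vec_mem (x : ℕ) : vec v x ∈ polySpan T (Fin.cons 1 v : Fin 5 → K) :=
  ⟨bits x, vec_eq_sum T v x⟩

omit F in
lemma one_mem : (1 : K) ∈ polySpan T (Fin.cons 1 v : Fin 5 → K) :=
  mem_polySpan (h := (Fin.cons 1 v : Fin 5 → K)) 0

lemma mul_mem {a b : K} (ha : a ∈ polySpan T (Fin.cons 1 v : Fin 5 → K))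
    (hb : b ∈ polySpan T (Fin.cons 1 v : Fin 5 → K)) : a * b ∈ polySpan T (Fin.cons 1 v : Fin 5 → K) := by
  refine polySpan_mul (fun i j => ?_) ha hb
  refine Fin.cases ?_ (fun i => ?_) i
  · rw [Fin.cons_zero, one_mul]; exact mem_polySpan (h := (Fin.cons 1 v : Fin 5 → K)) j
  refine Fin.cases ?_ (fun j => ?_) j
  · rw [Fin.cons_zero, mul_one]; exact mem_polySpan (h := (Fin.cons 1 v : Fin 5 → K)) i.succ
  obtain ⟨c, hc⟩ := F.rel _ (two_pow_lt i) _ (two_pow_lt j)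
  rw [vec_two_pow, vec_two_pow] at hc
  rw [Fin.cons_succ, Fin.cons_succ, hc]
  have h1 := aeval_mul_mem_polySpan (one_mem (T := T) (v := v)) c
  have h3 := aeval_mul_mem_polySpan (vec_mem (T := T) (v := v) (m₀ (2 ^ (i : ℕ)) (2 ^ (j : ℕ)))) (Polynomial.X + 1)
  have h4 := aeval_mul_mem_polySpan (vec_mem (T := T) (v := v) (m₁ (2 ^ (i : ℕ)) (2 ^ (j : ℕ)))) Polynomial.X
  have h5 := aeval_mul_mem_polySpan (vec_mem (T := T) (v := v) (m₂ (2 ^ (i : ℕ)) (2 ^ (j : ℕ)))) (Polynomial.X ^ 2 + Polynomial.X)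
  simp only [map_add, map_pow, map_one, Polynomial.aeval_X, mul_one] at h1 h3 h4 h5
  exact add_mem (add_mem (add_mem h1 h3) h4) h5

lemma eq_of_vec_add {a b a' b' : ℕ} (ha : a < 16) (hb : b < 16) (ha' : a' < 16) (hb' : b' < 16)
    {c : Polynomial F₂} {w : K} (hw : w ∈ polySpan T (Fin.cons 1 v : Fin 5 → K))
    (h : vec v a + T * vec v b = vec v a' + T * vec v b' + Polynomial.aeval T c + T ^ 2 * w) :
    a = a' ∧ b = b' := by
  obtain ⟨p, rfl⟩ := hw
  have h1 := F.indep (fun i => bits a i + Polynomial.X * bits b i - bits a' i - Polynomial.X * bits b' i -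
    (if i = 0 then c else 0) - Polynomial.X ^ 2 * p i) (by
      simp only [map_sub, map_add, map_mul, map_pow, Polynomial.aeval_X, sub_mul, add_mul, mul_assoc,
        Finset.sum_sub_distrib, Finset.sum_add_distrib, ← Finset.mul_sum]
      rw [← vec_eq_sum, ← vec_eq_sum, ← vec_eq_sum, ← vec_eq_sum, h]
      have : ∑ i : Fin 5, Polynomial.aeval T (if i = 0 then c else 0) * (Fin.cons 1 v : Fin 5 → K) i =
          Polynomial.aeval T c := by
        rw [Fin.sum_univ_succ]; simp
      rw [this]
      ring)
  have h3 : ∀ i : Fin 4, a.testBit i = a'.testBit i ∧ b.testBit i = b'.testBit i := by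
    intro i
    have h4 := congrFun h1 i.succ
    simp only [Fin.succ_ne_zero, if_false, sub_zero, Pi.zero_apply, bits, Fin.cons_succ] at h4
    have hite : ∀ x : ℕ, (if x.testBit i = true then (1 : Polynomial F₂) else 0) =
        Polynomial.C (if x.testBit i = true then (1 : F₂) else 0) := by intro x; split_ifs <;> simp
    simp only [hite] at h4
    have h5 := congrArg (fun q => Polynomial.coeff q 0) h4
    have h6 := congrArg (fun q => Polynomial.coeff q 1) h4
    have hX : (Polynomial.X ^ 2 * p i.succ).coeff 0 = 0 := by simp [pow_two, mul_assoc]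
    have hX1 : (Polynomial.X ^ 2 * p i.succ).coeff 1 = 0 := by
      rw [mul_comm, Polynomial.coeff_mul_X_pow']; simp
    simp only [Polynomial.coeff_sub, Polynomial.coeff_add, Polynomial.coeff_X_mul,
      Polynomial.mul_coeff_zero, Polynomial.coeff_X_zero, zero_mul, hX, hX1, Polynomial.coeff_zero, add_zero, sub_zero,
      Polynomial.coeff_C] at h5 h6
    norm_num at h5 h6
    have hb01 : ∀ s t : Bool, ((if s = true then (1 : F₂) else 0) - if t = true then 1 else 0) = 0 → s = t := by
      decide
    exact ⟨hb01 _ _ h5, hb01 _ _ h6⟩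
  exact ⟨eq_of_bits ha ha' fun i => (h3 i).1, eq_of_bits hb hb' fun i => (h3 i).2⟩

lemma defect_eq (h₀ : Balanced m₀) (h₁ : Balanced m₁) (h₂ : Balanced m₂) {x y : ℕ} (hx : x < 16)
    (hy : y < 16) : defect m₀ m₁ x y = defect m₀ m₂ x y := by
  have h2 := two_eq_zero_of_algebra K
  have P0 := F.product₀
  have P1 := F.product₁
  have P2 := F.product₂
  have hz := P0.lt x hx y hy
  have hsx := P0.lt x hx x hx
  have hsy := P0.lt y hy y hy
  have hsx1 := P1.lt x hx x hx
  have hsy1 := P1.lt y hy y hy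
  have hsx2 := P2.lt x hx x hx
  have hsy2 := P2.lt y hy y hy
  have hdx := xor_lt (xor_lt hsx hsx1) hsx2
  have hdy := xor_lt (xor_lt hsy hsy1) hsy2
  have Sz := F.sq h₀ h₁ h₂ _ hz
  have Sx := F.sq h₀ h₁ h₂ _ hx
  have Sy := F.sq h₀ h₁ h₂ _ hy
  obtain ⟨c, hc⟩ := F.rel x hx y hy
  obtain ⟨c₁, e1⟩ := F.rel _ hsx _ hsy
  obtain ⟨c₂, e2⟩ := F.rel _ hsx _ hdy
  obtain ⟨c₃, e3⟩ := F.rel _ hdx _ hsy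
  set z := m₀ x y
  set dx := m₀ x x ^^^ m₁ x x ^^^ m₂ x x with hdx'
  set dy := m₀ y y ^^^ m₁ y y ^^^ m₂ y y with hdy'
  have key := square_identity h2 T (vec v x) (vec v y) _ _ _ _ _ _ _ _ _ _ _ _ _ _ _ _ _ _ _ _ _ _ _ _ _
    hc Sz Sx Sy e1 (by rw [← vec_xor, ← vec_xor]; exact e2) (by rw [← vec_xor, ← vec_xor]; exact e3)
  have hT : ∀ {a : K}, a ∈ polySpan T (Fin.cons 1 v : Fin 5 → K) →
      T * a ∈ polySpan T (Fin.cons 1 v : Fin 5 → K) := fun h => mul_mem_polySpan_self h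
  have hT1 : ∀ {a : K}, a ∈ polySpan T (Fin.cons 1 v : Fin 5 → K) →
      (T + 1) * a ∈ polySpan T (Fin.cons 1 v : Fin 5 → K) := fun {a} h => by
    rw [add_mul, one_mul]; exact add_mem (hT h) h
  have hV := fun x => vec_mem (T := T) (v := v) x
  have hVV := fun x y => F.mul_mem (hV x) (hV y)
  have hw := add_mem (add_mem (add_mem (add_mem (add_mem (add_mem (add_mem (add_mem (add_mem
    (hV (m₂ z z)) (hVV z z)) (hVV (m₁ x y) (m₁ x y))) (hT1 (hT1 (hVV (m₂ x y) (m₂ x y)))))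
    (hV (m₂ (m₀ x x) (m₀ y y))))
    (add_mem (add_mem (hV (m₀ (m₀ x x) dy)) (hV (m₁ (m₀ x x) dy))) (hT1 (hV (m₂ (m₀ x x) dy)))))
    (add_mem (add_mem (hV (m₀ dx (m₀ y y))) (hV (m₁ dx (m₀ y y)))) (hT1 (hV (m₂ dx (m₀ y y))))))
    (F.mul_mem (add_mem (add_mem (hV (m₀ x x)) (hV (m₁ x x))) (hV (m₂ x x)))
      (add_mem (add_mem (hV (m₀ y y)) (hV (m₁ y y))) (hV (m₂ y y)))))
    (F.mul_mem (hV (m₂ x x)) (add_mem (add_mem (hV (m₀ y y))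
      (hT (add_mem (add_mem (hV (m₀ y y)) (hV (m₁ y y))) (hV (m₂ y y))))) (hT (hT (hV (m₂ y y)))))))
    (F.mul_mem (hV (m₂ y y)) (add_mem (hV (m₀ x x))
      (hT (add_mem (add_mem (hV (m₀ x x)) (hV (m₁ x x))) (hV (m₂ x x))))))
  have hpoly : Polynomial.aeval T c ^ 2 + Polynomial.aeval T c₁ + T * (Polynomial.aeval T c₂ +
      Polynomial.aeval T c₃) = Polynomial.aeval T (c ^ 2 + c₁ + Polynomial.X * (c₂ + c₃)) := by simp
  rw [hpoly] at key
  simp only [← vec_xor v] at key hw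
  obtain ⟨k0, k1⟩ := F.eq_of_vec_add (P0.lt _ hz _ hz)
    (xor_lt (xor_lt (P0.lt _ hz _ hz) (P1.lt _ hz _ hz)) (P2.lt _ hz _ hz)) (P0.lt _ hsx _ hsy)
    (xor_lt (xor_lt (xor_lt (xor_lt (P0.lt _ hsx _ hsy) (P1.lt _ hsx _ hsy)) (P2.lt _ hsx _ hsy))
      (P0.lt _ hsx _ hdy)) (P0.lt _ hdx _ hsy)) hw key
  rw [hdx', hdy', k0, P0.add_right hsx (xor_lt hsy hsy1) hsy2, P0.add_right hsx hsy hsy1,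
    P0.add _ (xor_lt hsx hsx1) _ hsx2 _ hsy, P0.add _ hsx _ hsx1 _ hsy] at k1
  refine eq_of_bits ?_ ?_ fun i => ?_
  · exact xor_lt (xor_lt (xor_lt (P1.lt _ hz _ hz) (P1.lt _ hsx _ hsy)) (P0.lt _ hsx1 _ hsy)) (P0.lt _ hsx _ hsy1)
  · exact xor_lt (xor_lt (xor_lt (P2.lt _ hz _ hz) (P2.lt _ hsx _ hsy)) (P0.lt _ hsx2 _ hsy)) (P0.lt _ hsx _ hsy2)
  have k2 := congrArg (fun n => Nat.testBit n i) k1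
  simp only [defect, Nat.testBit_xor] at k2 ⊢
  grind

end Frame

section Tables

/-- Digits in base sixteen. -/
def lookup (t x : ℕ) : ℕ := Nat.mod (Nat.shiftRight t (Nat.mul 4 x)) 16

lemma lookup_eq (t x : ℕ) : lookup t x = t / 2 ^ (4 * x) % 2 ^ 4 := by
  change t >>> (4 * x) % 2 ^ 4 = _
  rw [Nat.shiftRight_eq_div_pow]

lemma xor_div_mod (s t x k : ℕ) :
    (s ^^^ t) / 2 ^ x % 2 ^ k = (s / 2 ^ x % 2 ^ k) ^^^ (t / 2 ^ x % 2 ^ k) := by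
  simp only [← Nat.shiftRight_eq_div_pow]
  rw [Nat.shiftRight_xor_distrib, Nat.xor_mod_two_pow]

lemma lookup_xor (s t x : ℕ) : lookup (s ^^^ t) x = lookup s x ^^^ lookup t x := by
  simp only [lookup_eq, xor_div_mod]

lemma tabMul_four (t x y : ℕ) (hy : y < 16) : tabMul 4 t x y = lookup (t / 2 ^ (64 * x) % 2 ^ 64) y := by
  have h : tabMul 4 t x y = lookup t (16 * x + y) := rfl
  rw [h, lookup_eq, lookup_eq, mul_add, pow_add, ← Nat.div_div_eq_div_mul,
    show 4 * (16 * x) = 64 * x by ring]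
  interval_cases y <;> omega

/-- The linear map on four-bit strings with the given values. -/
def linTab (a b c d : ℕ) : ℕ :=
  Nat.xor (Nat.xor (Nat.mul a 0x1010101010101010) (Nat.mul b 0x1100110011001100))
    (Nat.xor (Nat.mul c 0x1111000011110000) (Nat.mul d 0x1111111100000000))

/-- The linear map on four-bit strings with the given values, in reverse order and with
values of sixteen digits. -/
def rowTab (a b c d : ℕ) : ℕ :=
  Nat.xor (Nat.xor (Nat.mul a 0x100000000000000000000000000000001000000000000000000000000000000010000000000000000000000000000000100000000000000000000000000000001000000000000000000000000000000010000000000000000000000000000000100000000000000000000000000000001)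
    (Nat.mul b 0x10000000000000001000000000000000000000000000000000000000000000001000000000000000100000000000000000000000000000000000000000000000100000000000000010000000000000000000000000000000000000000000000010000000000000001))
    (Nat.xor (Nat.mul c 0x100000000000000010000000000000001000000000000000100000000000000000000000000000000000000000000000000000000000000000000000000000001000000000000000100000000000000010000000000000001)
      (Nat.mul d 0x10000000000000001000000000000000100000000000000010000000000000001000000000000000100000000000000010000000000000001))

/-- The value of a linear map on a four-bit string. -/
def lin (a b c d x : ℕ) : ℕ :=
  ((if x.testBit 0 then a else 0) ^^^ (if x.testBit 1 then b else 0)) ^^^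
    ((if x.testBit 2 then c else 0) ^^^ (if x.testBit 3 then d else 0))

lemma lookup_linTab {a b c d x : ℕ} (ha : a < 16) (hb : b < 16) (hc : c < 16) (hd : d < 16) (hx : x < 16) :
    lookup (linTab a b c d) x = lin a b c d x := by
  have h0 : ∀ a < 16, ∀ x < 16, lookup (a * 0x1010101010101010) x = if x.testBit 0 then a else 0 := by
    decide +kernel
  have h1 : ∀ a < 16, ∀ x < 16, lookup (a * 0x1100110011001100) x = if x.testBit 1 then a else 0 := by
    decide +kernel
  have h2 : ∀ a < 16, ∀ x < 16, lookup (a * 0x1111000011110000) x = if x.testBit 2 then a else 0 := by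
    decide +kernel
  have h3 : ∀ a < 16, ∀ x < 16, lookup (a * 0x1111111100000000) x = if x.testBit 3 then a else 0 := by
    decide +kernel
  change lookup ((a * _ ^^^ b * _) ^^^ (c * _ ^^^ d * _)) x = _
  rw [lookup_xor, lookup_xor, lookup_xor, h0 a ha x hx, h1 b hb x hx, h2 c hc x hx, h3 d hd x hx, lin]

lemma linTab_lt {a b c d : ℕ} (ha : a < 16) (hb : b < 16) (hc : c < 16) (hd : d < 16) :
    linTab a b c d < 2 ^ 64 := by
  refine Nat.xor_lt_two_pow (Nat.xor_lt_two_pow ?_ ?_) (Nat.xor_lt_two_pow ?_ ?_)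
  · change a * _ < _
    omega
  · change b * _ < _
    omega
  · change c * _ < _
    omega
  · change d * _ < _
    omega

lemma mul_div_mod {a m n : ℕ} (ha : a < 2 ^ 64) (hm : m % 2 ^ n * (2 ^ 64 - 1) < 2 ^ n) :
    a * m / 2 ^ n % 2 ^ 64 = a * (m / 2 ^ n % 2 ^ 64) % 2 ^ 64 := by
  have h1 : a * (m % 2 ^ n) < 2 ^ n := by
    refine lt_of_le_of_lt ?_ hm
    rw [mul_comm]
    exact Nat.mul_le_mul_left _ (Nat.le_sub_one_of_lt ha)
  have h2 : a * m = a * (m % 2 ^ n) + 2 ^ n * (a * (m / 2 ^ n)) := by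
    conv_lhs => rw [← Nat.mod_add_div m (2 ^ n)]
    ring
  rw [h2, Nat.add_mul_div_left _ _ (Nat.two_pow_pos n), Nat.div_eq_of_lt h1, zero_add, Nat.mul_mod_mod]

lemma rowTab_div_mod {a b c d x : ℕ} (ha : a < 2 ^ 64) (hb : b < 2 ^ 64) (hc : c < 2 ^ 64) (hd : d < 2 ^ 64)
    (hx : x < 16) : rowTab a b c d / 2 ^ (64 * (15 - x)) % 2 ^ 64 = lin a b c d x := by
  have key : ∀ {i m : ℕ}, (∀ x < 16, m % 2 ^ (64 * (15 - x)) * (2 ^ 64 - 1) < 2 ^ (64 * (15 - x)) ∧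
      m / 2 ^ (64 * (15 - x)) % 2 ^ 64 = if x.testBit i then 1 else 0) → ∀ {a : ℕ}, a < 2 ^ 64 →
      a * m / 2 ^ (64 * (15 - x)) % 2 ^ 64 = if x.testBit i then a else 0 := by
    intro i m h a ha
    rw [mul_div_mod ha (h x hx).1, (h x hx).2]
    split_ifs
    · rw [mul_one, Nat.mod_eq_of_lt ha]
    · rw [mul_zero, Nat.zero_mod]
  change ((a * _ ^^^ b * _) ^^^ (c * _ ^^^ d * _)) / _ % _ = _
  rw [xor_div_mod, xor_div_mod, xor_div_mod, lin, key (i := 0) (by decide +kernel) ha,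
    key (i := 1) (by decide +kernel) hb, key (i := 2) (by decide +kernel) hc,
    key (i := 3) (by decide +kernel) hd]

lemma lin_apply (f : ℕ → ℕ) (hf : ∀ x < 16, ∀ y < 16, f (x ^^^ y) = f x ^^^ f y) {x : ℕ} (hx : x < 16) :
    lin (f 1) (f 2) (f 4) (f 8) x = f x := by
  have h0 : f 0 = 0 := by
    have := hf 0 (by decide) 0 (by decide)
    rwa [Nat.xor_self, Nat.xor_self] at this
  have h : ∀ x < 16, lin 1 2 4 8 x = x := by decide
  have hi : ∀ i a, a < 16 → (if x.testBit i then a else 0) < 16 := by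
    intro i a ha
    split_ifs
    · exact ha
    · decide
  have hs : ∀ i a, f (if x.testBit i then a else 0) = if x.testBit i then f a else 0 := by
    intro i a
    split_ifs
    · rfl
    · exact h0
  have i0 := hi 0 1 (by decide)
  have i1 := hi 1 2 (by decide)
  have i2 := hi 2 4 (by decide)
  have i3 := hi 3 8 (by decide)
  conv_rhs => rw [← h x hx, lin]
  rw [hf _ (xor_lt i0 i1) _ (xor_lt i2 i3), hf _ i0 _ i1, hf _ i2 _ i3, hs, hs, hs, hs, lin]

/-- The product given by a table with rows in reverse order. -/
def revMul (t x y : ℕ) : ℕ := tabMul 4 t (Nat.sub 15 x) y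

/-- The table of a product, with rows in reverse order. -/
def prodTab (e00 e01 e02 e03 e11 e12 e13 e22 e23 e33 : ℕ) : ℕ :=
  rowTab (linTab e00 e01 e02 e03) (linTab e01 e11 e12 e13) (linTab e02 e12 e22 e23)
    (linTab e03 e13 e23 e33)

lemma Product.eq_table {m : ℕ → ℕ → ℕ} (hm : Product m) {x y : ℕ} (hx : x < 16) (hy : y < 16) :
    revMul (prodTab (m 1 1) (m 1 2) (m 1 4) (m 1 8) (m 2 2) (m 2 4) (m 2 8) (m 4 4) (m 4 8) (m 8 8)) x y =
      m x y := by
  have d1 : 1 < 16 := by decide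
  have d2 : 2 < 16 := by decide
  have d4 : 4 < 16 := by decide
  have d8 : 8 < 16 := by decide
  have hrow : ∀ z < 16, lookup (linTab (m z 1) (m z 2) (m z 4) (m z 8)) y = m z y ∧
      linTab (m z 1) (m z 2) (m z 4) (m z 8) < 2 ^ 64 := fun z hz =>
    ⟨(lookup_linTab (hm.lt z hz 1 d1) (hm.lt z hz 2 d2) (hm.lt z hz 4 d4) (hm.lt z hz 8 d8) hy).trans
      (lin_apply (m z) (fun a ha b hb => hm.add_right hz ha hb) hy),
    linTab_lt (hm.lt z hz 1 d1) (hm.lt z hz 2 d2) (hm.lt z hz 4 d4) (hm.lt z hz 8 d8)⟩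
  have h2 := hrow 2 d2
  have h4 := hrow 4 d4
  have h8 := hrow 8 d8
  rw [hm.comm 2 d2 1 d1] at h2
  rw [hm.comm 4 d4 1 d1, hm.comm 4 d4 2 d2] at h4
  rw [hm.comm 8 d8 1 d1, hm.comm 8 d8 2 d2, hm.comm 8 d8 4 d4] at h8
  have hr : ∀ t, revMul t x y = tabMul 4 t (15 - x) y := fun t => rfl
  rw [hr, tabMul_four _ _ _ hy, prodTab, rowTab_div_mod (hrow 1 d1).2 h2.2 h4.2 h8.2 hx]
  have hl : ∀ i a, lookup (if x.testBit i then a else 0) y = if x.testBit i then lookup a y else 0 := by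
    intro i a
    split_ifs
    · rfl
    · rw [lookup_eq, Nat.zero_div, Nat.zero_mod]
  rw [lin, lookup_xor, lookup_xor, lookup_xor, hl, hl, hl, hl, (hrow 1 d1).1, h2.1, h4.1, h8.1]
  exact lin_apply (fun x => m x y) (fun a ha b hb => hm.add a ha b hb y hy) hx

end Tables

section Search

/-- Test a predicate on all smaller numbers. -/
def allBelow (n : ℕ) (f : ℕ → Bool) : Bool := Nat.rec true (fun i r => cond (f i) r false) n

lemma allBelow_spec {n : ℕ} {f : ℕ → Bool} (h : allBelow n f = true) : ∀ i < n, f i = true := by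
  induction n with
  | zero => intro i hi; exact absurd hi (Nat.not_lt_zero i)
  | succ n ih =>
    have h' : cond (f n) (allBelow n f) false = true := h
    cases h1 : f n with
    | false => rw [h1] at h'; exact absurd h' Bool.false_ne_true
    | true =>
      rw [h1] at h'
      intro i hi
      rcases Nat.lt_succ_iff_lt_or_eq.1 hi with h2 | rfl
      · exact ih h' i h2
      · exact h1

lemma allBelow_of {n : ℕ} {f : ℕ → Bool} (h : ∀ i < n, f i = true) : allBelow n f = true := by
  induction n with
  | zero => rfl
  | succ n ih =>
    change cond (f n) (allBelow n f) false = true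
    rw [h n (Nat.lt_succ_self n), ih fun i hi => h i (hi.trans (Nat.lt_succ_self n))]
    rfl

/-- Test a predicate on all members of a list. -/
def allList (l : List ℕ) (f : ℕ → Bool) : Bool := List.rec true (fun x _ r => cond (f x) r false) l

lemma allList_spec {l : List ℕ} {f : ℕ → Bool} (h : allList l f = true) : ∀ x ∈ l, f x = true := by
  induction l with
  | nil => intro x hx; exact absurd hx List.not_mem_nil
  | cons y l ih =>
    have h' : cond (f y) (allList l f) false = true := h
    cases h1 : f y with
    | false => rw [h1] at h'; exact absurd h' Bool.false_ne_true
    | true =>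
      rw [h1] at h'
      intro x hx
      rcases List.mem_cons.1 hx with rfl | h2
      · exact h1
      · exact ih h' x h2

/-- Extend a list successively by the given steps. -/
def each (n : ℕ) (step : ℕ → List ℕ → (List ℕ → Bool) → Bool) : List ℕ → (List ℕ → Bool) → Bool :=
  Nat.rec (fun A k => k A) (fun i ih A k => step i A fun B => ih B k) n

/-- A step produces a longer list with the stated property. -/
def Extends (step : List ℕ → (List ℕ → Bool) → Bool) (C : List ℕ → Prop) : Prop :=
  ∀ A k, step A k = true → ∃ B, A ⊆ B ∧ C B ∧ k B = true

lemma extends_each {n : ℕ} {step : ℕ → List ℕ → (List ℕ → Bool) → Bool} {C : ℕ → List ℕ → Prop}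
    (hC : ∀ i A B, A ⊆ B → C i A → C i B) (h : ∀ i < n, Extends (step i) (C i)) :
    Extends (each n step) fun B => ∀ i < n, C i B := by
  induction n with
  | zero => exact fun A k hk => ⟨A, List.Subset.refl A, fun i hi => absurd hi (Nat.not_lt_zero i), hk⟩
  | succ n ih =>
    intro A k hk
    have hk' : step n A (fun B => each n step B k) = true := hk
    obtain ⟨B, hAB, hB, hk2⟩ := h n (Nat.lt_succ_self n) A _ hk'
    obtain ⟨D, hBD, hD, hk3⟩ := ih (fun i hi => h i (hi.trans (Nat.lt_succ_self n))) B k hk2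
    refine ⟨D, List.Subset.trans hAB hBD, fun i hi => ?_, hk3⟩
    rcases Nat.lt_succ_iff_lt_or_eq.1 hi with h2 | rfl
    · exact hD i h2
    · exact hC i B D hBD hB

/-- Divide a list according to a binary digit. -/
def part (i : ℕ) (l : List ℕ) (k : List ℕ → List ℕ → Bool) : Bool :=
  List.rec (fun A B => k A B) (fun x _ ih A B =>
    cond (Nat.beq (Nat.mod (Nat.shiftRight x i) 2) 0) (ih (x :: A) B) (ih A (x :: B))) l [] []

/-- Test a relation on all pairs of elements of a list with the same `n` lowest digits. -/
def radix (f : ℕ → ℕ → Bool) (n : ℕ) : List ℕ → Bool :=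
  Nat.rec (fun l => allList l fun x => allList l fun y => f x y)
    (fun i ih l => part i l fun A B => cond (ih A) (ih B) false) n

lemma exists_part {i : ℕ} {l : List ℕ} {k : List ℕ → List ℕ → Bool} (h : part i l k = true) :
    ∃ A B, k A B = true ∧ ∀ x ∈ l, if x / 2 ^ i % 2 = 0 then x ∈ A else x ∈ B := by
  have key : ∀ (l A₀ B₀ : List ℕ), (List.rec (fun A B => k A B) (fun x _ ih A B =>
      cond (Nat.beq (Nat.mod (Nat.shiftRight x i) 2) 0) (ih (x :: A) B) (ih A (x :: B))) l
        : List ℕ → List ℕ → Bool) A₀ B₀ = true →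
      ∃ A B, A₀ ⊆ A ∧ B₀ ⊆ B ∧ k A B = true ∧ ∀ x ∈ l, if x / 2 ^ i % 2 = 0 then x ∈ A else x ∈ B := by
    intro l
    induction l with
    | nil => exact fun A B hk => ⟨A, B, List.Subset.refl A, List.Subset.refl B, hk,
        fun x hx => absurd hx List.not_mem_nil⟩
    | cons y l ih =>
      intro A B hk
      have hy : Nat.mod (Nat.shiftRight y i) 2 = y / 2 ^ i % 2 :=
        congrArg (· % 2) (Nat.shiftRight_eq_div_pow y i)
      simp only [hy] at hk
      cases h1 : Nat.beq (y / 2 ^ i % 2) 0 with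
      | true =>
        rw [h1] at hk
        obtain ⟨A', B', hA, hB, hk', hx⟩ := ih (y :: A) B hk
        refine ⟨A', B', fun z hz => hA (List.mem_cons_of_mem _ hz), hB, hk', fun x hx' => ?_⟩
        rcases List.mem_cons.1 hx' with rfl | h2
        · rw [if_pos (Nat.eq_of_beq_eq_true h1)]; exact hA List.mem_cons_self
        · exact hx x h2
      | false =>
        rw [h1] at hk
        obtain ⟨A', B', hA, hB, hk', hx⟩ := ih A (y :: B) hk
        refine ⟨A', B', hA, fun z hz => hB (List.mem_cons_of_mem _ hz), hk', fun x hx' => ?_⟩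
        rcases List.mem_cons.1 hx' with rfl | h2
        · rw [if_neg (Nat.ne_of_beq_eq_false h1)]; exact hB List.mem_cons_self
        · exact hx x h2
  obtain ⟨A, B, -, -, hk, hx⟩ := key l [] [] h
  exact ⟨A, B, hk, hx⟩

lemma radix_spec {f : ℕ → ℕ → Bool} {n : ℕ} {l : List ℕ} (h : radix f n l = true) :
    ∀ x ∈ l, ∀ y ∈ l, (∀ i < n, x / 2 ^ i % 2 = y / 2 ^ i % 2) → f x y = true := by
  induction n generalizing l with
  | zero => exact fun x hx y hy _ => allList_spec (allList_spec h x hx) y hy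
  | succ n ih =>
    obtain ⟨A, B, hk, hAB⟩ := exists_part (i := n) (k := fun A B => cond (radix f n A) (radix f n B) false) h
    intro x hx y hy hxy
    have h1 := hAB x hx
    have h2 := hAB y hy
    rw [← hxy n (Nat.lt_succ_self n)] at h2
    have h3 : ∀ i < n, x / 2 ^ i % 2 = y / 2 ^ i % 2 := fun i hi => hxy i (hi.trans (Nat.lt_succ_self n))
    cases h4 : radix f n A with
    | false => rw [h4] at hk; exact absurd hk Bool.false_ne_true
    | true =>
      rw [h4] at hk
      split_ifs at h1 h2
      · exact ih h4 x h1 y h2 h3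
      · exact ih hk x h1 y h2 h3

end Search

section Structures

/-- The bit string `defect`, with shared computations. -/
def fastDefect (m n : ℕ → ℕ → ℕ) (x y : ℕ) : ℕ :=
  force (m x y) fun a => force (m x x) fun b => force (m y y) fun c =>
  force (n x x) fun d => force (n y y) fun e =>
  Nat.xor (Nat.xor (Nat.xor (n a a) (n b c)) (m d c)) (m b e)

lemma fastDefect_eq (m n : ℕ → ℕ → ℕ) (x y : ℕ) : fastDefect m n x y = defect m n x y := by
  simp only [fastDefect, force_eq]
  rfl

/-- The collection of the values of `defect` at basis elements. -/
def defectKey (m n : ℕ → ℕ → ℕ) : ℕ :=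
  let f := fun x y k => Nat.add (fastDefect m n x y) (Nat.mul 16 k)
  f 1 2 (f 1 4 (f 1 8 (f 2 4 (f 2 8 (f 4 8 0)))))

/-- The sum of the diagonal coefficients of multiplication by `x`. -/
def tabTrace (t x : ℕ) : ℕ :=
  let f := fun i => Nat.shiftRight (revMul t x (Nat.pow 2 i)) i
  Nat.mod (Nat.xor (Nat.xor (f 0) (f 1)) (Nat.xor (f 2) (f 3))) 2

/-- The inverse of a permutation of the four-bit strings. -/
def invTab (P : ℕ) : ℕ := Nat.rec 0 (fun x s => Nat.add s (Nat.shiftLeft x (Nat.mul 4 (lookup P x)))) 16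

/-- The transport of the standard product by linear maps with values `a`, `b`, `c`, `d` and inverse `Q`. -/
def transTab (Q a b c d : ℕ) : ℕ :=
  let f := fun x y => lookup Q (star x y)
  prodTab (f a a) (f a b) (f a c) (f a d) (f b b) (f b c) (f b d) (f c c) (f c d) (f d d)

/-- A table together with its values of `defect`. -/
def keyed (t : ℕ) : ℕ := Nat.add (Nat.mod (defectKey star (revMul t)) (Nat.pow 2 24)) (Nat.mul (Nat.pow 2 24) t)

/-- Append the transport of the standard product by a linear map, if the map is invertible. -/
def append (a b c d : ℕ) (A : List ℕ) (k : List ℕ → Bool) : Bool :=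
  force (linTab a b c d) fun P => cond (allBelow 15 fun x => Nat.ble 1 (lookup P (Nat.succ x)))
    (force (invTab P) fun Q => cond (allBelow 16 fun x => Nat.beq (lookup Q (lookup P x)) x)
      (force (transTab Q a b c d) fun t => cond (allBelow 16 fun x => Nat.beq (tabTrace t x) 0)
        (force (keyed t) fun z => k (z :: A)) false)
      false)
    (k A)

lemma balanced_of_tabTrace {t : ℕ} (h : ∀ x < 16, Nat.beq (tabTrace t x) 0 = true) : Balanced (revMul t) := by
  intro x hx
  have h1 := Nat.eq_of_beq_eq_true (h x hx)
  have key : ∀ a b c d : ℕ, ((a >>> 0 ^^^ b >>> 1) ^^^ (c >>> 2 ^^^ d >>> 3)) % 2 = 0 →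
      (if a.testBit 0 then (1 : F₂) else 0) + (if b.testBit 1 then 1 else 0) + (if c.testBit 2 then 1 else 0) +
        (if d.testBit 3 then 1 else 0) = 0 := by
    intro a b c d h
    have h' := Nat.testBit_zero ((a >>> 0 ^^^ b >>> 1) ^^^ (c >>> 2 ^^^ d >>> 3))
    rw [h] at h'
    simp only [Nat.testBit_xor, Nat.testBit_shiftRight, add_zero] at h'
    revert h'
    cases a.testBit 0 <;> cases b.testBit 1 <;> cases c.testBit 2 <;> cases d.testBit 3 <;> decide
  rw [Fin.sum_univ_four]
  exact key _ _ _ _ h1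

/-- A list contains the tables of all transports by maps with the given values. -/
def Covers (a b c d : ℕ) (B : List ℕ) : Prop :=
  ∀ p q, CodeIso p q → p 1 = a → p 2 = b → p 4 = c → p 8 = d → ∃ t, Balanced (revMul t) ∧
    (∀ x < 16, ∀ y < 16, conj p q x y = revMul t x y) ∧ keyed t ∈ B

lemma extends_append (a b c d : ℕ) : Extends (append a b c d) (Covers a b c d) := by
  intro A k hk
  simp only [append, force_eq] at hk
  have hp : ∀ {p q : ℕ → ℕ}, CodeIso p q → p 1 = a → p 2 = b → p 4 = c → p 8 = d →
      ∀ x < 16, lookup (linTab a b c d) x = p x := by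
    rintro p q h rfl rfl rfl rfl x hx
    rw [lookup_linTab (h.lt _ (by decide)) (h.lt _ (by decide)) (h.lt _ (by decide)) (h.lt _ (by decide)) hx,
      lin_apply p h.xor hx]
  cases h1 : allBelow 15 fun x => Nat.ble 1 (lookup (linTab a b c d) (Nat.succ x)) with
  | false =>
    rw [h1] at hk
    refine ⟨A, List.Subset.refl A, fun p q h ha hb hc hd => ?_, hk⟩
    have h0 : p 0 = 0 := by
      have := h.xor 0 (by decide) 0 (by decide)
      rwa [Nat.xor_self, Nat.xor_self] at this
    have := allBelow_of (n := 15) (f := fun x => Nat.ble 1 (lookup (linTab a b c d) (Nat.succ x))) fun x hx => by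
      have hx1 : Nat.succ x < 16 := Nat.succ_lt_succ hx
      rw [hp h ha hb hc hd _ hx1]
      refine Nat.ble_eq_true_of_le (Nat.pos_of_ne_zero fun h2 => Nat.succ_ne_zero x ?_)
      rw [← h.left _ hx1, h2]
      have := h.left 0 (by decide)
      rwa [h0] at this
    rw [h1] at this
    exact absurd this Bool.false_ne_true
  | true =>
    rw [h1, cond_true] at hk
    cases h2 : allBelow 16 fun x => Nat.beq (lookup (invTab (linTab a b c d)) (lookup (linTab a b c d) x)) x with
    | false => rw [h2] at hk; exact absurd hk Bool.false_ne_true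
    | true =>
      rw [h2, cond_true] at hk
      set t := transTab (invTab (linTab a b c d)) a b c d with ht
      cases h3 : allBelow 16 fun x => Nat.beq (tabTrace t x) 0 with
      | false => rw [h3] at hk; exact absurd hk Bool.false_ne_true
      | true =>
        rw [h3, cond_true] at hk
        refine ⟨_, List.subset_cons_self _ A, fun p q h ha hb hc hd =>
          ⟨t, balanced_of_tabTrace (allBelow_spec h3), fun x hx y hy => ?_, List.mem_cons_self⟩, hk⟩
        have hq : ∀ y < 16, lookup (invTab (linTab a b c d)) y = q y := by
          intro y hy
          have := Nat.eq_of_beq_eq_true (allBelow_spec h2 _ (h.lt_inv y hy))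
          rwa [hp h ha hb hc hd _ (h.lt_inv y hy), h.right y hy] at this
        rw [← h.product.eq_table hx hy, ht]
        simp only [transTab, conj, ha, hb, hc, hd, hq _ (star_lt _ _)]

/-- The list of all transports of the standard product. -/
def transports : List ℕ → (List ℕ → Bool) → Bool :=
  each 3 fun a => each 16 fun b => each 16 fun c => each 16 fun d => append (lookup 0x431 a) b c d

lemma extends_transports : Extends transports fun B => ∀ a < 3, ∀ b < 16, ∀ c < 16, ∀ d < 16,
    Covers (lookup 0x431 a) b c d B := by
  have mono : ∀ {a b c d A B}, A ⊆ B → Covers a b c d A → Covers a b c d B :=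
    fun hAB h p q hp ha hb hc hd => (h p q hp ha hb hc hd).imp fun t ht => ⟨ht.1, ht.2.1, hAB ht.2.2⟩
  refine extends_each (fun i A B hAB h b hb c hc d hd => mono hAB (h b hb c hc d hd)) fun a _ => ?_
  refine extends_each (fun i A B hAB h c hc d hd => mono hAB (h c hc d hd)) fun b _ => ?_
  refine extends_each (fun i A B hAB h d hd => mono hAB (h d hd)) fun c _ => ?_
  exact extends_each (fun i A B hAB h => mono hAB h) fun d _ => extends_append _ _ _ _

end Structures

section Homs

/-- The coefficients of the standard elements in their products. -/
def coeffs {L : Type} [CommRing L] (m₀ m₁ m₂ : ℕ → ℕ → ℕ) (a : L) (i k l : Fin 4) : L :=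
  let f := fun m : ℕ → ℕ → ℕ => if (m (2 ^ (i : ℕ)) (2 ^ (l : ℕ))).testBit k then (1 : L) else 0
  (a + 1) * f m₀ + a * f m₁ + (a ^ 2 + a) * f m₂

/-- The values `a` and `b` satisfy the relations of the standard basis. -/
def IsPoint {L : Type} [CommRing L] (m₀ m₁ m₂ : ℕ → ℕ → ℕ) (a : L) (b : Fin 4 → L) : Prop :=
  ∀ i j : Fin 4, b i * b j = ∑ k : Fin 4, ∑ l : Fin 4, coeffs m₀ m₁ m₂ a i k l * coeffs m₀ m₁ m₂ a j l k +
    ∑ k : Fin 4, coeffs m₀ m₁ m₂ a i k j * b k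

variable {K : Type} [Field K] [Algebra (ZMod 2) K]

lemma map_coeffs {L : Type} [CommRing L] [Algebra (ZMod 2) L] (m₀ m₁ m₂ : ℕ → ℕ → ℕ) (a : L) (i k l : Fin 4) :
    Polynomial.aeval a (coeffs m₀ m₁ m₂ (Polynomial.X : Polynomial F₂) i k l) = coeffs m₀ m₁ m₂ a i k l := by
  simp only [coeffs, map_add, map_mul, map_pow, map_one, Polynomial.aeval_X, apply_ite (Polynomial.aeval a),
    map_zero]

lemma sum_coeffs_vec {L : Type} [CommRing L] (m₀ m₁ m₂ : ℕ → ℕ → ℕ) (a : L) (b : Fin 4 → L) (i j : Fin 4) :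
    ∑ k : Fin 4, coeffs m₀ m₁ m₂ a i k j * b k =
      (a + 1) * (∑ k : Fin 4, if (m₀ (2 ^ (i : ℕ)) (2 ^ (j : ℕ))).testBit k then b k else 0) +
      a * (∑ k : Fin 4, if (m₁ (2 ^ (i : ℕ)) (2 ^ (j : ℕ))).testBit k then b k else 0) +
      (a ^ 2 + a) * (∑ k : Fin 4, if (m₂ (2 ^ (i : ℕ)) (2 ^ (j : ℕ))).testBit k then b k else 0) := by
  simp only [Finset.mul_sum, ← Finset.sum_add_distrib]
  refine Finset.sum_congr rfl fun k _ => ?_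
  simp only [coeffs, add_mul, mul_assoc, ite_mul, one_mul, zero_mul]

namespace Frame

variable {T : K} {v : Fin 4 → K} {m₀ m₁ m₂ : ℕ → ℕ → ℕ} (F : Frame T v m₀ m₁ m₂)

include F

/-- The constant coefficients of products of standard elements are traces. -/
lemma isPoint (h₀ : Balanced m₀) (h₁ : Balanced m₁) (h₂ : Balanced m₂) : IsPoint m₀ m₁ m₂ T v := by
  choose c hc using fun i j : Fin 4 => F.rel _ (two_pow_lt i) _ (two_pow_lt j)
  intro i j
  have hA := fun i => hasMatrix_multMatrix (hc i)
  obtain ⟨A₀, hA₀, h0⟩ := F.exists_matrix h₀ h₁ h₂ _ (F.product₀.lt _ (two_pow_lt i) _ (two_pow_lt j))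
  obtain ⟨A₁, hA₁, h1⟩ := F.exists_matrix h₀ h₁ h₂ _ (F.product₁.lt _ (two_pow_lt i) _ (two_pow_lt j))
  obtain ⟨A₂, hA₂, h2⟩ := F.exists_matrix h₀ h₁ h₂ _ (F.product₂.lt _ (two_pow_lt i) _ (two_pow_lt j))
  have e1 := (hA i).mul (hA j)
  have e2 := (((HasMatrix.one.aeval_mul (c i j)).add (hA₀.aeval_mul (Polynomial.X + 1))).add
    (hA₁.aeval_mul Polynomial.X)).add (hA₂.aeval_mul (Polynomial.X ^ 2 + Polynomial.X))
  simp only [map_add, map_pow, map_one, Polynomial.aeval_X, mul_one] at e2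
  rw [← hc] at e2
  have e3 := congrArg Matrix.trace (e1.unique F.indep e2)
  have two : (2 : Polynomial F₂) = 0 := CharTwo.two_eq_zero
  rw [Matrix.trace_add, Matrix.trace_add, Matrix.trace_add, Matrix.trace_smul, Matrix.trace_smul,
    Matrix.trace_smul, Matrix.trace_smul, h0, h1, h2, Matrix.trace_one, Fintype.card_fin] at e3
  have hsymm : c j i = c i j := by
    have h := hc j i
    rw [mul_comm, hc i j, F.product₀.comm _ (two_pow_lt j) _ (two_pow_lt i),
      F.product₁.comm _ (two_pow_lt j) _ (two_pow_lt i), F.product₂.comm _ (two_pow_lt j) _ (two_pow_lt i)] at h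
    have h' : Polynomial.aeval T (c j i - c i j) = 0 := by
      rw [map_sub]
      linear_combination -h
    have := congrFun (F.indep (Fin.cons (c j i - c i j) 0) (by
      rw [Fin.sum_univ_succ]
      simp [h'])) 0
    exact sub_eq_zero.1 this
  have hsum : ∀ (i : Fin 4) (c : Fin 4 → Polynomial F₂), ∑ k : Fin 4, c k * bits (2 ^ (i : ℕ)) k.succ = c i := by
    intro i c
    rw [Finset.sum_eq_single i]
    · simp [bits]
    · intro k _ hk
      have : (2 ^ (i : ℕ)).testBit (k : ℕ) = false :=
        Nat.testBit_two_pow_of_ne fun h => hk (Fin.ext h.symm)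
      simp [bits, this]
    · exact fun h => absurd (Finset.mem_univ i) h
  have hco : ∀ i k l : Fin 4, multMatrix m₀ m₁ m₂ (2 ^ (i : ℕ)) (c i) k.succ l.succ =
      coeffs m₀ m₁ m₂ Polynomial.X i k l := by
    intro i k l
    simp [multMatrix, coeffs, bits]
  have hc0 : c i j = ∑ k : Fin 4, ∑ l : Fin 4,
      coeffs m₀ m₁ m₂ Polynomial.X i k l * coeffs m₀ m₁ m₂ Polynomial.X j l k := by
    have e4 : (multMatrix m₀ m₁ m₂ (2 ^ (i : ℕ)) (c i) * multMatrix m₀ m₁ m₂ (2 ^ (j : ℕ)) (c j)).trace =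
        c i j + c j i + ∑ k : Fin 4, ∑ l : Fin 4,
          coeffs m₀ m₁ m₂ Polynomial.X i k l * coeffs m₀ m₁ m₂ Polynomial.X j l k := by
      have z : ∀ i : Fin 4, multMatrix m₀ m₁ m₂ (2 ^ (i : ℕ)) (c i) 0 0 = 0 := fun i => rfl
      have z1 : ∀ i l : Fin 4, multMatrix m₀ m₁ m₂ (2 ^ (i : ℕ)) (c i) 0 l.succ = c i l := fun i l => by
        simp [multMatrix, bits]
      have z2 : ∀ i l : Fin 4, multMatrix m₀ m₁ m₂ (2 ^ (i : ℕ)) (c i) l.succ 0 = bits (2 ^ (i : ℕ)) l.succ :=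
        fun i l => rfl
      simp only [Matrix.trace, Matrix.diag, Matrix.mul_apply]
      rw [Fin.sum_univ_succ]
      simp only [Fin.sum_univ_succ (n := 4), hco, z, z1, z2, mul_zero, zero_add, Finset.sum_add_distrib]
      rw [hsum j (c i), Finset.sum_congr rfl fun k _ => mul_comm _ _, hsum i (c j), add_assoc]
    rw [e4, hsymm] at e3
    push_cast [smul_eq_mul] at e3
    linear_combination -e3 + (-1 * c i j) * two
  have := hc i j
  rw [vec_two_pow, vec_two_pow, hc0] at this
  rw [this, sum_coeffs_vec]
  simp only [map_sum, map_mul, map_coeffs, vec]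
  ring

end Frame

end Homs

section Places

lemma mul_mem_of_isPoint {R : Type} [CommRing R] [Algebra (ZMod 2) R] {m₀ m₁ m₂ : ℕ → ℕ → ℕ} {z : R}
    {h : Fin 4 → R} (hz : IsPoint m₀ m₁ m₂ z h) (i j : Fin 5) :
    (Fin.cons 1 h : Fin 5 → R) i * (Fin.cons 1 h : Fin 5 → R) j ∈ polySpan z (Fin.cons 1 h : Fin 5 → R) := by
  have hmem := fun i => mem_polySpan (z := z) (h := (Fin.cons 1 h : Fin 5 → R)) i
  refine Fin.cases ?_ (fun i => ?_) i
  · rw [Fin.cons_zero, one_mul]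
    exact hmem j
  refine Fin.cases ?_ (fun j => ?_) j
  · rw [Fin.cons_zero, mul_one]
    exact hmem _
  simp only [Fin.cons_succ]
  rw [hz i j]
  refine add_mem (sum_mem fun k _ => sum_mem fun l _ => ?_) (sum_mem fun k _ => ?_)
  · rw [← map_coeffs m₀ m₁ m₂ z i k l, ← map_coeffs m₀ m₁ m₂ z j l k, ← map_mul, ← mul_one (Polynomial.aeval z _)]
    exact aeval_mul_mem_polySpan (hmem 0) _
  · rw [← map_coeffs]
    exact aeval_mul_mem_polySpan (hmem k.succ) _

lemma IsPoint.prod {R L : Type} [CommRing R] [CommRing L] {m₀ m₁ m₂ : ℕ → ℕ → ℕ} {z : R} {a : L}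
    {h : Fin 4 → R} {b : Fin 4 → L} (hz : IsPoint m₀ m₁ m₂ z h) (ha : IsPoint m₀ m₁ m₂ a b) :
    IsPoint m₀ m₁ m₂ ((z, a) : R × L) fun i => (h i, b i) := by
  intro i j
  have hc : ∀ i k l, coeffs m₀ m₁ m₂ ((z, a) : R × L) i k l =
      (coeffs m₀ m₁ m₂ z i k l, coeffs m₀ m₁ m₂ a i k l) := by
    intro i k l
    simp only [coeffs]
    split_ifs <;> refine Prod.ext ?_ ?_ <;> simp
  simp only [hc, Prod.mk_mul_mk]
  refine Prod.ext ?_ ?_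
  · simp only [Prod.fst_add, Prod.fst_sum]
    exact hz i j
  · simp only [Prod.snd_add, Prod.snd_sum]
    exact ha i j

variable {K : Type} [Field K] [Algebra (ZMod 2) K] [GenusFourFive K]
variable {T : K} {P : Fin 3 → Place F₂ K} {r : Fin 3 → K → F32} (S : Setup T P r)
variable {v : Fin 4 → K} {m₀ m₁ m₂ : ℕ → ℕ → ℕ}

include S

/-- Solutions of the relations give homomorphisms. -/
lemma Setup.exists_hom (hv : Adapted T P r v) (F : Frame T v m₀ m₁ m₂) (h₀ : Balanced m₀) (h₁ : Balanced m₁)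
    (h₂ : Balanced m₂) {L : Type} [Field L] [Algebra (ZMod 2) L] {a : L} {b : Fin 4 → L}
    (h : IsPoint m₀ m₁ m₂ a b) : ∃ χ : affineRing (pole P) →+* L, ∀ (p : Polynomial F₂) (x : ℕ)
      (hb : Polynomial.aeval T p + vec v x ∈ affineRing (pole P)), χ ⟨_, hb⟩ = Polynomial.aeval a p + vec b x := by
  have hfg : (Fin.cons 1 fun i => (v i, b i) : Fin 5 → K × L) =
      fun i => ((Fin.cons 1 v : Fin 5 → K) i, (Fin.cons 1 b : Fin 5 → L) i) := by
    funext i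
    refine Fin.cases rfl (fun i => rfl) i
  have hmul := mul_mem_of_isPoint ((F.isPoint h₀ h₁ h₂).prod h)
  have hmem := fun i => mem_polySpan (z := (T, a)) (h := (Fin.cons 1 fun i => (v i, b i) : Fin 5 → K × L)) i
  rw [hfg] at hmul hmem
  have hD : 0 ≤ pole P := single_nonneg _
  obtain ⟨χ, hχ⟩ := exists_hom_of_basis F.indep (fun b hb => by
    obtain ⟨n, hn⟩ := affineRing_mem_RR hD hb
    exact S.mem_span_of_RR hv n b hn) a (Fin.cons 1 b) (hmem 0) hmul
  refine ⟨χ, fun p x hb => hχ (Polynomial.aeval T p + vec v x, Polynomial.aeval a p + vec b x) ?_ hb⟩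
  refine mem_polySpan_prod.2 ⟨(Fin.cons p (fun i : Fin 4 => if x.testBit i then 1 else 0) : Fin 5 → Polynomial F₂), ?_, ?_⟩
  · rw [Fin.sum_univ_succ]
    simp [vec, apply_ite (Polynomial.aeval T)]
  · rw [Fin.sum_univ_succ]
    simp [vec, apply_ite (Polynomial.aeval a)]

end Places

section Points

/-- The coefficients in the standard relations, as a bit string of length `e`. -/
def bitCoeffs (e s : ℕ) (m₀ m₁ m₂ : ℕ → ℕ → ℕ) (a i k l : ℕ) : ℕ :=
  let f := fun (m : ℕ → ℕ → ℕ) z => cond (Nat.beq (Nat.mod (Nat.shiftRight (m (Nat.pow 2 i) (Nat.pow 2 l)) k) 2) 1) z 0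
  Nat.xor (Nat.xor (f m₀ (Nat.xor a 1)) (f m₁ a)) (f m₂ (Nat.xor (tabMul e s a a) a))

/-- The digits of a point, as bit strings of length `e`. -/
def digit (e w i : ℕ) : ℕ := Nat.mod (lookup w i) (Nat.pow 2 e)

/-- The sum of four bit strings. -/
def xorFour (f : ℕ → ℕ) : ℕ := Nat.xor (Nat.xor (Nat.xor (f 0) (f 1)) (f 2)) (f 3)

/-- Test the relations of a point. -/
def checkPoint (e s : ℕ) (m₀ m₁ m₂ : ℕ → ℕ → ℕ) (w : ℕ) : Bool :=
  force (digit e w 0) fun a => allBelow 4 fun i => allBelow 4 fun j =>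
    Nat.beq (tabMul e s (digit e w (Nat.succ i)) (digit e w (Nat.succ j)))
      (Nat.xor
        (xorFour fun k => xorFour fun l => tabMul e s (bitCoeffs e s m₀ m₁ m₂ a i k l) (bitCoeffs e s m₀ m₁ m₂ a j l k))
        (xorFour fun k => tabMul e s (bitCoeffs e s m₀ m₁ m₂ a i k j) (digit e w (Nat.succ k))))

/-- The element of a field with the given digit. -/
def GF.digit (e s w i : ℕ) : GF e s := ⟨CFF.digit e w i, Nat.mod_lt _ (Nat.two_pow_pos e)⟩

lemma GF.val_sum_four {e s : ℕ} [GF.Valid e s] (f : Fin 4 → GF e s) (g : ℕ → ℕ) (h : ∀ i, (f i).1 = g i) :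
    (∑ i : Fin 4, f i).1 = xorFour g := by
  rw [Fin.sum_univ_four]
  simp only [GF.val_add, h]
  rfl

lemma GF.val_coeffs {e s : ℕ} [GF.Valid e s] (m₀ m₁ m₂ : ℕ → ℕ → ℕ) (a : GF e s) (i k l : Fin 4) :
    (coeffs m₀ m₁ m₂ a i k l).1 = bitCoeffs e s m₀ m₁ m₂ a.1 i k l := by
  have h : ∀ (n k : ℕ) (z : GF e s), (z * if n.testBit k then (1 : GF e s) else 0).1 =
      cond (Nat.beq (Nat.mod (Nat.shiftRight n k) 2) 1) z.1 0 := by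
    intro n k z
    have e1 : Nat.mod (Nat.shiftRight n k) 2 = n / 2 ^ k % 2 := congrArg (· % 2) (Nat.shiftRight_eq_div_pow n k)
    rw [e1, Nat.testBit_eq_decide_div_mod_eq]
    by_cases h1 : n / 2 ^ k % 2 = 1
    · rw [h1]
      simp
    · rw [show Nat.beq (n / 2 ^ k % 2) 1 = false from Bool.eq_false_iff.2 fun h => h1 (Nat.eq_of_beq_eq_true h)]
      simp [h1]
      rfl
  simp only [coeffs, bitCoeffs, GF.val_add, h]
  rw [sq, GF.val_mul]
  rfl

lemma isPoint_of_checkPoint {e s : ℕ} [GF.Valid e s] {m₀ m₁ m₂ : ℕ → ℕ → ℕ} {w : ℕ}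
    (h : checkPoint e s m₀ m₁ m₂ w = true) :
    IsPoint m₀ m₁ m₂ (GF.digit e s w 0) fun i => GF.digit e s w (i + 1) := by
  intro i j
  simp only [checkPoint, force_eq] at h
  have := Nat.eq_of_beq_eq_true (allBelow_spec (allBelow_spec h i i.2) j j.2)
  refine Fin.ext (this.trans ?_)
  rw [GF.val_add]
  refine (congrArg₂ Nat.xor ?_ ?_).symm
  · refine GF.val_sum_four _ _ fun k => GF.val_sum_four _ _ fun l => ?_
    rw [GF.val_mul, GF.val_coeffs, GF.val_coeffs]
    rfl
  · refine GF.val_sum_four _ _ fun k => ?_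
    rw [GF.val_mul, GF.val_coeffs]
    rfl

end Points

section Pairs

lemma GF.val_ite_testBit {e s : ℕ} [GF.Valid e s] (n k : ℕ) (z : GF e s) :
    (if n.testBit k then z else 0).1 = cond (Nat.beq (Nat.mod (Nat.shiftRight n k) 2) 1) z.1 0 := by
  have e1 : Nat.mod (Nat.shiftRight n k) 2 = n / 2 ^ k % 2 := congrArg (· % 2) (Nat.shiftRight_eq_div_pow n k)
  rw [e1, Nat.testBit_eq_decide_div_mod_eq]
  by_cases h1 : n / 2 ^ k % 2 = 1
  · rw [h1]
    simp
  · rw [show Nat.beq (n / 2 ^ k % 2) 1 = false from Bool.eq_false_iff.2 fun h => h1 (Nat.eq_of_beq_eq_true h)]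
    simp [h1]
    rfl

/-- A sum of a selection of the digits of a point. -/
def valueAt (s w : ℕ) : ℕ :=
  let f := fun k z => cond (Nat.beq (Nat.mod (Nat.shiftRight s k) 2) 1) z 0
  Nat.xor (f 4 (digit 4 w 0)) (xorFour fun i => f i (digit 4 w (Nat.succ i)))

/-- Test that two elements generate the field with sixteen elements and are not conjugate. -/
def checkValues (x y : ℕ) : Bool :=
  let f := fun z => tabMul 4 tabSixteen z z
  let d := fun a b r => cond (Nat.beq a b) false r
  force (f x) fun x₂ => force (f x₂) fun x₄ =>
    d x₄ x (d (f (f y)) y (d y x (d y x₂ (d y x₄ (d y (f x₄) true)))))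

/-- The relations have solutions which lead to a contradiction. -/
def Obstructed (m₀ m₁ m₂ : ℕ → ℕ → ℕ) : Prop :=
  ((∃ (a : GF 2 tabFour) (b : Fin 4 → GF 2 tabFour), IsPoint m₀ m₁ m₂ a b) ∧
    ∃ (a : GF 3 tabEight) (b : Fin 4 → GF 3 tabEight), IsPoint m₀ m₁ m₂ a b) ∨
  ∃ (p : Polynomial F₂) (x : ℕ) (a a' : GF 4 tabSixteen) (b b' : Fin 4 → GF 4 tabSixteen),
    (p = 0 ∨ p = Polynomial.X) ∧ IsPoint m₀ m₁ m₂ a b ∧ IsPoint m₀ m₁ m₂ a' b' ∧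
    ∀ y y', y = Polynomial.aeval a p + vec b x → y' = Polynomial.aeval a' p + vec b' x →
      y ^ 4 ≠ y ∧ y' ^ 4 ≠ y' ∧ y' ≠ y ∧ y' ≠ y ^ 2 ∧ y' ≠ y ^ 4 ∧ y' ≠ y ^ 8

/-- Test whether a pair of points leads to a contradiction. -/
def checkPoints (m₀ m₁ m₂ : ℕ → ℕ → ℕ) (w₁ w₂ s : ℕ) : Bool :=
  cond (Nat.beq s 0)
    (cond (checkPoint 2 tabFour m₀ m₁ m₂ w₁) (checkPoint 3 tabEight m₀ m₁ m₂ w₂) false)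
    (cond (checkValues (valueAt s w₁) (valueAt s w₂))
      (cond (checkPoint 4 tabSixteen m₀ m₁ m₂ w₁) (checkPoint 4 tabSixteen m₀ m₁ m₂ w₂) false) false)

lemma valueAt_eq (s w : ℕ) : valueAt s w = (Polynomial.aeval (GF.digit 4 tabSixteen w 0) (if s.testBit 4 then (Polynomial.X : Polynomial F₂) else 0) +
    vec (fun i : Fin 4 => GF.digit 4 tabSixteen w (i + 1)) s).1 := by
  rw [GF.val_add]
  refine congrArg₂ Nat.xor ?_ ?_
  · rw [apply_ite (Polynomial.aeval _), Polynomial.aeval_X, map_zero]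
    exact (GF.val_ite_testBit s 4 (GF.digit 4 tabSixteen w 0)).symm
  · exact (GF.val_sum_four (fun i : Fin 4 => if s.testBit i then GF.digit 4 tabSixteen w (i + 1) else 0) _
      fun i => GF.val_ite_testBit s i _).symm

lemma checkValues_spec {x y : GF 4 tabSixteen} (h : checkValues x.1 y.1 = true) :
    x ^ 4 ≠ x ∧ y ^ 4 ≠ y ∧ y ≠ x ∧ y ≠ x ^ 2 ∧ y ≠ x ^ 4 ∧ y ≠ x ^ 8 := by
  have hd : ∀ {a b r}, cond (Nat.beq a b) false r = true → a ≠ b ∧ r = true := by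
    intro a b r h
    cases h1 : Nat.beq a b with
    | true => rw [h1] at h; exact absurd h Bool.false_ne_true
    | false => rw [h1] at h; exact ⟨Nat.ne_of_beq_eq_false h1, h⟩
  have h2 : ∀ z : GF 4 tabSixteen, tabMul 4 tabSixteen z.1 z.1 = (z ^ 2).1 := fun z => by rw [sq, GF.val_mul]
  simp only [checkValues, force_eq, h2, ← pow_mul] at h
  obtain ⟨h1, h⟩ := hd h
  obtain ⟨h2, h⟩ := hd h
  obtain ⟨h3, h⟩ := hd h
  obtain ⟨h4, h⟩ := hd h
  obtain ⟨h5, h⟩ := hd h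
  obtain ⟨h6, -⟩ := hd h
  exact ⟨fun e => h1 (congrArg _ e), fun e => h2 (congrArg _ e), fun e => h3 (congrArg _ e),
    fun e => h4 (congrArg _ e), fun e => h5 (congrArg _ e), fun e => h6 (congrArg _ e)⟩

lemma obstructed_of_checkPoints {m₀ m₁ m₂ : ℕ → ℕ → ℕ} {w₁ w₂ s : ℕ} (h : checkPoints m₀ m₁ m₂ w₁ w₂ s = true) :
    Obstructed m₀ m₁ m₂ := by
  unfold checkPoints at h
  cases h0 : Nat.beq s 0 with
  | true =>
    rw [h0] at h
    obtain ⟨h1, h2⟩ := of_cond_false h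
    exact .inl ⟨⟨_, _, isPoint_of_checkPoint h1⟩, _, _, isPoint_of_checkPoint h2⟩
  | false =>
    rw [h0] at h
    obtain ⟨h1, h⟩ := of_cond_false h
    obtain ⟨h2, h3⟩ := of_cond_false h
    rw [valueAt_eq, valueAt_eq] at h1
    refine .inr ⟨if s.testBit 4 then Polynomial.X else 0, s, _, _, _, _, ?_, isPoint_of_checkPoint h2, isPoint_of_checkPoint h3, ?_⟩
    · split_ifs <;> simp
    · rintro _ _ rfl rfl
      exact checkValues_spec h1

/-- A list of points: each entry consists of a hash value, two points and a linear form. -/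
def certificates : ℕ := 0x2251301012017800076220330201e0002165201112021a025239808f16023500221221333202bb001231322122037f003007302132038d002030213022045100106023101204e905c913967622057001179f86022605bf003063201112060401ac7c6b5d32068f039de18169760731004015333202074b01e6a4868886082c000426202002086f048ac19156620879010ef994613609060118fc9066b9093c005570201102094401abcd630d820955000000201322098a01e33d9ad1590a1f01b90d2631520b0d0006672203220b650074112012220cf10002473123220d2c0298916992420d7201ca02984dd90db30016122103020deb0011453023020e8f1033ff8077620f3c0045442021220fc000071620300210ef00144120223211b401d3f48bd6d811d501e3292dd1c212010020643001321219003176321222126b04db08265112129500222720201213c30024012101021455003344202312148a00106020032215060064212000021508000760232022150d0108628fb492156c00332120113215f00117ee970256162905ab1763e772164a0119996bd92217b402f9e6841c8817df0166db84174617e600605322011217fa0350c894d7c817fc00452020322218a100437321322218ea02aa4c88e8661945005365211212194701966869dbb219a100253230002219e70056032003221a5403a0b1635b521a680001442231221b8c0041442000021c200020632331021c6c0065502031121d260054152233121d6b0004743133121f020005652123121f1b01efe89225262124002656222332212b04efba91b6a622c300305521231222e400000020211223130881706b4f6223190051512022322446041917675bc22447003757202122252d00104021211226b9003274212332279301dd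bb845ac827ab011aab8599c2281800271320000228b500620220220229d002be4e907b162a230210bb6583e22aa50007162133122ade0056302003122b1b0050412313222b7e0055442000022bb301c7df8126462bf10055352121222c5e0011053121222d3002aab0899c022e240007632320222e2e03170f9745162ebc0651eb8686762ef10289d18f2f422f030027362000222f1601a7ba6db8b22f750006402230122f90016bcc6ae9322fe60057232000022ff1004105301302308a0196686a43b2308b02a0a19e0e423140000224211032314b0040553032023176000000212012325502e381999d88327200405520102233240055453103123342005057301102335503c2ea80068633ff089563926616349100272722331235730000002111323610003023213332362900000022133236b00027242103123826003606201102383500540220000238a403448d99687838c800003421232238cc002323200122394c005001302122399901aa628f49b2399b0219fc86756239d70017622000023a400050113020123a6a01cd8d978c583ab60012272332023b410015042011323c7b0001232130123d910017002013223d940004143030123df305c266970bc63dfe0046502000023e730053102000023f160016552000023f9e0000002003223fba0002622100324090004123202002414d0291e1840266417401501892184241920845eb9b116641b6021ac761ae2241ce013fa9812556439800213220211243f1002252201022449b00127521120244a600070220010244a8001044203102450e0054153013124513000762200002451c004006203102463a004701201132473000123220201247c100151622300248140064313301324819000171223322491e007056203032492f01b2e89419d849c30051612002224a790020352023124a8a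0052732002024a990129ca9a11d64ad90065533012224b540015772012324c820035222130324c9d0015232000324d240051532021124d7a0023732020024dea0000002212324e1c0054623010024f400054163013324f4f000723200002508500441422032250d200667531030250ed003541311112519504c20a97ac6651ac018518853e4251b800221121332251cc00102223132252380005402113025257000216233122526c0015332302325270000427200022527300547321031253740045302202325408003555211022543a0000002221225598001054233102562b00515023022257b1021d8d98647257fe007156300332599d00117030220259a700151620000259b9016e849a0dd659d7016e7e8472465a4f0020602002025b210318519952825b240033042313325c440020272331125c5e011f5296b0c65ca60011213212125cad0030452021325cc20014062203025cd90006653220325cdb0052663312125ce001d94c87ffe85d1d0546cc88e6065db50012152132325e910519016464b25f50006016210302608100051221332260f7004525200002610b003021200132614302b1ab6e03b261c20aec2889670662620067233000126332005530322232637a00405032122263d3002212202232642e002446202112643c003404302312644c01b1ff878e966520002177300312665c00000020122266df044a618742626706001166323132671f0030072033226729000701201022676b02b0a7686bd267cd002625211232688b0042173003026a310042742000026a480020113213226a9b012cae899df26b5001bb1b6b65326c3a0017323332226cb60006312331026cef10f3c38160026e000236969072666ed80031602002226ee310fcff8766126f7801991e925726713000641521221271c20330d08811e6738403376892531273890030123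1022273fa000614230202746102824c9b7b76746603c85c9a147874a4026796871456757110cc3f801072764000136022131276480114cb98584876b6002164310302772100310422210277b400300621313277e800346320001279160026563110027926012794211cc2799d00622520030279d10040633113227ab50041542013227ad50065043101327ada011b538790f67ba601e1698457567bea07d4c5956a487bfc04981062d4427c1b0026042233327d2f0056472000027d4003e4e28169767d9b0010543311027dab0077452112127dae0062623312027db20040052012127df608fdc48506727e7201799f989e987f490036452000027f8e0005142010227f900004252112227f920015062003327fb101244a963b327fbe016b1a6481e2801303d91597d922802e00263120000280f50144c29e3bd281ad00015032230281b30005632010028265015c48829d52826c02b65720ba128340002575212112844101eebf86179684f8004460211132851400011620223285570288f16e2e728599045b71904566862b00404521220286eb002773202222877000334520202288160007442303128a3901baba63be328a7f0013112002128abe0007303310128acb0041623000328b240066752003128b8a0021322130128bb60016612301328cc701845484c2d28d7f0023342000028dc80054522000028e5c0011232003028f070015772101328f450036132332028f4d0011542000028fe210f0fc8661029000001440301022907a00115220231290ba0209e6610a1291e900565622013291fa002641230102926002b6bb8a8cd8929e02ca579bbd0992f50054043202129304006026201322932e0003172110129330005551320132933300563721113293d000272031133293fb00431120000294ca0116786b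bce2958400525121213295fa00162423112296d300000020230296d9001417310012971a000726213002976200074621200297c801776a67da9297cd00000020032297f1005514201302982c00004221201298a00017742001129903003206201002998e000661302132999000124533233299e60004553132129a150023512003029ad10005672000129b110055042212129c4d018eeb2132429cd30073552131229d3405fa5e8986669d570025772011329dcf0025512232229e2201798f6c5ee2a04101563a877146a0b201651f821652a19e004155222322a1d6002140233212a218002233203302a296000000201212a3220309e66669b2a5ff01e819822626a6190189dd98e788a654001013201222a68701d5d48017f8a6ae005051321102a7b604b4ab96ba06a80902aca1699372a8830106a49a16d6a8df003242211102a95c01011a805592a95f0117122058e2a971005571201222a9c7000474232212aa18002351200002aa1a003031200032aa24005110202012aa82001136200002aac2005411311312ab00001031200002ab94007632221032ad50000630213222ae7a089067842536ae960105588aaee2aed6006225200002aed802f4f5899e66af30002662200022af73001151323002af79006034201112af98000730201032b05301e689940336b072002332200132b0e1001026222312b157006426313012b24d000145302012b467000106232232b49a01488d8d6ff2b53401741f946636b67b002744320212b6e9002640201022b702047810914746b72a0444c69bc7b6b786001410330112b7c6004014222312b7ed006400212332b80f02cdcc296412b878000735213112b8cc01a0b49a60d6b8d1001731213002b9050030253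02222b944005675200212b95b007542200332ba0a006336200012ba11006562200002ba4c005151300132baea000000200122bb23003315200002bb91045c53862716bbf204e9608cc8d8bd53007042200002be1a002241200002be1b0176ac6d83d2be1c005416212302be4402c6229b3d02bea8000000201232beb0089871920176bf7a010e249806b2c00901998d93d682c11501f09e826426c12c001762202012c157003766200002c177001672300102c1ae002323231202c1ca058e116e97b2c1d2001144230012c2aa004151221032c35308482c9b0676c381000000220322c38b0131b521a0a2c41a038cd194f792c585007531213322c83701fdc596bbd9c8bb02c8a1917b66c8d8004515200002c921000755330322c93c003202203202c9970378096fd692c9e4001357200302c9ec004455330022c9ef000604210222ca0a0298f19e1988ca0d04ba008c9002ca1b001474202232ca1f017678981dd8ca33006756200112ca9b005155301212cb0e01ab1b9ea4a2cb31003133203002cb65004066331322cb8403268a8790f6cc45001350223312cc5b01dff9251022cced005160303112cd91002237203332ce05001313310232ce5b001541313322cf50000225201232cf5b01a1aa9e4ee2cf99004775300222d089021350206df2d0b2005545213002d101016a3f962146d1ac001367200212d220001414301132d243002260203222d344000706300202d369000602212102d374000306321202d383000266200002d3c4058f1c9d1888d3e4003523201302d4d701d5dc9708e8d4e102cabe9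8c498d4f7003043303332d5d9002154200002d632046b8c933162d693000774203312d6db000231200002d75f004047202202d7da03001964fb92d920003212201232d9c3002647231132d9e3041f36964232da3d000000210222da620214989b5362daa8002165230232dba1001706220302dc00000035212132dd590261876b2bf2dd7102f997917216de13007013303032de29000307202032df3304cb46862722df8106c8ce868066dfce0328c096a7a6dfd2001434300112dffa002742200222e111026822894b02e1b7028791927276e1f9004545200232e262000743303002e28e001051200002e363010d05844ae2e3f1041b766747a2e3f3000522223002e47c000000221322e54d019ef9824246e56e024d818d75e2e5d8001442223032e611049f55842676e614004041200002e76f006101201322e7a9001506200002e7c70281dc9c25a8e8590aa6ee8811e6e934005414312032e94d002457202132e952003500321332ebda002061322132ec34040b0180c052ec4c016a689bbcb6ec7d004255220112eccc003711210122ece50388ae808f16ede0002557201012ee7c001325200312ef2c02aa95845466ef8d01780965c7a2eff5000000223212f05a000056200002f0a501f039941036f145006220200232f18c0278e6820476f1a701e81580e3d8f2e7006030200102f346002532232122f4a2004445210232f4d902a442967b66f5ae000463223322f628005045311322f66e001371300122f66f000275201232f787000151203022f810002255301322f854004101210122f9d8002430200112f9dc003400221002fa55006646313332fb3b000000212032f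b500239f3912406fbcc003521222112fbe30210858e1422fd44000000202112fdf302532c90ac16fe3c005310203032fea3002274210012ff16004554301132ff4b011d048469d2ff8d006324200002ffe2

/-- An entry in the list of points. -/
def certificate (i : ℕ) : ℕ := Nat.mod (Nat.shiftRight certificates (Nat.mul 64 i)) (Nat.pow 2 64)

/-- Binary search for a hash value. -/
def findCertificate (h : ℕ) : ℕ :=
  (Nat.rec certificate (fun k ih i => force (Nat.add i (Nat.pow 2 k)) fun j =>
    cond (Nat.ble h (Nat.mod (certificate j) 65536)) (ih j) (ih i)) 10 : ℕ → ℕ) 0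

/-- The table of a transported product, from the images of the basis elements. -/
def transportTab (w : ℕ) : ℕ :=
  transTab (invTab (linTab (lookup w 0) (lookup w 1) (lookup w 2) (lookup w 3)))
    (lookup w 0) (lookup w 1) (lookup w 2) (lookup w 3)

/-- The tables of products in cyclic extensions. -/
def cyclicTab (i : ℕ) : ℕ := transportTab (Nat.mod (Nat.shiftRight 0x65d1da812b61 (Nat.mul 16 i)) 65536)

/-- Search for `t` among the tables of products in cyclic extensions. -/
def findCyclic (t : ℕ) (k : ℕ → Bool) : Bool :=
  cond (Nat.beq t (cyclicTab 0)) (k 0) (cond (Nat.beq t (cyclicTab 1)) (k 1)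
    (cond (Nat.beq t (cyclicTab 2)) (k 2) false))

/-- Test for the exceptional pairs of tables. -/
def checkSpecial (t₁ t₂ : ℕ) : Bool :=
  cond (Nat.beq t₁ t₂) (Nat.beq t₁ (transportTab 0x8421))
    (findCyclic t₁ fun _ => findCyclic t₂ fun _ => true)

/-- The exceptional pairs of tables. -/
def Special (t₁ t₂ : ℕ) : Prop := (t₁ = t₂ ∧ t₁ = transportTab 0x8421) ∨
  t₁ ≠ t₂ ∧ (∃ i < 3, t₁ = cyclicTab i) ∧ ∃ i < 3, t₂ = cyclicTab i

lemma findCyclic_spec {t : ℕ} {k : ℕ → Bool} (h : findCyclic t k = true) :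
    ∃ i < 3, t = cyclicTab i ∧ k i = true := by
  unfold findCyclic at h
  cases h0 : Nat.beq t (cyclicTab 0) with
  | true => rw [h0] at h; exact ⟨0, by decide, Nat.eq_of_beq_eq_true h0, h⟩
  | false =>
    rw [h0] at h
    cases h1 : Nat.beq t (cyclicTab 1) with
    | true => rw [h1] at h; exact ⟨1, by decide, Nat.eq_of_beq_eq_true h1, h⟩
    | false =>
      rw [h1] at h
      obtain ⟨h2, h⟩ := of_cond_false h
      exact ⟨2, by decide, Nat.eq_of_beq_eq_true h2, h⟩

lemma special_of_checkSpecial {t₁ t₂ : ℕ} (h : checkSpecial t₁ t₂ = true) : Special t₁ t₂ := by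
  unfold checkSpecial at h
  cases h0 : Nat.beq t₁ t₂ with
  | true => rw [h0] at h; exact .inl ⟨Nat.eq_of_beq_eq_true h0, Nat.eq_of_beq_eq_true h⟩
  | false =>
    rw [h0] at h
    obtain ⟨i, hi, ht, h⟩ := findCyclic_spec (k := fun _ => findCyclic t₂ fun _ => true) h
    obtain ⟨j, hj, ht', -⟩ := findCyclic_spec h
    exact .inr ⟨Nat.ne_of_beq_eq_false h0, ⟨i, hi, ht⟩, j, hj, ht'⟩

/-- Test a pair of tables. -/
def checkTables (t₁ t₂ : ℕ) : Bool :=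
  cond (Nat.beq (defectKey (revMul t₁) star) (defectKey (revMul t₁) (revMul t₂)))
    (cond (force (findCertificate (Nat.mod (Nat.add (Nat.mul 3 t₁) t₂) 65521)) fun c =>
        force (Nat.mod (Nat.shiftRight c 16) (Nat.pow 2 20)) fun w₁ =>
        force (Nat.mod (Nat.shiftRight c 36) (Nat.pow 2 20)) fun w₂ =>
        force (Nat.shiftRight c 56) fun s => checkPoints star (revMul t₁) (revMul t₂) w₁ w₂ s)
      true (checkSpecial t₁ t₂))
    true

/-- Test a pair of tables with their values of `defect`. -/
def checkKeyed (z₁ z₂ : ℕ) : Bool :=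
  cond (Nat.beq (Nat.mod z₁ (Nat.pow 2 24)) (Nat.mod z₂ (Nat.pow 2 24)))
    (force (Nat.shiftRight z₁ 24) fun t₁ => force (Nat.shiftRight z₂ 24) fun t₂ => checkTables t₁ t₂) true

lemma checkTables_spec {t₁ t₂ : ℕ} (h : checkTables t₁ t₂ = true)
    (hd : defectKey (revMul t₁) star = defectKey (revMul t₁) (revMul t₂)) :
    Special t₁ t₂ ∨ Obstructed star (revMul t₁) (revMul t₂) := by
  rw [checkTables, hd, Nat.beq_refl] at h
  refine (of_cond_true (a := force _ _) h).symm.imp special_of_checkSpecial fun h => ?_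
  simp only [force_eq] at h
  exact obstructed_of_checkPoints h

lemma checkKeyed_spec {t₁ t₂ : ℕ} (h : checkKeyed (keyed t₁) (keyed t₂) = true)
    (hk : defectKey star (revMul t₁) = defectKey star (revMul t₂)) : checkTables t₁ t₂ = true := by
  have hm : ∀ t, Nat.mod (keyed t) (Nat.pow 2 24) = Nat.mod (defectKey star (revMul t)) (Nat.pow 2 24) := by
    intro t
    change (_ % 2 ^ 24 + 2 ^ 24 * t) % 2 ^ 24 = _ % 2 ^ 24
    rw [Nat.add_mul_mod_self_left, Nat.mod_mod]
  have hs : ∀ t, Nat.shiftRight (keyed t) 24 = t := by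
    intro t
    refine (Nat.shiftRight_eq_div_pow (keyed t) 24).trans ?_
    change (_ % 2 ^ 24 + 2 ^ 24 * t) / 2 ^ 24 = t
    rw [Nat.add_mul_div_left _ _ (by norm_num), Nat.div_eq_of_lt (Nat.mod_lt _ (by norm_num)), zero_add]
  rw [checkKeyed, hm, hm, hk, Nat.beq_refl] at h
  simp only [force_eq, hs] at h
  exact h

lemma checkKeyed_all : transports [] (radix checkKeyed 14) = true := by decide +kernel

theorem exists_list_of_tables : ∃ B : List ℕ, (∀ a < 3, ∀ b < 16, ∀ c < 16, ∀ d < 16, Covers (lookup 0x431 a) b c d B) ∧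
    ∀ t₁ t₂, keyed t₁ ∈ B → keyed t₂ ∈ B → defectKey star (revMul t₁) = defectKey star (revMul t₂) →
      defectKey (revMul t₁) star = defectKey (revMul t₁) (revMul t₂) →
      Special t₁ t₂ ∨ Obstructed star (revMul t₁) (revMul t₂) := by
  obtain ⟨B, -, hB, hr⟩ := extends_transports [] _ checkKeyed_all
  refine ⟨B, hB, fun t₁ t₂ h₁ h₂ hk hd => checkTables_spec (checkKeyed_spec (radix_spec hr _ h₁ _ h₂ ?_) hk) hd⟩
  intro i hi
  have key : ∀ t, keyed t / 2 ^ i % 2 = defectKey star (revMul t) / 2 ^ i % 2 := by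
    intro t
    have h1 : ∀ a b : ℕ, (a % 2 ^ 24 + 2 ^ 24 * b) / 2 ^ i % 2 = a / 2 ^ i % 2 := by
      intro a b
      rw [show (2 : ℕ) ^ 24 = 2 ^ i * (2 * 2 ^ (23 - i)) by
        rw [← pow_succ', ← pow_add]; congr 1; omega]
      rw [mul_assoc, Nat.add_mul_div_left _ _ (Nat.two_pow_pos i), mul_assoc, Nat.add_mul_mod_self_left,
        Nat.mod_mul_right_div_self, Nat.mod_mul_right_mod]
    exact h1 _ _
  rw [key, key, hk]

end Pairs

section Normalization

/-- The square of a traceless element. -/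
def starSq (x : ℕ) : ℕ := star x x

lemma starSq_iterate_five : ∀ x < 16, starSq^[5] x = x := by decide +kernel

lemma starSq_xor : ∀ x < 16, ∀ y < 16, starSq (x ^^^ y) = starSq x ^^^ starSq y := by decide +kernel

lemma star_starSq : ∀ x < 16, ∀ y < 16, star (starSq x) (starSq y) = starSq (star x y) := by decide +kernel

lemma exists_starSq_iterate : ∀ x < 16, x ≠ 0 → ∃ i < 5, ∃ a < 3, starSq^[i] x = lookup 0x431 a := by
  decide +kernel

lemma balanced_star : Balanced star := by
  unfold Balanced
  decide +kernel

lemma starSq_lt (x : ℕ) : starSq x < 16 := star_lt x x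

lemma CodeIso.starSq {p q : ℕ → ℕ} (h : CodeIso p q) :
    CodeIso (fun x => CFF.starSq (p x)) (fun y => q (CFF.starSq^[4] y)) ∧
      ∀ x < 16, ∀ y < 16, conj (fun x => CFF.starSq (p x)) (fun y => q (CFF.starSq^[4] y)) x y = conj p q x y := by
  have h4 : ∀ y, CFF.starSq^[4] y < 16 := fun y => by
    rw [Function.iterate_succ_apply']; exact starSq_lt _
  refine ⟨⟨fun x _ => starSq_lt _, fun x hx y hy => ?_, fun y _ => h.lt_inv _ (h4 y), fun x hx => ?_, fun y hy => ?_⟩, ?_⟩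
  · simp only [h.xor x hx y hy]
    exact starSq_xor _ (h.lt x hx) _ (h.lt y hy)
  · have := starSq_iterate_five _ (h.lt x hx)
    rw [Function.iterate_succ_apply] at this
    simp only [this, h.left x hx]
  · have := starSq_iterate_five _ hy
    rw [Function.iterate_succ_apply'] at this
    simp only [h.right _ (h4 y), this]
  · intro x hx y hy
    unfold conj
    simp only
    rw [star_starSq _ (h.lt x hx) _ (h.lt y hy), ← Function.iterate_succ_apply, starSq_iterate_five _ (star_lt _ _)]

lemma CodeIso.exists_normalized {p q : ℕ → ℕ} (h : CodeIso p q) : ∃ p' q', CodeIso p' q' ∧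
    (∀ x < 16, ∀ y < 16, conj p' q' x y = conj p q x y) ∧ ∃ a < 3, p' 1 = lookup 0x431 a := by
  have key : ∀ i, ∃ p' q', CodeIso p' q' ∧ (∀ x < 16, ∀ y < 16, conj p' q' x y = conj p q x y) ∧
      p' 1 = CFF.starSq^[i] (p 1) := by
    intro i
    induction i with
    | zero => exact ⟨p, q, h, fun _ _ _ _ => rfl, rfl⟩
    | succ i ih =>
      obtain ⟨p', q', h1, h2, h3⟩ := ih
      refine ⟨_, _, h1.starSq.1, fun x hx y hy => (h1.starSq.2 x hx y hy).trans (h2 x hx y hy), ?_⟩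
      rw [Function.iterate_succ_apply', ← h3]
  have h0 : p 1 ≠ 0 := by
    intro h0
    have h1 := h.xor 1 (by decide) 1 (by decide)
    rw [Nat.xor_self, Nat.xor_self] at h1
    have h2 := h.left 1 (by decide)
    rw [h0, ← h1, h.left 0 (by decide)] at h2
    exact Nat.zero_ne_one h2
  obtain ⟨i, -, a, ha, hia⟩ := exists_starSq_iterate _ (h.lt 1 (by decide)) h0
  obtain ⟨p', q', h1, h2, h3⟩ := key i
  exact ⟨p', q', h1, h2, a, ha, h3.trans hia⟩

lemma defectKey_congr {m n m' n' : ℕ → ℕ → ℕ} (h : ∀ x < 16, ∀ y < 16, defect m n x y = defect m' n' x y) :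
    defectKey m n = defectKey m' n' := by
  simp only [defectKey, fastDefect_eq]
  rw [h 1 (by decide) 2 (by decide), h 1 (by decide) 4 (by decide), h 1 (by decide) 8 (by decide),
    h 2 (by decide) 4 (by decide), h 2 (by decide) 8 (by decide), h 4 (by decide) 8 (by decide)]

variable {K : Type} [Field K] [Algebra (ZMod 2) K] [GenusFourFive K]
variable {T : K} {P : Fin 3 → Place F₂ K} {r : Fin 3 → K → F32} {v : Fin 4 → K}

/-- The multiplication in the field is one of finitely many. -/
theorem Setup.exists_tables (S : Setup T P r) (hv : Adapted T P r v) : ∃ t₁ t₂, Frame T v star (revMul t₁) (revMul t₂) ∧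
    Balanced (revMul t₁) ∧ Balanced (revMul t₂) ∧ (Special t₁ t₂ ∨ Obstructed star (revMul t₁) (revMul t₂)) ∧
    ∀ x < 16, code T r v 1 (revMul t₁ x x) = starSq (code T r v 1 x) ∧
      code T r v 2 (revMul t₂ x x) = starSq (code T r v 2 x) := by
  obtain ⟨B, hB, hall⟩ := exists_list_of_tables
  choose q hq using S.exists_codeIso hv
  have F := S.frame hv hq
  have h₀ : ∀ x < 16, ∀ y < 16, conj (code T r v 0) (q 0) x y = star x y := by
    intro x hx y hy
    unfold conj
    rw [S.code_zero hv x hx, S.code_zero hv y hy]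
    conv_lhs => rw [← S.code_zero hv _ (star_lt x y)]
    exact (hq 0).left _ (star_lt x y)
  have key : ∀ p, ∃ t, Balanced (revMul t) ∧
      (∀ x < 16, ∀ y < 16, conj (code T r v p) (q p) x y = revMul t x y) ∧ keyed t ∈ B := by
    intro p
    obtain ⟨p', q', h', hc, a, ha, h1⟩ := (hq p).exists_normalized
    obtain ⟨t, ht, htc, htB⟩ := hB a ha _ (h'.lt 2 (by decide)) _ (h'.lt 4 (by decide)) _ (h'.lt 8 (by decide))
      p' q' h' h1 rfl rfl rfl
    exact ⟨t, ht, fun x hx y hy => (hc x hx y hy).symm.trans (htc x hx y hy), htB⟩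
  obtain ⟨t₁, b₁, c₁, m₁⟩ := key 1
  obtain ⟨t₂, b₂, c₂, m₂⟩ := key 2
  have F' := F.congr h₀ c₁ c₂
  refine ⟨t₁, t₂, F', b₁, b₂, hall t₁ t₂ m₁ m₂ (defectKey_congr fun x hx y hy => F'.defect_eq balanced_star b₁ b₂ hx hy)
    (defectKey_congr fun x hx y hy => F'.swap.defect_eq b₁ balanced_star b₂ hx hy), fun x hx => ⟨?_, ?_⟩⟩
  · rw [← c₁ x hx x hx]
    exact (hq 1).right _ (star_lt _ _)
  · rw [← c₂ x hx x hx]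
    exact (hq 2).right _ (star_lt _ _)

end Normalization

section Obstruction

lemma pow_eq_of_mem_subring {L : Type*} [Field L] [Finite L] (S : Subring L) {y : L} (hy : y ∈ S) :
    y ^ Nat.card S = y := by
  have : Fintype S := Fintype.ofFinite S
  rw [Nat.card_eq_fintype_card]
  exact congrArg Subtype.val (@FiniteField.pow_card S (Fintype.groupWithZeroOfCancel S) _ ⟨y, hy⟩)

lemma pow_sixteen (y : GF 4 tabSixteen) : y ^ 16 = y := by
  have : Fintype (GF 4 tabSixteen) := Fintype.ofFinite _
  have h := FiniteField.pow_card y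
  rwa [← Nat.card_eq_fintype_card, GF.card] at h

variable {K : Type} [Field K] [Algebra (ZMod 2) K] [GenusFourFive K]
variable {T : K} {P : Fin 3 → Place F₂ K} {r : Fin 3 → K → F32} {v : Fin 4 → K}

lemma Setup.not_obstructed (S : Setup T P r) (hv : Adapted T P r v) {m₀ m₁ m₂ : ℕ → ℕ → ℕ}
    (F : Frame T v m₀ m₁ m₂) (h₀ : Balanced m₀) (h₁ : Balanced m₁) (h₂ : Balanced m₂) :
    ¬ Obstructed m₀ m₁ m₂ := by
  have hD : (0 : Divisor F₂ K) ≤ pole P := single_nonneg _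
  have hD0 : pole P ≠ 0 := by simp [pole]
  rintro (⟨⟨a, b, hab⟩, a', b', hab'⟩ | ⟨p, x, a, a', b, b', hp, hab, hab', h⟩)
  · obtain ⟨χ, -⟩ := S.exists_hom hv F h₀ h₁ h₂ hab
    obtain ⟨χ', -⟩ := S.exists_hom hv F h₀ h₁ h₂ hab'
    obtain ⟨Q, -, hQ, -, -⟩ := exists_place_dvd hD hD0 (GF.card 2 tabFour) χ
    obtain ⟨Q', -, hQ', -, -⟩ := exists_place_dvd hD hD0 (GF.card 3 tabEight) χ'
    have hQ2 := two_le_placeDegree Q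
    have hQ2' := two_le_placeDegree Q'
    exact not_two_and_three ((Nat.prime_two.eq_one_or_self_of_dvd _ hQ).resolve_left (by omega))
      ((Nat.prime_three.eq_one_or_self_of_dvd _ hQ').resolve_left (by omega))
  have hmem : Polynomial.aeval T p + vec v x ∈ affineRing (pole P) := by
    refine add_mem ?_ (mem_affineRing_of_RR (S.traceless_vec hv x).mem)
    rcases hp with rfl | rfl
    · rw [map_zero]
      exact zero_mem _
    · rw [Polynomial.aeval_X]
      exact mem_affineRing_of_RR S.T_mem
  obtain ⟨χ, hχ⟩ := S.exists_hom hv F h₀ h₁ h₂ hab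
  obtain ⟨χ', hχ'⟩ := S.exists_hom hv F h₀ h₁ h₂ hab'
  obtain ⟨Q, hQP, hQd, hQc, hQ⟩ := exists_place_dvd hD hD0 (GF.card 4 tabSixteen) χ
  obtain ⟨Q', hQP', hQd', hQc', hQ'⟩ := exists_place_dvd hD hD0 (GF.card 4 tabSixteen) χ'
  have hy := hχ p x hmem
  have hy' := hχ' p x hmem
  obtain ⟨n₁, n₂, n₃, n₄, n₅, n₆⟩ := h _ _ hy hy'
  set β : affineRing (pole P) := ⟨_, hmem⟩
  have hdeg : ∀ {Q : Place F₂ K} {χ : affineRing (pole P) →+* GF 4 tabSixteen}, placeDegree F₂ Q ∣ 4 →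
      2 ^ placeDegree F₂ Q = Nat.card χ.range → χ β ^ 4 ≠ χ β → placeDegree F₂ Q = 4 := by
    intro Q χ h4 hc hn
    have h2 := two_le_placeDegree Q
    have hle := Nat.le_of_dvd (by norm_num) h4
    have hne : placeDegree F₂ Q ≠ 2 := by
      intro h2
      rw [h2] at hc
      have := pow_eq_of_mem_subring χ.range ⟨β, rfl⟩
      rw [← hc] at this
      exact hn this
    interval_cases placeDegree F₂ Q <;> simp_all
  have hQ4 := hdeg hQd hQc n₁
  have hQQ' := place_four_unique hQ4 (hdeg hQd' hQc' n₂)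
  have hf : ∀ j k : ℕ, j < k → k < 4 → χ β ^ 2 ^ j ≠ χ β ^ 2 ^ k := by
    intro j k hjk hk e
    have e1 : ∀ n, χ β ^ 2 ^ n = iterateFrobenius (GF 4 tabSixteen) 2 n (χ β) := fun n => rfl
    obtain ⟨i, rfl⟩ := Nat.exists_eq_add_of_lt hjk
    have e2 : χ β = χ β ^ 2 ^ (i + 1) := by
      refine (iterateFrobenius (GF 4 tabSixteen) 2 j).injective ?_
      rw [← e1, map_pow, ← e1, ← pow_mul, ← pow_add, ← add_assoc]
      exact e
    have h16 := pow_sixteen (χ β)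
    have h2 : χ β ≠ χ β ^ 2 := fun h => n₁ (by
      conv_rhs => rw [h, h]
      ring)
    rcases (by omega : i = 0 ∨ i = 1 ∨ i = 2) with rfl | rfl | rfl
    · exact h2 e2
    · exact n₁ e2.symm
    · apply h2
      conv_rhs => rw [e2]
      rw [← pow_mul]
      exact h16.symm
  let ψ : Option (Fin 4) → affineRing (pole P) →+* GF 4 tabSixteen :=
    fun i => i.elim χ' fun k => (iterateFrobenius (GF 4 tabSixteen) 2 k).comp χ
  have hinj : Function.Injective ψ := by
    have hs : ∀ k : Fin 4, ψ (some k) β = χ β ^ 2 ^ (k : ℕ) := fun k => rfl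
    have hn : ∀ k : Fin 4, ψ none β ≠ ψ (some k) β := by
      intro k
      rw [hs]
      fin_cases k
      · rw [Fin.val_mk, pow_zero, pow_one]
        exact n₃
      · exact n₄
      · exact n₅
      · exact n₆
    rintro (_ | j) (_ | k) e
    · rfl
    · exact absurd (congrArg (· β) e) (hn k)
    · exact absurd (congrArg (· β) e).symm (hn j)
    · have e' : χ β ^ 2 ^ (j : ℕ) = χ β ^ 2 ^ (k : ℕ) := congrArg (· β) e
      rcases lt_trichotomy (j : ℕ) k with hjk | hjk | hjk
      · exact absurd e' (hf _ _ hjk k.2)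
      · rw [Fin.ext hjk]
      · exact absurd e'.symm (hf _ _ hjk j.2)
  have := card_le_of_same_place hD hD0 hQP hinj (fun i b => by
    cases i with
    | none => rw [hQQ']; exact hQ' b
    | some k => exact (map_eq_zero_iff _ (iterateFrobenius (GF 4 tabSixteen) 2 k).injective).trans (hQ b))
  rw [hQ4, Fintype.card_option, Fintype.card_fin] at this
  omega

end Obstruction

section ConstantExtension

lemma revMul_transportTab : ∀ x < 16, ∀ y < 16, revMul (transportTab 0x8421) x y = star x y := by decide +kernel

variable {K : Type} [Field K] [Algebra (ZMod 2) K] [GenusFourFive K]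
variable {T : K} {v : Fin 4 → K}

omit [GenusFourFive K] [Algebra (ZMod 2) K] in
lemma mem_of_pow_eq (O : ValuationSubring K) {w : K} (h : w ^ 32 = w) : w ∈ O := by
  rcases O.mem_or_inv_mem w with hw | hw
  · exact hw
  rcases eq_or_ne w 0 with rfl | h0
  · exact zero_mem O
  have e : w = w⁻¹ ^ 30 := by
    rw [inv_pow]
    refine eq_inv_of_mul_eq_one_left ?_
    refine mul_right_cancel₀ h0 ?_
    linear_combination h
  rw [e]
  exact pow_mem hw 30

lemma Frame.not_constant (F : Frame T v star star star) : False := by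
  have hind : ∀ p q : Polynomial F₂, Polynomial.aeval T p + Polynomial.aeval T q * v 0 = 0 → p = 0 ∧ q = 0 := by
    intro p q h
    have := F.indep (![p, q, 0, 0, 0]) (by
      rw [Fin.sum_univ_five]
      simpa using h)
    exact ⟨congrFun this 0, congrFun this 1⟩
  have h2 := two_eq_zero (K := K)
  have h1 : vec v 1 = v 0 := vec_two_pow v 0
  have hN : T ^ 2 + T + 1 ≠ 0 := by
    intro h
    have := (hind (Polynomial.X ^ 2 + Polynomial.X + 1) 0 (by simpa using h)).1
    have := congrArg (Polynomial.eval 0) this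
    simp at this
  have hsq : ∀ x < 16, (vec v x / (T ^ 2 + T + 1)) ^ 2 = vec v (starSq x) / (T ^ 2 + T + 1) := by
    intro x hx
    rw [_root_.div_pow, div_eq_div_iff (pow_ne_zero 2 hN) hN]
    have := F.sq balanced_star balanced_star balanced_star x hx
    unfold starSq
    linear_combination (T ^ 2 + T + 1) * this + (T ^ 2 + T + 1) * T * vec v (star x x) * h2
  have hit : ∀ n, (vec v 1 / (T ^ 2 + T + 1)) ^ 2 ^ n = vec v (starSq^[n] 1) / (T ^ 2 + T + 1) ∧ starSq^[n] 1 < 16 := by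
    intro n
    induction n with
    | zero => exact ⟨by simp, by decide⟩
    | succ n ih =>
      rw [pow_succ 2, pow_mul, ih.1, Function.iterate_succ_apply']
      exact ⟨hsq _ ih.2, starSq_lt _⟩
  have h5 := (hit 5).1
  rw [starSq_iterate_five 1 (by decide)] at h5
  have hc := exists_constant fun P : Place F₂ K => mem_of_pow_eq P.1 h5
  rw [h1, div_eq_zero_iff, div_eq_one_iff_eq hN] at hc
  rcases hc with (hc | hc) | hc
  · exact one_ne_zero (hind 0 1 (by simpa using hc)).2
  · exact hN hc
  · refine one_ne_zero (hind (-(Polynomial.X ^ 2 + Polynomial.X + 1)) 1 ?_).2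
    simp only [map_neg, map_add, map_pow, Polynomial.aeval_X, map_one]
    linear_combination hc

end ConstantExtension

section Automorphisms

lemma forall_of_xor {Q : ℕ → Prop} (h : ∀ x < 16, ∀ y < 16, Q x → Q y → Q (x ^^^ y)) (h1 : Q 1) (h2 : Q 2)
    (h4 : Q 4) (h8 : Q 8) : ∀ x < 16, Q x := by
  have e0 := h 1 (by decide) 1 (by decide) h1 h1
  have e3 := h 1 (by decide) 2 (by decide) h1 h2
  have e5 := h 1 (by decide) 4 (by decide) h1 h4
  have e6 := h 2 (by decide) 4 (by decide) h2 h4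
  have e7 := h 3 (by decide) 4 (by decide) e3 h4
  have e9 := h 1 (by decide) 8 (by decide) h1 h8
  have e10 := h 2 (by decide) 8 (by decide) h2 h8
  have e11 := h 3 (by decide) 8 (by decide) e3 h8
  have e12 := h 4 (by decide) 8 (by decide) h4 h8
  have e13 := h 5 (by decide) 8 (by decide) e5 h8
  have e14 := h 6 (by decide) 8 (by decide) e6 h8
  have e15 := h 7 (by decide) 8 (by decide) e7 h8
  intro x hx
  interval_cases x <;> assumption

/-- Squaring of traceless elements as a matrix. -/
def sqMatrix : Matrix (Fin 4) (Fin 4) F₂ := .of fun i k => if (starSq (2 ^ (i : ℕ))).testBit k then 1 else 0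

lemma sqMatrix_mul : sqMatrix * sqMatrix ^ 4 = 1 := by
  unfold sqMatrix
  decide +kernel

variable {K : Type} [Field K] [Algebra (ZMod 2) K]

lemma vec_starSq (v : Fin 4 → K) : ∀ x < 16, vec (fun i => vec v (starSq (2 ^ (i : ℕ)))) x = vec v (starSq x) := by
  have h := vec_two_pow fun i : Fin 4 => vec v (starSq (2 ^ (i : ℕ)))
  refine forall_of_xor (fun x hx y hy h1 h2 => ?_) (h 0) (h 1) (h 2) (h 3)
  rw [vec_xor, h1, h2, starSq_xor x hx y hy, vec_xor]

lemma Frame.twist {T : K} {v : Fin 4 → K} {m₀ m₁ m₂ : ℕ → ℕ → ℕ} (F : Frame T v m₀ m₁ m₂)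
    (h₀ : ∀ x < 16, ∀ y < 16, m₀ (starSq x) (starSq y) = starSq (m₀ x y))
    (h₁ : ∀ x < 16, ∀ y < 16, m₁ (starSq x) (starSq y) = starSq (m₁ x y))
    (h₂ : ∀ x < 16, ∀ y < 16, m₂ (starSq x) (starSq y) = starSq (m₂ x y)) :
    Frame T (fun i => vec v (starSq (2 ^ (i : ℕ)))) m₀ m₁ m₂ := by
  refine ⟨fun p hp => ?_, F.product₀, F.product₁, F.product₂, fun x hx y hy => ?_⟩
  · let M := sqMatrix.map (algebraMap F₂ (Polynomial F₂))
    have hM : M * M ^ 4 = 1 := by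
      have := congrArg (algebraMap F₂ (Polynomial F₂)).mapMatrix sqMatrix_mul
      rwa [map_mul, map_pow, map_one] at this
    have key : Fin.cons (p 0) (Matrix.vecMul (fun i => p (Fin.succ i)) M) = (0 : Fin 5 → Polynomial F₂) := by
      refine F.indep _ ?_
      rw [Fin.sum_univ_succ] at hp ⊢
      simp only [Fin.cons_zero, Fin.cons_succ] at hp ⊢
      rw [← hp]
      congr 1
      simp only [Matrix.vecMul, dotProduct, map_sum, Finset.sum_mul, vec, Finset.mul_sum]
      rw [Finset.sum_comm]
      refine Finset.sum_congr rfl fun i _ => Finset.sum_congr rfl fun k _ => ?_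
      simp only [M, sqMatrix, Matrix.map_apply, Matrix.of_apply]
      split_ifs <;> simp
    have h0 : p 0 = 0 := congrFun key 0
    have h1 : Matrix.vecMul (fun i => p (Fin.succ i)) M = 0 := funext fun i => congrFun key i.succ
    have h2 : (fun i => p (Fin.succ i)) = 0 := by
      rw [← Matrix.vecMul_one (fun i => p (Fin.succ i)), ← hM, ← Matrix.vecMul_vecMul, h1, Matrix.zero_vecMul]
    funext i
    exact Fin.cases h0 (fun i => congrFun h2 i) i
  · obtain ⟨c, hc⟩ := F.rel _ (starSq_lt x) _ (starSq_lt y)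
    refine ⟨c, ?_⟩
    rw [vec_starSq v x hx, vec_starSq v y hy, vec_starSq v _ (F.product₀.lt x hx y hy),
      vec_starSq v _ (F.product₁.lt x hx y hy), vec_starSq v _ (F.product₂.lt x hx y hy), hc,
      h₀ x hx y hy, h₁ x hx y hy, h₂ x hx y hy]

variable [Algebra (RatFunc (ZMod 2)) K] [IsScalarTower (ZMod 2) (RatFunc (ZMod 2)) K]

lemma exists_algEquiv (hdeg : Module.finrank (RatFunc (ZMod 2)) K = 5) {v w : Fin 4 → K} {m₀ m₁ m₂ : ℕ → ℕ → ℕ}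
    (hv : PolyIndep (algebraMap (RatFunc F₂) K RatFunc.X) (Fin.cons 1 v : Fin 5 → K))
    (h : IsPoint m₀ m₁ m₂ (algebraMap (RatFunc F₂) K RatFunc.X) v)
    (h' : IsPoint m₀ m₁ m₂ (algebraMap (RatFunc F₂) K RatFunc.X) w) :
    ∃ σ : K ≃ₐ[RatFunc F₂] K, ∀ i, σ (v i) = w i := by
  have hfin : FiniteDimensional (RatFunc F₂) K := Module.finite_of_finrank_pos (by omega)
  rw [polyIndep_iff] at hv
  let B := basisOfLinearIndependentOfCardEqFinrank hv (by rw [hdeg, Fintype.card_fin])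
  have hB : ∀ i, B i = (Fin.cons 1 v : Fin 5 → K) i := fun i => by
    rw [coe_basisOfLinearIndependentOfCardEqFinrank]
  let f : K →ₗ[RatFunc F₂] K := B.constr ℕ (Fin.cons 1 w : Fin 5 → K)
  have hf : ∀ i, f ((Fin.cons 1 v : Fin 5 → K) i) = (Fin.cons 1 w : Fin 5 → K) i := fun i => by
    rw [← hB]
    exact B.constr_basis ℕ _ i
  have f1 : f 1 = 1 := hf 0
  have fv : ∀ i, f (v i) = w i := fun i => hf i.succ
  have hc : ∀ i k l, coeffs m₀ m₁ m₂ (algebraMap (RatFunc F₂) K RatFunc.X) i k l =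
      algebraMap (RatFunc F₂) K (coeffs m₀ m₁ m₂ RatFunc.X i k l) := by
    intro i k l
    simp only [coeffs, map_add, map_mul, map_pow, map_one, apply_ite (algebraMap (RatFunc F₂) K), map_zero]
  have fvv : ∀ i j, f (v i * v j) = w i * w j := by
    intro i j
    rw [h i j, h' i j]
    simp only [hc, map_add, map_sum, ← map_mul, ← Algebra.smul_def, map_smul, fv]
    simp only [Algebra.algebraMap_eq_smul_one, map_smul, f1]
  have hmul : ∀ x y, f (x * y) = f x * f y := by
    have key : (LinearMap.mul (RatFunc F₂) K).compr₂ f = (LinearMap.mul (RatFunc F₂) K).compl₁₂ f f := by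
      refine LinearMap.ext_basis B B fun i j => ?_
      rw [hB, hB, LinearMap.compr₂_apply, LinearMap.compl₁₂_apply, LinearMap.mul_apply', LinearMap.mul_apply']
      refine Fin.cases ?_ (fun i => ?_) i <;> refine Fin.cases ?_ (fun j => ?_) j <;>
        simp [f1, fv, fvv]
    exact fun x y => congrArg (fun g => g x y) key
  let g : K →ₐ[RatFunc F₂] K := AlgHom.ofLinearMap f f1 hmul
  exact ⟨AlgEquiv.ofBijective g g.bijective, fv⟩

end Automorphisms

section Transport

variable {K : Type} [Field K] [Algebra (ZMod 2) K]

/-- The preimage of a place under an automorphism. -/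
def comapPlace (θ : K ≃+* K) (P : Place F₂ K) : Place F₂ K :=
  mkPlace (P.1.comap (θ : K →+* K)) fun h => P.2.1 <| top_le_iff.1 fun f _ => by
    have h1 : θ.symm f ∈ P.1.comap (θ : K →+* K) := h ▸ ValuationSubring.mem_top _
    have h2 : θ (θ.symm f) ∈ P.1 := h1
    rwa [θ.apply_symm_apply] at h2

variable (θ : K ≃+* K) (P : Place F₂ K)

lemma mem_comapPlace {f : K} : f ∈ (comapPlace θ P).1 ↔ θ f ∈ P.1 := Iff.rfl

lemma comapPlace_injective : Function.Injective (comapPlace (K := K) θ) := fun P Q h => by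
  refine Subtype.ext (SetLike.ext fun f => ?_)
  rw [← θ.apply_symm_apply f, ← mem_comapPlace, h, mem_comapPlace]

/-- The restriction of an automorphism to the preimage of a place. -/
def comapEquiv : (comapPlace θ P).1 ≃+* P.1 := .ofBijective
  (((θ : K →+* K).comp (comapPlace θ P).1.subtype).codRestrict P.1.toSubring fun f => f.2)
  ⟨fun _ _ h => Subtype.ext (θ.injective (congrArg Subtype.val h)), fun g =>
    ⟨⟨θ.symm g, by rw [mem_comapPlace, θ.apply_symm_apply]; exact g.2⟩, Subtype.ext (θ.apply_symm_apply g.1)⟩⟩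

variable [GenusFour K]

lemma ordAt_comapPlace {f : K} (hf : f ≠ 0) : ordAt (comapPlace θ P).1 f = ordAt P.1 (θ f) := by
  obtain ⟨ϖ, hϖ⟩ := IsDiscreteValuationRing.exists_irreducible (comapPlace θ P).1
  obtain ⟨u, hu⟩ := exists_unit_zpow hϖ hf
  have h : θ f = (((Units.mapEquiv (comapEquiv θ P).toMulEquiv u : (P.1)ˣ) : P.1) : K) *
      ((comapEquiv θ P ϖ : P.1) : K) ^ ordAt (comapPlace θ P).1 f := by
    conv_lhs => rw [hu, map_mul, map_zpow₀]
    rfl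
  rw [h, ordAt_eq ((MulEquiv.irreducible_iff (comapEquiv θ P)).2 hϖ)]

lemma mem_lev_comapPlace {n : ℤ} {f : K} : f ∈ lev (comapPlace θ P) n ↔ θ f ∈ lev P n := by
  by_cases hf : f = 0
  · simp [hf]
  · rw [mem_lev_iff hf, mem_lev_iff ((map_ne_zero_iff θ θ.injective).2 hf), ordAt_comapPlace θ P hf]

lemma placeDegree_comapPlace : placeDegree F₂ (comapPlace θ P) = placeDegree F₂ P := by
  have h := Nat.card_congr (IsLocalRing.ResidueField.mapEquiv (comapEquiv θ P)).toEquiv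
  rw [card_residue, card_residue] at h
  exact Nat.pow_right_injective le_rfl h

lemma eq_of_ordAt_eq {f g : K} (hf : f ≠ 0) (hg : g ≠ 0) (h : ∀ P : Place F₂ K, ordAt P.1 f = ordAt P.1 g) :
    f = g := by
  have h1 := div_ne_zero hf hg
  rcases exists_constant (f := f / g) fun P => by rw [mem_iff_ordAt h1, ordAt_div hf hg, h, sub_self] with h2 | h2
  · exact absurd h2 h1
  · exact (div_eq_one_iff_eq hg).1 h2

end Transport

namespace Setup

variable {K : Type} [Field K] [Algebra (ZMod 2) K] [GenusFourFive K] {T : K} {P : Fin 3 → Place F₂ K}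
  {r : Fin 3 → K → F32} (S : Setup T P r)

/-- Functions with zeros at the three places and common poles. -/
def zeroFun (T : K) : Fin 3 → K := ![T, T + 1, 1]

include S

lemma zeroFun_ne (p : Fin 3) : zeroFun T p ≠ 0 := by
  fin_cases p
  exacts [S.ne_zero, S.ne_one, one_ne_zero]

lemma ordAt_zeroFun (p : Fin 3) (Q : Place F₂ K) :
    ordAt Q.1 (zeroFun T p) = Finsupp.single (P p) (1 : ℤ) Q - Finsupp.single (P 2) (1 : ℤ) Q := by
  fin_cases p
  · have h := DFunLike.congr_fun S.div_zero Q
    rwa [div_apply S.ne_zero] at h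
  · have h := DFunLike.congr_fun S.div_one Q
    rwa [div_apply S.ne_one] at h
  · exact ordAt_one.trans (sub_self _).symm

lemma exists_of_degree_five {Q : Place F₂ K} (hQ : placeDegree F₂ Q = 5) : ∃ p, Q = P p := by
  obtain ⟨f, hf, hd⟩ := exists_div_of_deg_zero (D := Finsupp.single Q 1 - pole P) (by
    rw [map_sub, deg_place, deg_place, hQ, S.degree, sub_self])
  have hmem : f ∈ RRspace F₂ (pole P) := (mem_RR_iff hf).2 (by
    rw [← hd, sub_add_cancel]; exact single_nonneg Q)
  obtain ⟨p, hp⟩ : ∃ p, f = zeroFun T p := by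
    obtain ⟨a, b, rfl⟩ := S.mem_line hmem
    have h2 : ∀ a b : F₂, a = 0 ∧ b = 0 ∨ a = 0 ∧ b = 1 ∨ a = 1 ∧ b = 1 ∨ a = 1 ∧ b = 0 := by decide
    rcases h2 a b with ⟨rfl, rfl⟩ | ⟨rfl, rfl⟩ | ⟨rfl, rfl⟩ | ⟨rfl, rfl⟩
    · simp at hf
    · exact ⟨0, by simp [zeroFun]⟩
    · exact ⟨1, by simp [zeroFun, add_comm]⟩
    · exact ⟨2, by simp [zeroFun]⟩
  refine ⟨p, Finsupp.single_left_injective one_ne_zero (sub_left_injective (b := pole P) ?_)⟩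
  ext R
  have := DFunLike.congr_fun hd R
  rw [div_apply hf, hp, S.ordAt_zeroFun] at this
  simpa using this

lemma exists_perm (θ : K ≃+* K) :
    ∃ π : Fin 3 → Fin 3, Function.Injective π ∧ ∀ p, comapPlace θ (P p) = P (π p) := by
  choose π hπ using fun p => S.exists_of_degree_five (placeDegree_comapPlace θ (P p) |>.trans (S.degree p))
  exact ⟨π, fun p q h => S.inj (comapPlace_injective θ (by rw [hπ, hπ, h])), hπ⟩

lemma apply_T {θ : K ≃+* K} {π : Fin 3 → Fin 3} (hπ : ∀ p, comapPlace θ (P p) = P (π p)) {a b : Fin 3}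
    (ha : π a = 0) (hb : π b = 2) : θ T = zeroFun T a / zeroFun T b := by
  refine eq_of_ordAt_eq ((map_ne_zero_iff θ θ.injective).2 S.ne_zero) (div_ne_zero (S.zeroFun_ne a) (S.zeroFun_ne b))
    fun Q => ?_
  rw [ordAt_div (S.zeroFun_ne a) (S.zeroFun_ne b), S.ordAt_zeroFun, S.ordAt_zeroFun, ← ordAt_comapPlace θ Q S.ne_zero]
  have h := S.ordAt_zeroFun 0 (comapPlace θ Q)
  rw [← ha, ← hπ a, ← hb, ← hπ b] at h
  simp only [Finsupp.single_apply, (comapPlace_injective θ).eq_iff] at h ⊢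
  rw [sub_sub_sub_cancel_right, ← h, ha]
  rfl

end Setup

section Frobenius

variable {K : Type} [Field K] [Algebra (ZMod 2) K]

/-- The map `τ` induces squaring on the residue field. -/
def FrobAt [GenusFour K] (P : Place F₂ K) (τ : K → K) : Prop := ∀ f ∈ lev P 0, τ f - f ^ 2 ∈ lev P 1

lemma FrobAt.comap [GenusFour K] {P : Place F₂ K} {τ : K → K} (h : FrobAt P τ) (θ : K ≃+* K) :
    FrobAt (comapPlace θ P) fun f => θ.symm (τ (θ f)) := fun f hf => by
  rw [mem_lev_comapPlace] at hf ⊢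
  rw [map_sub, θ.apply_symm_apply, map_pow]
  exact h _ hf

namespace Setup

variable [GenusFourFive K] {T : K} {P : Fin 3 → Place F₂ K} {r : Fin 3 → K → F32} (S : Setup T P r)
include S

lemma comapPlace_eq {τ : K ≃+* K} (hT : τ T = T) (p : Fin 3) : comapPlace τ (P p) = P p := by
  obtain ⟨π, -, hπ⟩ := S.exists_perm τ
  have h := ordAt_comapPlace τ (P p) S.ne_zero
  rw [hπ, hT, S.ordAt_T, S.ordAt_T] at h
  have key : ∀ p q : Fin 3, (if q = 0 then (1 : ℤ) else if q = 2 then -1 else 0) =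
    (if p = 0 then 1 else if p = 2 then -1 else 0) → q = p := by decide
  rw [hπ, key _ _ h]

lemma apply_mem_lev {τ : K ≃+* K} (hT : τ T = T) {p : Fin 3} {n : ℤ} {f : K} (hf : f ∈ lev (P p) n) :
    τ f ∈ lev (P p) n :=
  (mem_lev_comapPlace τ (P p)).1 (by rwa [S.comapPlace_eq hT])

variable {v : Fin 4 → K} (hv : Adapted T P r v) {τ : K ≃+* K} (hT : τ T = T) {m : ℕ → ℕ}
  (hm : ∀ x < 16, τ (vec v x) = vec v (m x))

omit [Algebra (ZMod 2) K] [GenusFourFive K] S in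
include hT hm in
lemma apply_vec_scale (p : Fin 3) {x : ℕ} (hx : x < 16) :
    τ (vec v x * scale T p ^ 2) = vec v (m x) * scale T p ^ 2 := by
  have : τ (scale T p) = scale T p := by
    unfold scale
    rw [apply_ite τ, map_inv₀, hT, map_one]
  rw [map_mul, map_pow, hm x hx, this]

include hv hT hm

lemma code_of_frobAt {p : Fin 3} (h : FrobAt (P p) τ) {x : ℕ} (hx : x < 16) :
    code T r v p (m x) = starSq (code T r v p x) := by
  have h0 := S.mem_lev_of_RR (S.traceless_vec hv x).mem p
  have h1 := (S.res p).congr (S.apply_mem_lev hT h0) (h _ h0)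
  rw [apply_vec_scale hT hm p hx, pow_two (_ * _), (S.res p).mul _ h0 _ h0] at h1
  have ht := (S.traceless_vec hv x).tr p
  exact (congrArg F32.half h1).trans (F32.half_mul _ _ ht ht)

lemma frobAt_of_code {p : Fin 3} (h : ∀ x < 16, code T r v p (m x) = starSq (code T r v p x)) :
    FrobAt (P p) τ := by
  have := charTwo (K := K)
  intro f hf
  obtain ⟨q, hq⟩ := S.exists_codeIso hv p
  have hx := hq.lt_inv _ (F32.half_lt (r p f))
  have hc := hq.right _ (F32.half_lt (r p f))
  set x := q (F32.half (r p f))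
  have h0 : ∀ y, vec v y * scale T p ^ 2 ∈ lev (P p) 0 := fun y => S.mem_lev_of_RR (S.traceless_vec hv y).mem p
  have one : ∀ t : F₂, t • (1 : K) ∈ lev (P p) 0 := fun t => Submodule.smul_mem _ t (mem_lev_zero.2 (one_mem _))
  have hr : ∀ y t, r p (vec v y * scale T p ^ 2 + t • (1 : K)) = ev T r 2 p (vec v y) + t • 1 := fun y t => by
    rw [(S.res p).add _ (h0 y) _ (one t), (S.res p).smul, (S.res p).one]
    rfl
  have h1 := hr x (F32.tr (r p f))
  set t := F32.tr (r p f) with ht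
  have h2 : r p f = ev T r 2 p (vec v x) + t • 1 := by
    refine F32.ext_of ?_ ?_
    · rw [F32.tr_add, (S.traceless_vec hv x).tr, F32.tr_smul_one, zero_add]
    · rw [F32.half_add, F32.half_smul_one, Nat.xor_zero]
      exact hc.symm
  have h3 : ev T r 2 p (vec v (m x)) = ev T r 2 p (vec v x) * ev T r 2 p (vec v x) := by
    have tr_sq : ∀ c : F32, F32.tr (c * c) = F32.tr c := by decide +kernel
    have htr := fun y => (S.traceless_vec hv y).tr p
    refine F32.ext_of (by rw [tr_sq, htr, htr]) ?_
    rw [F32.half_mul _ _ (htr x) (htr x)]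
    exact h x hx
  have hsub : ∀ a ∈ lev (P p) 0, ∀ b ∈ lev (P p) 0, r p a = r p b → a - b ∈ lev (P p) 1 := fun a ha b hb hab => by
    rw [← (S.res p).zero_iff _ (sub_mem ha hb), CharTwo.sub_eq_add, (S.res p).add _ ha _ hb, hab,
      CharTwo.add_self_eq_zero]
  have two : ∀ t : F₂, t = 0 ∨ t = 1 := by decide
  have hτf := S.apply_mem_lev hT hf
  have h4 := S.apply_mem_lev hT (hsub _ hf _ (add_mem (h0 x) (one t)) (h2.trans h1.symm))
  have h5 : τ (t • (1 : K)) = t • 1 := by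
    rcases two t with h | h <;> simp [h]
  rw [map_sub, map_add, apply_vec_scale hT hm p hx, h5] at h4
  refine hsub _ hτf _ (pow_two f ▸ ?_) ?_
  · simpa using mul_mem_lev hf hf
  · rw [(S.res p).congr hτf h4, hr, h3, pow_two, (S.res p).mul _ hf _ hf, h2]
    generalize ev T r 2 p (vec v x) = c
    rcases two t with h | h
    · simp [h]
    · rw [h, one_smul, CharTwo.add_mul_self, mul_one]

end Setup

end Frobenius

section Cyclic

lemma cyclicTab_sq : ∀ i < 3, ∀ x < 16, revMul (cyclicTab i) x x = starSq^[2 + i] x := by decide +kernel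

lemma cyclicTab_starSq : ∀ i < 3, ∀ x < 16, ∀ y < 16,
    revMul (cyclicTab i) (starSq x) (starSq y) = starSq (revMul (cyclicTab i) x y) := by decide +kernel

lemma perm_eq_id : ∀ i < 3, ∀ j < 3, i ≠ j → ∀ k < 5, ∀ π : Fin 3 → Fin 3,
    (∀ p, starSq^[k * ![1, 2 + i, 2 + j] p] 1 = starSq^[![1, 2 + i, 2 + j] (π p)] 1) → π = id := by
  intro i hi j hj hij k hk π h
  have key : ∀ k < 5, ∀ a b c : Fin 3, ¬ (
      starSq^[k * 1] 1 = starSq^[![1, 2 + i, 2 + j] a] 1 ∧ starSq^[k * (2 + i)] 1 = starSq^[![1, 2 + i, 2 + j] b] 1 ∧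
      starSq^[k * (2 + j)] 1 = starSq^[![1, 2 + i, 2 + j] c] 1) ∨ a = 0 ∧ b = 1 ∧ c = 2 := by
    interval_cases i <;> interval_cases j <;> first | exact absurd rfl hij | decide +kernel
  obtain ⟨h0, h1, h2⟩ := (key k hk _ _ _).resolve_left (not_not_intro ⟨h 0, h 1, h 2⟩)
  funext p
  fin_cases p <;> assumption

variable {K : Type} [Field K] [Algebra (ZMod 2) K]

lemma Frame.exists_generator [Algebra (RatFunc (ZMod 2)) K] [IsScalarTower (ZMod 2) (RatFunc (ZMod 2)) K]
    (hdeg : Module.finrank (RatFunc (ZMod 2)) K = 5) {v : Fin 4 → K} {m₀ m₁ m₂ : ℕ → ℕ → ℕ}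
    (F : Frame (algebraMap (RatFunc F₂) K RatFunc.X) v m₀ m₁ m₂)
    (b₀ : Balanced m₀) (b₁ : Balanced m₁) (b₂ : Balanced m₂)
    (h₀ : ∀ x < 16, ∀ y < 16, m₀ (starSq x) (starSq y) = starSq (m₀ x y))
    (h₁ : ∀ x < 16, ∀ y < 16, m₁ (starSq x) (starSq y) = starSq (m₁ x y))
    (h₂ : ∀ x < 16, ∀ y < 16, m₂ (starSq x) (starSq y) = starSq (m₂ x y)) :
    ∃ σ : K ≃ₐ[RatFunc F₂] K, orderOf σ = 5 ∧ ∀ n : ℕ, ∀ x < 16, (σ ^ n) (vec v x) = vec v (starSq^[n] x) := by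
  obtain ⟨σ, hσ⟩ := exists_algEquiv hdeg F.indep (F.isPoint b₀ b₁ b₂) ((F.twist h₀ h₁ h₂).isPoint b₀ b₁ b₂)
  have h1 : ∀ x < 16, σ (vec v x) = vec v (starSq x) := fun x hx => by
    rw [← vec_starSq v x hx]
    simp only [vec, map_sum, apply_ite σ, hσ, map_zero]
  have hlt : ∀ n : ℕ, ∀ x < 16, starSq^[n] x < 16 := fun n x hx => by
    cases n with
    | zero => exact hx
    | succ n => rw [Function.iterate_succ_apply']; exact starSq_lt _
  have hn : ∀ n : ℕ, ∀ x < 16, (σ ^ n) (vec v x) = vec v (starSq^[n] x) := fun n x hx => by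
    induction n with
    | zero => rfl
    | succ n ih => rw [pow_succ', AlgEquiv.mul_apply, ih, h1 _ (hlt n x hx), Function.iterate_succ_apply']
  have : Fact (Nat.Prime 5) := ⟨by norm_num⟩
  refine ⟨σ, orderOf_eq_prime ?_ fun h => ?_, hn⟩
  · have hfin : FiniteDimensional (RatFunc F₂) K := Module.finite_of_finrank_pos (by omega)
    let B := basisOfLinearIndependentOfCardEqFinrank (polyIndep_iff.1 F.indep) (by rw [hdeg, Fintype.card_fin])
    have hB : ∀ i, B i = (Fin.cons 1 v : Fin 5 → K) i := fun i => by
      rw [coe_basisOfLinearIndependentOfCardEqFinrank]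
    suffices h : (σ ^ 5).toLinearMap = LinearMap.id from AlgEquiv.ext fun f => LinearMap.congr_fun h f
    refine B.ext fun i => ?_
    rw [hB]
    refine Fin.cases (map_one (σ ^ 5)) (fun i => ?_) i
    change (σ ^ 5) (v i) = v i
    have := hn 5 _ (two_pow_lt i)
    rwa [starSq_iterate_five _ (two_pow_lt i), vec_two_pow] at this
  · have h2 : (Fin.cons 1 v : Fin 5 → K) 1 = (Fin.cons 1 v : Fin 5 → K) 2 := by
      have h3 := hσ 0
      rw [h] at h3
      exact h3.trans (vec_two_pow v 1)
    exact absurd ((polyIndep_iff.1 F.indep).injective h2) (by decide)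

variable [Algebra (RatFunc (ZMod 2)) K]

omit [Algebra (ZMod 2) K] in
lemma apply_algebraMap {θ : K ≃+* K}
    (hθ : θ (algebraMap (RatFunc F₂) K RatFunc.X) = algebraMap (RatFunc F₂) K RatFunc.X) (x : RatFunc F₂) :
    θ (algebraMap (RatFunc F₂) K x) = algebraMap (RatFunc F₂) K x := by
  have key : (θ : K →+* K).comp (algebraMap (RatFunc F₂) K) = algebraMap (RatFunc F₂) K := by
    refine IsFractionRing.ringHom_ext (A := Polynomial F₂) fun p => ?_
    refine RingHom.congr_fun (f := ((θ : K →+* K).comp (algebraMap (RatFunc F₂) K)).comp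
      (algebraMap (Polynomial F₂) (RatFunc F₂))) (g := (algebraMap (RatFunc F₂) K).comp
      (algebraMap (Polynomial F₂) (RatFunc F₂))) (Polynomial.ringHom_ext' (Subsingleton.elim _ _) ?_) p
    simpa using hθ
  exact RingHom.congr_fun key x

omit [Algebra (ZMod 2) K] in
lemma card_algEquiv (hdeg : Module.finrank (RatFunc (ZMod 2)) K = 5) {σ : K ≃ₐ[RatFunc F₂] K}
    (hσ : orderOf σ = 5) : Nat.card (K ≃ₐ[RatFunc F₂] K) = 5 := by
  have hfin : FiniteDimensional (RatFunc F₂) K := Module.finite_of_finrank_pos (by omega)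
  have h1 : Nat.card (K ≃ₐ[RatFunc F₂] K) ≤ 5 := by
    rw [Nat.card_eq_fintype_card, ← hdeg]
    exact AlgEquiv.card_le
  have h2 := Nat.le_of_dvd Nat.card_pos (hσ ▸ orderOf_dvd_natCard σ)
  omega

lemma Setup.apply_T_eq [GenusFourFive K] (hdeg : Module.finrank (RatFunc (ZMod 2)) K = 5)
    {P : Fin 3 → Place F₂ K} {r : Fin 3 → K → F32} (S : Setup (algebraMap (RatFunc F₂) K RatFunc.X) P r)
    {v : Fin 4 → K} (hv : Setup.Adapted (algebraMap (RatFunc F₂) K RatFunc.X) P r v)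
    {σ : K ≃ₐ[RatFunc F₂] K} (h5 : orderOf σ = 5)
    (hσ : ∀ n : ℕ, ∀ x < 16, (σ ^ n) (vec v x) = vec v (starSq^[n] x)) {i j : ℕ} (hi : i < 3) (hj : j < 3) (hij : i ≠ j)
    (hc : ∀ p, ∀ x < 16, Setup.code (algebraMap (RatFunc F₂) K RatFunc.X) r v p (starSq^[![1, 2 + i, 2 + j] p] x) =
      starSq (Setup.code (algebraMap (RatFunc F₂) K RatFunc.X) r v p x)) (θ : K ≃+* K) :
    θ (algebraMap (RatFunc F₂) K RatFunc.X) = algebraMap (RatFunc F₂) K RatFunc.X := by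
  obtain ⟨π, hinj, hπ⟩ := S.exists_perm θ
  obtain ⟨a, ha⟩ := Finite.injective_iff_surjective.1 hinj 0
  obtain ⟨b, hb⟩ := Finite.injective_iff_surjective.1 hinj 2
  have hθ := S.apply_T hπ ha hb
  set T := algebraMap (RatFunc F₂) K RatFunc.X with hT
  have fixT : ∀ τ : K ≃ₐ[RatFunc F₂] K, τ T = T := fun τ => τ.commutes _
  have fixes : ∀ τ : K ≃ₐ[RatFunc F₂] K, τ (θ T) = θ T := fun τ => by
    have h : ∀ p, τ (zeroFun T p) = zeroFun T p := fun p => by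
      fin_cases p
      exacts [fixT τ, (map_add τ T 1).trans (by rw [fixT, map_one]; rfl), map_one τ]
    rw [hθ, map_div₀, h, h]
  let τ : K ≃ₐ[RatFunc F₂] K := AlgEquiv.ofRingEquiv (f := (θ.trans σ.toRingEquiv).trans θ.symm)
    (apply_algebraMap (θ.symm_apply_eq.2 (fixes σ)))
  have hτ : ∀ f, τ f = θ.symm (σ (θ f)) := fun _ => rfl
  have hτn : ∀ n : ℕ, ∀ f, (τ ^ n) f = θ.symm ((σ ^ n) (θ f)) := fun n f => by
    induction n with
    | zero => exact (θ.symm_apply_apply f).symm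
    | succ n ih => rw [pow_succ', AlgEquiv.mul_apply, ih, hτ, θ.apply_symm_apply, ← AlgEquiv.mul_apply, ← pow_succ']
  obtain ⟨k, hk, hkτ⟩ : ∃ k < 5, σ ^ k = τ := by
    have h := card_algEquiv hdeg h5
    have : Fact (Nat.Prime 5) := ⟨by norm_num⟩
    obtain ⟨n, hn⟩ := mem_powers_of_prime_card (g' := τ) h (fun h1 : σ = 1 => by simp [h1] at h5)
    exact ⟨n % 5, Nat.mod_lt _ (by decide), by rw [← h5, pow_mod_orderOf]; exact hn⟩
  have key : ∀ p, starSq^[k * ![1, 2 + i, 2 + j] p] 1 = starSq^[![1, 2 + i, 2 + j] (π p)] 1 := fun p => by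
    have h1 := (S.frobAt_of_code hv (τ := (σ ^ ![1, 2 + i, 2 + j] p).toRingEquiv) (fixT _) (hσ _) (hc p)).comap θ
    rw [hπ] at h1
    have h2 : (fun f => θ.symm ((σ ^ ![1, 2 + i, 2 + j] p).toRingEquiv (θ f))) =
        (σ ^ (k * ![1, 2 + i, 2 + j] p)).toRingEquiv := by
      funext f
      rw [pow_mul, hkτ]
      exact (hτn _ f).symm
    rw [h2] at h1
    have h3 := S.code_of_frobAt hv (fixT _) (hσ _) h1 (x := 1) (by decide)
    obtain ⟨q, hq⟩ := S.exists_codeIso hv (π p)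
    have hlt : ∀ n : ℕ, starSq^[n] 1 < 16 := fun n => by
      cases n with
      | zero => decide
      | succ n => rw [Function.iterate_succ_apply']; exact starSq_lt _
    rw [← hq.left _ (hlt (k * _)), h3, ← hc _ 1 (by decide), hq.left _ (hlt _)]
  have hid := perm_eq_id i hi j hj hij k hk π key
  rw [hid, id_eq] at ha hb
  rw [hθ, ha, hb]
  exact div_one T

end Cyclic

section Automorphisms

variable {K : Type} [Field K] [Algebra (ZMod 2) K]

lemma Setup.exists_cyclicTab [GenusFourFive K] {T : K} {P : Fin 3 → Place F₂ K} {r : Fin 3 → K → F32}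
    (S : Setup T P r) {v : Fin 4 → K} (hv : Setup.Adapted T P r v) :
    ∃ i < 3, ∃ j < 3, i ≠ j ∧ ∃ t₁ t₂, t₁ = cyclicTab i ∧ t₂ = cyclicTab j ∧
      Frame T v star (revMul t₁) (revMul t₂) ∧ Balanced (revMul t₁) ∧ Balanced (revMul t₂) ∧
      ∀ p, ∀ x < 16, Setup.code T r v p (starSq^[![1, 2 + i, 2 + j] p] x) = starSq (Setup.code T r v p x) := by
  obtain ⟨t₁, t₂, F, b₁, b₂, h | h, hsq⟩ := S.exists_tables hv
  · obtain ⟨rfl, rfl⟩ | ⟨hne, ⟨i, hi, h1⟩, j, hj, h2⟩ := h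
    · exact ((F.congr (fun _ _ _ _ => rfl) revMul_transportTab revMul_transportTab).not_constant).elim
    · refine ⟨i, hi, j, hj, fun h => hne (by rw [h1, h2, h]), t₁, t₂, h1, h2, F, b₁, b₂, fun p x hx => ?_⟩
      obtain ⟨h3, h4⟩ := hsq x hx
      fin_cases p
      · exact (S.code_zero hv _ (starSq_lt x)).trans (congrArg starSq (S.code_zero hv x hx).symm)
      · rwa [h1, cyclicTab_sq i hi x hx] at h3
      · rwa [h2, cyclicTab_sq j hj x hx] at h4
  · exact (S.not_obstructed hv F balanced_star b₁ b₂ h).elim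

variable [Algebra (RatFunc (ZMod 2)) K] [IsScalarTower (ZMod 2) (RatFunc (ZMod 2)) K]

lemma apply_eq_and_card_algEquiv [GenusFourFive K] (hdeg : Module.finrank (RatFunc (ZMod 2)) K = 5) :
    (∀ (θ : K ≃+* K) (x : RatFunc F₂), θ (algebraMap (RatFunc F₂) K x) = algebraMap (RatFunc F₂) K x) ∧
      Nat.card (K ≃ₐ[RatFunc F₂] K) = 5 := by
  obtain ⟨P, hP⟩ := exists_triple (degFive_T hdeg)
  choose r hr using fun p => exists_res (hP.degree p)
  have S : Setup (algebraMap (RatFunc F₂) K RatFunc.X) P r := ⟨hP, hr⟩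
  obtain ⟨v, hv⟩ := S.exists_adapted
  obtain ⟨i, hi, j, hj, hij, t₁, t₂, rfl, rfl, F, b₁, b₂, hc⟩ := S.exists_cyclicTab hv
  obtain ⟨σ, h5, hσ⟩ := F.exists_generator hdeg balanced_star b₁ b₂ star_starSq (cyclicTab_starSq i hi)
    (cyclicTab_starSq j hj)
  exact ⟨fun θ => apply_algebraMap (S.apply_T_eq hdeg hv h5 hσ hi hj hij hc θ), card_algEquiv hdeg h5⟩

end Automorphisms

end CFF

open CFF in
/-- For a congruence function field `K` over `𝔽₂` of genus `4` and class
number `1`, with rational subfield `k = 𝔽₂(T)` of degree `5`: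
`Aut_{𝔽₂}(K) = Aut_k(K) = Gal(K/k)` — every `𝔽₂`-automorphism of `K` fixes `k`
pointwise — and this group is cyclic of order `5`. -/
theorem automorphism_group_is_cyclic_of_order_five
    (K : Type) [Field K] [Algebra (ZMod 2) K]
    [Algebra (RatFunc (ZMod 2)) K] [IsScalarTower (ZMod 2) (RatFunc (ZMod 2)) K]
    (hFF : IsFunctionField (ZMod 2) K)
    (hconst : HasExactConstants (ZMod 2) K)
    (hg : genus (ZMod 2) K = 4)
    (hh : classNumber (ZMod 2) K = 1)
    (hdeg : Module.finrank (RatFunc (ZMod 2)) K = 5) :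
    (∀ (θ : K ≃ₐ[ZMod 2] K) (x : RatFunc (ZMod 2)),
      θ (algebraMap (RatFunc (ZMod 2)) K x) = algebraMap (RatFunc (ZMod 2)) K x) ∧
    IsCyclic (K ≃ₐ[ZMod 2] K) ∧ Nat.card (K ≃ₐ[ZMod 2] K) = 5 ∧
    IsCyclic (K ≃ₐ[RatFunc (ZMod 2)] K) ∧
    Nat.card (K ≃ₐ[RatFunc (ZMod 2)] K) = 5 := by
  have : GenusFourFive K :=
    { sep := ⟨_, isSep_T hdeg⟩, const := hconst, gen := hg, cls := hh, gener := ⟨_, degFive_T hdeg⟩ }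
  obtain ⟨hfix, hcard⟩ := apply_eq_and_card_algEquiv (K := K) hdeg
  have hfix' : ∀ (θ : K ≃ₐ[ZMod 2] K) (x : RatFunc (ZMod 2)),
      θ (algebraMap (RatFunc (ZMod 2)) K x) = algebraMap (RatFunc (ZMod 2)) K x :=
    fun θ => hfix θ.toRingEquiv
  have e : (K ≃ₐ[ZMod 2] K) ≃ (K ≃ₐ[RatFunc (ZMod 2)] K) :=
    { toFun := fun θ => AlgEquiv.ofRingEquiv (f := θ.toRingEquiv) (hfix' θ)
      invFun := fun τ => τ.restrictScalars (ZMod 2)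
      left_inv := fun θ => rfl
      right_inv := fun τ => rfl }
  have hcard' := (Nat.card_congr e).trans hcard
  have : Fact (Nat.Prime 5) := ⟨by norm_num⟩
  exact ⟨hfix', isCyclic_of_prime_card hcard', hcard', isCyclic_of_prime_card hcard, hcard⟩
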